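/- Let n ≥ 3, 0 < α < 1, ζ > 1 and ζ' > 0. Let f : ℝⁿ → ℝ be α-Hölder continuous on every compact set, with finite limit f(∞) = lim_{|x|→∞} f(x), satisfying limsup_{|x|→∞} ( |x|^ζ |f(x) − f(∞)| + |x|^{α+ζ'} [f]_{C^α(B̄_{|x|/2}(x))} ) < ∞. Let u ∈ C²(ℝⁿ) be convex and satisfy det D²u(x) = e^{n f(x)} for all x ∈ ℝⁿ. Then there exist C > 0, ε > 0, a symmetric positive definite n×n matrix A with det A = e^{n f(∞)}, b ∈ ℝⁿ and c ∈ ℝ such that sup_{ℝⁿ}|D²u| + [D²u]_{C^α(ℝⁿ)} ≤ C and, with Q(x) = ½xᵀAx + b·x + c, |D^k(u − Q)(x)| ≤ C|x|^{2−ε−k} for k = 0, 1, 2 and all |x| ≥ 1. -/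

import Mathlib

open Filter

/-- The Hessian matrix `(∂ᵢ∂ⱼ u(x))` of a function on Euclidean space. -/
noncomputable def hess {n : ℕ} (u : EuclideanSpace ℝ (Fin n) → ℝ)
    (x : EuclideanSpace ℝ (Fin n)) : Matrix (Fin n) (Fin n) ℝ :=
  Matrix.of fun i j =>
    iteratedFDeriv ℝ 2 u x ![EuclideanSpace.single i 1, EuclideanSpace.single j 1]

noncomputable section

open Filter MeasureTheory Metric
open scoped Matrix RealInnerProductSpace Topology ContDiff
open Real (norm_of_nonneg mul_rpow sqrt norm_eq_abs coe_toNNReal rpow_one sqrt_sq sqrt_pos sq_sqrt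
  rpow_le_rpow dist_eq one_rpow rpow_mul exp exp_pos rpow_add rpow_le_rpow_of_exponent_le div_rpow
  rpow_neg log log_mul exp_le_exp exp_add exp_zero)
open Matrix (det_mul det_one det_smul smul_mul PosDef vecMulVec det_transpose PosSemidef
  mul_nonsing_inv isHermitian_one trace_smul diag trace_sub trace_one)
open Fintype (card_fin card sum_option)
open Finset (sum_le_sum mul_sum sum_comm sum_congr sum_add_distrib sum_sub_distrib sum_const
  card_univ sum_mul_sum range sum_nonneg sum_div single_le_sum abs_sum_le_sum_abs)
open EuclideanSpace (single norm_eq norm_sq_eq)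
open Function (update comp Injective uncurry uncurry_def)
open Set (mem_ofPred_eq Icc)
open MeasureTheory.Measure (hausdorffMeasure real ae_ne)

/-- Euclidean `n`-space. -/
abbrev Eu (n : ℕ) := EuclideanSpace ℝ (Fin n)

notation:max "𝔹" n:max => closedBall (0 : Eu n)

variable {n : ℕ} {u v w f g U : Eu n → ℝ}

/-- Real square matrices. -/
abbrev Mat (n : ℕ) := Matrix (Fin n) (Fin n) ℝ

lemma ex_eq {α : Sort*} (a : α) : ∃ b, b = a := ⟨a, rfl⟩

lemma ex_pos (a : ℝ) (h : 0 < a := by positivity) : ∃ b, b = a ∧ 0 < b := ⟨a, rfl, h⟩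

lemma one_le_n [NeZero n] : (1 : ℝ) ≤ n := by exact_mod_cast Nat.one_le_iff_ne_zero.2 (NeZero.ne n)

lemma norm_unit {x : Eu n} (h : 0 < ‖x‖) : ‖‖x‖⁻¹ • x‖ = 1 := by
  rw [norm_smul, norm_inv, norm_norm, inv_mul_cancel₀ h.ne']

/-- The bilinear form of a matrix. -/
def Bf (M : Mat n) (x y : Eu n) : ℝ := ∑ i, ∑ j, M i j * x i * y j

/-- The quadratic form of a matrix. -/
def Qf (M : Mat n) (x : Eu n) : ℝ := ∑ i, ∑ j, M i j * x i * x j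

/-- The linear map of a matrix on Euclidean space. -/
def mulE (L : Mat n) : Eu n →L[ℝ] Eu n := Matrix.toEuclideanCLM (𝕜 := ℝ) L

/-- The matrix whose columns are a given family of vectors. -/
def colsOf (ξ : Fin n → Eu n) : Mat n := Matrix.of fun i k => ξ k i

lemma Qf_eq_Bf (M : Mat n) (x : Eu n) : Qf M x = Bf M x x := rfl

lemma mulE_apply (L : Mat n) (x : Eu n) (i : Fin n) : mulE L x i = ∑ j, L i j * x j := rfl

lemma Bf_eq_dot (M : Mat n) (x y : Eu n) : Bf M x y = x.ofLp ⬝ᵥ (M *ᵥ y.ofLp) := by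
  simp only [Bf, dotProduct, Matrix.mulVec, mul_sum]
  refine sum_congr rfl fun i _ => sum_congr rfl fun j _ => by ring

lemma Bf_eq_inner (M : Mat n) (x y : Eu n) : Bf M x y = ⟪x, mulE M y⟫ := by
  rw [Bf_eq_dot, mulE, Matrix.inner_toEuclideanCLM]

lemma Bf_one (x y : Eu n) : Bf 1 x y = ⟪x, y⟫ := by rw [Bf_eq_inner, mulE, map_one]; rfl

lemma Qf_one (x : Eu n) : Qf 1 x = ‖x‖ ^ 2 := by rw [Qf_eq_Bf, Bf_one, real_inner_self_eq_norm_sq]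

lemma mulE_mul (A B : Mat n) (x : Eu n) : mulE (A * B) x = mulE A (mulE B x) := by
  rw [mulE, map_mul]; rfl

lemma mulE_one (x : Eu n) : mulE 1 x = x := by rw [mulE, map_one]; rfl

lemma Bf_add_left (M : Mat n) (x y z : Eu n) : Bf M (x + y) z = Bf M x z + Bf M y z := by
  simp only [Bf_eq_inner, inner_add_left]

lemma Bf_add_right (M : Mat n) (x y z : Eu n) : Bf M x (y + z) = Bf M x y + Bf M x z := by
  simp only [Bf_eq_inner, map_add, inner_add_right]

lemma Bf_smul_left (M : Mat n) (c : ℝ) (x y : Eu n) : Bf M (c • x) y = c * Bf M x y := by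
  simp only [Bf_eq_inner, inner_smul_left]; simp

lemma Bf_smul_right (M : Mat n) (c : ℝ) (x y : Eu n) : Bf M x (c • y) = c * Bf M x y := by
  simp only [Bf_eq_inner, map_smul, inner_smul_right]

lemma Bf_comm {M : Mat n} (hM : M.IsHermitian) (x y : Eu n) : Bf M x y = Bf M y x := by
  rw [Bf, sum_comm]; refine sum_congr rfl fun i _ => sum_congr rfl fun j _ => ?_
  have := hM.apply i j; simp at this; rw [← this]; ring

lemma Qf_smul (M : Mat n) (c : ℝ) (x : Eu n) : Qf M (c • x) = c ^ 2 * Qf M x := by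
  rw [Qf_eq_Bf, Bf_smul_left, Bf_smul_right, Qf_eq_Bf]; ring

lemma Qf_zero_right (M : Mat n) : Qf M 0 = 0 := by simp [Qf]

lemma Qf_neg (M : Mat n) (x : Eu n) : Qf M (-x) = Qf M x := by simp [Qf]

lemma Qf_add_matrix (M N : Mat n) (x : Eu n) : Qf (M + N) x = Qf M x + Qf N x := by
  simp only [Qf, Matrix.add_apply, add_mul, sum_add_distrib]

lemma Qf_sub_matrix (M N : Mat n) (x : Eu n) : Qf (M - N) x = Qf M x - Qf N x := by
  simp only [Qf, Matrix.sub_apply, sub_mul, sum_sub_distrib]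

lemma Qf_smul_matrix (c : ℝ) (M : Mat n) (x : Eu n) : Qf (c • M) x = c * Qf M x := by
  simp only [Qf, Matrix.smul_apply, smul_eq_mul, mul_sum]
  refine sum_congr rfl fun i _ => sum_congr rfl fun j _ => by ring

lemma Qf_add_sub (M : Mat n) (x y : Eu n) :
    Qf M (x + y) + Qf M (x - y) = 2 * Qf M x + 2 * Qf M y := by
  simp only [Qf_eq_Bf, sub_eq_add_neg, ← neg_one_smul ℝ y, Bf_add_left, Bf_add_right, Bf_smul_left,
    Bf_smul_right]
  ring

lemma Bf_transpose_mul_mul (M L : Mat n) (x y : Eu n) :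
    Bf (Lᵀ * M * L) x y = Bf M (mulE L x) (mulE L y) := by
  rw [Bf_eq_dot, Bf_eq_dot]; change _ = (L *ᵥ x.ofLp) ⬝ᵥ (M *ᵥ (L *ᵥ y.ofLp))
  rw [Matrix.mulVec_mulVec, Matrix.dotProduct_mulVec, Matrix.dotProduct_mulVec, mul_assoc,
    ← Matrix.vecMul_vecMul, Matrix.vecMul_transpose]

lemma Qf_transpose_mul_mul (M L : Mat n) (x : Eu n) :
    Qf (Lᵀ * M * L) x = Qf M (mulE L x) := Bf_transpose_mul_mul M L x x

lemma Qf_transpose_mul_self (B : Mat n) (x : Eu n) : Qf (Bᵀ * B) x = ‖mulE B x‖ ^ 2 := by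
  rw [← Qf_one, ← Qf_transpose_mul_mul, mul_one]

lemma inner_mulE_transpose (L : Mat n) (x y : Eu n) : ⟪mulE Lᵀ x, y⟫ = ⟪x, mulE L y⟫ := by
  rw [real_inner_comm, ← Bf_eq_inner, ← Bf_eq_inner, Bf, Bf, sum_comm]
  refine sum_congr rfl fun i _ => sum_congr rfl fun j _ => ?_; rw [Matrix.transpose_apply]; ring

lemma mulE_smul (r : ℝ) (L : Mat n) (y : Eu n) : mulE (r • L) y = r • mulE L y := by
  ext i; simp [mulE_apply, mul_sum, mul_assoc]

lemma smul_transpose_mul_mul (k s : ℝ) (L M : Mat n) :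
    k • ((s • L)ᵀ * M * (s • L)) = (k * s ^ 2) • (Lᵀ * M * L) := by
  rw [Matrix.transpose_smul]; simp only [smul_mul, Matrix.mul_smul, smul_smul, sq, mul_assoc]

lemma det_sq_mul_det {L M : Mat n} (h : Lᵀ * M * L = 1) : L.det ^ 2 * M.det = 1 := by
  have := congrArg Matrix.det h; rw [det_mul, det_mul, det_transpose, det_one] at this; linarith

lemma Bf_single (M : Mat n) (i j : Fin n) : Bf M (single i 1) (single j 1) = M i j := by simp [Bf]

lemma mulE_colsOf_single (ξ : Fin n → Eu n) (k : Fin n) : mulE (colsOf ξ) (single k 1) = ξ k := by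
  ext i; rw [mulE_apply]; simp [colsOf]

lemma colsOf_gram (M : Mat n) (ξ : Fin n → Eu n) (k l : Fin n) :
    ((colsOf ξ)ᵀ * M * colsOf ξ) k l = Bf M (ξ k) (ξ l) := by
  rw [← Bf_single ((colsOf ξ)ᵀ * M * colsOf ξ), Bf_transpose_mul_mul, mulE_colsOf_single,
    mulE_colsOf_single]

lemma posSemidef_iff_Qf {M : Mat n} (hM : M.IsHermitian) :
    M.PosSemidef ↔ ∀ x : Eu n, 0 ≤ Qf M x := by
  constructor
  · intro h x
    have := h.dotProduct_mulVec_nonneg x.ofLp; simpa [Qf_eq_Bf, Bf_eq_dot] using this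
  · intro h
    refine PosSemidef.of_dotProduct_mulVec_nonneg hM fun x => ?_; have := h (WithLp.toLp 2 x)
    simpa [Qf_eq_Bf, Bf_eq_dot] using this

lemma posDef_iff_Qf {M : Mat n} (hM : M.IsHermitian) :
    M.PosDef ↔ ∀ x : Eu n, x ≠ 0 → 0 < Qf M x := by
  constructor
  · intro h x hx
    have := h.dotProduct_mulVec_pos (x := x.ofLp) (by simpa using hx)
    simpa [Qf_eq_Bf, Bf_eq_dot] using this
  · intro h
    refine PosDef.of_dotProduct_mulVec_pos hM fun x hx => ?_
    have := h (WithLp.toLp 2 x) (by simpa using hx); simpa [Qf_eq_Bf, Bf_eq_dot] using this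

lemma posDef_transpose_mul_mul {M L B : Mat n} (hM : M.PosDef) (h : L * B = 1) :
    (Bᵀ * M * B).PosDef := by
  refine (posDef_iff_Qf ?_).2 fun x hx => ?_
  · have := Matrix.isHermitian_conjTranspose_mul_mul B hM.1
    rwa [Matrix.conjTranspose_eq_transpose_of_trivial] at this
  · rw [Qf_transpose_mul_mul]
    refine (posDef_iff_Qf hM.1).1 hM _ fun h0 => hx ?_; have := congrArg (mulE L) h0
    rwa [← mulE_mul, h, mulE_one, map_zero] at this

lemma amgm_trace [NeZero n] {M : Mat n} (hM : M.PosSemidef) :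
    n * M.det ^ ((1 : ℝ) / n) ≤ M.trace := by
  have hn : (0 : ℝ) < n := by exact_mod_cast Nat.pos_of_ne_zero (NeZero.ne n)
  have h := Real.geom_mean_le_arith_mean Finset.univ (fun _ : Fin n => (1 : ℝ))
    hM.1.eigenvalues (fun _ _ => zero_le_one) (by simpa using hn)
    (fun i _ => hM.eigenvalues_nonneg i)
  rw [hM.1.det_eq_prod_eigenvalues, hM.1.trace_eq_sum_eigenvalues]
  simp only [rpow_one, sum_const, card_univ, card_fin, nsmul_eq_mul, mul_one, one_mul] at h
  rw [le_div_iff₀ hn] at h; simpa [mul_comm] using h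

lemma amgm_frame [NeZero n] {M : Mat n} (hM : M.PosSemidef) (ξ : Fin n → Eu n) :
    n * (M.det * (colsOf ξ).det ^ 2) ^ ((1 : ℝ) / n) ≤ ∑ k, Qf M (ξ k) := by
  have h := amgm_trace (hM.conjTranspose_mul_mul_same (colsOf ξ))
  rw [Matrix.conjTranspose_eq_transpose_of_trivial] at h
  have h1 : ((colsOf ξ)ᵀ * M * colsOf ξ).trace = ∑ k, Qf M (ξ k) := by
    rw [Matrix.trace]; exact sum_congr rfl fun k _ => colsOf_gram M ξ k k
  rw [h1, det_mul, det_mul, det_transpose] at h; convert h using 3; ring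

lemma exists_transpose_mul_self {M : Mat n} (hM : M.PosDef) :
    ∃ B : Mat n, M = Bᵀ * B ∧ IsUnit B.det := by
  let U := (hM.1.eigenvectorUnitary : Mat n)
  let d : Fin n → ℝ := fun i => sqrt (hM.1.eigenvalues i)
  have key : M = (Matrix.diagonal d * star U)ᵀ * (Matrix.diagonal d * star U) := by
    conv_lhs => rw [hM.1.spectral_theorem]
    rw [Unitary.conjStarAlgAut_apply, Matrix.transpose_mul, Matrix.diagonal_transpose,
      Matrix.star_eq_conjTranspose U, Matrix.conjTranspose_eq_transpose_of_trivial,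
      Matrix.transpose_transpose]
    rw [mul_assoc U (Matrix.diagonal d), ← mul_assoc (Matrix.diagonal d),
      Matrix.diagonal_mul_diagonal, ← mul_assoc]
    congr 2
    ext i j; simp only [d]
    by_cases h : i = j
    · subst h; simp [Real.mul_self_sqrt (hM.eigenvalues_pos i).le]
    · simp [h]
  refine ⟨_, key, ?_⟩; have h := hM.det_pos; rw [key, det_mul, det_transpose] at h
  rw [isUnit_iff_ne_zero]; intro h0; rw [h0] at h; simp at h

lemma exists_normalizing {M : Mat n} (hM : M.PosDef) :
    ∃ L B : Mat n, Lᵀ * M * L = 1 ∧ L * B = 1 ∧ B * L = 1 ∧ M = Bᵀ * B := by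
  obtain ⟨B, hB, hu⟩ := exists_transpose_mul_self hM; have h1 : B * B⁻¹ = 1 := mul_nonsing_inv B hu
  have h2 : B⁻¹ * B = 1 := Matrix.nonsing_inv_mul B hu; refine ⟨B⁻¹, B, ?_, h2, h1, hB⟩
  have h3 : (B⁻¹)ᵀ * Bᵀ = 1 := by rw [← Matrix.transpose_mul, h1, Matrix.transpose_one]
  rw [hB, ← mul_assoc, h3, one_mul, h1]

lemma exists_frame [NeZero n] {M : Mat n} (hM : M.PosDef) {e : Eu n} (he : e ≠ 0) :
    ∃ ξ : Fin n → Eu n, ξ 0 = (sqrt (Qf M e))⁻¹ • e ∧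
      (∀ k l, Bf M (ξ k) (ξ l) = if k = l then 1 else 0) ∧ M.det * (colsOf ξ).det ^ 2 = 1 := by
  obtain ⟨L, B, h1, h2, h3, h4⟩ := exists_normalizing hM
  have hBB : ∀ x y : Eu n, Bf M x y = ⟪mulE B x, mulE B y⟫ := by
    intro x y; rw [h4, ← Bf_one, ← Bf_transpose_mul_mul, mul_one]
  have hQ : Qf M e = ‖mulE B e‖ ^ 2 := by rw [Qf_eq_Bf, hBB, real_inner_self_eq_norm_sq]
  have hpos : 0 < Qf M e := (posDef_iff_Qf hM.1).1 hM e he; have hBe : mulE B e ≠ 0 := by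
    intro h; rw [hQ, h] at hpos; simp at hpos
  let v : Fin n → Eu n := fun _ => (‖mulE B e‖)⁻¹ • mulE B e
  have hv : Orthonormal ℝ (({0} : Set (Fin n)).domRestrict v) := by
    constructor
    · intro i
      change ‖(‖mulE B e‖)⁻¹ • mulE B e‖ = 1
      rw [norm_smul, norm_inv, norm_norm, inv_mul_cancel₀ (norm_ne_zero_iff.2 hBe)]
    · intro i j hij
      exact absurd (Subsingleton.elim i j) hij
  obtain ⟨o, ho⟩ := hv.exists_orthonormalBasis_extension_of_card_eq (by simp)
  have horth : ∀ k l, Bf M (mulE L (o k)) (mulE L (o l)) = if k = l then 1 else 0 := by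
    intro k l; rw [hBB, ← mulE_mul, ← mulE_mul, h3, mulE_one, mulE_one]
    exact orthonormal_iff_ite.1 o.orthonormal k l
  refine ⟨fun k => mulE L (o k), ?_, horth, ?_⟩
  · have : o 0 = v 0 := ho 0 (by simp)
    simp only [this, v]; rw [map_smul, ← mulE_mul, h2, mulE_one, hQ, sqrt_sq (norm_nonneg _)]
  · have hg : (colsOf fun k => mulE L (o k))ᵀ * M * colsOf (fun k => mulE L (o k)) = 1 := by
      ext k l; rw [colsOf_gram, horth, Matrix.one_apply]
    have := congrArg Matrix.det hg; rw [det_mul, det_mul, det_transpose, det_one] at this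
    linarith [this]

lemma colsOf_add_smul_det [NeZero n] (ξ : Fin n → Eu n) (c : Fin n → ℝ) (hc : c 0 = 0) :
    (colsOf fun k => ξ k + c k • ξ 0).det = (colsOf ξ).det := by
  rw [← det_transpose, ← det_transpose (colsOf ξ)]
  refine Matrix.det_eq_of_forall_row_eq_smul_add_const c 0 hc ?_; intro i j; simp [colsOf]

lemma amgm_sheared [NeZero n] {M G : Mat n} (hM : 0 < M.det)
    (hG : G.PosSemidef) (ξ : Fin n → Eu n) (hξ : M.det * (colsOf ξ).det ^ 2 = 1)
    (c : Fin n → ℝ) (hc : c 0 = 0) :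
    n * (G.det / M.det) ^ ((1 : ℝ) / n) ≤ ∑ k, Qf G (ξ k + c k • ξ 0) := by
  have h := amgm_frame hG (fun k => ξ k + c k • ξ 0); rw [colsOf_add_smul_det ξ c hc] at h
  have : (colsOf ξ).det ^ 2 = 1 / M.det := by field_simp; linarith
  rw [this] at h; simpa [div_eq_mul_inv] using h

lemma exists_coord_ne_zero [NeZero n] : ∃ e : Eu n, e ≠ 0 ∧ ‖e‖ = 1 :=
  ⟨single 0 1, by simp, by simp⟩

lemma det_mono [NeZero n] {A B : Mat n} (hA : A.PosSemidef) (hB : B.PosDef)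
    (h : ∀ x : Eu n, Qf A x ≤ Qf B x) : A.det ≤ B.det := by
  have hn : (0 : ℝ) < n := by exact_mod_cast Nat.pos_of_ne_zero (NeZero.ne n)
  obtain ⟨e, he, -⟩ := exists_coord_ne_zero (n := n); obtain ⟨ξ, -, h2, h3⟩ := exists_frame hB he
  have h4 := amgm_sheared hB.det_pos hA ξ h3 (fun _ => 0) rfl
  have h5 : ∑ k, Qf A (ξ k + (0 : ℝ) • ξ 0) ≤ n := by
    calc _ ≤ ∑ k : Fin n, (1 : ℝ) := by
          refine sum_le_sum fun k _ => ?_; have := h2 k k; simp only [if_true] at this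
          rw [zero_smul, add_zero, ← this]; exact h _
      _ = n := by simp
  have h6 : (A.det / B.det) ^ ((1 : ℝ) / n) ≤ 1 := by
    have := h4.trans h5
    rwa [mul_le_iff_le_one_right hn] at this
  have h7 : A.det / B.det ≤ 1 := by
    by_contra hlt
    push Not at hlt
    have := Real.one_lt_rpow hlt (z := (1 : ℝ) / n) (by positivity); linarith
  rwa [div_le_one hB.det_pos] at h7

lemma posDef_of_posSemidef_det_pos {A : Mat n} (hA : A.PosSemidef)
    (h : 0 < A.det) : A.PosDef := hA.posDef_iff_det_ne_zero.2 h.ne'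

lemma isHermitian_vecMulVec_self (a : Fin n → ℝ) : (vecMulVec a a).IsHermitian := by
  ext i j; simp [vecMulVec, mul_comm]

lemma Qf_vecMulVec (a : Fin n → ℝ) (x : Eu n) : Qf (vecMulVec a a) x = (∑ i, a i * x i) ^ 2 := by
  rw [sq, sum_mul_sum]; refine sum_congr rfl fun i _ => sum_congr rfl fun j _ => ?_
  simp [vecMulVec]; ring

lemma det_one_add_vecMulVec (γ : ℝ) (a : Fin n → ℝ) :
    ((1 : Mat n) + γ • vecMulVec a a).det = 1 + γ * ∑ i, a i ^ 2 := by
  have h := Matrix.det_one_add_replicateCol_mul_replicateRow (ι := Unit) (γ • a) a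
  rw [← Matrix.vecMulVec_eq] at h; rw [← Matrix.smul_vecMulVec, h]; simp [dotProduct, mul_sum, sq]
  refine sum_congr rfl fun i _ => by ring

lemma frame_norm_lower [NeZero n] {M : Mat n} (hM : M.PosDef) {e : Eu n}
    (he : ‖e‖ = 1) (ξ : Fin n → Eu n) (h0 : ξ 0 = (sqrt (Qf M e))⁻¹ • e)
    (horth : ∀ k l, Bf M (ξ k) (ξ l) = if k = l then 1 else 0)
    (hdet : M.det * (colsOf ξ).det ^ 2 = 1) :
    n * (Qf M e / M.det) ^ ((1 : ℝ) / n) - 1 ≤ ∑ k, ‖ξ k‖ ^ 2 := by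
  have he0 : e ≠ 0 := by rw [← norm_ne_zero_iff, he]; norm_num
  have hμ : 0 < Qf M e := (posDef_iff_Qf hM.1).1 hM e he0; set μ := Qf M e with hμd
  let a : Fin n → ℝ := fun i => mulE M e i
  have ha : ∀ x : Eu n, ∑ i, a i * x i = Bf M x e := by
    intro x; rw [Bf_eq_inner]; simp [PiLp.inner_apply, a]
  let G : Mat n := 1 + μ⁻¹ • vecMulVec a a
  have hQG : ∀ x, Qf G x = ‖x‖ ^ 2 + μ⁻¹ * (Bf M x e) ^ 2 := by
    intro x; simp only [G]; rw [Qf_add_matrix, Qf_one, Qf_smul_matrix, Qf_vecMulVec, ha]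
  have hG : G.PosSemidef := by
    refine (posSemidef_iff_Qf ?_).2 ?_
    · exact isHermitian_one.add ((isHermitian_vecMulVec_self a).smul (by simp [IsSelfAdjoint]))
    · intro x; rw [hQG]; positivity
  have hGdet : μ ≤ G.det := by
    simp only [G]; rw [det_one_add_vecMulVec]; have h1 : ∑ i, a i ^ 2 = ‖mulE M e‖ ^ 2 := by
      rw [norm_sq_eq]; simp [a]
    have h2 : μ ≤ ‖mulE M e‖ := by
      rw [hμd, Qf_eq_Bf, Bf_eq_inner]
      calc _ ≤ ‖e‖ * ‖mulE M e‖ := real_inner_le_norm _ _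
        _ = _ := by rw [he, one_mul]
    rw [h1]; have : μ ≤ μ⁻¹ * ‖mulE M e‖ ^ 2 := by rw [le_inv_mul_iff₀ hμ]; nlinarith
    linarith
  have h4 := amgm_sheared hM.det_pos hG ξ hdet (fun _ => 0) rfl
  have h5 : ∑ k, Qf G (ξ k + (0 : ℝ) • ξ 0) = ∑ k, ‖ξ k‖ ^ 2 + 1 := by
    have : ∀ k, Qf G (ξ k + (0 : ℝ) • ξ 0) = ‖ξ k‖ ^ 2 + if k = 0 then 1 else 0 := by
      intro k; rw [zero_smul, add_zero, hQG]
      congr 1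
      have h6 : Bf M (ξ k) e = sqrt μ * Bf M (ξ k) (ξ 0) := by
        rw [h0, Bf_smul_right, ← mul_assoc, mul_inv_cancel₀ (sqrt_pos.2 hμ).ne', one_mul]
      rw [h6, horth]
      split_ifs
      · rw [mul_one, sq_sqrt hμ.le, inv_mul_cancel₀ hμ.ne']
      · simp
    rw [sum_congr rfl fun k _ => this k, sum_add_distrib]; simp
  have h7 : (μ / M.det) ^ ((1 : ℝ) / n) ≤ (G.det / M.det) ^ ((1 : ℝ) / n) := by
    refine rpow_le_rpow (div_nonneg hμ.le hM.det_pos.le) ?_ (by positivity)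
    exact div_le_div_of_nonneg_right hGdet hM.det_pos.le
  rw [h5] at h4
  have : (n : ℝ) * (μ / M.det) ^ ((1 : ℝ) / n) ≤ n * (G.det / M.det) ^ ((1 : ℝ) / n) := by gcongr
  linarith

lemma Eu_sum_single (x : Eu n) : x = ∑ i, x i • (single i (1 : ℝ) : Eu n) := by
  ext j; rw [WithLp.ofLp_sum, Finset.sum_apply]; simp

lemma hess_apply (u : Eu n → ℝ) (x : Eu n) (i j : Fin n) :
    hess u x i j = fderiv ℝ (fderiv ℝ u) x (single i 1) (single j 1) := by
  simp [hess, iteratedFDeriv_two_apply]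

lemma Bf_eq_of_bilin (T : Eu n →L[ℝ] Eu n →L[ℝ] ℝ) (M : Mat n)
    (h : ∀ i j, M i j = T (single i 1) (single j 1)) (x y : Eu n) :
    T x y = Bf M x y := by
  conv_lhs => rw [Eu_sum_single x, Eu_sum_single y]
  simp only [map_sum, map_smul, _root_.sum_apply, _root_.smul_apply, smul_eq_mul, Bf, mul_sum, h]
  rw [sum_comm]; refine sum_congr rfl fun i _ => sum_congr rfl fun j _ => by ring

lemma fderiv_fderiv_eq (u : Eu n → ℝ) (x ξ η : Eu n) :
    fderiv ℝ (fderiv ℝ u) x ξ η = Bf (hess u x) ξ η :=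
  Bf_eq_of_bilin _ _ (hess_apply u x) ξ η

lemma matrix_eq_of_Bf {A B : Mat n} (h : ∀ x y : Eu n, Bf A x y = Bf B x y) : A = B := by
  ext i j; rw [← Bf_single A, h, Bf_single B]

section calculus
variable {u : Eu n → ℝ}

lemma contDiff_one_fderiv (hu : ContDiff ℝ 2 u) : ContDiff ℝ 1 (fderiv ℝ u) :=
  hu.fderiv_right (by norm_num)

lemma hu_diff (hu : ContDiff ℝ 2 u) : Differentiable ℝ u := hu.differentiable (by norm_num)

lemma hu_diff2 (hu : ContDiff ℝ 2 u) : Differentiable ℝ (fderiv ℝ u) :=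
  (contDiff_one_fderiv hu).differentiable (by norm_num)

lemma hess_isHermitian (hu : ContDiff ℝ 2 u) (x : Eu n) : (hess u x).IsHermitian := by
  have h : IsSymmSndFDerivAt ℝ u x := hu.contDiffAt.isSymmSndFDerivAt (by simp); ext i j
  simp only [Matrix.conjTranspose_apply, star_trivial, hess_apply]; exact h _ _

lemma continuous_hess_apply (hu : ContDiff ℝ 2 u) (i j : Fin n) :
    Continuous fun x => hess u x i j := by
  simp only [hess_apply]; have := (contDiff_one_fderiv hu).continuous_fderiv (by norm_num); fun_prop

lemma continuous_Qf_hess (hu : ContDiff ℝ 2 u) (ξ : Eu n) :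
    Continuous fun x => Qf (hess u x) ξ := by
  unfold Qf; have := continuous_hess_apply hu; fun_prop

lemma continuous_det_hess (hu : ContDiff ℝ 2 u) : Continuous fun x => (hess u x).det := by
  refine Continuous.matrix_det ?_; exact continuous_matrix fun i j => continuous_hess_apply hu i j

lemma hasDerivAt_add_smul (x ξ : Eu n) (s : ℝ) : HasDerivAt (fun s : ℝ => x + s • ξ) ξ s := by
  simpa using ((hasDerivAt_id s).smul_const ξ).const_add x

lemma hasDerivAt_line (hu : ContDiff ℝ 2 u) (x ξ : Eu n) (s : ℝ) :
    HasDerivAt (fun s : ℝ => u (x + s • ξ)) (fderiv ℝ u (x + s • ξ) ξ) s :=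
  ((hu_diff hu) (x + s • ξ)).hasFDerivAt.comp_hasDerivAt s (hasDerivAt_add_smul x ξ s)

lemma hasDerivAt_line2 (hu : ContDiff ℝ 2 u) (x ξ η : Eu n) (s : ℝ) :
    HasDerivAt (fun s : ℝ => fderiv ℝ u (x + s • ξ) η) (Bf (hess u (x + s • ξ)) ξ η) s := by
  have h := ((hu_diff2 hu) (x + s • ξ)).hasFDerivAt.comp_hasDerivAt s (hasDerivAt_add_smul x ξ s)
  have h2 := h.clm_apply (hasDerivAt_const s η); simpa [fderiv_fderiv_eq] using h2

lemma second_deriv_test_max {φ φ' : ℝ → ℝ} {c : ℝ} (h1 : ∀ᶠ s in 𝓝 (0 : ℝ), HasDerivAt φ (φ' s) s)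
    (h2 : HasDerivAt φ' c 0) (hmax : IsLocalMax φ 0) : φ' 0 = 0 ∧ c ≤ 0 := by
  have hd0 : φ' 0 = 0 := hmax.hasDerivAt_eq_zero h1.self_of_nhds; refine ⟨hd0, ?_⟩
  by_contra hc
  push Not at hc
  have hderiv : deriv φ =ᶠ[𝓝 0] φ' := h1.mono fun s hs => hs.deriv
  have hdd : deriv (deriv φ) 0 = c := by rw [hderiv.deriv_eq, h2.deriv]
  have hmin : IsLocalMin φ 0 :=
    isLocalMin_of_deriv_deriv_pos (by rw [hdd]; exact hc) (by rw [hderiv.self_of_nhds, hd0])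
      h1.self_of_nhds.continuousAt
  have hconst : φ =ᶠ[𝓝 0] fun _ => φ 0 := by
    filter_upwards [hmax, hmin] with s hs1 hs2 using le_antisymm hs1 hs2
  have hd : deriv φ =ᶠ[𝓝 0] fun _ => 0 := by have := hconst.deriv; simpa using this
  have : deriv (deriv φ) 0 = 0 := by rw [hd.deriv_eq]; simp
  linarith

lemma tendsto_line_zero (x ξ : Eu n) : Tendsto (fun s : ℝ => x + s • ξ) (𝓝 0) (𝓝 x) := by
  have : Continuous fun s : ℝ => x + s • ξ := by fun_prop
  simpa using this.tendsto 0

lemma isLocalMax_line {x : Eu n} (h : IsLocalMax v x) (ξ : Eu n) :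
    IsLocalMax (fun s : ℝ => v (x + s • ξ)) 0 := by
  have h1 : IsLocalMax v (x + (0 : ℝ) • ξ) := by simpa using h
  exact h1.comp_continuous (g := fun s : ℝ => x + s • ξ) (b := 0) (by fun_prop)

lemma Qf_hess_le_of_isLocalMax {v q : Eu n → ℝ} (hv : ContDiff ℝ 2 v) (hq : ContDiff ℝ 2 q)
    {x : Eu n} (h : IsLocalMax (fun y => v y - q y) x) (ξ : Eu n) :
    Qf (hess v x) ξ ≤ Qf (hess q x) ξ := by
  have h1 := (second_deriv_test_max (φ := fun s : ℝ => v (x + s • ξ) - q (x + s • ξ))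
    (φ' := fun s : ℝ => fderiv ℝ v (x + s • ξ) ξ - fderiv ℝ q (x + s • ξ) ξ)
    (Eventually.of_forall fun s => (hasDerivAt_line hv x ξ s).sub (hasDerivAt_line hq x ξ s))
    ((hasDerivAt_line2 hv x ξ ξ 0).sub (hasDerivAt_line2 hq x ξ ξ 0))
    (isLocalMax_line h ξ)).2
  simp only [zero_smul, add_zero] at h1; rw [Qf_eq_Bf, Qf_eq_Bf]; linarith

lemma Qf_hess_ge_of_isLocalMin {v q : Eu n → ℝ} (hv : ContDiff ℝ 2 v) (hq : ContDiff ℝ 2 q)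
    {x : Eu n} (h : IsLocalMin (fun y => v y - q y) x) (ξ : Eu n) :
    Qf (hess q x) ξ ≤ Qf (hess v x) ξ := by
  refine Qf_hess_le_of_isLocalMax hq hv ?_ ξ; have := h.neg; simpa using this

lemma convex_tangent (hu : ContDiff ℝ 2 u) (hc : ConvexOn ℝ Set.univ u) (x y : Eu n) :
    u x + fderiv ℝ u x (y - x) ≤ u y := by
  have hg : ConvexOn ℝ Set.univ fun s : ℝ => u (x + s • (y - x)) := by
    have := hc.comp_affineMap (AffineMap.lineMap x y : ℝ →ᵃ[ℝ] Eu n); rw [Set.preimage_univ] at this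
    refine this.congr fun s _ => ?_; simp [AffineMap.lineMap_apply, add_comm]
  have h0 := hasDerivAt_line hu x (y - x) 0
  have h := hg.le_slope_of_hasDerivAt (x := 0) (y := 1) (by simp) (by simp) (by norm_num) h0
  simp only [slope_def_field, zero_smul, add_zero, one_smul, add_sub_cancel, sub_zero, div_one] at h
  linarith

lemma hess_posSemidef (hu : ContDiff ℝ 2 u) (hc : ConvexOn ℝ Set.univ u) (x : Eu n) :
    (hess u x).PosSemidef := by
  refine (posSemidef_iff_Qf (hess_isHermitian hu x)).2 fun ξ => ?_
  have h1 := (second_deriv_test_max (φ := fun s : ℝ => s * fderiv ℝ u x ξ - u (x + s • ξ))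
    (φ' := fun s : ℝ => fderiv ℝ u x ξ - fderiv ℝ u (x + s • ξ) ξ)
    (Eventually.of_forall fun s => by
      have h := ((hasDerivAt_id s).mul_const (fderiv ℝ u x ξ)).sub (hasDerivAt_line hu x ξ s)
      rw [one_mul] at h; exact h)
    ((hasDerivAt_const 0 (fderiv ℝ u x ξ)).sub (hasDerivAt_line2 hu x ξ ξ 0))
    (Eventually.of_forall fun s => by
      have := convex_tangent hu hc x (x + s • ξ); simp at this ⊢; linarith)).2
  simp only [zero_smul, add_zero] at h1; rw [Qf_eq_Bf]; linarith

lemma hess_posDef (hu : ContDiff ℝ 2 u) (hc : ConvexOn ℝ Set.univ u) {x : Eu n}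
    (h : 0 < (hess u x).det) : (hess u x).PosDef :=
  posDef_of_posSemidef_det_pos (hess_posSemidef hu hc x) h

lemma hess_eq_of_fderiv {x : Eu n} {M : Mat n}
    (h : ∀ ξ η, fderiv ℝ (fderiv ℝ v) x ξ η = Bf M ξ η) : hess v x = M :=
  matrix_eq_of_Bf fun ξ η => by rw [← fderiv_fderiv_eq, h]

lemma hess_add {v w : Eu n → ℝ} (hv : ContDiff ℝ 2 v) (hw : ContDiff ℝ 2 w) (x : Eu n) :
    hess (fun y => v y + w y) x = hess v x + hess w x := by
  have h1 : fderiv ℝ (fun y => v y + w y) = fun y => fderiv ℝ v y + fderiv ℝ w y := by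
    ext1 y; exact fderiv_fun_add (hu_diff hv y) (hu_diff hw y)
  ext i j; rw [Matrix.add_apply, hess_apply, hess_apply, hess_apply, h1,
    fderiv_fun_add (hu_diff2 hv x) (hu_diff2 hw x)]
  simp

lemma hess_const_mul (hv : ContDiff ℝ 2 v) (c : ℝ) (x : Eu n) :
    hess (fun y => c * v y) x = c • hess v x := by
  have h1 : fderiv ℝ (fun y => c * v y) = fun y => c • fderiv ℝ v y := by
    ext1 y; exact fderiv_const_mul (hu_diff hv y) c
  ext i j; rw [Matrix.smul_apply, hess_apply, hess_apply, h1, fderiv_fun_const_smul (hu_diff2 hv x)]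
  simp

lemma hess_sub {v w : Eu n → ℝ} (hv : ContDiff ℝ 2 v) (hw : ContDiff ℝ 2 w) (x : Eu n) :
    hess (fun y => v y - w y) x = hess v x - hess w x := by
  have h := hess_add hv (contDiff_const.mul hw : ContDiff ℝ 2 fun y => (-1 : ℝ) * w y) x
  rw [hess_const_mul hw] at h; simpa [sub_eq_add_neg] using h

lemma hess_affine (b : Eu n) (d : ℝ) (x : Eu n) : hess (fun y => ⟪b, y⟫ + d) x = 0 := by
  have h1 : fderiv ℝ (fun y : Eu n => ⟪b, y⟫ + d) = fun _ => innerSL ℝ b := by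
    ext1 y; exact ((innerSL ℝ b).hasFDerivAt.add_const d).fderiv
  ext i j; rw [hess_apply, h1]; simp

lemma contDiff_Qf (M : Mat n) {k : WithTop ℕ∞} : ContDiff ℝ k fun y : Eu n => Qf M y := by
  unfold Qf; refine ContDiff.sum fun i _ => ContDiff.sum fun j _ => ?_; fun_prop

lemma Qf_add (M : Mat n) (hM : M.IsHermitian) (x y : Eu n) :
    Qf M (x + y) = Qf M x + 2 * Bf M x y + Qf M y := by
  have := Bf_comm hM x y; simp only [Qf_eq_Bf, Bf_add_left, Bf_add_right]; linarith

/-- The bilinear form of a matrix as a continuous bilinear map. -/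
def BfL (M : Mat n) : Eu n →L[ℝ] Eu n →L[ℝ] ℝ := (innerSL ℝ (E := Eu n)).flip.comp (mulE M)

lemma BfL_apply (M : Mat n) (hM : M.IsHermitian) (x y : Eu n) : BfL M x y = Bf M x y := by
  rw [Bf_comm hM, Bf_eq_inner]; rfl

lemma fderiv_half_Qf (M : Mat n) (hM : M.IsHermitian) :
    fderiv ℝ (fun y : Eu n => (1 / 2 : ℝ) * Qf M y) = fun y => BfL M y := by
  ext1 x; refine HasFDerivAt.fderiv ?_
  have h : (fun y : Eu n => (1 / 2 : ℝ) * Qf M y) = fun y => (1 / 2 : ℝ) * BfL M y y := by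
    ext y; rw [BfL_apply M hM, Qf_eq_Bf]
  rw [h]; have h2 := ((BfL M).hasFDerivAt (x := x)).clm_apply (hasFDerivAt_id x)
  refine (h2.const_mul (1 / 2 : ℝ)).congr_fderiv ?_; ext y
  simp only [_root_.smul_apply, _root_.add_apply,
    ContinuousLinearMap.comp_apply, ContinuousLinearMap.flip_apply, smul_eq_mul, id,
    ContinuousLinearMap.id_apply, BfL_apply M hM]
  rw [Bf_comm hM y x]; ring

lemma hess_half_Qf (M : Mat n) (hM : M.IsHermitian) (x : Eu n) :
    hess (fun y : Eu n => (1 / 2 : ℝ) * Qf M y) x = M := by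
  refine hess_eq_of_fderiv fun ξ η => ?_; rw [fderiv_half_Qf M hM, (BfL M).fderiv, BfL_apply M hM]

lemma hess_comp_affine (hu : ContDiff ℝ 2 u) (c : ℝ) (x0 : Eu n) (L : Mat n) (y : Eu n) :
    hess (fun y => c * u (x0 + mulE L y)) y = c • (Lᵀ * hess u (x0 + mulE L y) * L) := by
  have hA : ∀ y, HasFDerivAt (fun y => x0 + mulE L y) (mulE L) y := fun y =>
    (mulE L).hasFDerivAt.const_add x0
  have h1 : fderiv ℝ (fun y => c * u (x0 + mulE L y)) =
      fun y => c • (fderiv ℝ u (x0 + mulE L y)).comp (mulE L) := by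
    ext1 y; exact ((((hu_diff hu) _).hasFDerivAt.comp y (hA y)).const_mul c).fderiv
  refine hess_eq_of_fderiv fun ξ η => ?_
  have h2 : HasFDerivAt (fun y => fderiv ℝ u (x0 + mulE L y))
      ((fderiv ℝ (fderiv ℝ u) (x0 + mulE L y)).comp (mulE L)) y :=
    ((hu_diff2 hu) _).hasFDerivAt.comp y (hA y)
  have h3 := (h2.clm_comp (hasFDerivAt_const (mulE L) y)).const_smul c
  have h5 : fderiv ℝ (fun y => c • (fderiv ℝ u (x0 + mulE L y)).comp (mulE L)) y = _ := h3.fderiv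
  rw [h1, h5]; have h4 : Bf (c • (Lᵀ * hess u (x0 + mulE L y) * L)) ξ η
      = c * Bf (Lᵀ * hess u (x0 + mulE L y) * L) ξ η := by
    simp only [Bf, Matrix.smul_apply, smul_eq_mul, mul_sum]
    refine sum_congr rfl fun i _ => sum_congr rfl fun j _ => by ring
  rw [h4, Bf_transpose_mul_mul, ← fderiv_fderiv_eq]; simp

lemma det_hess_comp_affine (hu : ContDiff ℝ 2 u) (c : ℝ) (x0 : Eu n) (L : Mat n) (y : Eu n) :
    (hess (fun y => c * u (x0 + mulE L y)) y).det
      = c ^ n * L.det ^ 2 * (hess u (x0 + mulE L y)).det := by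
  rw [hess_comp_affine hu, det_smul, det_mul, det_mul, det_transpose]; simp; ring

lemma contDiff_comp_affine (hu : ContDiff ℝ 2 u) (c : ℝ) (x0 : Eu n)
    (L : Mat n) : ContDiff ℝ 2 fun y => c * u (x0 + mulE L y) := by
  have : ContDiff ℝ 2 fun y => x0 + mulE L y := contDiff_const.add (mulE L).contDiff
  exact contDiff_const.mul (hu.comp this)

lemma convexOn_comp_affine (hc : ConvexOn ℝ Set.univ u) {c : ℝ} (hc0 : 0 ≤ c) (x0 : Eu n)
    (L : Mat n) : ConvexOn ℝ Set.univ fun y => c * u (x0 + mulE L y) := by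
  have h := (hc.comp_affineMap
    ((AffineMap.const ℝ (Eu n) x0) + (mulE L : Eu n →ₗ[ℝ] Eu n).toAffineMap)).smul hc0
  rw [Set.preimage_univ] at h; exact h

lemma hasFDerivAt_gradient (hu : ContDiff ℝ 2 u) (x : Eu n) :
    HasFDerivAt (gradient u) (mulE (hess u x)) x := by
  have h := (((InnerProductSpace.toDual ℝ (Eu n)).symm.toContinuousLinearEquiv
    : _ ≃L[ℝ] _).toContinuousLinearMap.hasFDerivAt).comp x ((hu_diff2 hu) x).hasFDerivAt
  refine h.congr_fderiv ?_; ext1 ξ; refine ext_inner_left ℝ fun η => ?_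
  rw [← Bf_eq_inner, Bf_comm (hess_isHermitian hu x), ← fderiv_fderiv_eq]; rw [real_inner_comm]
  simp

lemma inner_gradient (x ξ : Eu n) : ⟪gradient u x, ξ⟫ = fderiv ℝ u x ξ := by simp [gradient]

lemma det_mulE (M : Mat n) : (mulE M).det = M.det := by
  rw [ContinuousLinearMap.det, mulE]
  simp [Matrix.coe_toEuclideanCLM_eq_toEuclideanLin, Matrix.toEuclideanLin_eq_toLin_orthonormal]

lemma gradient_injective (hu : ContDiff ℝ 2 u) (h : ∀ x, (hess u x).PosDef) :
    Injective (gradient u) := by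
  intro x y hxy
  by_contra hne
  have hd : y - x ≠ 0 := sub_ne_zero.2 (Ne.symm hne)
  have hmono : StrictMono fun s : ℝ => fderiv ℝ u (x + s • (y - x)) (y - x) := by
    refine strictMono_of_deriv_pos fun s => ?_; rw [(hasDerivAt_line2 hu x (y - x) (y - x) s).deriv]
    exact (posDef_iff_Qf (h _).1).1 (h _) _ hd
  have := hmono (show (0 : ℝ) < 1 by norm_num)
  simp only [zero_smul, add_zero, one_smul, add_sub_cancel] at this
  rw [← inner_gradient, ← inner_gradient, hxy] at this; exact lt_irrefl _ this

lemma continuous_gradient (hu : ContDiff ℝ 2 u) : Continuous (gradient u) :=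
  continuous_iff_continuousAt.2 fun x => (hasFDerivAt_gradient hu x).continuousAt

end calculus

/-- The Laplacian. -/
def lap (u : Eu n → ℝ) (x : Eu n) : ℝ := (hess u x).trace

lemma continuous_lap (hu : ContDiff ℝ 2 u) : Continuous (lap u) := by
  unfold lap Matrix.trace; exact continuous_finsetSum _ fun i _ => continuous_hess_apply hu i i

section
variable {x : Eu n} {r : ℝ}

lemma intOn (hg : Continuous g := by fun_prop) : IntegrableOn g (closedBall x r) :=
  hg.continuousOn.integrableOn_compact (isCompact_closedBall x r)

lemma int_mono (h : ∀ y ∈ closedBall x r, f y ≤ g y) (hf : Continuous f := by fun_prop)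
    (hg : Continuous g := by fun_prop) : ∫ y in closedBall x r, f y ≤ ∫ y in closedBall x r, g y :=
  setIntegral_mono_on (intOn hf) (intOn hg) measurableSet_closedBall h

lemma int_add (hf : Continuous f := by fun_prop) (hg : Continuous g := by fun_prop) :
    ∫ y in closedBall x r, (f y + g y) = (∫ y in closedBall x r, f y) + ∫ y in closedBall x r, g y :=
  integral_add (intOn hf) (intOn hg)

end

lemma setIntegral_mono_ball (hg : Continuous g) (h0 : ∀ x, 0 ≤ g x) {x y : Eu n}
    {r s : ℝ} (h : closedBall x r ⊆ closedBall y s) :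
    ∫ z in closedBall x r, g z ≤ ∫ z in closedBall y s, g z :=
  setIntegral_mono_set (intOn hg) (Eventually.of_forall h0) h.eventuallyLE

lemma int_abs_nonneg {x : Eu n} {r : ℝ} : 0 ≤ ∫ z in closedBall x r, |g z| :=
  integral_nonneg fun _ => abs_nonneg _

lemma integral_affine_image (x0 : Eu n) {L : Mat n} (hL : L.det ≠ 0)
    {s : Set (Eu n)} (hs : MeasurableSet s) (g : Eu n → ℝ) :
    ∫ x in (fun y => x0 + mulE L y) '' s, g x = |L.det| * ∫ y in s, g (x0 + mulE L y) := by
  have hinj : Injective fun y => x0 + mulE L y := by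
    intro a b hab; have h1 : mulE L a = mulE L b := add_left_cancel hab
    have h2 : L⁻¹ * L = 1 := Matrix.nonsing_inv_mul L (isUnit_iff_ne_zero.2 hL)
    have h3 := congrArg (mulE L⁻¹) h1
    rwa [← mulE_mul, ← mulE_mul, h2, mulE_one, mulE_one] at h3
  rw [integral_image_eq_integral_abs_det_fderiv_smul volume hs (f' := fun _ => mulE L)
    (fun y _ => ((mulE L).hasFDerivAt.const_add x0).hasFDerivWithinAt) hinj.injOn]
  simp only [det_mulE, smul_eq_mul]; rw [integral_const_mul]

lemma integral_comp_affine_le (x0 : Eu n) {L : Mat n} (hL : L.det ≠ 0)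
    (hg : Continuous g) (h0 : ∀ x, 0 ≤ g x) {a b : Eu n} {r s : ℝ}
    (h : ∀ y ∈ closedBall a r, x0 + mulE L y ∈ closedBall b s) :
    ∫ y in closedBall a r, g (x0 + mulE L y) ≤ |L.det|⁻¹ * ∫ x in closedBall b s, g x := by
  rw [le_inv_mul_iff₀ (abs_pos.2 hL), ← integral_affine_image x0 hL measurableSet_closedBall g]
  refine setIntegral_mono_set (intOn hg) (Eventually.of_forall h0) ?_
  exact LE.le.eventuallyLE (by rintro _ ⟨y, hy, rfl⟩; exact h y hy)

lemma mulE_smul_one (c : ℝ) (y : Eu n) : mulE (c • (1 : Mat n)) y = c • y := by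
  ext i; simp [mulE_apply, Matrix.one_apply]

lemma integral_comp_smul_le (x0 : Eu n) {c : ℝ} (hc : c ≠ 0)
    (hg : Continuous g) (h0 : ∀ x, 0 ≤ g x) {a b : Eu n} {r s : ℝ}
    (h : ∀ y ∈ closedBall a r, x0 + c • y ∈ closedBall b s) :
    ∫ y in closedBall a r, g (x0 + c • y) ≤ (|c| ^ n)⁻¹ * ∫ x in closedBall b s, g x := by
  have h1 := integral_comp_affine_le x0 (L := c • (1 : Mat n))
    (by simp [hc]) hg h0 (a := a) (b := b) (r := r) (s := s)
    (by simpa only [mulE_smul_one] using h)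
  simpa only [mulE_smul_one, det_smul, det_one, mul_one, card_fin, abs_pow] using h1

/-- The volume of the unit ball. -/
def ωn (n : ℕ) : ℝ := (volume : Measure (Eu n)).real (closedBall 0 1)

lemma ωn_pos : 0 < ωn n := by
  refine ENNReal.toReal_pos (measure_closedBall_pos volume _ one_pos).ne' ?_
  exact (isCompact_closedBall _ _).measure_lt_top.ne

lemma vol_closedBall (x : Eu n) {r : ℝ} (hr : 0 ≤ r) :
    (volume : Measure (Eu n)).real (closedBall x r) = r ^ n * ωn n := by
  rw [real, Measure.addHaar_closedBall' volume x hr, ENNReal.toReal_mul,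
    ENNReal.toReal_ofReal (by positivity)]
  simp [ωn, real]

lemma convex_sup_le_integral (hU : ConvexOn ℝ Set.univ U) {w : Eu n → ℝ}
    (hw : Continuous w) {M : Mat n} {m : ℝ} (hm : 0 ≤ m)
    (hM : ∀ y, Qf M y ≤ m * ‖y‖ ^ 2)
    (hP : ∀ x y, (U (x + y) - w (x + y)) + (U (x - y) - w (x - y)) - 2 * (U x - w x) = Qf M y)
    (x : Eu n) {ρ : ℝ} (hρ : 0 < ρ) :
    |w x| ≤ 4 * (ωn n * ρ ^ n)⁻¹ * (∫ z in closedBall x (2 * ρ), |w z|) + m * ρ ^ 2 := by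
  have hV : (volume : Measure (Eu n)).real (closedBall 0 ρ) = ωn n * ρ ^ n := by
    rw [vol_closedBall _ hρ.le, mul_comm]
  have hVpos : 0 < ωn n * ρ ^ n := mul_pos ωn_pos (by positivity)
  set I := ∫ z in closedBall x (2 * ρ), |w z|
  have hmid : ∀ a b : Eu n, 2 * U a ≤ U (a + b) + U (a - b) := by
    intro a b; have h2' := hU.2
    have h := h2' (Set.mem_univ (a + b)) (Set.mem_univ (a - b)) (show (0 : ℝ) ≤ 1 / 2 by norm_num)
      (show (0 : ℝ) ≤ 1 / 2 by norm_num) (by norm_num)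
    have h2 : (1 / 2 : ℝ) • (a + b) + (1 / 2 : ℝ) • (a - b) = a := by module
    rw [h2] at h; simp only [smul_eq_mul] at h; linarith
  have hpt : ∀ y ∈ 𝔹 n ρ, |w x| - m * ρ ^ 2 ≤
      2 * |w (x + (1 : ℝ) • y)| + |w (x + (-1 : ℝ) • y)| + |w (x + (2 : ℝ) • y)| := by
    intro y hy; have hy' : ‖y‖ ≤ ρ := by simpa using hy
    have hQ : Qf M y ≤ m * ρ ^ 2 := (hM y).trans (by gcongr); have h1 := hmid x y; have h2 := hP x y
    have h3 := hmid (x + y) y; have h4 := hP (x + y) y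
    have e1 : x + y + y = x + (2 : ℝ) • y := by module
    have e2 : x + y - y = x := by module
    have e3 : x + y = x + (1 : ℝ) • y := by module
    have e4 : x - y = x + (-1 : ℝ) • y := by module
    rw [e1, e2, e3] at h3 h4; rw [e3, e4] at h1 h2
    have a1 := abs_le.1 (le_refl |w (x + (1 : ℝ) • y)|)
    have a2 := abs_le.1 (le_refl |w (x + (-1 : ℝ) • y)|)
    have a3 := abs_le.1 (le_refl |w (x + (2 : ℝ) • y)|)
    rcases abs_cases (w x) with ⟨h, -⟩ | ⟨h, -⟩ <;> rw [h] <;>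
      linarith [abs_nonneg (w (x + (1 : ℝ) • y)), abs_nonneg (w (x + (-1 : ℝ) • y)),
        abs_nonneg (w (x + (2 : ℝ) • y))]
  have hIB := int_mono hpt
  have hj : ∫ y in 𝔹 n ρ, (2 * |w (x + (1 : ℝ) • y)| + |w (x + (-1 : ℝ) • y)| +
      |w (x + (2 : ℝ) • y)|) = 2 * (∫ y in 𝔹 n ρ, |w (x + (1 : ℝ) • y)|) +
      (∫ y in 𝔹 n ρ, |w (x + (-1 : ℝ) • y)|) +
      ∫ y in 𝔹 n ρ, |w (x + (2 : ℝ) • y)| := by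
    rw [int_add, int_add, integral_const_mul]
  rw [hj] at hIB; have hcv : ∀ c : ℝ, 1 ≤ |c| → |c| ≤ 2 → ∫ y in 𝔹 n ρ, |w (x + c • y)| ≤ I := by
    intro c h1 h2; have hc : c ≠ 0 := by intro h; rw [h] at h1; simp at h1; linarith
    have h3 := integral_comp_smul_le x hc (g := fun z => |w z|) hw.abs (fun _ => abs_nonneg _)
      (a := 0) (b := x) (r := ρ) (s := 2 * ρ) (by
        intro y hy; have hy' : ‖y‖ ≤ ρ := by simpa using hy
        simp only [mem_closedBall, dist_eq_norm, add_sub_cancel_left, norm_smul, norm_eq_abs]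
        gcongr)
    refine h3.trans ?_; have : (|c| ^ n)⁻¹ ≤ 1 := inv_le_one_of_one_le₀ (one_le_pow₀ h1)
    calc _ ≤ 1 * I := by gcongr
      _ = I := one_mul I
  have k1 := hcv 1 (by norm_num) (by norm_num); have k2 := hcv (-1) (by norm_num) (by norm_num)
  have k3 := hcv 2 (by norm_num) (by norm_num); rw [setIntegral_const, hV, smul_eq_mul] at hIB
  have : ωn n * ρ ^ n * (|w x| - m * ρ ^ 2) ≤ 4 * I := by linarith
  rw [← le_div_iff₀' hVpos] at this
  have e : 4 * (ωn n * ρ ^ n)⁻¹ * I = 4 * I / (ωn n * ρ ^ n) := by ring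
  rw [e]; linarith

lemma inner_gradient_gradient (f g : Eu n → ℝ) (x : Eu n) :
    ⟪gradient f x, gradient g x⟫ = ∑ i, fderiv ℝ f x (single i 1) * fderiv ℝ g x (single i 1) := by
  rw [PiLp.inner_apply]; refine sum_congr rfl fun i _ => ?_
  have : ∀ h : Eu n → ℝ, gradient h x i = fderiv ℝ h x (single i 1) := by
    intro h; rw [← inner_gradient, PiLp.inner_apply]; simp
  simp [this, mul_comm]

lemma lap_eq_sum (φ : Eu n → ℝ) (x : Eu n) : lap φ x = ∑ i, fderiv ℝ (fderiv ℝ φ) x (single i 1)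
      (single i 1) := by
  simp only [lap, Matrix.trace, diag, hess_apply]

lemma green {f φ : Eu n → ℝ} (hf : ContDiff ℝ 1 f) (hφ : ContDiff ℝ 2 φ)
    (hs : HasCompactSupport f ∨ HasCompactSupport φ) :
    ∫ x, ⟪gradient f x, gradient φ x⟫ = -∫ x, f x * lap φ x := by
  have c2 : Continuous (fderiv ℝ φ) := (contDiff_one_fderiv hφ).continuous
  have key : ∀ i : Fin n, Integrable (fun x => f x * fderiv ℝ (fderiv ℝ φ) x
        (single i 1) (single i 1)) ∧
      Integrable (fun x => fderiv ℝ f x (single i 1) * fderiv ℝ φ x (single i 1)) ∧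
      ∫ x, f x * fderiv ℝ (fderiv ℝ φ) x (single i 1)
        (single i 1) = -∫ x, fderiv ℝ f x (single i 1) *
        fderiv ℝ φ x (single i 1) := by
    intro i; set e : Eu n := single i 1
    let g : Eu n → ℝ := fun x => fderiv ℝ φ x e
    have hg' : ∀ x, fderiv ℝ g x e = fderiv ℝ (fderiv ℝ φ) x e e := by
      intro x; have h := (((hu_diff2 hφ) x).hasFDerivAt.clm_apply (hasFDerivAt_const e x)).fderiv
      have h' : fderiv ℝ g x = _ := h; rw [h']; simp
    have i1 : Integrable (fun x => f x * fderiv ℝ (fderiv ℝ φ) x e e) := by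
      refine Continuous.integrable_of_hasCompactSupport ?_ ?_
      · exact hf.continuous.mul (by fun_prop)
      · rcases hs with h | h
        · exact h.mul_right
        · refine HasCompactSupport.mul_left ?_
          exact (h.fderiv (𝕜 := ℝ)).fderiv (𝕜 := ℝ) |>.comp_left
            (g := fun T : Eu n →L[ℝ] Eu n →L[ℝ] ℝ => T e e) (by simp)
    have i2 : Integrable (fun x => fderiv ℝ f x e * fderiv ℝ φ x e) := by
      refine Continuous.integrable_of_hasCompactSupport (by fun_prop) ?_
      rcases hs with h | h
      · refine HasCompactSupport.mul_right ?_
        exact (h.fderiv (𝕜 := ℝ)).comp_left (g := fun T : Eu n →L[ℝ] ℝ => T e) (by simp)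
      · refine HasCompactSupport.mul_left ?_
        exact (h.fderiv (𝕜 := ℝ)).comp_left (g := fun T : Eu n →L[ℝ] ℝ => T e) (by simp)
    have i3 : Integrable (fun x => f x * g x) := by
      refine Continuous.integrable_of_hasCompactSupport (hf.continuous.mul (by fun_prop)) ?_
      rcases hs with h | h
      · exact h.mul_right
      · refine HasCompactSupport.mul_left ?_
        exact (h.fderiv (𝕜 := ℝ)).comp_left (g := fun T : Eu n →L[ℝ] ℝ => T e) (by simp)
    refine ⟨i1, i2, ?_⟩
    have h := integral_mul_fderiv_eq_neg_fderiv_mul_of_integrable (f := f) (g := g) (v := e)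
      (μ := volume) i2 (by simpa only [hg'] using i1) i3
      (fun x _ => hf.differentiable (by norm_num) x)
      (fun x _ => ((hu_diff2 hφ) x).clm_apply (differentiableAt_const e))
    simpa only [hg'] using h
  simp_rw [inner_gradient_gradient, lap_eq_sum, mul_sum]
  rw [integral_finsetSum _ fun i _ => (key i).2.1, integral_finsetSum _ fun i _ => (key i).1,
    ← Finset.sum_neg_distrib]
  refine sum_congr rfl fun i _ => ?_; rw [(key i).2.2, neg_neg]

lemma integral_mul_lap_comm {f φ : Eu n → ℝ} (hf : ContDiff ℝ 2 f) (hφ : ContDiff ℝ 2 φ)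
    (hs : HasCompactSupport f) : ∫ x, f x * lap φ x = ∫ x, φ x * lap f x := by
  have h1 := green (hf.of_le (by norm_num)) hφ (Or.inl hs)
  have h2 := green (hφ.of_le (by norm_num)) hf (Or.inr hs)
  simp_rw [real_inner_comm] at h2
  linarith

lemma taylor_two {φ φ' φ'' : ℝ → ℝ} (h1 : ∀ t, HasDerivAt φ (φ' t) t)
    (h2 : ∀ t, HasDerivAt φ' (φ'' t) t) {c δ : ℝ} (h : ∀ t ∈ Icc (0 : ℝ) 1, |φ'' t - c| ≤ δ) :
    |φ 1 - φ 0 - φ' 0 - c / 2| ≤ δ := by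
  have hδ : 0 ≤ δ := (abs_nonneg _).trans (h 0 (by simp))
  have h3 : ∀ t ∈ Icc (0 : ℝ) 1, |φ' t - φ' 0 - c * t| ≤ δ := by
    intro t ht; have := (convex_Icc (0 : ℝ) 1).norm_image_sub_le_of_norm_hasDerivWithin_le
      (f := fun t => φ' t - c * t) (f' := fun t => φ'' t - c) (C := δ)
      (fun x _ => ((h2 x).sub (by simpa using (hasDerivAt_id x).const_mul c)).hasDerivWithinAt)
      (fun x hx => by simpa using h x hx) (Set.left_mem_Icc.2 zero_le_one) ht
    simp only [norm_eq_abs] at this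
    rw [show φ' t - φ' 0 - c * t = φ' t - c * t - (φ' 0 - c * 0) by ring]; refine this.trans ?_
    rw [sub_zero, abs_of_nonneg ht.1]; nlinarith [ht.2]
  have := (convex_Icc (0 : ℝ) 1).norm_image_sub_le_of_norm_hasDerivWithin_le
      (f := fun t => φ t - φ' 0 * t - c / 2 * t ^ 2) (f' := fun t => φ' t - φ' 0 - c * t) (C := δ)
      (fun x _ => by
        have e1 : HasDerivAt (fun t => φ' 0 * t) (φ' 0) x := by
          simpa using (hasDerivAt_id x).const_mul (φ' 0)
        have e2 : HasDerivAt (fun t => c / 2 * t ^ 2) (c * x) x := by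
          exact ((hasDerivAt_pow 2 x).const_mul (c / 2)).congr_deriv (by push_cast; ring)
        exact (((h1 x).sub e1).sub e2).hasDerivWithinAt)
      (fun x hx => by simpa using h3 x hx) (Set.left_mem_Icc.2 zero_le_one)
      (Set.right_mem_Icc.2 zero_le_one)
  simp only [norm_eq_abs] at this
  rw [show φ 1 - φ 0 - φ' 0 - c / 2 = φ 1 - φ' 0 * 1 - c / 2 * 1 ^ 2 -
    (φ 0 - φ' 0 * 0 - c / 2 * 0 ^ 2) by ring]
  simpa using this

lemma setIntegral_swap {X Y : Type*} [MetricSpace X] [MetricSpace Y] [MeasurableSpace X]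
    [MeasurableSpace Y] [BorelSpace X] [BorelSpace Y] [SecondCountableTopology X]
    [SecondCountableTopology Y] (μ : Measure X) (ν : Measure Y) [SFinite μ] [SFinite ν]
    [IsFiniteMeasureOnCompacts μ] [IsFiniteMeasureOnCompacts ν]
    {A : Set X} {B : Set Y} (hA : IsCompact A) (hB : IsCompact B) {F : X → Y → ℝ}
    (hF : Continuous (uncurry F)) :
    ∫ x in A, ∫ y in B, F x y ∂ν ∂μ = ∫ y in B, ∫ x in A, F x y ∂μ ∂ν := by
  refine integral_integral_swap ?_; rw [Measure.prod_restrict]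
  have : IsFiniteMeasureOnCompacts (μ.prod ν) := by
    refine ⟨fun K hK => ?_⟩; have h1 : K ⊆ (Prod.fst '' K) ×ˢ (Prod.snd '' K) := fun p hp =>
      ⟨⟨p, hp, rfl⟩, ⟨p, hp, rfl⟩⟩
    refine (measure_mono h1).trans_lt ?_; rw [Measure.prod_prod]
    exact ENNReal.mul_lt_top (hK.image continuous_fst).measure_lt_top
      (hK.image continuous_snd).measure_lt_top
  exact hF.continuousOn.integrableOn_compact (hA.prod hB)

/-- A smooth radial bump supported in the unit ball. -/
def bumpΨ (n : ℕ) (y : Eu n) : ℝ := expNegInvGlue (1 - ‖y‖ ^ 2)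

/-- The radial kernel `K` with `∇Ψ(y) = -K(y) y`. -/
def bumpK (n : ℕ) (y : Eu n) : ℝ := 2 * deriv expNegInvGlue (1 - ‖y‖ ^ 2)

lemma contDiff_deriv_glue : ContDiff ℝ ∞ (deriv expNegInvGlue) :=
  ((contDiff_infty_iff_deriv (f := expNegInvGlue)).1 expNegInvGlue.contDiff).2

lemma contDiff_bumpΨ : ContDiff ℝ ∞ (bumpΨ n) :=
  expNegInvGlue.contDiff.comp (contDiff_const.sub (contDiff_norm_sq ℝ))

lemma contDiff_bumpK : ContDiff ℝ ∞ (bumpK n) :=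
  contDiff_const.mul (contDiff_deriv_glue.comp (contDiff_const.sub (contDiff_norm_sq ℝ)))

lemma bumpΨ_nonneg (y : Eu n) : 0 ≤ bumpΨ n y := expNegInvGlue.nonneg _

lemma bumpK_nonneg (y : Eu n) : 0 ≤ bumpK n y :=
  mul_nonneg zero_le_two expNegInvGlue.monotone.deriv_nonneg

lemma bumpΨ_eq_zero {y : Eu n} (hy : 1 ≤ ‖y‖) : bumpΨ n y = 0 :=
  expNegInvGlue.zero_of_nonpos (by nlinarith)

lemma bumpK_eq_zero {y : Eu n} (hy : 1 ≤ ‖y‖) : bumpK n y = 0 := by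
  have h : expNegInvGlue (1 - ‖y‖ ^ 2) = 0 := expNegInvGlue.zero_of_nonpos (by nlinarith)
  have : IsLocalMin expNegInvGlue (1 - ‖y‖ ^ 2) :=
    Eventually.of_forall fun z => by rw [h]; exact expNegInvGlue.nonneg z
  rw [bumpK, this.deriv_eq_zero, mul_zero]

lemma hasCompactSupport_of_norm {r : ℝ} (h : ∀ y, r ≤ ‖y‖ → g y = 0) : HasCompactSupport g :=
  HasCompactSupport.intro (isCompact_closedBall (0 : Eu n) r) fun x hx =>
    h x (le_of_lt (by simpa using hx))

lemma hasCompactSupport_bumpΨ : HasCompactSupport (bumpΨ n) :=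
  hasCompactSupport_of_norm fun _ => bumpΨ_eq_zero

lemma hasCompactSupport_bumpK : HasCompactSupport (bumpK n) :=
  hasCompactSupport_of_norm fun _ => bumpK_eq_zero

lemma fderiv_bumpΨ (y η : Eu n) : fderiv ℝ (bumpΨ n) y η = -(bumpK n y * ⟪y, η⟫) := by
  have h1 : HasDerivAt expNegInvGlue (deriv expNegInvGlue (1 - ‖y‖ ^ 2)) (1 - ‖y‖ ^ 2) :=
    ((expNegInvGlue.contDiff (n := 1)).differentiable (by norm_num) _).hasDerivAt
  have h2 : HasFDerivAt (fun y : Eu n => 1 - ‖y‖ ^ 2) (-(2 • innerSL ℝ y)) y := by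
    have := (hasStrictFDerivAt_norm_sq y).hasFDerivAt; exact this.const_sub 1
  have h3 := (h1.comp_hasFDerivAt y h2).fderiv; have h4 : fderiv ℝ (bumpΨ n) y = _ := h3; rw [h4]
  simp [bumpK]; ring

/-- The total mass of `K`. -/
def κ0 (n : ℕ) : ℝ := ∫ y, bumpK n y

lemma κ0_pos [NeZero n] : 0 < κ0 n := by
  obtain ⟨t, ht, hd⟩ := exists_deriv_eq_slope expNegInvGlue (zero_lt_one)
    (expNegInvGlue.contDiff (n := 1)).continuous.continuousOn
    ((expNegInvGlue.contDiff (n := 1)).differentiable (by norm_num)).differentiableOn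
  refine contDiff_bumpK.continuous.integral_pos_of_hasCompactSupport_nonneg_nonzero
    (μ := volume) hasCompactSupport_bumpK bumpK_nonneg
    (x := single 0 (sqrt (1 - t))) ?_
  rw [bumpK, PiLp.norm_single, norm_eq_abs, sq_abs, sq_sqrt (by linarith [ht.2]),
    sub_sub_cancel, hd, expNegInvGlue.zero_of_nonpos le_rfl]
  have := expNegInvGlue.pos_of_pos one_pos; simp [this.ne']

lemma integral_eq_setIntegral_closedBall {r : ℝ} (h : ∀ y, r ≤ ‖y‖ → g y = 0) :
    ∫ y, g y = ∫ y in closedBall 0 r, g y := by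
  rw [setIntegral_eq_integral_of_forall_compl_eq_zero]; intro x hx
  exact h x (le_of_lt (by simpa using hx))

lemma hess_comp_smul (hw : ContDiff ℝ 2 w) (x : Eu n) (s : ℝ) (y : Eu n) :
    lap (fun y => w (x + s • y)) y = s ^ 2 * lap w (x + s • y) := by
  have h := hess_comp_affine hw 1 x (s • (1 : Mat n)) y; simp only [mulE_smul_one, one_mul] at h
  rw [lap, h, lap]; simp [trace_smul, pow_two, mul_assoc]

lemma mean_formula (hw : ContDiff ℝ 2 w) (x : Eu n) : ∫ y, (w (x + y) - w x) * bumpK n y =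
      ∫ s in Icc (0 : ℝ) 1, s * ∫ y in 𝔹 n 1, bumpΨ n y * lap w (x + s • y) := by
  have c1 : Continuous (fderiv ℝ w) := (contDiff_one_fderiv hw).continuous
  have hK : Continuous (bumpK n) := contDiff_bumpK.continuous
  rw [integral_eq_setIntegral_closedBall (r := 1) (fun y hy => by rw [bumpK_eq_zero hy, mul_zero])]
  have h1 : ∀ y : Eu n, (w (x + y) - w x) * bumpK n y =
      ∫ s in Icc (0 : ℝ) 1, fderiv ℝ w (x + s • y) y * bumpK n y := by
    intro y
    have hd : ∀ s : ℝ, HasDerivAt (fun s : ℝ => w (x + s • y)) (fderiv ℝ w (x + s • y) y) s :=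
      fun s => hasDerivAt_line hw x y s
    have := intervalIntegral.integral_eq_sub_of_hasDerivAt (a := 0) (b := 1) (fun s _ => hd s)
      (Continuous.intervalIntegrable (by fun_prop) 0 1)
    simp only [one_smul, zero_smul, add_zero] at this
    rw [integral_mul_const, ← this, intervalIntegral.integral_of_le zero_le_one,
      integral_Icc_eq_integral_Ioc]
  simp_rw [h1]
  rw [setIntegral_swap volume volume (isCompact_closedBall _ _) isCompact_Icc
    (F := fun (y : Eu n) (s : ℝ) => fderiv ℝ w (x + s • y) y * bumpK n y)
    (by simp only [uncurry_def]; fun_prop)]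
  rw [integral_Icc_eq_integral_Ioc, integral_Icc_eq_integral_Ioc]
  refine setIntegral_congr_fun measurableSet_Ioc fun s hs => ?_
  have hss : ContDiff ℝ 2 fun y => w (x + s • y) := by fun_prop
  have hgr := green (contDiff_bumpΨ.of_le (by exact_mod_cast le_top)) hss
    (Or.inl hasCompactSupport_bumpΨ)
  have hg : ∀ y, ⟪gradient (bumpΨ n) y, gradient (fun y => w (x + s • y)) y⟫ =
      -(s * (fderiv ℝ w (x + s • y) y * bumpK n y)) := by
    intro y; rw [inner_gradient, fderiv_bumpΨ, real_inner_comm, inner_gradient]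
    have hc : HasFDerivAt (fun y => w (x + s • y))
        ((fderiv ℝ w (x + s • y)).comp (s • ContinuousLinearMap.id ℝ (Eu n))) y :=
      (hu_diff hw (x + s • y)).hasFDerivAt.comp y (((hasFDerivAt_id y).const_smul s).const_add x)
    rw [hc.fderiv]; simp; ring
  simp_rw [hg, hess_comp_smul hw] at hgr
  rw [integral_eq_setIntegral_closedBall (r := 1) (fun y hy => by rw [bumpK_eq_zero hy]; simp),
    integral_eq_setIntegral_closedBall (r := 1) (fun y hy => by rw [bumpΨ_eq_zero hy]; simp),
    integral_neg, integral_const_mul] at hgr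
  have e : ∀ y : Eu n, bumpΨ n y * (s ^ 2 * lap w (x + s • y)) =
      s ^ 2 * (bumpΨ n y * lap w (x + s • y)) := fun y => by ring
  simp_rw [e] at hgr
  rw [integral_const_mul] at hgr; have : s * (∫ y in 𝔹 n 1, fderiv ℝ w (x + s • y) y * bumpK n y) =
      s * (s * ∫ y in 𝔹 n 1, bumpΨ n y * lap w (x + s • y)) := by
    linarith [hgr]
  exact mul_left_cancel₀ hs.1.ne' this

lemma bumpΨ_le_one (y : Eu n) : bumpΨ n y ≤ 1 := by
  unfold bumpΨ expNegInvGlue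
  split_ifs with h
  · exact zero_le_one
  · rw [Real.exp_le_one_iff]
    have : 0 < (1 - ‖y‖ ^ 2)⁻¹ := inv_pos.2 (not_le.1 h); linarith

lemma integral_mollify_sub_le (hw : ContDiff ℝ 2 w) {a b : ℝ} (hab : a + 1 ≤ b) :
    ∫ x in 𝔹 n a, |∫ y, (w (x + y) - w x) * bumpK n y| ≤ ωn n * ∫ x in 𝔹 n b, |lap w x| := by
  have hl : Continuous (lap w) := continuous_lap hw
  have hΨ : Continuous (bumpΨ n) := contDiff_bumpΨ.continuous; set T := ∫ x in 𝔹 n b, |lap w x|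
  obtain ⟨A, hA⟩ : ∃ A : Eu n → ℝ → ℝ, ∀ x s,
      A x s = ∫ y in 𝔹 n 1, |lap w (x + s • y)| := ⟨_, fun _ _ => rfl⟩
  obtain ⟨B, hB⟩ : ∃ B : Eu n → ℝ → ℝ, ∀ x s,
      B x s = s * ∫ y in 𝔹 n 1, bumpΨ n y * lap w (x + s • y) :=
    ⟨_, fun _ _ => rfl⟩
  have hK1 : IsCompact (𝔹 n 1) := isCompact_closedBall _ _; have hc1 : Continuous (uncurry A) := by
    simp only [uncurry_def, hA]; exact continuous_parametric_integral_of_continuous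
      (f := fun (p : Eu n × ℝ) (y : Eu n) => |lap w (p.1 + p.2 • y)|)
      (by simp only [uncurry_def]; fun_prop) hK1
  have hc2 : Continuous (uncurry B) := by
    simp only [uncurry_def, hB]
    exact continuous_snd.mul (continuous_parametric_integral_of_continuous
      (f := fun (p : Eu n × ℝ) (y : Eu n) => bumpΨ n y * lap w (p.1 + p.2 • y))
      (by simp only [uncurry_def]; fun_prop) hK1)
  have hc3 : Continuous fun x : Eu n => ∫ s in Icc (0 : ℝ) 1, A x s :=
    continuous_parametric_integral_of_continuous hc1 isCompact_Icc
  have hc4 : Continuous fun x : Eu n => ∫ s in Icc (0 : ℝ) 1, B x s :=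
    continuous_parametric_integral_of_continuous hc2 isCompact_Icc
  have hc1' : ∀ x, Continuous (A x) := fun x => hc1.comp (Continuous.prodMk_right x)
  have hc2' : ∀ x, Continuous (B x) := fun x => hc2.comp (Continuous.prodMk_right x)
  have hmean : ∀ x, ∫ y, (w (x + y) - w x) * bumpK n y = ∫ s in Icc (0 : ℝ) 1, B x s := by
    intro x
    simp_rw [mean_formula hw x, hB]
  have hpt : ∀ x : Eu n, |∫ s in Icc (0 : ℝ) 1, B x s| ≤ ∫ s in Icc (0 : ℝ) 1, A x s := by
    intro x; refine (abs_integral_le_integral_abs).trans ?_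
    refine setIntegral_mono_on ?_ ?_ measurableSet_Icc fun s hs => ?_
    · exact (hc2' x).abs.integrableOn_Icc
    · exact (hc1' x).integrableOn_Icc
    · rw [hA, hB, abs_mul, abs_of_nonneg hs.1]
      have h1 : |∫ y in 𝔹 n 1, bumpΨ n y * lap w (x + s • y)| ≤
          ∫ y in 𝔹 n 1, |lap w (x + s • y)| := by
        refine abs_integral_le_integral_abs.trans (int_mono fun y _ => ?_)
        rw [abs_mul, abs_of_nonneg (bumpΨ_nonneg y)]
        exact mul_le_of_le_one_left (abs_nonneg _) (bumpΨ_le_one y)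
      exact (mul_le_mul hs.2 h1 (abs_nonneg _) zero_le_one).trans (by rw [one_mul])
  have hT' : ∀ s ∈ Icc (0 : ℝ) 1, ∀ y ∈ 𝔹 n 1, ∫ x in 𝔹 n a, |lap w (x + s • y)| ≤ T := by
    intro s hs y hy; have hy' : ‖y‖ ≤ 1 := by simpa using hy
    have := integral_comp_smul_le (s • y) (one_ne_zero) (g := fun z => |lap w z|) hl.abs
      (fun _ => abs_nonneg _) (a := 0) (b := 0) (r := a) (s := b) (by
        intro z hz; have hz' : ‖z‖ ≤ a := by simpa using hz
        simp only [mem_closedBall, dist_zero_right, one_smul]; refine (norm_add_le _ _).trans ?_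
        rw [norm_smul, norm_eq_abs, abs_of_nonneg hs.1]; nlinarith [hs.1, hs.2, norm_nonneg y])
    simpa [add_comm] using this
  calc ∫ x in 𝔹 n a, |∫ y, (w (x + y) - w x) * bumpK n y|
      ≤ ∫ x in 𝔹 n a, ∫ s in Icc (0 : ℝ) 1, A x s := by
        simp_rw [hmean]
        exact setIntegral_mono_on (intOn hc4.abs) (intOn hc3) measurableSet_closedBall fun x _ => hpt x
    _ = ∫ s in Icc (0 : ℝ) 1, ∫ x in 𝔹 n a, A x s :=
        setIntegral_swap volume volume (isCompact_closedBall _ _) isCompact_Icc hc1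
    _ = ∫ s in Icc (0 : ℝ) 1, ∫ y in 𝔹 n 1, ∫ x in 𝔹 n a, |lap w (x + s • y)| := by
        refine setIntegral_congr_fun measurableSet_Icc fun s _ => ?_; simp only [hA]
        exact setIntegral_swap volume volume (isCompact_closedBall _ _) hK1
          (F := fun x y => |lap w (x + s • y)|) (by simp only [uncurry_def]; fun_prop)
    _ ≤ ∫ s in Icc (0 : ℝ) 1, ωn n * T := by
        have hc5 : Continuous fun p : ℝ × Eu n =>
            ∫ x in 𝔹 n a, |lap w (x + p.1 • p.2)| :=
          continuous_parametric_integral_of_continuous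
            (f := fun (p : ℝ × Eu n) (x : Eu n) => |lap w (x + p.1 • p.2)|)
            (by simp only [uncurry_def]; fun_prop) (isCompact_closedBall _ _)
        have hc6 : Continuous fun s : ℝ => ∫ y in 𝔹 n 1, ∫ x in 𝔹 n a, |lap w (x + s • y)| :=
          continuous_parametric_integral_of_continuous (f := fun (s : ℝ) (y : Eu n) =>
              ∫ x in 𝔹 n a, |lap w (x + s • y)|) hc5 hK1
        refine setIntegral_mono_on hc6.integrableOn_Icc continuous_const.integrableOn_Icc
          measurableSet_Icc fun s hs => ?_
        calc _ ≤ ∫ y in 𝔹 n 1, T :=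
              setIntegral_mono_on (intOn (hc5.comp (Continuous.prodMk_right s))) intOn
                measurableSet_closedBall (hT' s hs)
          _ = _ := by rw [setIntegral_const, smul_eq_mul]; rfl
    _ = ωn n * T := by simp

lemma exists_lipschitz_of_hasCompactSupport {F : Type*} [NormedAddCommGroup F] [NormedSpace ℝ F]
    {K : Eu n → F} (h : ContDiff ℝ 1 K) (hs : HasCompactSupport K) : ∃ C : ℝ, 0 ≤ C ∧
      (∀ z, ‖K z‖ ≤ C) ∧ ∀ z z', ‖K z - K z'‖ ≤ C * ‖z - z'‖ := by
  obtain ⟨C, hC⟩ := h.lipschitzWith_of_hasCompactSupport hs one_ne_zero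
  obtain ⟨C1, hC1⟩ := hs.exists_bound_of_continuous h.continuous
  have p1 : 0 ≤ C1 := (norm_nonneg _).trans (hC1 0)
  refine ⟨C + C1, by positivity, fun z => (hC1 z).trans (by linarith [C.coe_nonneg]),
    fun z z' => ?_⟩
  have := hC.dist_le_mul z z'; rw [dist_eq_norm, dist_eq_norm] at this
  nlinarith [norm_nonneg (z - z')]

lemma exists_C2_lipschitz {K : Eu n → ℝ} (hK : ContDiff ℝ 3 K)
    (hs : HasCompactSupport K) : ∃ C : ℝ, 0 ≤ C ∧ (∀ z, |K z| ≤ C) ∧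
      (∀ z, ‖fderiv ℝ K z‖ ≤ C) ∧ (∀ z z', ‖fderiv ℝ K z - fderiv ℝ K z'‖ ≤ C * ‖z - z'‖) ∧
      (∀ z, ‖fderiv ℝ (fderiv ℝ K) z‖ ≤ C) ∧
      ∀ z z', ‖fderiv ℝ (fderiv ℝ K) z - fderiv ℝ (fderiv ℝ K) z'‖ ≤ C * ‖z - z'‖ := by
  have h0 : ContDiff ℝ 2 (fderiv ℝ K) := hK.fderiv_right (by norm_num)
  have h1 : ContDiff ℝ 1 (fderiv ℝ (fderiv ℝ K)) := h0.fderiv_right (by norm_num)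
  have s1 : HasCompactSupport (fderiv ℝ K) := hs.fderiv (𝕜 := ℝ)
  obtain ⟨C2, p2, a2, b2⟩ := exists_lipschitz_of_hasCompactSupport h1 (s1.fderiv (𝕜 := ℝ))
  obtain ⟨C1, p1, a1, b1⟩ := exists_lipschitz_of_hasCompactSupport (h0.of_le one_le_two) s1
  obtain ⟨C0, p0, a0, -⟩ := exists_lipschitz_of_hasCompactSupport (hK.of_le (by norm_num)) hs
  have q0 : C0 ≤ C0 + C1 + C2 := by linarith
  have q1 : C1 ≤ C0 + C1 + C2 := by linarith
  have q2 : C2 ≤ C0 + C1 + C2 := by linarith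
  exact ⟨C0 + C1 + C2, by linarith, fun z => (a0 z).trans q0, fun z => (a1 z).trans q1,
    fun z z' => (b1 z z').trans (mul_le_mul_of_nonneg_right q1 (norm_nonneg _)),
    fun z => (a2 z).trans q2,
    fun z z' => (b2 z z').trans (mul_le_mul_of_nonneg_right q2 (norm_nonneg _))⟩

lemma mollify_expansion : ∃ C : ℝ, 0 < C ∧ ∀ w : Eu n → ℝ, ContDiff ℝ 2 w →
    ∃ (S : Mat n) (b : Eu n) (c : ℝ), S.IsHermitian ∧ (∀ i j, |S i j| ≤ C * ∫ x in 𝔹 n 2, |w x|) ∧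
      (|S.trace| ≤ C * ∫ x in 𝔹 n 2, |lap w x|) ∧
      ∀ x : Eu n, ‖x‖ ≤ 1 → |(∫ y, w (x + y) * bumpK n y) - (1 / 2 * Qf S x + ⟪b, x⟫ + c)| ≤
        C * ‖x‖ ^ 3 * ∫ x in 𝔹 n 2, |w x| := by
  have hK3 : ContDiff ℝ 3 (bumpK n) := by exact_mod_cast contDiff_infty.1 contDiff_bumpK 3
  obtain ⟨C, hC0, hCK, hC1, -, hC2, hCL⟩ := exists_C2_lipschitz hK3 hasCompactSupport_bumpK
  refine ⟨C + 1, by positivity, fun w hw => ?_⟩; have hK2 : ContDiff ℝ 2 (bumpK n) := by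
    exact_mod_cast contDiff_infty.1 contDiff_bumpK 2
  have cw := hw.continuous; have cl := continuous_lap hw; have cK := hK2.continuous
  have cD : Continuous (fderiv ℝ (bumpK n)) := (contDiff_one_fderiv hK2).continuous
  set I := ∫ x in 𝔹 n 2, |w x| with hI
  let B2 : Set (Eu n) := closedBall 0 2
  let S : Mat n := fun i j => ∫ z in B2, w z * hess (bumpK n) z i j
  let b : Eu n := WithLp.toLp 2 fun i => -∫ z in B2, w z * fderiv ℝ (bumpK n) z (single i 1)
  let c : ℝ := ∫ z in B2, w z * bumpK n z
  have hIB : ∀ {g : Eu n → ℝ}, Continuous g → IntegrableOn g B2 := fun hg =>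
    intOn hg
  have hbd : ∀ (g : Eu n → ℝ) (D : ℝ), Continuous g → (∀ z, |g z| ≤ D) →
      |∫ z in B2, w z * g z| ≤ D * I := by
    intro g D hg hD; refine (abs_integral_le_integral_abs).trans ?_; rw [hI, ← integral_const_mul]
    refine int_mono fun z _ => ?_; rw [abs_mul, mul_comm]
    exact mul_le_mul_of_nonneg_right (hD z) (abs_nonneg _)
  refine ⟨S, b, c, ?_, ?_, ?_, ?_⟩
  · ext i j
    show (∫ z in B2, w z * hess (bumpK n) z j i) = ∫ z in B2, w z * hess (bumpK n) z i j
    have h : ∀ z, hess (bumpK n) z j i = hess (bumpK n) z i j :=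
      fun z => (hess_isHermitian hK2 z).apply i j
    simp_rw [h]
  · intro i j
    refine (hbd _ C (continuous_hess_apply hK2 i j) fun z => ?_).trans (by gcongr; linarith)
    rw [hess_apply, ← norm_eq_abs]; refine (ContinuousLinearMap.le_opNorm₂ _ _ _).trans ?_
    simpa using hC2 z
  · have hz : ∀ y : Eu n, 2 ≤ ‖y‖ → bumpK n y = 0 := fun y hy => bumpK_eq_zero (by linarith)
    have hlz : ∀ y : Eu n, 2 ≤ ‖y‖ → lap (bumpK n) y = 0 := by
      intro y hy; have : bumpK n =ᶠ[𝓝 y] fun _ => 0 := by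
        filter_upwards [(isOpen_lt continuous_const continuous_norm).mem_nhds
          (show (1 : ℝ) < ‖y‖ by linarith)] with z hz
        exact bumpK_eq_zero (le_of_lt hz)
      have h2 : fderiv ℝ (bumpK n) =ᶠ[𝓝 y] 0 := by have := this.fderiv (𝕜 := ℝ); simpa using this
      rw [lap_eq_sum, h2.fderiv_eq]; simp
    have h1 : S.trace = ∫ z in 𝔹 n 2, bumpK n z * lap w z := by
      have h3 := integral_mul_lap_comm hK2 hw hasCompactSupport_bumpK
      rw [integral_eq_setIntegral_closedBall (r := 2) (fun y hy => by rw [hz y hy, zero_mul]),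
        integral_eq_setIntegral_closedBall (r := 2) (fun y hy => by rw [hlz y hy, mul_zero])] at h3
      rw [h3]; simp only [lap, Matrix.trace, diag, mul_sum, S]; rw [integral_finsetSum]; intro i _
      exact hIB (cw.mul (continuous_hess_apply hK2 i i))
    rw [h1]; refine (abs_integral_le_integral_abs).trans ?_; rw [← integral_const_mul]
    refine int_mono fun z _ => ?_; rw [abs_mul]; gcongr; linarith [hCK z]
  · intro x hx
    have e1 : ∫ y, w (x + y) * bumpK n y = ∫ z in B2, w z * bumpK n (z - x) := by
      rw [← integral_add_left_eq_self (fun z => w z * bumpK n (z - x)) x |>.trans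
        (integral_eq_setIntegral_closedBall (r := 2) fun y hy => ?_)]
      · simp
      · rw [bumpK_eq_zero, mul_zero]
        have := norm_sub_norm_le y x; linarith
    have e2 : 1 / 2 * Qf S x + ⟪b, x⟫ + c = ∫ z in B2, w z * (1 / 2 * Qf (hess (bumpK n) z) x -
        fderiv ℝ (bumpK n) z x + bumpK n z) := by
      have q1 : Qf S x = ∫ z in B2, w z * Qf (hess (bumpK n) z) x := by
        simp only [Qf, S, mul_sum]; rw [integral_finsetSum]
        · refine sum_congr rfl fun i _ => ?_
          rw [integral_finsetSum]
          · refine sum_congr rfl fun j _ => ?_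
            rw [← integral_mul_const, ← integral_mul_const]
            congr 1; ext z; ring
          · intro j _
            have := continuous_hess_apply hK2 i j; exact hIB (by fun_prop)
        · intro i _
          refine hIB (continuous_finsetSum _ fun j _ => ?_); have := continuous_hess_apply hK2 i j
          fun_prop
      have q2 : ⟪b, x⟫ = ∫ z in B2, w z * (-fderiv ℝ (bumpK n) z x) := by
        rw [PiLp.inner_apply]
        have : ∀ z, w z * (-fderiv ℝ (bumpK n) z x) = ∑ i, -(w z * fderiv ℝ (bumpK n) z
            (single i 1)) * x i := by
          intro z
          conv_lhs => rw [Eu_sum_single x]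
          simp only [map_sum, map_smul, smul_eq_mul, mul_sum, ← Finset.sum_neg_distrib]
          refine sum_congr rfl fun i _ => by ring
        simp_rw [this]
        rw [integral_finsetSum]
        · refine sum_congr rfl fun i _ => ?_
          rw [integral_mul_const, integral_neg]; simp [b, mul_comm]
        · intro i _
          exact hIB (by fun_prop)
      have cQ : Continuous fun z => Qf (hess (bumpK n) z) x := continuous_Qf_hess hK2 x
      rw [q1, q2, ← integral_const_mul, ← integral_add (hIB (by fun_prop)) (hIB (by fun_prop)),
        ← integral_add (hIB (by fun_prop)) (hIB (by fun_prop))]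
      congr 1; ext z; ring
    have cQ : Continuous fun z => Qf (hess (bumpK n) z) x := continuous_Qf_hess hK2 x
    rw [e1, e2, ← integral_sub (hIB (by fun_prop)) (hIB (by fun_prop))]
    simp_rw [← mul_sub]
    refine (hbd _ (C * ‖x‖ ^ 3) (by fun_prop) fun z => ?_).trans (by gcongr; linarith)
    have ht := taylor_two (φ := fun t => bumpK n (z + t • (-x)))
      (φ' := fun t => fderiv ℝ (bumpK n) (z + t • (-x)) (-x))
      (φ'' := fun t => Bf (hess (bumpK n) (z + t • (-x))) (-x) (-x))
      (fun t => hasDerivAt_line hK2 z (-x) t) (fun t => hasDerivAt_line2 hK2 z (-x) (-x) t)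
      (c := Qf (hess (bumpK n) z) (-x)) (δ := C * ‖x‖ ^ 3) (by
        intro t ht; rw [Qf_eq_Bf, ← fderiv_fderiv_eq, ← fderiv_fderiv_eq,
          ← _root_.sub_apply, ← _root_.sub_apply, ← norm_eq_abs]
        refine (ContinuousLinearMap.le_opNorm₂ _ _ _).trans ?_; have := hCL (z + t • (-x)) z
        rw [add_sub_cancel_left, norm_smul, norm_neg, norm_eq_abs, abs_of_nonneg ht.1] at this
        rw [norm_neg]; have h5 : C * (t * ‖x‖) ≤ C * ‖x‖ := by
          gcongr; exact mul_le_of_le_one_left (norm_nonneg _) ht.2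
        calc _ ≤ (C * ‖x‖) * ‖x‖ * ‖x‖ := by gcongr; exact this.trans h5
          _ = _ := by ring)
    simp only [one_smul, zero_smul, add_zero, Qf_neg, map_neg] at ht; convert ht using 2
    rw [← sub_eq_add_neg]; ring

/-- Smooth convex functions with positive Hessian determinant. -/
structure MAConvex (v : Eu n → ℝ) : Prop where
  smooth : ContDiff ℝ 2 v
  convex : ConvexOn ℝ Set.univ v
  det_pos : ∀ x, 0 < (hess v x).det

/-- The Hessian determinant. -/
def dhess (v : Eu n → ℝ) (x : Eu n) : ℝ := (hess v x).det

/-- Difference from the standard paraboloid. -/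
def devi (v : Eu n → ℝ) (x : Eu n) : ℝ := v x - 1 / 2 * Qf 1 x

section
variable {v : Eu n → ℝ}

lemma MAConvex.posDef (hv : MAConvex v) (x : Eu n) : (hess v x).PosDef :=
  hess_posDef hv.smooth hv.convex (hv.det_pos x)

lemma MAConvex.continuous_dhess (hv : MAConvex v) : Continuous (dhess v) :=
  continuous_det_hess hv.smooth

lemma contDiff_half_Qf (M : Mat n) :
    ContDiff ℝ 2 fun y : Eu n => (1 / 2 : ℝ) * Qf M y := contDiff_const.mul (contDiff_Qf M)

lemma contDiff_devi (hv : ContDiff ℝ 2 v) : ContDiff ℝ 2 (devi v) := hv.sub (contDiff_half_Qf 1)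

lemma hess_devi (hv : ContDiff ℝ 2 v) (x : Eu n) : hess (devi v) x = hess v x - 1 := by
  have := hess_sub hv (contDiff_half_Qf (1 : Mat n)) x; rw [hess_half_Qf 1 isHermitian_one] at this
  exact this

lemma lap_devi_ge [NeZero n] (hv : MAConvex v) (x : Eu n) :
    -(n * |dhess v x - 1|) ≤ lap (devi v) x := by
  have hn := one_le_n (n := n); rw [lap, hess_devi hv.smooth, trace_sub, trace_one, card_fin]
  have h := amgm_trace (hess_posSemidef hv.smooth hv.convex x)
  change n * dhess v x ^ ((1 : ℝ) / n) ≤ _ at h; have hg : 0 < dhess v x := hv.det_pos x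
  have h1 : -|dhess v x - 1| ≤ dhess v x ^ ((1 : ℝ) / n) - 1 := by
    rcases le_total (dhess v x) 1 with h2 | h2
    · have := Real.rpow_le_rpow_of_exponent_ge hg h2 (show (1 : ℝ) / n ≤ 1 by
        rw [div_le_one (by linarith)]; exact hn)
      rw [rpow_one] at this; linarith [neg_abs_le (dhess v x - 1)]
    · have := Real.one_le_rpow h2 (show (0 : ℝ) ≤ 1 / n by positivity)
      linarith [abs_nonneg (dhess v x - 1)]
  nlinarith

lemma exists_cutoff (n : ℕ) {a b : ℝ} (ha : 0 < a) (hab : a < b) : ∃ (η : Eu n → ℝ) (C : ℝ),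
    0 ≤ C ∧ ContDiff ℝ 2 η ∧ HasCompactSupport η ∧ (∀ x, 0 ≤ η x) ∧ (∀ x, η x ≤ 1) ∧
    (∀ x, ‖x‖ ≤ a → η x = 1) ∧ (∀ x, b ≤ ‖x‖ → η x = 0) ∧ (∀ x, b ≤ ‖x‖ → lap η x = 0) ∧
    (∀ x, b ≤ ‖x‖ → fderiv ℝ η x = 0) ∧
    (∀ x, |lap η x| ≤ C) ∧ ∀ z z', ‖fderiv ℝ η z - fderiv ℝ η z'‖ ≤ C * ‖z - z'‖ := by
  let B : ContDiffBump (0 : Eu n) := ⟨a, (a + b) / 2, ha, by linarith⟩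
  have hB3 : ContDiff ℝ 3 B := B.contDiff; have hs : HasCompactSupport B := B.hasCompactSupport
  obtain ⟨C, hC0, -, -, hL, hC2, -⟩ := exists_C2_lipschitz hB3 hs
  have hz : ∀ x : Eu n, (a + b) / 2 ≤ ‖x‖ → B x = 0 := fun x hx =>
    B.zero_of_le_dist (by simpa using hx)
  have hev : ∀ x : Eu n, b ≤ ‖x‖ → (B : Eu n → ℝ) =ᶠ[𝓝 x] fun _ => 0 := by
    intro x hx; filter_upwards [(isOpen_lt continuous_const continuous_norm).mem_nhds
      (show (a + b) / 2 < ‖x‖ by linarith)] with z h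
    exact hz z (le_of_lt h)
  have hev1 : ∀ x : Eu n, b ≤ ‖x‖ → fderiv ℝ (B : Eu n → ℝ) =ᶠ[𝓝 x] 0 := by
    intro x hx; simpa using (hev x hx).fderiv (𝕜 := ℝ)
  refine ⟨B, n * C + C, by positivity, hB3.of_le (by norm_num), hs, fun x => B.nonneg,
    fun x => B.le_one, fun x hx => B.one_of_mem_closedBall (by simpa using hx),
    fun x hx => hz x (by linarith), ?_, ?_, ?_, ?_⟩
  · intro x hx
    rw [lap_eq_sum, (hev1 x hx).fderiv_eq]; simp
  · intro x hx
    exact (hev1 x hx).self_of_nhds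
  · intro x
    rw [lap_eq_sum]; have : |∑ i, fderiv ℝ (fderiv ℝ (B : Eu n → ℝ)) x (single i 1)
        (single i 1)| ≤ ∑ _i : Fin n, C := by
      refine (abs_sum_le_sum_abs _ _).trans (sum_le_sum fun i _ => ?_); rw [← norm_eq_abs]
      refine (ContinuousLinearMap.le_opNorm₂ _ _ _).trans ?_; simpa using hC2 x
    simp at this; linarith
  · intro z z'
    refine (hL z z').trans (mul_le_mul_of_nonneg_right ?_ (norm_nonneg _))
    have : 0 ≤ n * C := by positivity
    linarith

lemma setIntegral_eq_of_zero {r : ℝ} (h : ∀ y, r ≤ ‖y‖ → g y = 0) :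
    ∫ y in closedBall 0 r, g y = ∫ y, g y := (integral_eq_setIntegral_closedBall h).symm

lemma integral_abs_lap_le [NeZero n] (hv : MAConvex v) {a b : ℝ} {η : Eu n → ℝ} (hab : a ≤ b)
    (hη : Continuous η) (h0 : ∀ x, 0 ≤ η x) (h1 : ∀ x, η x ≤ 1) (ha : ∀ x, ‖x‖ ≤ a → η x = 1)
    (hb : ∀ x, b ≤ ‖x‖ → η x = 0) :
    ∫ x in 𝔹 n a, |lap (devi v) x| ≤ (∫ x, η x * lap (devi v) x) +
      2 * n * ∫ x in 𝔹 n b, |dhess v x - 1| := by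
  have cl : Continuous (lap (devi v)) := continuous_lap (contDiff_devi hv.smooth)
  have cg := hv.continuous_dhess
  have hpos : ∀ x, 0 ≤ η x * (lap (devi v) x + 2 * n * |dhess v x - 1|) := by
    intro x; have := lap_devi_ge hv x; have h2 : (0 : ℝ) ≤ n * |dhess v x - 1| := by positivity
    exact mul_nonneg (h0 x) (by linarith)
  calc ∫ x in 𝔹 n a, |lap (devi v) x|
      ≤ ∫ x in 𝔹 n a, η x * (lap (devi v) x + 2 * n * |dhess v x - 1|) := by
        refine int_mono fun x hx => ?_; rw [ha x (by simpa using hx), one_mul]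
        have := lap_devi_ge hv x; have h2 : (0 : ℝ) ≤ n * |dhess v x - 1| := by positivity
        rw [abs_le]; constructor <;> linarith
    _ ≤ ∫ x in 𝔹 n b, η x * (lap (devi v) x + 2 * n * |dhess v x - 1|) :=
        setIntegral_mono_ball (by fun_prop) hpos (closedBall_subset_closedBall hab)
    _ = (∫ x in 𝔹 n b, η x * lap (devi v) x) + ∫ x in 𝔹 n b, η x * (2 * n * |dhess v x - 1|) := by
        simp_rw [mul_add]
        exact int_add
    _ ≤ _ := by
        rw [setIntegral_eq_of_zero fun y hy => by rw [hb y hy, zero_mul]]; rw [← integral_const_mul]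
        refine add_le_add le_rfl ?_; refine int_mono fun x hx => ?_
        exact mul_le_of_le_one_left (by positivity) (h1 x)

lemma abs_integral_mul_le {w g : Eu n → ℝ} (hw : Continuous w) (hg : Continuous g) {C r : ℝ}
    (hC : ∀ x ∈ 𝔹 n r, |g x| ≤ C) (hr : ∀ x, r ≤ ‖x‖ → g x = 0) :
    |∫ x, w x * g x| ≤ C * ∫ x in 𝔹 n r, |w x| := by
  rw [← setIntegral_eq_of_zero fun y hy => by rw [hr y hy, mul_zero], ← integral_const_mul]
  refine abs_integral_le_integral_abs.trans (int_mono fun x hx => ?_); rw [abs_mul, mul_comm]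
  exact mul_le_mul_of_nonneg_right (hC x hx) (abs_nonneg _)

lemma caccioppoli {w η : Eu n → ℝ} (hw : ContDiff ℝ 2 w) (hη : ContDiff ℝ 2 η)
    (hs : HasCompactSupport η) :
    ∫ x, η x * ‖gradient w x‖ ^ 2 = -(∫ x, w x * (η x * lap w x)) +
      1 / 2 * ∫ x, w x * (w x * lap η x) := by
  have cw := hw.continuous; have cη := hη.continuous; have cgw := continuous_gradient hw
  have cgη := continuous_gradient hη
  have h1 := green (f := fun x => η x * w x) ((hη.mul hw).of_le one_le_two) hw (Or.inl hs.mul_right)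
  have h2 := green (f := fun x => w x * w x) ((hw.mul hw).of_le one_le_two) hη (Or.inr hs)
  have e1 : ∀ x, ⟪gradient (fun x => η x * w x) x, gradient w x⟫ =
      η x * ‖gradient w x‖ ^ 2 + w x * ⟪gradient η x, gradient w x⟫ := by
    intro x; rw [inner_gradient, fderiv_fun_mul (hu_diff hη x) (hu_diff hw x)]
    simp only [_root_.add_apply, _root_.smul_apply, smul_eq_mul]
    rw [← inner_gradient, ← inner_gradient, real_inner_self_eq_norm_sq]
  have e2 : ∀ x, ⟪gradient (fun x => w x * w x) x, gradient η x⟫ =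
      2 * (w x * ⟪gradient η x, gradient w x⟫) := by
    intro x; rw [inner_gradient, fderiv_fun_mul (hu_diff hw x) (hu_diff hw x)]
    simp only [_root_.add_apply, _root_.smul_apply, smul_eq_mul]
    rw [← inner_gradient, real_inner_comm]; ring
  simp_rw [e1] at h1
  simp_rw [e2] at h2
  have hgs : HasCompactSupport (gradient η) := by
    refine (hs.fderiv (𝕜 := ℝ)).comp_left (g := (InnerProductSpace.toDual ℝ (Eu n)).symm) ?_; simp
  rw [integral_const_mul] at h2; rw [integral_add] at h1
  · have e3 : ∀ x, η x * w x * lap w x = w x * (η x * lap w x) := fun x => by ring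
    have e4 : ∀ x, w x * w x * lap η x = w x * (w x * lap η x) := fun x => by ring
    simp_rw [e3] at h1
    simp_rw [e4] at h2
    linarith
  · exact Continuous.integrable_of_hasCompactSupport (by fun_prop) hs.mul_right
  · refine Continuous.integrable_of_hasCompactSupport (by fun_prop) (HasCompactSupport.mul_left ?_)
    refine hgs.mono fun x hx => ?_; simp only [Function.mem_support] at hx ⊢
    intro h; rw [h] at hx; simp at hx

lemma subset_gradient_image (hv : ContDiff ℝ 2 v) {r : ℝ} {s : ℝ} (hr : 0 ≤ r)
    (hs : ∀ x ∈ 𝔹 n (r + 1), |devi v x| ≤ s) (hs4 : s < 1 / 4) :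
    𝔹 n r ⊆ gradient v '' 𝔹 n (r + 1) := by
  intro p hp; have hp' : ‖p‖ ≤ r := by simpa using hp
  have hvq : ∀ x, v x = devi v x + 1 / 2 * ‖x‖ ^ 2 := fun x => by simp [devi, Qf_one]
  obtain ⟨x, hx, hmin⟩ := (isCompact_closedBall (0 : Eu n) (r + 1)).exists_isMinOn
    ⟨0, by simp; linarith⟩ (f := fun x => v x - ⟪p, x⟫)
    (by have := hv.continuous; fun_prop)
  have hx' : ‖x‖ ≤ r + 1 := by simpa using hx
  refine ⟨x, hx, ?_⟩; have hpx := hmin (closedBall_subset_closedBall (by linarith) hp)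
  simp only [mem_ofPred_eq] at hpx; have hIB : ‖x‖ < r + 1 := by
    rcases lt_or_eq_of_le hx' with h | h
    · exact h
    · exfalso
      have a1 := (abs_le.1 (hs x hx)).1
      have a2 := (abs_le.1 (hs p (closedBall_subset_closedBall (by linarith) hp))).2
      rw [hvq, hvq p, real_inner_self_eq_norm_sq] at hpx
      have h3 : ‖x - p‖ ^ 2 = ‖x‖ ^ 2 - 2 * ⟪x, p⟫ + ‖p‖ ^ 2 := norm_sub_sq_real x p
      have h4 : 1 ≤ ‖x - p‖ := by have := norm_sub_norm_le x p; linarith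
      rw [real_inner_comm] at h3; nlinarith
  have hloc : IsLocalMin (fun x => v x - ⟪p, x⟫) x := by
    refine hmin.isLocalMin ?_
    exact mem_of_superset (isOpen_ball.mem_nhds (show x ∈ ball (0 : Eu n) (r + 1) by simpa using hIB))
      ball_subset_closedBall
  have hd : HasFDerivAt (fun x => v x - ⟪p, x⟫) (fderiv ℝ v x - innerSL ℝ p) x :=
    (hu_diff hv x).hasFDerivAt.sub (innerSL ℝ p).hasFDerivAt
  have h0 := hloc.hasFDerivAt_eq_zero hd; refine ext_inner_right ℝ fun ξ => ?_; rw [inner_gradient]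
  have := congrArg (fun T : Eu n →L[ℝ] ℝ => T ξ) h0; simp at this; linarith

lemma gradient_devi (hv : ContDiff ℝ 2 v) (x : Eu n) : gradient v x = x + gradient (devi v) x := by
  refine ext_inner_right ℝ fun ξ => ?_; rw [inner_add_left, inner_gradient, inner_gradient]
  have h : fderiv ℝ (devi v) x = fderiv ℝ v x - BfL 1 x := by
    rw [← congrFun (fderiv_half_Qf (1 : Mat n) isHermitian_one) x]
    exact fderiv_sub (hu_diff hv x) (hu_diff (contDiff_half_Qf 1) x)
  rw [h]; simp [BfL_apply 1 isHermitian_one, Bf_one]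

lemma transport_estimate (hv : MAConvex v) {r s C : ℝ} (hr : 0 ≤ r)
    (hs : ∀ x ∈ 𝔹 n (r + 1), |devi v x| ≤ s) (hs4 : s < 1 / 4) {η : Eu n → ℝ}
    (hη : ContDiff ℝ 2 η) (hcs : HasCompactSupport η) (h0 : ∀ x, 0 ≤ η x) (h1 : ∀ x, η x ≤ 1)
    (hb : ∀ x, r ≤ ‖x‖ → η x = 0) (hb' : ∀ x, r ≤ ‖x‖ → fderiv ℝ η x = 0) (hC : 0 ≤ C)
    (hL : ∀ z z', ‖fderiv ℝ η z - fderiv ℝ η z'‖ ≤ C * ‖z - z'‖) :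
    |∫ x, η x * lap (devi v) x| ≤ C * (∫ x in 𝔹 n (r + 1),
      ‖gradient (devi v) x‖ ^ 2) + ∫ x in 𝔹 n (r + 1), |dhess v x - 1| := by
  set B := 𝔹 n (r + 1); have cη := hη.continuous; have cgv := continuous_gradient hv.smooth
  have cgw := continuous_gradient (contDiff_devi hv.smooth); have cgη := continuous_gradient hη
  have cg := hv.continuous_dhess; have hinj := gradient_injective hv.smooth hv.posDef
  have hIB : ∀ {g : Eu n → ℝ}, Continuous g → IntegrableOn g B := fun hg =>
    intOn hg
  have hcv : ∫ z, η z = ∫ x in B, η (gradient v x) * dhess v x := by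
    have := integral_image_eq_integral_abs_det_fderiv_smul volume measurableSet_closedBall
      (f' := fun x => mulE (hess v x)) (s := B)
      (fun x _ => (hasFDerivAt_gradient hv.smooth x).hasFDerivWithinAt) hinj.injOn η
    rw [setIntegral_eq_integral_of_forall_compl_eq_zero] at this
    · rw [this]
      refine setIntegral_congr_fun measurableSet_closedBall fun x _ => ?_
      simp only [det_mulE, smul_eq_mul]; rw [abs_of_pos (hv.det_pos x), mul_comm]; rfl
    · intro x hx
      apply hb
      by_contra h
      exact hx (subset_gradient_image hv.smooth hr hs hs4 (by simpa using (not_le.1 h).le))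
  have hcv2 : ∫ z, η z = ∫ x in B, η x :=
    integral_eq_setIntegral_closedBall fun y hy => hb y (by linarith)
  have hgreen := green (hη.of_le one_le_two) (contDiff_devi hv.smooth) (Or.inl hcs)
  have hgl : ∫ x, ⟪gradient η x, gradient (devi v) x⟫ =
      ∫ x in B, ⟪gradient η x, gradient (devi v) x⟫ :=
    integral_eq_setIntegral_closedBall fun y hy => by rw [inner_gradient, hb' y (by linarith)]; simp
  have hkey : ∫ x in B, ⟪gradient η x, gradient (devi v) x⟫ =
      (∫ x in B, η (gradient v x) * (1 - dhess v x)) -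
      ∫ x in B, (η (gradient v x) - η x - ⟪gradient η x, gradient (devi v) x⟫) := by
    rw [← integral_sub (hIB (by fun_prop)) (hIB (by fun_prop))]
    have : ∀ x, η (gradient v x) * (1 - dhess v x) -
        (η (gradient v x) - η x - ⟪gradient η x, gradient (devi v) x⟫) =
        ⟪gradient η x, gradient (devi v) x⟫ + (η x - η (gradient v x) * dhess v x) :=
      fun x => by ring
    simp_rw [this]
    rw [integral_add (hIB (by fun_prop)) (hIB (by fun_prop)),
      integral_sub (hIB (by fun_prop)) (hIB (by fun_prop)), ← hcv, ← hcv2]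
    ring
  have hb1 : |∫ x in B, η (gradient v x) * (1 - dhess v x)| ≤ ∫ x in B, |dhess v x - 1| := by
    refine abs_integral_le_integral_abs.trans (int_mono fun x _ => ?_)
    rw [abs_mul, abs_of_nonneg (h0 _), abs_sub_comm]
    exact mul_le_of_le_one_left (abs_nonneg _) (h1 _)
  have hb2 : |∫ x in B, (η (gradient v x) - η x - ⟪gradient η x, gradient (devi v) x⟫)| ≤
      C * ∫ x in B, ‖gradient (devi v) x‖ ^ 2 := by
    refine (abs_integral_le_integral_abs).trans ?_; rw [← integral_const_mul]
    refine int_mono fun x _ => ?_; rw [gradient_devi hv.smooth x, inner_gradient]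
    set d := gradient (devi v) x
    have := (convex_segment x (x + d)).norm_image_sub_le_of_norm_hasFDerivWithin_le'
      (f := η) (f' := fderiv ℝ η) (φ := fderiv ℝ η x) (C := C * ‖d‖) (x := x) (y := x + d)
      (fun z _ => (hu_diff hη z).hasFDerivAt.hasFDerivWithinAt) (fun z hz => ?_)
      (left_mem_segment ℝ x (x + d)) (right_mem_segment ℝ x (x + d))
    · rw [add_sub_cancel_left, norm_eq_abs] at this
      refine this.trans (le_of_eq (by ring))
    · refine (hL z x).trans ?_
      gcongr; rw [segment_eq_image'] at hz; obtain ⟨t, ht, rfl⟩ := hz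
      simp only [add_sub_cancel_left, norm_smul, norm_eq_abs, abs_of_nonneg ht.1]
      exact mul_le_of_le_one_left (norm_nonneg _) ht.2
  have : ∫ x, η x * lap (devi v) x = -∫ x in B, ⟪gradient η x, gradient (devi v) x⟫ := by
    rw [← hgl, hgreen, neg_neg]
  rw [this, abs_neg, hkey]; refine (abs_sub _ _).trans ?_; linarith

lemma integral_lap_small (n : ℕ) [NeZero n] : ∃ C : ℝ, 0 < C ∧ ∀ v : Eu n → ℝ, MAConvex v →
    ∀ s : ℝ, s < 1 / 4 → (∀ x ∈ 𝔹 n 7, |devi v x| ≤ s) →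
    ∫ x in 𝔹 n 3, |lap (devi v) x| ≤ C * (s * (∫ x in 𝔹 n 8, |devi v x|) +
        ∫ x in 𝔹 n 8, |dhess v x - 1|) := by
  obtain ⟨η1, C1, p1, d1, k1, z1, o1, i1, e1, l1, -, b1, -⟩ :=
    exists_cutoff n (show (0 : ℝ) < 7 by norm_num) (show (7 : ℝ) < 8 by norm_num)
  obtain ⟨η2, C2, p2, d2, k2, z2, o2, i2, e2, l2, -, b2, -⟩ :=
    exists_cutoff n (show (0 : ℝ) < 5 by norm_num) (show (5 : ℝ) < 6 by norm_num)
  obtain ⟨η3, C3, p3, d3, k3, z3, o3, i3, e3, l3, f3, b3, L3⟩ :=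
    exists_cutoff n (show (0 : ℝ) < 3 by norm_num) (show (3 : ℝ) < 4 by norm_num)
  refine ⟨C3 * (C1 + C2) + 2 * n * C3 + 2 * n + 1, by positivity, fun v hv s hs4 hs => ?_⟩
  have hw := contDiff_devi hv.smooth; have cw := hw.continuous; have cl := continuous_lap hw
  have cg := hv.continuous_dhess; have cgr := continuous_gradient hw
  set E := ∫ x in 𝔹 n 8, |devi v x|; set σ := ∫ x in 𝔹 n 8, |dhess v x - 1|
  have hσ0 : 0 ≤ σ := int_abs_nonneg; have hs0 : 0 ≤ s := (abs_nonneg _).trans (hs 0 (by simp))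
  have hmono : ∀ {g : Eu n → ℝ}, Continuous g → (∀ x, 0 ≤ g x) → ∀ {a b : ℝ}, a ≤ b →
      ∫ x in 𝔹 n a, g x ≤ ∫ x in 𝔹 n b, g x :=
    fun hg h0 _ _ hab => setIntegral_mono_ball hg h0 (closedBall_subset_closedBall hab)
  have hT7 : ∫ x in 𝔹 n 7, |lap (devi v) x| ≤ C1 * E + 2 * n * σ := by
    refine (integral_abs_lap_le hv (by norm_num) d1.continuous z1 o1 i1 e1).trans ?_; gcongr
    rw [integral_mul_lap_comm d1 hw k1]
    exact (le_abs_self _).trans (abs_integral_mul_le cw (continuous_lap d1) (fun x _ => b1 x) l1)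
  have hG : ∫ x in 𝔹 n 5, ‖gradient (devi v) x‖ ^ 2 ≤ s * (C1 * E + 2 * n * σ) + s * C2 * E := by
    have h1 : ∫ x in 𝔹 n 5, ‖gradient (devi v) x‖ ^ 2 ≤ ∫ x, η2 x * ‖gradient (devi v) x‖ ^ 2 := by
      rw [integral_eq_setIntegral_closedBall (r := 6) fun y hy => by rw [e2 y hy, zero_mul]]
      refine le_trans (le_of_eq ?_) (hmono (g := fun x => η2 x * ‖gradient (devi v) x‖ ^ 2)
        (by have := d2.continuous; fun_prop) (fun x => mul_nonneg (z2 x) (by positivity))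
        (show (5 : ℝ) ≤ 6 by norm_num))
      refine setIntegral_congr_fun measurableSet_closedBall fun x hx => ?_
      rw [i2 x (by simpa using hx), one_mul]
    rw [caccioppoli hw d2 k2] at h1; have c2 := d2.continuous; have cl2 := continuous_lap d2
    have h2 : |∫ x, (η2 x * lap (devi v) x) * devi v x| ≤ s * (C1 * E + 2 * n * σ) := by
      rw [← setIntegral_eq_of_zero (r := 6) fun y hy => by rw [e2 y hy, zero_mul, zero_mul]]
      refine (abs_integral_le_integral_abs).trans ?_
      refine le_trans ?_ (mul_le_mul_of_nonneg_left hT7 hs0); rw [← integral_const_mul]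
      refine le_trans ?_ (hmono (g := fun x => s * |lap (devi v) x|) (by fun_prop)
        (fun x => by positivity) (show (6 : ℝ) ≤ 7 by norm_num))
      refine int_mono fun x hx => ?_; rw [abs_mul, mul_comm, abs_mul, abs_of_nonneg (z2 x)]
      have h3 := hs x (closedBall_subset_closedBall (by norm_num) hx)
      have h4 : η2 x * |lap (devi v) x| ≤ |lap (devi v) x| :=
        mul_le_of_le_one_left (abs_nonneg _) (o2 x)
      exact mul_le_mul h3 h4 (mul_nonneg (z2 x) (abs_nonneg _)) hs0
    have h3 : |∫ x, devi v x * (devi v x * lap η2 x)| ≤ s * C2 * E := by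
      refine (abs_integral_mul_le cw (by fun_prop) (C := s * C2) (r := 6) (fun x hx => ?_)
        fun x hx => by rw [l2 x hx, mul_zero]).trans ?_
      · rw [abs_mul]
        exact mul_le_mul (hs x (closedBall_subset_closedBall (by norm_num) hx)) (b2 x)
          (abs_nonneg _) hs0
      · exact mul_le_mul_of_nonneg_left (hmono cw.abs (fun x => abs_nonneg _) (by norm_num))
          (by positivity)
    have h2' : ∫ x, devi v x * (η2 x * lap (devi v) x) =
        ∫ x, (η2 x * lap (devi v) x) * devi v x := by congr 1; ext x; ring
    rw [h2'] at h1; have := abs_le.1 h2; have := abs_le.1 h3; have : 0 ≤ s * C2 * E := by positivity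
    linarith
  have h3 := integral_abs_lap_le hv (show (3 : ℝ) ≤ 4 by norm_num) d3.continuous z3 o3 i3 e3
  have h4 := transport_estimate hv (r := 4) (s := s) (C := C3) (by norm_num)
    (fun x hx => hs x (closedBall_subset_closedBall (by norm_num) hx)) hs4 d3 k3 z3 o3 e3 f3 p3 L3
  have e5 : (4 : ℝ) + 1 = 5 := by norm_num
  rw [e5] at h4; have h5 : ∫ x in 𝔹 n 5, |dhess v x - 1| ≤ σ :=
    hmono (by fun_prop) (fun x => abs_nonneg _) (by norm_num)
  have h6 : ∫ x in 𝔹 n 4, |dhess v x - 1| ≤ σ :=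
    hmono (by fun_prop) (fun x => abs_nonneg _) (by norm_num)
  have h7 := mul_le_mul_of_nonneg_left hG p3
  have h8 : (2 * n : ℝ) * ∫ x in 𝔹 n 4, |dhess v x - 1| ≤ 2 * n * σ := by gcongr
  have hsσ : s * σ ≤ σ := mul_le_of_le_one_left hσ0 (by linarith)
  have h9 : 2 * n * C3 * (s * σ) ≤ 2 * n * C3 * σ := by gcongr
  have h10 : 0 ≤ (2 * n * C3 + 2 * n + 1) * (s * E) := by positivity
  have h11 : 0 ≤ (C3 * (C1 + C2)) * σ := by positivity
  have := le_abs_self (∫ x, η3 x * lap (devi v) x); nlinarith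
end

lemma sum_abs_sq_le (x : Eu n) : (∑ i, |x i|) ^ 2 ≤ n * ‖x‖ ^ 2 := by
  rw [norm_sq_eq]; have := sq_sum_le_card_mul_sum_sq (s := Finset.univ) (f := fun i => |x i|)
  simpa using this

lemma abs_Bf_le {S : Mat n} {ε : ℝ} (hS : ∀ i j, |S i j| ≤ ε) (x y : Eu n) :
    |Bf S x y| ≤ ε * ((∑ i, |x i|) * ∑ j, |y j|) := by
  rw [sum_mul_sum, mul_sum]; refine (abs_sum_le_sum_abs _ _).trans (sum_le_sum fun i _ => ?_)
  rw [mul_sum]; refine (abs_sum_le_sum_abs _ _).trans (sum_le_sum fun j _ => ?_)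
  rw [abs_mul, abs_mul, mul_assoc]; exact mul_le_mul_of_nonneg_right (hS i j) (by positivity)

lemma abs_Qf_le {S : Mat n} {ε : ℝ} (hε : 0 ≤ ε) (hS : ∀ i j, |S i j| ≤ ε)
    (x : Eu n) : |Qf S x| ≤ n * ε * ‖x‖ ^ 2 := by
  have h1 := abs_Bf_le hS x x; rw [← sq] at h1
  have h2 := mul_le_mul_of_nonneg_left (sum_abs_sq_le x) hε; rw [Qf_eq_Bf]; linarith

lemma eigenvalue_eq_Qf {A : Mat n} (hA : A.IsHermitian) (i : Fin n) :
    ∃ e : Eu n, ‖e‖ = 1 ∧ hA.eigenvalues i = Qf A e := by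
  refine ⟨hA.eigenvectorBasis i, hA.eigenvectorBasis.orthonormal.1 i, ?_⟩
  rw [Qf_eq_Bf, Bf_eq_dot, hA.eigenvalues_eq]; simp

lemma det_normalize [NeZero n] {S : Mat n} (hS : S.IsHermitian) {ε t : ℝ}
    (hε : ∀ i j, |S i j| ≤ ε) (hεn : ε ≤ 1 / (2 * n ^ 2)) (ht : |S.trace| ≤ t) (ht2 : t ≤ 1 / 2) :
    ∃ M : Mat n, M.PosDef ∧ M.det = 1 ∧ ∀ i j, |M i j - (1 + S) i j| ≤ 8 * n ^ 3 * (t + ε ^ 2) := by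
  have hn := one_le_n (n := n); have hε0 : 0 ≤ ε := (abs_nonneg _).trans (hε 0 0)
  have ht0 : 0 ≤ t := (abs_nonneg _).trans ht; have hnε : n * ε ≤ 1 / 2 := by
    have h1 : n * ε ≤ n * (1 / (2 * n ^ 2)) := by gcongr
    have h2 : n * (1 / (2 * (n : ℝ) ^ 2)) = 1 / (2 * n) := by field_simp
    have h3 : 1 / (2 * (n : ℝ)) ≤ 1 / 2 := by apply one_div_le_one_div_of_le <;> linarith
    linarith
  have hε1 : ε ≤ 1 := by nlinarith
  let A : Mat n := 1 + S
  have hA : A.IsHermitian := isHermitian_one.add hS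
  have hμ : ∀ i, |hA.eigenvalues i - 1| ≤ n * ε := by
    intro i; obtain ⟨e, he, h⟩ := eigenvalue_eq_Qf hA i; have h1 := abs_Qf_le hε0 hε e
    rw [h, Qf_add_matrix, Qf_one, he]; rw [he] at h1; simpa using h1
  have hpos : ∀ i, 1 / 2 ≤ hA.eigenvalues i := fun i => by have := (abs_le.1 (hμ i)).1; linarith
  set ℓ := ∑ i, log (hA.eigenvalues i) with hℓ; have hdet : A.det = exp ℓ := by
    rw [hA.det_eq_prod_eigenvalues, hℓ, Real.exp_sum]; refine Finset.prod_congr rfl fun i _ => ?_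
    rw [Real.exp_log (by linarith [hpos i])]; rfl
  have htr : ∑ i, (hA.eigenvalues i - 1) = S.trace := by
    have := hA.trace_eq_sum_eigenvalues; rw [sum_sub_distrib]
    simp only [A, Matrix.trace_add, trace_one, card_fin] at this; simp at this ⊢; linarith
  have hup : ℓ ≤ S.trace := by
    rw [← htr]; exact sum_le_sum fun i _ => Real.log_le_sub_one_of_pos (by linarith [hpos i])
  have hlo : S.trace - 2 * n * (n * ε) ^ 2 ≤ ℓ := by
    have : ∑ i, ((hA.eigenvalues i - 1) - 2 * (n * ε) ^ 2) ≤ ℓ := by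
      refine sum_le_sum fun i _ => ?_; have hp := hpos i
      have h1 := Real.one_sub_inv_le_log_of_pos (show 0 < hA.eigenvalues i by linarith)
      have h2 : (hA.eigenvalues i - 1) - 2 * (hA.eigenvalues i - 1) ^ 2 ≤
          1 - (hA.eigenvalues i)⁻¹ := by
        have hp' : 0 < hA.eigenvalues i := by linarith
        have h5 : 1 - (hA.eigenvalues i)⁻¹ = (hA.eigenvalues i - 1) / hA.eigenvalues i := by
          field_simp
        rw [h5, le_div_iff₀ hp']; nlinarith [sq_nonneg (hA.eigenvalues i - 1)]
      have h3 : (hA.eigenvalues i - 1) ^ 2 ≤ (n * ε) ^ 2 := by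
        rw [← sq_abs]; exact pow_le_pow_left₀ (abs_nonneg _) (hμ i) 2
      linarith
    rw [sum_sub_distrib, htr] at this; simp at this ⊢; linarith
  have hℓb : |ℓ| ≤ t + 2 * n * (n * ε) ^ 2 := by
    have h2 := abs_le.1 ht; rw [abs_le]; constructor <;> linarith
  have hℓ1 : |ℓ| ≤ 1 := by
    have : 2 * n * (n * ε) ^ 2 ≤ 1 / 2 := by
      have h4 : n * (n * ε) ≤ 1 / 2 := by
        have h1 : n * (n * ε) ≤ n * (n * (1 / (2 * n ^ 2))) := by gcongr
        have h2 : n * (n * (1 / (2 * (n : ℝ) ^ 2))) = 1 / 2 := by field_simp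
        linarith
      have h5 : 0 ≤ n * ε := by positivity
      nlinarith
    linarith
  have hx1 : |-ℓ / n| ≤ |ℓ| := by
    rw [abs_div, abs_neg, Nat.abs_cast]; exact div_le_self (abs_nonneg _) hn
  have hexp := Real.abs_exp_sub_one_le (hx1.trans hℓ1); set c := exp (-ℓ / n) with hc
  have hc0 : 0 < c := exp_pos _; refine ⟨c • A, ?_, ?_, fun i j => ?_⟩
  · refine PosDef.smul ?_ hc0
    refine (posDef_iff_Qf hA).2 fun x hx => ?_; have h1 := (abs_le.1 (abs_Qf_le hε0 hε x)).1
    rw [Qf_add_matrix, Qf_one]; have : 0 < ‖x‖ ^ 2 := by positivity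
    nlinarith
  · rw [det_smul, hdet, card_fin, hc, ← Real.exp_nat_mul, ← exp_add]
    have : (n : ℝ) * (-ℓ / n) + ℓ = 0 := by field_simp; ring
    rw [this, exp_zero]
  · have e : (c • A) i j - (1 + S) i j = (c - 1) * A i j := by
      simp only [A, Matrix.smul_apply, smul_eq_mul]; ring
    rw [e, abs_mul]; have hAij : |A i j| ≤ 2 := by
      have h1 : |(1 : Mat n) i j| ≤ 1 := by rw [Matrix.one_apply]; split_ifs <;> simp
      calc |A i j| ≤ |(1 : Mat n) i j| + |S i j| := abs_add_le _ _
        _ ≤ 2 := by linarith [hε i j]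
    calc |c - 1| * |A i j| ≤ (2 * |ℓ|) * 2 := by gcongr; exact hexp.trans (by linarith)
      _ ≤ 4 * (t + 2 * n * (n * ε) ^ 2) := by linarith
      _ ≤ _ := by
          have h3 : 1 ≤ (n : ℝ) ^ 3 := one_le_pow₀ hn
          have : 2 * (n : ℝ) * (n * ε) ^ 2 = 2 * n ^ 3 * ε ^ 2 := by ring
          rw [this]; nlinarith [mul_nonneg (sub_nonneg.2 h3) ht0]

set_option maxHeartbeats 2000000 in
/-- One improvement step: an almost-paraboloid is much closer to a paraboloid on a smaller ball. -/
theorem one_step_centered (n : ℕ) [NeZero n] : ∃ C : ℝ, 0 < C ∧ ∀ θ : ℝ, 0 < θ → θ ≤ 1 → ∃ ε0 : ℝ, 0 < ε0 ∧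
    ∀ (v : Eu n → ℝ), MAConvex v → ∀ E σ : ℝ, E ≤ ε0 → σ ≤ ε0 → ∫ x in 𝔹 n 8, |devi v x| ≤ E →
      ∫ x in 𝔹 n 8, |dhess v x - 1| ≤ σ →
      ∃ (M : Mat n) (b : Eu n) (c : ℝ), M.PosDef ∧ M.det = 1 ∧
        (∀ i j, |M i j - (1 : Mat n) i j| ≤ C * (E + σ)) ∧
        ∫ x in 𝔹 n θ, |v x - (1 / 2 * Qf M x + ⟪b, x⟫ + c)| ≤ C * (θ ^ (n + 3) * E + σ) := by
  have hn := one_le_n (n := n); obtain ⟨C1, hC1, H1⟩ := integral_lap_small n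
  obtain ⟨C2, hC2, H2⟩ := mollify_expansion (n := n); have hκ := κ0_pos (n := n)
  have hω := @ωn_pos n; set k := (κ0 n)⁻¹; have hk0 : 0 < k := inv_pos.2 hκ
  set D := 8 * (n : ℝ) ^ 3 * (k * C2 * C1 + (k * C2) ^ 2) with hD
  set Cf := D + k * C2 + k * ωn n * (C2 + C1) + ωn n * n * D with hCf
  refine ⟨Cf, by positivity, fun θ hθ0 hθ1 => ?_⟩; set κ := θ ^ (n + 3) / 5 with hκd
  have hθn : θ ^ (n + 3) ≤ 1 := pow_le_one₀ hθ0.le hθ1; have hκ0 : 0 < κ := by positivity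
  set ρ := κ / 2 with hρ; have hρ0 : 0 < ρ := by positivity
  set ε0 := min (min κ (κ / 2 * (ωn n * ρ ^ n) / 4))
    (min (1 / (4 * (k * C2 * C1))) (1 / (2 * n ^ 2 * (k * C2)))) with hε₀
  have g1 : ε0 ≤ κ := (min_le_left _ _).trans (min_le_left _ _)
  have g2 : ε0 ≤ κ / 2 * (ωn n * ρ ^ n) / 4 := (min_le_left _ _).trans (min_le_right _ _)
  have g3 : ε0 ≤ 1 / (4 * (k * C2 * C1)) := (min_le_right _ _).trans (min_le_left _ _)
  have g4 : ε0 ≤ 1 / (2 * n ^ 2 * (k * C2)) := (min_le_right _ _).trans (min_le_right _ _)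
  refine ⟨ε0, by positivity, fun v hv E σ hEε hσε hE hσ => ?_⟩; have hw := contDiff_devi hv.smooth
  have cw := hw.continuous; have hE0 : 0 ≤ E := (int_abs_nonneg).trans hE
  have hσ0 : 0 ≤ σ := (int_abs_nonneg).trans hσ; have hsup : ∀ x ∈ 𝔹 n 7, |devi v x| ≤ κ := by
    intro x hx; have hx' : ‖x‖ ≤ 7 := by simpa using hx
    have h := convex_sup_le_integral hv.convex cw (M := 1) (m := 1) zero_le_one
      (fun y => by rw [Qf_one, one_mul]) (fun x y => by
        have := Qf_add_sub (1 : Mat n) x y; simp only [devi]; linarith) x hρ0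
    have h2 : ∫ z in closedBall x (2 * ρ), |devi v z| ≤ E := by
      refine le_trans (setIntegral_mono_ball cw.abs (fun _ => abs_nonneg _)
        (closedBall_subset_closedBall' ?_)) hE
      rw [dist_zero_right]; linarith
    have h3 : 4 * (ωn n * ρ ^ n)⁻¹ * ∫ z in closedBall x (2 * ρ), |devi v z| ≤ κ / 2 := by
      calc _ ≤ 4 * (ωn n * ρ ^ n)⁻¹ * (κ / 2 * (ωn n * ρ ^ n) / 4) := by gcongr; linarith
        _ = κ / 2 := by field_simp
    nlinarith
  have hT := H1 v hv κ (by linarith) hsup; set T := ∫ x in 𝔹 n 3, |lap (devi v) x|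
  have hT' : T ≤ C1 * (κ * E + σ) := hT.trans (by gcongr)
  obtain ⟨S, b, c, hS, hSe, hSt, hexp⟩ := H2 (devi v) hw; have hE2 : ∫ x in 𝔹 n 2, |devi v x| ≤ E :=
    (setIntegral_mono_ball cw.abs (fun _ => abs_nonneg _)
      (closedBall_subset_closedBall (by norm_num))).trans hE
  have hT2 : ∫ x in 𝔹 n 2, |lap (devi v) x| ≤ T :=
    setIntegral_mono_ball (continuous_lap hw).abs (fun _ => abs_nonneg _)
      (closedBall_subset_closedBall (by norm_num))
  obtain ⟨M, hM, hMd, hMe⟩ := det_normalize (S := k • S) (hS.smul (IsSelfAdjoint.all k))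
    (ε := k * C2 * E) (t := k * C2 * T)
    (fun i j => by
      rw [Matrix.smul_apply, smul_eq_mul, abs_mul, abs_of_pos hk0, mul_assoc]
      exact mul_le_mul_of_nonneg_left ((hSe i j).trans (by gcongr)) hk0.le)
    (by
      rw [le_div_iff₀ (by positivity)]; have h5 := hEε.trans g4
      rw [le_div_iff₀ (by positivity)] at h5; linarith)
    (by
      rw [trace_smul, smul_eq_mul, abs_mul, abs_of_pos hk0, mul_assoc]
      exact mul_le_mul_of_nonneg_left (hSt.trans (by gcongr)) hk0.le)
    (by
      have h5 : κ * E + σ ≤ 2 * ε0 := by nlinarith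
      have h6 : T ≤ C1 * (2 * ε0) := hT'.trans (by gcongr); rw [le_div_iff₀ (by positivity)] at g3
      have h7 : k * C2 * T ≤ k * C2 * (C1 * (2 * ε0)) := by gcongr
      linarith)
  set q := 8 * (n : ℝ) ^ 3 * (k * C2 * T + (k * C2 * E) ^ 2) with hq
  have hqD : q ≤ D * (κ * E + σ) := by
    have h1 : k * C2 * T ≤ k * C2 * (C1 * (κ * E + σ)) := by gcongr
    have h2 : (k * C2 * E) ^ 2 ≤ (k * C2) ^ 2 * (κ * E + σ) := by
      rw [mul_pow]; gcongr; have : E * E ≤ κ * E := by gcongr; linarith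
      nlinarith
    calc q ≤ 8 * (n : ℝ) ^ 3 * (k * C2 * (C1 * (κ * E + σ)) + (k * C2) ^ 2 * (κ * E + σ)) := by
          rw [hq]; gcongr
      _ = D * (κ * E + σ) := by rw [hD]; ring
  have hq0 : 0 ≤ q := by positivity
  have hκθ : κ ≤ θ ^ (n + 3) := by rw [hκd]; linarith [pow_pos hθ0 (n + 3)]
  have hκE : κ * E ≤ θ ^ (n + 3) * E := by gcongr
  refine ⟨M, k • b, k * c, hM, hMd, fun i j => ?_, ?_⟩
  · have e : M i j - (1 : Mat n) i j = (M i j - (1 + k • S) i j) + k * S i j := by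
      simp only [Matrix.add_apply, Matrix.smul_apply, smul_eq_mul]; ring
    rw [e]; refine (abs_add_le _ _).trans ?_; have h1 : |k * S i j| ≤ k * C2 * E := by
      rw [abs_mul, abs_of_pos hk0, mul_assoc]
      exact mul_le_mul_of_nonneg_left ((hSe i j).trans (by gcongr)) hk0.le
    have h3 : D * (κ * E + σ) ≤ D * (E + σ) := by
      gcongr; exact mul_le_of_le_one_left hE0 (by linarith)
    have h4 : k * C2 * E ≤ k * C2 * (E + σ) := by gcongr; linarith
    have h5 : 0 ≤ (k * ωn n * (C2 + C1) + ωn n * n * D) * (E + σ) := by positivity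
    have := hMe i j; rw [hCf]; linarith
  · have cQ : Continuous fun x : Eu n => Qf M x := (contDiff_Qf M (k := 2)).continuous
    have cv := hv.smooth.continuous
    have hmol := integral_mollify_sub_le hw (a := 2) (b := 3) (by norm_num)
    have cK : Continuous (bumpK n) := contDiff_bumpK.continuous
    obtain ⟨m, hm⟩ : ∃ m : Eu n → ℝ, ∀ x, m x = ∫ y, (devi v (x + y) - devi v x) * bumpK n y :=
      ⟨_, fun _ => rfl⟩
    have i1 : ∀ x, Integrable fun y => devi v (x + y) * bumpK n y := fun x =>
      Continuous.integrable_of_hasCompactSupport (by fun_prop) hasCompactSupport_bumpK.mul_left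
    have i2 : ∀ x, Integrable fun y => devi v x * bumpK n y := fun x =>
      Continuous.integrable_of_hasCompactSupport (by fun_prop) hasCompactSupport_bumpK.mul_left
    have hm' : ∀ x, m x = (∫ y, devi v (x + y) * bumpK n y) - κ0 n * devi v x := by
      intro x; rw [hm]
      simp_rw [sub_mul]
      rw [integral_sub (i1 x) (i2 x), integral_const_mul]; simp only [κ0]; ring
    have cm : Continuous m := by
      have : m = fun x => (∫ y in 𝔹 n 1, devi v (x + y) * bumpK n y) - κ0 n * devi v x := by
        ext x; rw [hm', setIntegral_eq_of_zero fun y hy => by rw [bumpK_eq_zero hy, mul_zero]]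
      rw [this]; refine Continuous.sub ?_ (by fun_prop)
      exact continuous_parametric_integral_of_continuous
        (f := fun x y => devi v (x + y) * bumpK n y)
        (by simp only [uncurry_def]; fun_prop) (isCompact_closedBall _ _)
    simp_rw [← hm] at hmol
    have hmθ : ∫ x in 𝔹 n θ, |m x| ≤ ωn n * T :=
      (setIntegral_mono_ball cm.abs (fun _ => abs_nonneg _)
        (closedBall_subset_closedBall (by linarith))).trans hmol
    have hpt : ∀ x ∈ 𝔹 n θ,
        |v x - (1 / 2 * Qf M x + ⟪k • b, x⟫ + k * c)| ≤
          (n * q + k * C2 * (θ ^ 3 * E)) + k * |m x| := by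
      intro x hx; have hx' : ‖x‖ ≤ θ := by simpa using hx
      have hx1 : ‖x‖ ^ 2 ≤ 1 := pow_le_one₀ (norm_nonneg _) (hx'.trans hθ1)
      have a1 := hexp x (hx'.trans hθ1); have a2 := hm' x
      set P := 1 / 2 * Qf S x + ⟪b, x⟫ + c with hP; set J := ∫ y, devi v (x + y) * bumpK n y
      have a3 : |Qf (M - (1 + k • S)) x| ≤ n * q := by
        refine (abs_Qf_le hq0 (fun i j => by simpa using hMe i j) x).trans ?_
        exact mul_le_of_le_one_right (by positivity) hx1
      rw [Qf_sub_matrix, Qf_add_matrix, Qf_smul_matrix] at a3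
      have hkκ : k * κ0 n = 1 := inv_mul_cancel₀ hκ.ne'
      have e : v x - (1 / 2 * Qf M x + ⟪k • b, x⟫ + k * c) =
          k * (J - P) - k * m x - 1 / 2 * (Qf M x - (Qf 1 x + k * Qf S x)) := by
        have : devi v x = k * (J - m x) := by rw [a2]; linear_combination (-devi v x) * hkκ
        rw [devi] at this; rw [inner_smul_left, hP]; simp only [conj_trivial]
        linear_combination this
      rw [e]; have a4 : |k * (J - P)| ≤ k * C2 * (θ ^ 3 * E) := by
        rw [abs_mul, abs_of_pos hk0, mul_assoc]
        refine mul_le_mul_of_nonneg_left (a1.trans ?_) hk0.le; rw [mul_assoc]; gcongr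
      have a5 : |k * m x| = k * |m x| := by rw [abs_mul, abs_of_pos hk0]
      have a6 : |1 / 2 * (Qf M x - (Qf 1 x + k * Qf S x))| ≤ n * q := by
        rw [abs_mul, abs_of_pos (by norm_num)]
        linarith [abs_nonneg (Qf M x - (Qf 1 x + k * Qf S x))]
      calc _ ≤ |k * (J - P)| + |k * m x| + |1 / 2 * (Qf M x - (Qf 1 x + k * Qf S x))| := by
            refine (abs_sub _ _).trans (add_le_add (abs_sub _ _) le_rfl)
        _ ≤ _ := by linarith
    calc ∫ x in 𝔹 n θ, |v x - (1 / 2 * Qf M x + ⟪k • b, x⟫ + k * c)|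
        ≤ ∫ x in 𝔹 n θ, ((n * q + k * C2 * (θ ^ 3 * E)) + k * |m x|) := int_mono hpt
      _ = θ ^ n * ωn n * (n * q + k * C2 * (θ ^ 3 * E)) + k * ∫ x in 𝔹 n θ, |m x| := by
          rw [int_add, setIntegral_const, integral_const_mul, vol_closedBall _ hθ0.le, smul_eq_mul]
      _ ≤ θ ^ n * ωn n * (n * q + k * C2 * (θ ^ 3 * E)) + k * (ωn n * T) := by gcongr
      _ ≤ _ := by
          have b1 : θ ^ n * ωn n * (n * q) ≤ ωn n * n * D * (θ ^ (n + 3) * E + σ) := by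
            calc θ ^ n * ωn n * (n * q) ≤ 1 * ωn n * (n * (D * (θ ^ (n + 3) * E + σ))) := by
                  gcongr
                  · exact pow_le_one₀ hθ0.le hθ1
                  · exact hqD.trans (by gcongr)
              _ = _ := by ring
          have b2 : θ ^ n * ωn n * (k * C2 * (θ ^ 3 * E)) = k * ωn n * C2 * (θ ^ (n + 3) * E) := by
            ring
          have b3 : k * (ωn n * T) ≤ k * ωn n * C1 * (θ ^ (n + 3) * E + σ) := by
            calc k * (ωn n * T) ≤ k * (ωn n * (C1 * (θ ^ (n + 3) * E + σ))) := by
                  gcongr; exact hT'.trans (by gcongr)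
              _ = _ := by ring
          have b4 : 0 ≤ k * ωn n * C2 * σ := by positivity
          have b5 : 0 ≤ (D + k * C2) * (θ ^ (n + 3) * E + σ) := by positivity
          rw [mul_add, b2, hCf]; linarith

section
variable {v : Eu n → ℝ}

lemma contDiff_affine (b : Eu n) (c : ℝ) : ContDiff ℝ 2 fun x : Eu n => ⟪b, x⟫ + c :=
  (contDiff_const.inner ℝ contDiff_id).add contDiff_const

lemma MAConvex.sub_affine (hv : MAConvex v) (b : Eu n) (c : ℝ) :
    MAConvex fun x => v x - (⟪b, x⟫ + c) := by
  have hl := contDiff_affine b c; refine ⟨hv.smooth.sub hl, ?_, fun x => ?_⟩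
  · refine hv.convex.sub ⟨convex_univ, fun x _ y _ s t hs ht hst => le_of_eq ?_⟩
    simp only [inner_add_right, inner_smul_right, smul_eq_mul]
    linear_combination c * hst
  · rw [hess_sub hv.smooth hl, hess_affine, sub_zero]; exact hv.det_pos x

lemma dhess_sub_affine (hv : ContDiff ℝ 2 v) (b : Eu n) (c : ℝ) (x : Eu n) :
    dhess (fun x => v x - (⟪b, x⟫ + c)) x = dhess v x := by
  have hl := contDiff_affine b c; rw [dhess, hess_sub hv hl, hess_affine, sub_zero]; rfl

lemma MAConvex.comp_affine (hv : MAConvex v) {c : ℝ} (hc : 0 < c) (x0 : Eu n)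
    {L : Mat n} (hL : L.det ≠ 0) : MAConvex fun y => c * v (x0 + mulE L y) := by
  refine ⟨contDiff_comp_affine hv.smooth c x0 L, convexOn_comp_affine hv.convex hc.le x0 L,
    fun y => ?_⟩
  rw [det_hess_comp_affine hv.smooth]; have := hv.det_pos (x0 + mulE L y)
  have : 0 < L.det ^ 2 := by positivity
  positivity

lemma sum_abs_le (x : Eu n) : ∑ i, |x i| ≤ sqrt n * ‖x‖ := by
  refine Real.le_sqrt_of_sq_le (sum_abs_sq_le x) |>.trans (le_of_eq ?_)
  rw [Real.sqrt_mul (by positivity), sqrt_sq (norm_nonneg x)]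

lemma abs_Bf_le_norm {S : Mat n} {ε : ℝ} (hε : 0 ≤ ε)
    (hS : ∀ i j, |S i j| ≤ ε) (x y : Eu n) : |Bf S x y| ≤ n * ε * (‖x‖ * ‖y‖) := by
  refine (abs_Bf_le hS x y).trans ?_
  have h1 : (∑ i, |x i|) * ∑ j, |y j| ≤ (sqrt n * ‖x‖) * (sqrt n * ‖y‖) :=
    mul_le_mul (sum_abs_le x) (sum_abs_le y) (sum_nonneg fun _ _ => abs_nonneg _) (by positivity)
  have h2 := Real.mul_self_sqrt (show (0 : ℝ) ≤ n by positivity)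
  calc _ ≤ ε * ((sqrt n * ‖x‖) * (sqrt n * ‖y‖)) := by gcongr
    _ = _ := by linear_combination (ε * ‖x‖ * ‖y‖) * h2

lemma abs_entry_le_of_Qf {S : Mat n} (hS : S.IsHermitian) {ε : ℝ}
    (h : ∀ x : Eu n, ‖x‖ ≤ 1 → |Qf S x| ≤ ε) (i j : Fin n) : |S i j| ≤ 2 * ε := by
  have hh : ∀ x : Eu n, ‖x‖ ≤ 2 → |Qf S x| ≤ 4 * ε := by
    intro x hx; have := h ((1 / 2 : ℝ) • x) (by rw [norm_smul]; norm_num; linarith)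
    rw [Qf_smul, abs_mul, abs_of_nonneg (by norm_num)] at this; linarith
  set a : Eu n := single i 1; set b : Eu n := single j 1; have ha : ‖a‖ = 1 := by simp [a]
  have hb : ‖b‖ = 1 := by simp [b]
  have e1 := Qf_add S hS a b; have e2 := Qf_add S hS a (-b); have e3 : Bf S a (-b) = -Bf S a b := by
    rw [← neg_one_smul ℝ b, Bf_smul_right]; ring
  rw [Qf_neg, e3] at e2; rw [← Bf_single S i j]
  have h1 := abs_le.1 (hh (a + b) ((norm_add_le _ _).trans (by linarith)))
  have h2 := abs_le.1 (hh (a + -b) ((norm_add_le _ _).trans (by rw [norm_neg]; linarith)))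
  rw [abs_le]; constructor <;> linarith [h1.1, h1.2, h2.1, h2.2]

lemma entry_le_of_integral {S : Mat n} (hS : S.IsHermitian) {p : Eu n → ℝ}
    (hp : Continuous p) (hpS : ∀ x y, p (x + y) + p (x - y) - 2 * p x = Qf S y) (x0 : Eu n)
    {r η : ℝ} (hr : 0 < r) (h : ∫ x in closedBall x0 r, |p x| ≤ η * r ^ (n + 2)) (i j : Fin n) :
    |S i j| ≤ 32 * 2 ^ n * (ωn n)⁻¹ * η := by
  have hω := @ωn_pos n
  have key : ∀ y : Eu n, ‖y‖ ≤ r / 2 → |Qf S y| ≤ 4 * 2 ^ n * (ωn n)⁻¹ * η * r ^ 2 := by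
    intro y hy
    have hpt : ∀ x ∈ closedBall x0 (r / 2), |Qf S y| ≤ |p (x + y)| + |p (x + -y)| + 2 * |p x| := by
      intro x _; rw [← hpS x y, ← sub_eq_add_neg]
      calc _ ≤ |p (x + y) + p (x - y)| + |2 * p x| := abs_sub _ _
        _ ≤ |p (x + y)| + |p (x - y)| + |2 * p x| := by gcongr; exact abs_add_le _ _
        _ = _ := by rw [abs_mul, abs_two]
    have hI := int_mono hpt
    have hsh : ∀ z : Eu n, ‖z‖ ≤ r / 2 → ∫ x in closedBall x0 (r / 2), |p (x + z)| ≤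
        ∫ x in closedBall x0 r, |p x| := by
      intro z hz; have := integral_comp_smul_le z one_ne_zero (g := fun x => |p x|) hp.abs
        (fun _ => abs_nonneg _) (a := x0) (b := x0) (r := r / 2) (s := r) (by
          intro x hx; rw [mem_closedBall, dist_eq_norm] at hx ⊢
          rw [one_smul, show z + x - x0 = z + (x - x0) by abel]
          refine (norm_add_le _ _).trans (by linarith))
      simpa [add_comm] using this
    rw [int_add, int_add,
      integral_const_mul, setIntegral_const, vol_closedBall _ (by linarith), smul_eq_mul] at hI
    have h1 := hsh y hy; have h2 := hsh (-y) (by simpa using hy)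
    have h3 := hsh 0 (by simp; linarith); simp only [add_zero] at h3
    have h4 : (r / 2) ^ n * ωn n * |Qf S y| ≤ 4 * (η * r ^ (n + 2)) := by linarith
    have h5 : 4 * 2 ^ n * (ωn n)⁻¹ * η * r ^ 2 = 4 * (η * r ^ (n + 2)) / ((r / 2) ^ n * ωn n) := by
      rw [div_pow, pow_add]; field_simp
    rw [h5, le_div_iff₀ (by positivity)]; linarith
  have := abs_entry_le_of_Qf hS (ε := 16 * 2 ^ n * (ωn n)⁻¹ * η) (fun x hx => by
    have h1 := key ((r / 2) • x) (by
      rw [norm_smul, norm_eq_abs, abs_of_pos (by positivity)]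
      exact mul_le_of_le_one_right (by positivity) hx)
    rw [Qf_smul, abs_mul, abs_of_pos (by positivity)] at h1; have hr2 : 0 < r ^ 2 := by positivity
    nlinarith) i j
  linarith

lemma Qf_quad_second_diff (M : Mat n) (b : Eu n) (c : ℝ) (x y : Eu n) :
    (1 / 2 * Qf M (x + y) + ⟪b, x + y⟫ + c) + (1 / 2 * Qf M (x - y) + ⟪b, x - y⟫ + c) -
      2 * (1 / 2 * Qf M x + ⟪b, x⟫ + c) = Qf M y := by
  have := Qf_add_sub M x y; rw [inner_add_right, inner_sub_right]; linarith

lemma continuous_quad (M : Mat n) (b : Eu n) (c : ℝ) :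
    Continuous fun x : Eu n => 1 / 2 * Qf M x + ⟪b, x⟫ + c := by
  have := (contDiff_Qf M (k := 2)).continuous; fun_prop
end

/-- On a ball `u` is within `E`, in `L¹`, of a quadratic polynomial with second order part `M`. -/
def QApprox (u : Eu n → ℝ) (M : Mat n) (x0 : Eu n) (r E : ℝ) : Prop :=
  ∃ (b : Eu n) (c : ℝ), ∫ x in closedBall x0 r, |u x - (1 / 2 * Qf M x + ⟪b, x⟫ + c)| ≤ E

section
variable {u v : Eu n → ℝ} {M N : Mat n} {x0 x1 : Eu n} {r s E E' : ℝ}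

lemma QApprox.mono (h : QApprox u M x0 r E) (hu : Continuous u)
    (hs : closedBall x1 s ⊆ closedBall x0 r) (hE : E ≤ E') : QApprox u M x1 s E' := by
  obtain ⟨b, c, h⟩ := h; have := continuous_quad M b c
  exact ⟨b, c, (setIntegral_mono_ball (by fun_prop) (fun _ => abs_nonneg _) hs).trans (h.trans hE)⟩

lemma QApprox.entry (h : QApprox u M x0 r (E * r ^ (n + 2))) (h' : QApprox u N x0 r (E' * r ^ (n + 2)))
    (hu : Continuous u) (hM : M.IsHermitian) (hN : N.IsHermitian) (hr : 0 < r) (i j : Fin n) :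
    |M i j - N i j| ≤ 32 * 2 ^ n * (ωn n)⁻¹ * (E + E') := by
  obtain ⟨b, c, h⟩ := h; obtain ⟨b', c', h'⟩ := h'; have cM := continuous_quad M b c
  have cN := continuous_quad N b' c'; refine entry_le_of_integral (S := M - N) (hM.sub hN)
    (p := fun x => (1 / 2 * Qf M x + ⟪b, x⟫ + c) - (1 / 2 * Qf N x + ⟪b', x⟫ + c'))
    (by fun_prop) (fun x y => ?_) x0 hr ?_ i j
  · rw [Qf_sub_matrix, ← Qf_quad_second_diff M b c x y, ← Qf_quad_second_diff N b' c' x y]; ring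
  · rw [add_mul]
    refine le_trans ?_ (add_le_add h h'); rw [← int_add]; refine int_mono fun x _ => ?_
    rw [abs_sub_comm (u x)]; refine le_trans (le_of_eq ?_) (abs_add_le _ _)
    congr 1; ring

lemma QApprox.pullback (h : QApprox v M x0 r E) (hv : Continuous v) (hM : M.IsHermitian) {k : ℝ}
    (hk : 0 ≤ k) (y1 : Eu n) {B : Mat n} (hB : B.det ≠ 0) (hu : ∀ x, u x = k * v (y1 + mulE B x))
    (hm : ∀ x ∈ closedBall x1 s, y1 + mulE B x ∈ closedBall x0 r) :
    QApprox u (k • (Bᵀ * M * B)) x1 s (k * (|B.det|⁻¹ * E)) := by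
  obtain ⟨b, c, h⟩ := h; have := continuous_quad M b c
  refine ⟨k • mulE Bᵀ (mulE M y1 + b), k * (1 / 2 * Qf M y1 + ⟪b, y1⟫ + c), ?_⟩
  have h1 := integral_comp_affine_le y1 hB (g := fun x => |v x - (1 / 2 * Qf M x + ⟪b, x⟫ + c)|)
    (by fun_prop) (fun _ => abs_nonneg _) hm
  have h2 : ∀ x, |u x - (1 / 2 * Qf (k • (Bᵀ * M * B)) x + ⟪k • mulE Bᵀ (mulE M y1 + b), x⟫ +
      k * (1 / 2 * Qf M y1 + ⟪b, y1⟫ + c))| = k * |v (y1 + mulE B x) -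
        (1 / 2 * Qf M (y1 + mulE B x) + ⟪b, y1 + mulE B x⟫ + c)| := fun x => by
    rw [← abs_of_nonneg hk, ← abs_mul, abs_of_nonneg hk, hu, Qf_add M hM, Qf_smul_matrix,
      Qf_transpose_mul_mul, real_inner_smul_left, inner_mulE_transpose, inner_add_left,
      inner_add_right, Bf_comm hM, Bf_eq_inner, real_inner_comm (mulE B x)]
    congr 1; ring
  simp_rw [h2]
  rw [integral_const_mul]; gcongr; exact h1.trans (by gcongr)

end

lemma dhess_rescale (hv : ContDiff ℝ 2 v) {r : ℝ} (hr : 0 < r) (x0 : Eu n) {L : Mat n}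
    (hL : L.det ^ 2 = 1) (y : Eu n) :
    dhess (fun y => (r ^ 2)⁻¹ * v (x0 + mulE (r • L) y)) y = dhess v (x0 + mulE (r • L) y) := by
  rw [dhess, det_hess_comp_affine hv, det_smul, card_fin, mul_pow, hL, dhess]
  have : ((r ^ 2)⁻¹) ^ n * (r ^ n) ^ 2 = 1 := by
    rw [inv_pow, ← pow_mul, ← pow_mul, mul_comm 2 n]; exact inv_mul_cancel₀ (by positivity)
  rw [mul_one, this, one_mul]

lemma rescale_maconvex (hv : MAConvex v) {r : ℝ} (hr : 0 < r) (x0 : Eu n) {L : Mat n}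
    (hL : L.det ^ 2 = 1) : MAConvex fun y => (r ^ 2)⁻¹ * v (x0 + mulE (r • L) y) := by
  refine hv.comp_affine (by positivity) x0 ?_; rw [det_smul]
  have : L.det ≠ 0 := by rintro h; rw [h] at hL; norm_num at hL
  positivity

/-- One improvement step around the standard paraboloid. -/
theorem one_step (n : ℕ) [NeZero n] : ∃ C : ℝ, 0 < C ∧ ∀ θ : ℝ, 0 < θ → θ ≤ 1 → ∃ ε0 : ℝ, 0 < ε0 ∧
    ∀ (v : Eu n → ℝ), MAConvex v → ∀ E σ : ℝ, E ≤ ε0 → σ ≤ ε0 → QApprox v 1 0 8 E →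
      ∫ x in 𝔹 n 8, |dhess v x - 1| ≤ σ →
      ∃ M : Mat n, M.PosDef ∧ M.det = 1 ∧ (∀ i j, |M i j - (1 : Mat n) i j| ≤ C * (E + σ)) ∧
        QApprox v M 0 θ (C * (θ ^ (n + 3) * E + σ)) := by
  obtain ⟨C, hC, H⟩ := one_step_centered n; refine ⟨C, hC, fun θ hθ hθ1 => ?_⟩
  obtain ⟨ε0, hε, H⟩ := H θ hθ hθ1; refine ⟨ε0, hε, fun v hv E σ hE hσ ⟨b, c, hQ⟩ hd => ?_⟩
  obtain ⟨M, b', c', h1, h2, h3, h4⟩ := H _ (hv.sub_affine b c) E σ hE hσ (le_trans (le_of_eq (by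
    congr 1; ext x; rw [devi]; congr 1; ring)) hQ) (by simpa only [dhess_sub_affine hv.smooth])
  refine ⟨M, h1, h2, h3, b + b', c + c', le_trans (le_of_eq ?_) h4⟩
  congr 1; ext x; rw [inner_add_left]; congr 1; ring

/-- One improvement step around a general paraboloid. -/
theorem one_step_general (n : ℕ) [NeZero n] : ∃ C : ℝ, 1 ≤ C ∧ ∀ θ : ℝ, 0 < θ → θ ≤ 1 / 32 →
    ∃ ε0 : ℝ, 0 < ε0 ∧
    ∀ (v : Eu n → ℝ), MAConvex v → ∀ r E σ : ℝ, 0 < r → E ≤ ε0 → σ ≤ ε0 → ∀ M : Mat n, M.PosDef →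
      M.det = 1 → (∀ i j, |M i j - (1 : Mat n) i j| ≤ 1 / (2 * n)) → QApprox v M 0 r (E * r ^ (n + 2)) →
      ∫ x in 𝔹 n r, |dhess v x - 1| ≤ σ * r ^ n →
      ∃ M' : Mat n, M'.PosDef ∧ M'.det = 1 ∧ (∀ i j, |M' i j - M i j| ≤ C * (E + σ)) ∧
        QApprox v M' 0 (θ * r) (C * (θ * E + (θ ^ (n + 2))⁻¹ * σ) * (θ * r) ^ (n + 2)) := by
  have hn := one_le_n (n := n); obtain ⟨C, hC, H⟩ := one_step n
  refine ⟨4 * n * C * 16 ^ (n + 2) + 32 ^ (n + 3) * C + 1, by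
    have : 0 ≤ 4 * n * C * 16 ^ (n + 2) + 32 ^ (n + 3) * C := by positivity
    linarith, fun θ hθ0 hθ1 => ?_⟩
  obtain ⟨ε, hε, H⟩ := H (32 * θ) (by positivity) (by linarith)
  refine ⟨ε / 16 ^ (n + 2), by positivity, fun v hv r E σ hr hE hσ M hM hMd hM1 hI hJ => ?_⟩
  obtain ⟨L, B, h1, h2, h3, h4⟩ := exists_normalizing hM
  have hdL : L.det ^ 2 = 1 := by have := det_sq_mul_det h1; rwa [hMd, mul_one] at this
  have hdB : B.det ^ 2 = 1 := by rw [← hMd, h4, det_mul, det_transpose, sq]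
  have hab : ∀ a : ℝ, a ^ 2 = 1 → |a| = 1 := fun a ha =>
    (pow_eq_one_iff_of_nonneg (abs_nonneg _) two_ne_zero).1 (by rw [sq_abs, ha])
  have hQ1 : ∀ x : Eu n, |‖mulE B x‖ ^ 2 - ‖x‖ ^ 2| ≤ 1 / 2 * ‖x‖ ^ 2 := by
    intro x; have := abs_Qf_le (ε := 1 / (2 * n)) (by positivity) (S := M - 1) hM1 x
    rw [Qf_sub_matrix, Qf_one, h4, Qf_transpose_mul_self] at this; refine this.trans (le_of_eq ?_)
    field_simp
  have hBn : ∀ x, ‖mulE B x‖ ≤ 2 * ‖x‖ := fun x =>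
    abs_le_of_sq_le_sq' (by linarith [(abs_le.1 (hQ1 x)).2, sq_nonneg ‖x‖]) (by positivity) |>.2
  have hLn : ∀ x, ‖mulE L x‖ ≤ 2 * ‖x‖ := fun x => by
    have := (abs_le.1 (hQ1 (mulE L x))).1; rw [← mulE_mul, h3, mulE_one] at this
    exact abs_le_of_sq_le_sq' (by linarith [sq_nonneg ‖x‖]) (by positivity) |>.2
  obtain ⟨ρ, hρ, hρ0⟩ := ex_pos (r / 16); have hrρ : r = 16 * ρ := by rw [hρ]; ring
  have hE0 : 0 ≤ E := by
    obtain ⟨b, c, hI⟩ := hI; exact nonneg_of_mul_nonneg_left ((int_abs_nonneg).trans hI)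
      (by positivity)
  have hσ0 : 0 ≤ σ := nonneg_of_mul_nonneg_left ((int_abs_nonneg).trans hJ) (by positivity)
  have hdρL : |(ρ • L).det| = ρ ^ n := by
    rw [det_smul, abs_mul, hab _ hdL, card_fin, mul_one, abs_of_pos (by positivity)]
  have hdρB : |(ρ⁻¹ • B).det| = (ρ ^ n)⁻¹ := by
    rw [det_smul, abs_mul, hab _ hdB, card_fin, mul_one, abs_of_pos (by positivity), inv_pow]
  have hdρL0 : (ρ • L).det ≠ 0 := by rw [← abs_pos, hdρL]; positivity
  have hdρB0 : (ρ⁻¹ • B).det ≠ 0 := by rw [← abs_pos, hdρB]; positivity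
  obtain ⟨V, hVd⟩ := ex_eq (fun y => (ρ ^ 2)⁻¹ * v (0 + mulE (ρ • L) y) : Eu n → ℝ)
  have hV : MAConvex V := hVd ▸ rescale_maconvex hv hρ0 0 hdL; have cv := hv.smooth.continuous
  have hmap : ∀ y ∈ 𝔹 n 8, (0 : Eu n) + mulE (ρ • L) y ∈ 𝔹 n r := by
    intro y hy; have hy' : ‖y‖ ≤ 8 := by simpa using hy
    rw [mem_closedBall, dist_zero_right, zero_add, mulE_smul, norm_smul_of_nonneg hρ0.le, hrρ,
      mul_comm 16]
    gcongr; linarith [hLn y]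
  have hE8 := hI.pullback cv hM.1 (u := V) (k := (ρ ^ 2)⁻¹) (by positivity) 0 hdρL0
    (fun y => by rw [hVd]) hmap
  rw [smul_transpose_mul_mul, h1, inv_mul_cancel₀ (by positivity), one_smul] at hE8
  have hσ8 : ∫ y in 𝔹 n 8, |dhess V y - 1| ≤ 16 ^ n * σ := by
    have cg := hv.continuous_dhess
    have h5 := integral_comp_affine_le 0 hdρL0 (g := fun x => |dhess v x - 1|) (by fun_prop)
      (fun _ => abs_nonneg _) hmap
    simp_rw [hVd, dhess_rescale hv.smooth hρ0 0 hdL]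
    rw [hdρL] at h5
    calc _ ≤ (ρ ^ n)⁻¹ * (σ * r ^ n) := h5.trans (by gcongr)
      _ = _ := by rw [hrρ, mul_pow]; field_simp
  have h16 : (16 : ℝ) ^ n ≤ 16 ^ (n + 2) := pow_le_pow_right₀ (by norm_num) (by omega)
  rw [le_div_iff₀ (by positivity)] at hE hσ
  obtain ⟨N, hN, hNd, hN1, hNI⟩ := H V hV (16 ^ (n + 2) * E) (16 ^ (n + 2) * σ)
    (by linarith) (by linarith) (hE8.mono hV.smooth.continuous subset_rfl (le_of_eq (by
      rw [hdρL, hrρ, mul_pow]; field_simp; ring))) (hσ8.trans (by gcongr))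
  refine ⟨Bᵀ * N * B, posDef_transpose_mul_mul hN h2, ?_, fun i j => ?_, ?_⟩
  · rw [det_mul, det_mul, det_transpose, hNd, mul_one, ← sq, hdB]
  · have e : (Bᵀ * N * B) i j - M i j = Bf (N - 1) (mulE B (single i 1))
        (mulE B (single j 1)) := by
      rw [← Bf_transpose_mul_mul, Bf_single, Matrix.mul_sub, Matrix.sub_mul, mul_one, ← h4]
      rfl
    rw [e]; refine (abs_Bf_le_norm (ε := C * (16 ^ (n + 2) * E + 16 ^ (n + 2) * σ)) (by positivity)
      (fun i j => by simpa using hN1 i j) _ _).trans ?_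
    have h5 := hBn (single i 1); have h6 := hBn (single j 1)
    simp only [PiLp.norm_single, norm_one, mul_one] at h5 h6
    have h7 := mul_le_mul h5 h6 (norm_nonneg _) (by norm_num)
    calc _ ≤ n * (C * (16 ^ (n + 2) * E + 16 ^ (n + 2) * σ)) * (2 * 2) := by gcongr
      _ ≤ _ := by linarith [show 0 ≤ (32 ^ (n + 3) * C + 1) * (E + σ) by positivity]
  · have h5 := hNI.pullback hV.smooth.continuous hN.1 (u := v) (x1 := 0) (s := θ * r) (k := ρ ^ 2)
      (by positivity) 0 hdρB0 (fun x => by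
        simp only [hVd, zero_add]
        rw [← mulE_mul, smul_mul, Matrix.mul_smul, h2, smul_smul, mul_inv_cancel₀ hρ0.ne', one_smul,
          mulE_one]
        field_simp) (fun x hx => by
        have hx' : ‖x‖ ≤ θ * r := by simpa using hx
        rw [mem_closedBall, dist_zero_right, zero_add, mulE_smul, norm_smul, norm_inv,
          norm_of_nonneg hρ0.le, inv_mul_le_iff₀ hρ0]
        rw [hrρ] at hx'; linarith [hBn x])
    have e : ρ ^ 2 * ρ⁻¹ ^ 2 = 1 := by field_simp
    rw [smul_transpose_mul_mul, e, one_smul, hdρB, inv_inv] at h5; refine h5.mono cv subset_rfl ?_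
    calc _ = (32 ^ (n + 3) * C * (θ * E) + C * ((θ ^ (n + 2))⁻¹ * σ)) * (θ * r) ^ (n + 2) := by
          rw [hrρ]; field_simp; ring
      _ ≤ _ := by
          have h32 : (1 : ℝ) ≤ 32 ^ (n + 3) := one_le_pow₀ (by norm_num)
          have g3 : 0 ≤ (4 * n * C * 16 ^ (n + 2) + 1) * (θ * E + (θ ^ (n + 2))⁻¹ * σ) := by
            positivity
          have g4 : C * ((θ ^ (n + 2))⁻¹ * σ) ≤ 32 ^ (n + 3) * C * ((θ ^ (n + 2))⁻¹ * σ) := by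
            gcongr; exact le_mul_of_one_le_left hC.le h32
          gcongr; linarith

/-- Iteration of the improvement step. -/
theorem iteration (n : ℕ) [NeZero n] {a : ℝ} (ha1 : a < 1) :
    ∃ θ ε0 C : ℝ, 0 < θ ∧ θ ≤ 1 / 32 ∧ 0 < ε0 ∧ 1 ≤ C ∧
    ∀ (v : Eu n → ℝ), MAConvex v → ∀ (e σ : ℕ → ℝ) (J : ℕ), (∀ j, 0 ≤ e j) → (∀ j, 0 ≤ σ j) →
      (∀ j < J, ∫ x in 𝔹 n (θ ^ j), |dhess v x - 1| ≤ σ j * (θ ^ j) ^ n) →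
      (∀ j < J, θ ^ a * e j + C * σ j ≤ e (j + 1)) → ∑ j ∈ range (J + 1), e j ≤ ε0 →
      QApprox v 1 0 1 (e 0) → ∀ j ≤ J, ∃ M : Mat n, M.PosDef ∧ M.det = 1 ∧
        (∀ i k, |M i k - (1 : Mat n) i k| ≤ C * ∑ i ∈ range (j + 1), e i) ∧
        QApprox v M 0 (θ ^ j) (e j * (θ ^ j) ^ (n + 2)) := by
  have hn := one_le_n (n := n); obtain ⟨C, hC, H⟩ := one_step_general n
  set θ := min (1 / 32) ((1 / C) ^ (1 / (1 - a))); have hθ0 : 0 < θ := by positivity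
  have hθ32 : θ ≤ 1 / 32 := min_le_left _ _; have hCθ : C * θ ≤ θ ^ a := by
    have h1 : θ ^ (1 - a) ≤ 1 / C := by
      calc θ ^ (1 - a) ≤ ((1 / C) ^ (1 / (1 - a))) ^ (1 - a) :=
            rpow_le_rpow hθ0.le (min_le_right _ _) (by linarith)
        _ = 1 / C := by rw [← rpow_mul (by positivity), one_div_mul_cancel (by linarith), rpow_one]
    have h2 : θ = θ ^ (1 - a) * θ ^ a := by rw [← rpow_add hθ0]; simp
    have h3 : C * θ ^ (1 - a) ≤ 1 := by
      calc C * θ ^ (1 - a) ≤ C * (1 / C) := by gcongr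
        _ = 1 := by field_simp
    calc C * θ = (C * θ ^ (1 - a)) * θ ^ a := by rw [mul_assoc, ← h2]
      _ ≤ 1 * θ ^ a := by gcongr
      _ = θ ^ a := one_mul _
  obtain ⟨ε, hε, H⟩ := H θ hθ0 hθ32; set K := 2 * C * (θ ^ (n + 2))⁻¹ with hK
  have hinv : 1 ≤ (θ ^ (n + 2))⁻¹ :=
    (one_le_inv₀ (by positivity)).2 (pow_le_one₀ hθ0.le (by linarith))
  have hCK : 2 * C ≤ K := by rw [hK]; exact le_mul_of_one_le_right (by linarith) hinv
  have hK1 : 1 ≤ K := by linarith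
  refine ⟨θ, min ε (1 / (4 * n * K)), 2 * K, hθ0, hθ32, by positivity, by linarith, ?_⟩
  intro v hv e σ J he hσ hJ hrec hsum h0 j
  suffices hmain : j ≤ J → ∃ M : Mat n, M.PosDef ∧ M.det = 1 ∧
      (∀ i k, |M i k - (1 : Mat n) i k| ≤ K * (2 * ∑ i ∈ range (j + 1), e i - e j)) ∧
      QApprox v M 0 (θ ^ j) (e j * (θ ^ j) ^ (n + 2)) by
    intro hj; obtain ⟨M, h1, h2, h3, h4⟩ := hmain hj
    refine ⟨M, h1, h2, fun i k => (h3 i k).trans ?_, h4⟩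
    calc _ ≤ K * (2 * ∑ i ∈ range (j + 1), e i) :=
          mul_le_mul_of_nonneg_left (by linarith [he j]) (by linarith)
      _ = _ := by ring
  have hle : ∀ j ≤ J, ∑ i ∈ range (j + 1), e i ≤ min ε (1 / (4 * n * K)) := by
    intro j hj; refine (Finset.sum_le_sum_of_subset_of_nonneg ?_ fun i _ _ => he i).trans hsum
    exact Finset.range_subset_range.2 (by omega)
  induction j with
  | zero =>
    intro _; refine ⟨1, PosDef.one, det_one, fun i k => ?_, by simpa using h0⟩
    have h1 := mul_nonneg (show 0 ≤ K by linarith) (he 0)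
    rw [sub_self, abs_zero, zero_add, Finset.sum_range_one]; linarith
  | succ j ih =>
    intro hj; obtain ⟨M, hM, hMd, hM1, hMI⟩ := ih (by omega); have hs1 := hle j (by omega)
    have hs2 := hle (j + 1) hj; have hej : e j ≤ ∑ i ∈ range (j + 1), e i :=
      single_le_sum (f := e) (fun i _ => he i) (by simp)
    have hej1 : e (j + 1) ≤ ∑ i ∈ range (j + 1 + 1), e i :=
      single_le_sum (f := e) (fun i _ => he i) (by simp)
    have hr := hrec j (by omega); have hθe : 0 ≤ θ ^ a * e j := mul_nonneg (by positivity) (he j)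
    have hσe : σ j ≤ e (j + 1) := by
      have : σ j ≤ K * σ j := le_mul_of_one_le_left (hσ j) hK1; linarith [hσ j]
    obtain ⟨M', hM', hMd', hMM, hI'⟩ := H v hv (θ ^ j) (e j) (σ j) (by positivity)
      (hej.trans (hs1.trans (min_le_left _ _)))
      (hσe.trans (hej1.trans (hs2.trans (min_le_left _ _)))) M hM hMd
      (fun i k => (hM1 i k).trans (by
        calc _ ≤ K * (2 * (1 / (4 * n * K))) := by
              gcongr; linarith [he j, hs1.trans (min_le_right _ _)]
          _ = _ := by field_simp; norm_num)) hMI (hJ j (by omega))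
    refine ⟨M', hM', hMd', fun i k => ?_, ?_⟩
    · have e1 : M' i k - (1 : Mat n) i k = (M' i k - M i k) +
          (M i k - (1 : Mat n) i k) := by ring
      rw [e1, Finset.sum_range_succ]; refine (abs_add_le _ _).trans ?_; have h3 := hMM i k
      have h4 := hM1 i k; have h5 : C * (e j + σ j) ≤ K * (e j + e (j + 1)) :=
        mul_le_mul (by linarith) (by linarith) (add_nonneg (he j) (hσ j)) (by linarith)
      linarith
    · rw [pow_succ, mul_comm (θ ^ j) θ]
      refine hI'.mono hv.smooth.continuous subset_rfl ?_; gcongr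
      have h3 : C * (θ * e j) ≤ θ ^ a * e j := by
        rw [← mul_assoc]; exact mul_le_mul_of_nonneg_right hCθ (he j)
      have h4 : C * ((θ ^ (n + 2))⁻¹ * σ j) ≤ K * σ j := by
        rw [hK]; have : 0 ≤ C * (θ ^ (n + 2))⁻¹ * σ j := mul_nonneg (by positivity) (hσ j); linarith
      linarith

section
variable {v : Eu n → ℝ}

lemma contDiff_quad (S : Mat n) (y b : Eu n) (d : ℝ) :
    ContDiff ℝ 2 fun z => 1 / 2 * Qf S (z - y) + (⟪b, z - y⟫ + d) := by
  have h1 : ContDiff ℝ 2 fun z : Eu n => z - y := contDiff_id.sub contDiff_const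
  exact ((contDiff_half_Qf S).comp h1).add ((contDiff_affine b d).comp h1)

lemma hess_quad {S : Mat n} (hS : S.IsHermitian) (y b : Eu n) (d : ℝ) (x : Eu n) :
    hess (fun z => 1 / 2 * Qf S (z - y) + (⟪b, z - y⟫ + d)) x = S := by
  have h := hess_comp_affine ((contDiff_half_Qf S).add (contDiff_affine b d)) 1 (-y) 1 x
  rw [hess_add (contDiff_half_Qf S) (contDiff_affine b d), hess_affine, hess_half_Qf S hS] at h
  simp only [mulE_one, one_mul, Matrix.transpose_one, mul_one, add_zero, one_smul,
    neg_add_eq_sub] at h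
  exact h

lemma exists_hess_ge {v q : Eu n → ℝ} (hv : ContDiff ℝ 2 v) (hq : ContDiff ℝ 2 q) {Ω : Set (Eu n)}
    (hΩ : IsCompact Ω) {x0 : Eu n} (hx0 : x0 ∈ Ω)
    (h : ∀ x ∈ Ω, x ∉ interior Ω → v x0 - q x0 < v x - q x) :
    ∃ x ∈ interior Ω, ∀ ξ, Qf (hess q x) ξ ≤ Qf (hess v x) ξ := by
  obtain ⟨x, hx, hmin⟩ := hΩ.exists_isMinOn ⟨x0, hx0⟩ (f := fun x => v x - q x)
    (hv.continuous.sub hq.continuous).continuousOn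
  have hxi : x ∈ interior Ω := by
    by_contra hc
    exact absurd (hmin hx0) (not_le.2 (h x hx hc))
  exact ⟨x, hxi, fun ξ => Qf_hess_ge_of_isLocalMin hv hq
    (hmin.isLocalMin (mem_interior_iff_mem_nhds.1 hxi)) ξ⟩

lemma MAConvex.pos (hv : MAConvex v) (h0 : v 0 = 0) (hnn : ∀ x, 0 ≤ v x) {x : Eu n} (hx : x ≠ 0) :
    0 < v x := by
  refine lt_of_le_of_ne (hnn x) fun h => hx ?_; have hz : ∀ y, v y = 0 → gradient v y = 0 := by
    intro y hy; have : IsLocalMin v y := Eventually.of_forall fun z => by rw [hy]; exact hnn z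
    refine ext_inner_right ℝ fun ξ => ?_; rw [inner_gradient, this.fderiv_eq_zero]; simp
  exact gradient_injective hv.smooth hv.posDef ((hz x h.symm).trans (hz 0 h0).symm)

lemma MAConvex.isCompact_sublevel [NeZero n] (hv : MAConvex v) (h0 : v 0 = 0)
    (hnn : ∀ x, 0 ≤ v x) (h : ℝ) : IsCompact {x | v x ≤ h} := by
  obtain ⟨e, he, he1⟩ := exists_coord_ne_zero (n := n)
  obtain ⟨x, hx, hmin⟩ := (isCompact_sphere (0 : Eu n) 1).exists_isMinOn ⟨e, by simpa using he1⟩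
    hv.smooth.continuous.continuousOn
  have hx1 : ‖x‖ = 1 := by simpa using hx
  have hm : 0 < v x := hv.pos h0 hnn (by rw [← norm_ne_zero_iff, hx1]; norm_num)
  refine (isCompact_closedBall (0 : Eu n) (max 1 (h / v x))).of_isClosed_subset
    (isClosed_le hv.smooth.continuous continuous_const) fun y hy => ?_
  simp only [mem_closedBall, dist_zero_right]
  by_contra hc
  push Not at hc
  obtain ⟨hc1, hc2⟩ := max_lt_iff.1 hc; have hy0 : 0 < ‖y‖ := by linarith
  have h1 := hv.convex.2 (Set.mem_univ (0 : Eu n)) (Set.mem_univ y)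
    (show 0 ≤ 1 - ‖y‖⁻¹ by have := inv_le_one_of_one_le₀ hc1.le; linarith)
    (show 0 ≤ ‖y‖⁻¹ by positivity) (by ring)
  rw [smul_zero, zero_add, h0, smul_zero, zero_add, smul_eq_mul] at h1
  have h2 : v x ≤ v (‖y‖⁻¹ • y) := hmin (by simp [norm_smul, hy0.ne'])
  have h3 : v x * ‖y‖ ≤ v y := by
    have := h2.trans h1; rw [inv_mul_eq_div, le_div_iff₀ hy0] at this; exact this
  have hy' : v y ≤ h := hy; rw [div_lt_iff₀ hm] at hc2; linarith [mul_comm ‖y‖ (v x)]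

lemma exists_max_simplex {K : Set (Eu n)} (hK : IsCompact K) {r : ℝ} (hr : 0 < r)
    (hrK : 𝔹 n r ⊆ K) :
    ∃ p : Fin n → Eu n, (∀ i, p i ∈ K) ∧ (colsOf p).det ≠ 0 ∧
      ∀ c : Eu n, mulE (colsOf p) c ∈ K → ∀ i, |c i| ≤ 1 := by
  have hcont : Continuous fun p : Fin n → Eu n => |(colsOf p).det| := by
    refine continuous_abs.comp (Continuous.matrix_det ?_); refine continuous_matrix fun i j => ?_
    simp only [colsOf, Matrix.of_apply]; fun_prop
  have hmem : ∀ i : Fin n, (single i r : Eu n) ∈ K := fun i =>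
    hrK (by simp [abs_of_pos hr])
  obtain ⟨p, hp, hmax⟩ := (isCompact_univ_pi fun _ : Fin n => hK).exists_isMaxOn
    ⟨fun i => single i r, fun i _ => hmem i⟩ hcont.continuousOn
  have hdet : (colsOf p).det ≠ 0 := by
    have h1 := hmax (show (fun i => (single i r : Eu n)) ∈ _ from fun i _ => hmem i)
    have h2 : colsOf (fun i => (single i r : Eu n)) = r • (1 : Mat n) := by
      ext i j; simp [colsOf, Matrix.one_apply]
    simp only [mem_ofPred_eq, h2, det_smul, det_one, mul_one] at h1; intro h; rw [h, abs_zero] at h1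
    have : 0 < |r ^ card (Fin n)| := by positivity
    linarith
  refine ⟨p, fun i => hp i trivial, hdet, fun c hc i => ?_⟩
  have h1 := hmax (show update p i (mulE (colsOf p) c) ∈ _ from fun j _ => by
    by_cases hj : j = i
    · subst hj; simpa using hc
    · simpa [hj] using hp j trivial)
  have h2 : colsOf (update p i (mulE (colsOf p) c)) =
      (colsOf p).updateCol i (colsOf p *ᵥ c.ofLp) := by
    ext k j
    by_cases hj : j = i
    · subst hj; simp [colsOf]; rfl
    · simp [colsOf, hj]
  have h3 : ((colsOf p).updateCol i (colsOf p *ᵥ c.ofLp)).det = c i * (colsOf p).det := by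
    rw [← Matrix.cramer_apply, Matrix.cramer_eq_adjugate_mulVec, Matrix.mulVec_mulVec,
      Matrix.adjugate_mul, Matrix.smul_mulVec, Matrix.one_mulVec]
    simp [mul_comm]
  simp only [mem_ofPred_eq, h2, h3, abs_mul] at h1
  exact le_of_mul_le_mul_right (by linarith) (abs_pos.2 hdet)

lemma posDef_smul_one {a : ℝ} (ha : 0 < a) : (a • (1 : Mat n)).PosDef := PosDef.one.smul ha

lemma det_smul_one (a : ℝ) : (a • (1 : Mat n)).det = a ^ n := by simp

lemma exists_normalization (n : ℕ) [NeZero n] {lam : ℝ} (hlam : 0 < lam) : ∃ C : ℝ, 1 ≤ C ∧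
    ∀ u : Eu n → ℝ, MAConvex u → (∀ x, lam ≤ dhess u x) → u 0 = 0 → (∀ x, 0 ≤ u x) →
    ∀ h : ℝ, 0 < h → ∃ T : Mat n, T.det ^ 2 = h ^ n ∧ ∀ y, u (mulE T y) ≤ h → ‖y‖ ≤ C := by
  have hn := one_le_n (n := n); have hn0 : (0 : ℝ) < n := by linarith
  set a : ℝ := 12 * n ^ 2 with ha; have ha0 : 0 < a := by positivity
  refine ⟨sqrt n * max 1 (a ^ n / lam), ?_, fun u hu hdet h0 hnn h hh => ?_⟩
  · have h1 : 1 ≤ sqrt n := Real.one_le_sqrt.2 hn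
    have h2 : (1 : ℝ) ≤ max 1 (a ^ n / lam) := le_max_left _ _; nlinarith
  obtain ⟨r, hr, hrK⟩ : ∃ r > 0, 𝔹 n r ⊆ {x | u x ≤ h} := by
    have : {x | u x < h} ∈ 𝓝 (0 : Eu n) :=
      (isOpen_lt hu.smooth.continuous continuous_const).mem_nhds (by simpa [h0] using hh)
    obtain ⟨r, hr, hs⟩ := Metric.nhds_basis_closedBall.mem_iff.1 this
    exact ⟨r, hr, fun x hx => (show u x < h from hs hx).le⟩
  obtain ⟨p, hp, hpd, hpc⟩ := exists_max_simplex (hu.isCompact_sublevel h0 hnn h) hr hrK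
  set P := colsOf p with hP; set δ := P.det ^ 2 / h ^ n with hδ; have hδ0 : 0 < δ := by positivity
  have hV : MAConvex fun y => h⁻¹ * u (0 + mulE P y) := hu.comp_affine (by positivity) 0 hpd
  have hVd : ∀ y, δ * lam ≤ (hess (fun y => h⁻¹ * u (0 + mulE P y)) y).det := by
    intro y; rw [det_hess_comp_affine hu.smooth]
    have : h⁻¹ ^ n * P.det ^ 2 = δ := by rw [hδ, inv_pow]; ring
    rw [this]; exact mul_le_mul_of_nonneg_left (hdet _) hδ0.le
  have hδa : δ * lam ≤ a ^ n := by
    set xh : Eu n := WithLp.toLp 2 fun _ => 1 / (2 * n)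
    have hc0 : (0 : ℝ) < 1 / (2 * n) := by positivity
    have hsimp : ∀ y ∈ closedBall xh (1 / (2 * n)), u (mulE P y) ≤ h := by
      intro y hy; rw [mem_closedBall, dist_eq_norm] at hy
      have hyi : ∀ i, |y i - 1 / (2 * n)| ≤ 1 / (2 * n) := fun i =>
        (PiLp.norm_apply_le (y - xh) i).trans hy
      have hy0 : ∀ i, 0 ≤ y i := fun i => by have := (abs_le.1 (hyi i)).1; linarith
      have hy1 : ∑ i, y i ≤ 1 := by
        have : ∑ i, y i ≤ ∑ _i : Fin n, (1 : ℝ) / n := sum_le_sum fun i _ => by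
          have := (abs_le.1 (hyi i)).2
          have e : (1 : ℝ) / n = 1 / (2 * n) + 1 / (2 * n) := by field_simp; norm_num
          linarith
        simpa [hn0.ne'] using this
      have key := hu.convex.map_sum_le (t := Finset.univ)
        (w := fun o : Option (Fin n) => o.elim (1 - ∑ i, y i) y.ofLp)
        (p := fun o => o.elim 0 p) (fun o _ => by
          cases o with
          | none => simpa using hy1
          | some i => exact hy0 i) (by rw [sum_option]; simp) (fun _ _ => Set.mem_univ _)
      rw [sum_option, sum_option] at key
      simp only [Option.elim, smul_zero, zero_add, h0, smul_eq_mul, mul_zero] at key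
      have e : mulE P y = ∑ i, y i • p i := by
        conv_lhs => rw [Eu_sum_single y]
        simp only [map_sum, map_smul, hP, mulE_colsOf_single]
      rw [e]; refine key.trans ?_
      calc ∑ i, y i * u (p i) ≤ ∑ i, y i * h :=
            sum_le_sum fun i _ => mul_le_mul_of_nonneg_left (hp i) (hy0 i)
        _ = (∑ i, y i) * h := by rw [Finset.sum_mul]
        _ ≤ h := mul_le_of_le_one_left hh.le hy1
    obtain ⟨x, -, hx⟩ := exists_hess_ge (contDiff_quad (a • (1 : Mat n)) xh 0 0) hV.smooth
      (isCompact_closedBall xh (1 / (2 * n))) (mem_closedBall_self hc0.le) (fun x hx hxi => by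
        have hxd : ‖x - xh‖ = 1 / (2 * n) := by
          rw [mem_closedBall, dist_eq_norm] at hx
          refine le_antisymm hx (not_lt.1 fun hlt => hxi ?_)
          rw [interior_closedBall _ hc0.ne', mem_ball, dist_eq_norm]; exact hlt
        have h1 : h⁻¹ * u (0 + mulE P x) ≤ 1 := by
          rw [zero_add, inv_mul_le_iff₀ hh, mul_one]; exact hsimp x hx
        have h2 : 0 ≤ h⁻¹ * u (0 + mulE P xh) := mul_nonneg (by positivity) (hnn _)
        simp only [sub_self, Qf_zero_right, inner_zero_left, Qf_smul_matrix, Qf_one, hxd]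
        have : 1 / 2 * (a * (1 / (2 * (n : ℝ))) ^ 2) = 3 / 2 := by rw [ha]; field_simp; norm_num
        rw [this]; linarith)
    rw [hess_quad (posDef_smul_one ha0).1] at hx
    have := det_mono (hess_posSemidef hV.smooth hV.convex x) (posDef_smul_one ha0) hx
    rw [det_smul_one] at this; exact (hVd x).trans this
  set k : ℝ := δ⁻¹ ^ (((2 * n : ℕ) : ℝ)⁻¹); have hk0 : 0 < k := by positivity
  have hk2 : k ^ (2 * n) = δ⁻¹ :=
    Real.rpow_inv_natCast_pow (by positivity) (by have := NeZero.ne n; omega)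
  have hmulk : ∀ y, mulE (k • P) y = mulE P (k • y) := by
    intro y; rw [map_smul]; ext i; simp [mulE_apply, mul_sum, mul_assoc]
  refine ⟨k • P, ?_, fun y hy => ?_⟩
  · rw [det_smul, card_fin, mul_pow, ← pow_mul, mul_comm n 2, hk2, hδ]
    field_simp
  · rw [hmulk] at hy
    have h1 : ∀ i, |(k • y) i| ≤ 1 := hpc _ hy; have h2 : ‖k • y‖ ≤ sqrt n := by
      rw [norm_eq]; refine Real.sqrt_le_sqrt ?_
      calc ∑ i, ‖(k • y) i‖ ^ 2 ≤ ∑ _i : Fin n, (1 : ℝ) :=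
            sum_le_sum fun i _ => pow_le_one₀ (norm_nonneg _) (h1 i)
        _ = n := by simp
    rw [norm_smul, norm_eq_abs, abs_of_pos hk0] at h2; have h3 : k⁻¹ ≤ max 1 (a ^ n / lam) := by
      rcases le_total k⁻¹ 1 with h4 | h4
      · exact h4.trans (le_max_left _ _)
      · refine le_trans ?_ (le_max_right _ _)
        have h5 : k⁻¹ ≤ k⁻¹ ^ (2 * n) := le_self_pow₀ h4 (by have := NeZero.ne n; omega)
        rw [inv_pow, hk2, inv_inv] at h5; rw [le_div_iff₀ hlam]; nlinarith
    calc ‖y‖ = k⁻¹ * (k * ‖y‖) := by field_simp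
      _ ≤ k⁻¹ * sqrt n := by gcongr
      _ ≤ max 1 (a ^ n / lam) * sqrt n := by gcongr
      _ = _ := mul_comm _ _

lemma sublevel_separation (n : ℕ) [NeZero n] {Lam C : ℝ} (hC : 1 ≤ C) :
    ∃ T0 : ℝ, 0 < T0 ∧ T0 ≤ 1 ∧ ∀ v : Eu n → ℝ, MAConvex v → (∀ x, dhess v x ≤ Lam) → v 0 = 0 →
      (∀ x, 0 ≤ v x) → (∀ y, v y ≤ 1 → ‖y‖ ≤ C) →
      ∀ x w, v x ≤ 1 / 2 → ‖w‖ ≤ T0 → v (x + w) ≤ 1 := by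
  set ε : ℝ := 1 / (16 * C ^ 2) with hε; have hε0 : 0 < ε := by positivity
  set a : ℝ := max 1 (ε * (Lam / ε ^ n)); have ha1 : 1 ≤ a := le_max_left _ _
  have hT : 1 / (8 * a * C) ≤ 1 := by rw [div_le_one (by positivity)]; nlinarith
  refine ⟨1 / (8 * a * C), by positivity, hT, fun v hv hdet h0 hnn hsub x w hx hw => ?_⟩
  by_contra hc
  push Not at hc
  have hline : Continuous fun s : ℝ => v (x + s • w) := by have := hv.smooth.continuous; fun_prop
  obtain ⟨s, hs, hys⟩ := intermediate_value_Icc (zero_le_one' ℝ) hline.continuousOn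
    (show (1 : ℝ) ∈ Icc (v (x + (0 : ℝ) • w)) (v (x + (1 : ℝ) • w)) by
      constructor
      · simp; linarith
      · simpa using hc.le)
  set y := x + s • w with hy; have hy1 : v y = 1 := hys; set g := gradient v y with hg
  have hg0 : g ≠ 0 := by
    intro h; have h1 := convex_tangent hv.smooth hv.convex y 0
    rw [← inner_gradient, ← hg, h, inner_zero_left, h0, hy1] at h1; linarith
  set ν := ‖g‖⁻¹ • g with hν
  have hν1 : ‖ν‖ = 1 := by rw [hν, norm_smul, norm_inv, norm_norm, inv_mul_cancel₀ (by simpa using hg0)]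
  have hνs : ∀ z, v z ≤ 1 → ⟪ν, z - y⟫ ≤ 0 := by
    intro z hz; have h1 := convex_tangent hv.smooth hv.convex y z
    rw [← inner_gradient, ← hg, hy1] at h1; rw [hν, inner_smul_left]
    exact mul_nonpos_of_nonneg_of_nonpos (by simp) (by linarith)
  set S : Mat n := ε • (1 : Mat n) + a • vecMulVec ν.ofLp ν.ofLp with hS
  have hQS : ∀ z : Eu n, Qf S z = ε * ‖z‖ ^ 2 + a * ⟪ν, z⟫ ^ 2 := by
    intro z
    rw [hS, Qf_add_matrix, Qf_smul_matrix, Qf_smul_matrix, Qf_one, Qf_vecMulVec, PiLp.inner_apply]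
    simp [mul_comm]
  have hSh : S.IsHermitian :=
    (posDef_smul_one hε0).1.add ((isHermitian_vecMulVec_self _).smul (IsSelfAdjoint.all a))
  have hSd : Lam < S.det := by
    have e : S = ε • ((1 : Mat n) + (a / ε) • vecMulVec ν.ofLp ν.ofLp) := by
      rw [smul_add, smul_smul, mul_div_cancel₀ _ hε0.ne']
    have hsum : ∑ i, ν i ^ 2 = 1 := by have := norm_sq_eq ν; rw [hν1] at this; simpa using this.symm
    rw [e, det_smul, det_one_add_vecMulVec, hsum, card_fin, mul_one]
    have h1 : ε * (Lam / ε ^ n) ≤ a := le_max_right _ _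
    have h2 : Lam / ε ^ n ≤ a / ε := by rw [le_div_iff₀ hε0]; linarith
    rw [div_le_iff₀ (by positivity)] at h2; have : 0 < ε ^ n := by positivity
    linarith
  set q : Eu n → ℝ := fun z => 1 / 2 * Qf S (z - y) + (⟪(a * C) • ν, z - y⟫ + (1 - 2 * ε * C ^ 2))
    with hq
  have hy2 : ‖y‖ ≤ C := hsub y hy1.le
  have hεC : 2 * ε * C ^ 2 = 1 / 8 := by rw [hε]; field_simp; norm_num
  have hqx : v x - q x < 0 := by
    have h1 : |⟪ν, x - y⟫| ≤ 1 / (8 * a * C) := by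
      refine (abs_real_inner_le_norm _ _).trans ?_
      rw [hν1, one_mul, hy, sub_add_cancel_left, norm_neg, norm_smul, norm_eq_abs,
        abs_of_nonneg hs.1]
      exact (mul_le_of_le_one_left (norm_nonneg _) hs.2).trans hw
    have h2 := (abs_le.1 h1).1; have h3 : a * C * (1 / (8 * a * C)) = 1 / 8 := by field_simp
    have h4 : a * C * (-(1 / (8 * a * C))) ≤ a * C * ⟪ν, x - y⟫ := by gcongr
    have h5 : 0 ≤ Qf S (x - y) := by rw [hQS]; positivity
    simp only [hq, inner_smul_left, conj_trivial]; linarith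
  obtain ⟨z, -, hz⟩ := exists_hess_ge hv.smooth (contDiff_quad S y ((a * C) • ν) (1 - 2 * ε * C ^ 2))
    (hv.isCompact_sublevel h0 hnn 1) (show x ∈ {x | v x ≤ 1} from by
      simp only [mem_ofPred_eq]; linarith) (fun z hz hzi => by
      have hz1 : v z = 1 := by
        refine le_antisymm hz (not_lt.1 fun hlt => hzi ?_)
        exact interior_maximal (fun t ht => le_of_lt ht)
          (isOpen_lt hv.smooth.continuous continuous_const) hlt
      refine lt_of_lt_of_le hqx ?_
      have h1 : ‖z - y‖ ≤ 2 * C := (norm_sub_le _ _).trans (by linarith [hsub z hz])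
      have h2 := hνs z hz; have h3 : -(2 * C) ≤ ⟪ν, z - y⟫ := by
        have := (abs_le.1 (abs_real_inner_le_norm ν (z - y))).1; rw [hν1, one_mul] at this; linarith
      rw [hz1, hQS, real_inner_smul_left ν (z - y) (a * C)]
      have h4 : ‖z - y‖ ^ 2 ≤ (2 * C) ^ 2 := pow_le_pow_left₀ (norm_nonneg _) h1 2
      have h5 : ε * ‖z - y‖ ^ 2 ≤ ε * (2 * C) ^ 2 := by gcongr
      have h6 : 0 ≤ a * (-⟪ν, z - y⟫ * (⟪ν, z - y⟫ + 2 * C)) :=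
        mul_nonneg (by linarith) (mul_nonneg (by linarith) (by linarith))
      nlinarith)
  rw [hess_quad hSh] at hz
  have hSpd : S.PosSemidef := (posSemidef_iff_Qf hSh).2 fun z => by rw [hQS]; positivity
  have := det_mono hSpd (hv.posDef z) hz; have h2 := hdet z; rw [dhess] at h2; linarith
end

/-- A smooth regularisation of the norm. -/
def psi (ε : ℝ) (x : Eu n) : ℝ := sqrt (‖x‖ ^ 2 + ε ^ 2)

section
variable {ε : ℝ}

lemma psi_pos (hε : 0 < ε) (x : Eu n) : 0 < psi ε x := sqrt_pos.2 (by positivity)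

lemma psi_sq (x : Eu n) : psi ε x ^ 2 = ‖x‖ ^ 2 + ε ^ 2 := sq_sqrt (by positivity)

lemma norm_le_psi (x : Eu n) : ‖x‖ ≤ psi ε x := Real.le_sqrt_of_sq_le (by nlinarith)

lemma psi_le (hε : 0 < ε) (x : Eu n) : psi ε x ≤ ‖x‖ + ε :=
  Real.sqrt_le_iff.2 ⟨by positivity, by nlinarith [norm_nonneg x]⟩

lemma contDiff_psi (hε : 0 < ε) : ContDiff ℝ 2 (psi (n := n) ε) :=
  ((contDiff_norm_sq ℝ).add contDiff_const).sqrt fun x => by positivity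

lemma convexOn_psi (hε : 0 < ε) : ConvexOn ℝ Set.univ (psi (n := n) ε) := by
  refine ⟨convex_univ, fun x _ y _ s t hs ht hst => ?_⟩; have hx := psi_pos hε x
  have hy := psi_pos hε y; rw [smul_eq_mul, smul_eq_mul]
  refine Real.sqrt_le_iff.2 ⟨by positivity, ?_⟩
  have h1 : ‖x‖ * ‖y‖ + ε ^ 2 ≤ psi ε x * psi ε y := by
    refine abs_le_of_sq_le_sq' ?_ (by positivity) |>.2; rw [mul_pow, psi_sq, psi_sq]
    nlinarith [sq_nonneg (ε * (‖x‖ - ‖y‖))]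
  have h2 : ‖s • x + t • y‖ ≤ s * ‖x‖ + t * ‖y‖ := by
    refine (norm_add_le _ _).trans ?_
    rw [norm_smul, norm_smul, norm_eq_abs, norm_eq_abs, abs_of_nonneg hs, abs_of_nonneg ht]
  have h3 : ‖s • x + t • y‖ ^ 2 ≤ (s * ‖x‖ + t * ‖y‖) ^ 2 := pow_le_pow_left₀ (norm_nonneg _) h2 2
  have h4 := psi_sq (ε := ε) x; have h5 := psi_sq (ε := ε) y
  have h6 : s * t * (‖x‖ * ‖y‖ + ε ^ 2) ≤ s * t * (psi ε x * psi ε y) := by gcongr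
  have h7 : ε ^ 2 = (s + t) ^ 2 * ε ^ 2 := by rw [hst]; ring
  calc _ ≤ (s * ‖x‖ + t * ‖y‖) ^ 2 + (s + t) ^ 2 * ε ^ 2 := by linarith
    _ ≤ s ^ 2 * psi ε x ^ 2 + t ^ 2 * psi ε y ^ 2 + 2 * (s * t * (psi ε x * psi ε y)) := by
        rw [h4, h5]; linarith
    _ = _ := by ring

lemma hasDerivAt_psi_line (hε : 0 < ε) (x ξ : Eu n) (s : ℝ) :
    HasDerivAt (fun s : ℝ => psi ε (x + s • ξ)) (⟪x + s • ξ, ξ⟫ / psi ε (x + s • ξ)) s := by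
  have h1 : HasDerivAt (fun s : ℝ => ‖x + s • ξ‖ ^ 2 + ε ^ 2) (2 * ⟪x + s • ξ, ξ⟫) s :=
    ((hasDerivAt_add_smul x ξ s).norm_sq).add_const _
  have h2 := h1.sqrt (by positivity); refine h2.congr_deriv ?_; rw [psi]; field_simp

lemma fderiv_psi (hε : 0 < ε) (x ξ : Eu n) : fderiv ℝ (psi ε) x ξ = ⟪x, ξ⟫ / psi ε x := by
  have h1 := hasDerivAt_line (contDiff_psi hε) x ξ 0; have h2 := hasDerivAt_psi_line hε x ξ 0
  simpa using h1.unique h2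

lemma abs_fderiv_psi_le (hε : 0 < ε) (x ξ : Eu n) : |fderiv ℝ (psi ε) x ξ| ≤ ‖ξ‖ := by
  have hx := psi_pos hε x; rw [fderiv_psi hε, abs_div, abs_of_pos hx, div_le_iff₀ hx]
  refine (abs_real_inner_le_norm _ _).trans ?_; rw [mul_comm]; gcongr; exact norm_le_psi x

lemma Qf_hess_psi_ge (hε : 0 < ε) (x ξ : Eu n) :
    ε ^ 2 * ‖ξ‖ ^ 2 / psi ε x ^ 3 ≤ Qf (hess (psi ε) x) ξ := by
  have hx := psi_pos hε x; have h1 := hasDerivAt_line2 (contDiff_psi hε) x ξ ξ 0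
  have hin : HasDerivAt (fun s : ℝ => ⟪x + s • ξ, ξ⟫) (‖ξ‖ ^ 2) 0 := by
    have := (hasDerivAt_add_smul x ξ 0).inner ℝ (hasDerivAt_const (0 : ℝ) ξ)
    simpa [real_inner_self_eq_norm_sq] using this
  have h2 := hin.div (hasDerivAt_psi_line hε x ξ 0) (by simpa using hx.ne')
  have e : (fun s : ℝ => fderiv ℝ (psi ε) (x + s • ξ) ξ) =
      fun s : ℝ => ⟪x + s • ξ, ξ⟫ / psi ε (x + s • ξ) := by ext s; rw [fderiv_psi hε]
  rw [e] at h1; have h3 := h1.unique h2; simp only [zero_smul, add_zero] at h3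
  rw [Qf_eq_Bf, h3, div_le_div_iff₀ (by positivity) (by positivity)]; have h4 := psi_sq (ε := ε) x
  have h5 : ⟪x, ξ⟫ ^ 2 ≤ ‖x‖ ^ 2 * ‖ξ‖ ^ 2 := by
    rw [← sq_abs, ← mul_pow]; exact pow_le_pow_left₀ (abs_nonneg _) (abs_real_inner_le_norm _ _) 2
  have h6 : (‖ξ‖ ^ 2 * psi ε x - ⟪x, ξ⟫ * (⟪x, ξ⟫ / psi ε x)) * psi ε x ^ 3 =
      (‖ξ‖ ^ 2 * psi ε x ^ 2 - ⟪x, ξ⟫ ^ 2) * psi ε x ^ 2 := by field_simp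
  rw [h6]; have : ε ^ 2 * ‖ξ‖ ^ 2 ≤ ‖ξ‖ ^ 2 * psi ε x ^ 2 - ⟪x, ξ⟫ ^ 2 := by rw [h4]; linarith
  gcongr

lemma Qf_hess_psi_nonneg (hε : 0 < ε) (x ξ : Eu n) : 0 ≤ Qf (hess (psi ε) x) ξ := by
  have := psi_pos hε x; exact le_trans (by positivity) (Qf_hess_psi_ge hε x ξ)

lemma Qf_hess_psi_ge_near (hε : 0 < ε) {x : Eu n} (hx : ‖x‖ ≤ ε) (ξ : Eu n) :
    ‖ξ‖ ^ 2 / (3 * ε) ≤ Qf (hess (psi ε) x) ξ := by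
  refine le_trans ?_ (Qf_hess_psi_ge hε x ξ); have hp := psi_pos hε x
  have h1 : psi ε x ^ 3 ≤ 3 * ε ^ 3 := by
    have h2 : psi ε x ^ 2 ≤ 2 * ε ^ 2 := by rw [psi_sq]; nlinarith [norm_nonneg x]
    have h3 : psi ε x ≤ 3 / 2 * ε := abs_le_of_sq_le_sq' (by nlinarith) (by positivity) |>.2
    nlinarith
  rw [div_le_div_iff₀ (by positivity) (by positivity)]
  nlinarith [sq_nonneg ‖ξ‖, mul_le_mul_of_nonneg_left h1 (sq_nonneg ‖ξ‖)]

lemma log_max_test {D D' r r' P P' : ℝ → ℝ} {D2 r2 P₂ w1 w2 α1 α2 : ℝ} {m : ℕ}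
    (hD : ∀ s, HasDerivAt D (D' s) s) (hD' : HasDerivAt D' D2 0)
    (hr : ∀ s, HasDerivAt r (r' s) s) (hr' : HasDerivAt r' r2 0)
    (hP : ∀ s, HasDerivAt P (P' s) s) (hP' : HasDerivAt P' P₂ 0)
    (hD0 : 0 < D 0) (hr0 : 0 < r 0) (hw1 : 0 < w1) (hw2 : 0 < w2)
    (hmax : ∀ᶠ s in 𝓝 (0 : ℝ), D s / ((w1 + s * α1) * (w2 + s * α2)) * r s ^ m * exp (P s) ≤
      D 0 / (w1 * w2) * r 0 ^ m * exp (P 0)) :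
    D2 / D 0 - (α1 / w1 + α2 / w2 - m * (r' 0 / r 0) - P' 0) ^ 2 + (α1 / w1) ^ 2 +
      (α2 / w2) ^ 2 + m * (r2 / r 0 - (r' 0 / r 0) ^ 2) + P₂ ≤ 0 := by
  have hlin : ∀ w α s : ℝ, HasDerivAt (fun s => w + s * α) α s := fun w α s => by
    simpa using ((hasDerivAt_id s).mul_const α).const_add w
  have pD : ∀ᶠ s in 𝓝 (0 : ℝ), 0 < D s := (hD 0).continuousAt.eventually (lt_mem_nhds hD0)
  have pr : ∀ᶠ s in 𝓝 (0 : ℝ), 0 < r s := (hr 0).continuousAt.eventually (lt_mem_nhds hr0)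
  have pw : ∀ w α : ℝ, 0 < w → ∀ᶠ s in 𝓝 (0 : ℝ), 0 < w + s * α := fun w α hw =>
    (hlin w α 0).continuousAt.eventually (lt_mem_nhds (by simpa using hw))
  have p1 := pw w1 α1 hw1; have p2 := pw w2 α2 hw2; have key := second_deriv_test_max
    (φ := fun s => log (D s) - log (w1 + s * α1) - log (w2 + s * α2) + m * log (r s) + P s)
    (φ' := fun s => D' s / D s - α1 / (w1 + s * α1) - α2 / (w2 + s * α2) + m * (r' s / r s) + P' s)
    (c := (D2 * D 0 - D' 0 * D' 0) / D 0 ^ 2 - (0 * w1 - α1 * α1) / w1 ^ 2 -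
      (0 * w2 - α2 * α2) / w2 ^ 2 + m * ((r2 * r 0 - r' 0 * r' 0) / r 0 ^ 2) + P₂) ?_ ?_ ?_
  · obtain ⟨k1, k2⟩ := key
    simp only [zero_mul, add_zero] at k1
    have e1 : α1 / w1 + α2 / w2 - m * (r' 0 / r 0) - P' 0 = D' 0 / D 0 := by linarith
    rw [e1]; refine le_trans (le_of_eq ?_) k2; field_simp; ring
  · filter_upwards [pD, pr, p1, p2] with s h1 h2 h3 h4
    exact (((((hD s).log h1.ne').sub ((hlin w1 α1 s).log h3.ne')).sub
      ((hlin w2 α2 s).log h4.ne')).add (((hr s).log h2.ne').const_mul (m : ℝ))).add (hP s)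
  · have d1 := hD'.div (hD 0) hD0.ne'
    have d2 := hr'.div (hr 0) hr0.ne'
    have d3 := (hasDerivAt_const (0 : ℝ) α1).div (hlin w1 α1 0) (by simpa using hw1.ne')
    have d4 := (hasDerivAt_const (0 : ℝ) α2).div (hlin w2 α2 0) (by simpa using hw2.ne')
    simp only [zero_mul, add_zero] at d3 d4
    refine HasDerivAt.congr_deriv ((((d1.sub d3).sub d4).add (d2.const_mul (m : ℝ))).add hP') ?_
    simp
  · filter_upwards [pD, pr, p1, p2, hmax] with s h1 h2 h3 h4 h5
    have hlog : ∀ {d a b r p : ℝ}, 0 < d → 0 < a → 0 < b → 0 < r →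
        log (d / (a * b) * r ^ m * exp p) = log d - log a - log b + m * log r + p := by
      intro d a b r p hd ha hb hr
      rw [log_mul (by positivity) (by positivity), log_mul (by positivity) (by positivity),
        Real.log_div (by positivity) (by positivity), log_mul (by positivity) (by positivity),
        Real.log_pow, Real.log_exp]
      ring
    have h6 := Real.log_le_log (by positivity) h5; rw [hlog h1 h3 h4 h2, hlog hD0 hw1 hw2 hr0] at h6
    simpa using h6
end

/-- The excess of a chord of `vp` over the value of `v` at an intermediate point. -/
def chord (v vp : Eu n → ℝ) (e x : Eu n) (t1 t2 : ℝ) : ℝ :=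
  (t2 * vp (x + t1 • e) + t1 * vp (x - t2 • e)) / (t1 + t2) - v x

/-- The auxiliary function of the finite difference Pogorelov estimate. -/
def pogG (v vp P : Eu n → ℝ) (b : ℝ) (e x : Eu n) (t1 t2 : ℝ) : ℝ :=
  chord v vp e x t1 t2 / ((t1 + b) * (t2 + b)) * (1 / 2 - v x) ^ n * exp (P x)

section
variable {v vp P : Eu n → ℝ} {b t0 T0 : ℝ} {e x : Eu n} {t1 t2 : ℝ}

lemma pog_var_inner (hv : ContDiff ℝ 2 v) (hP : ContDiff ℝ 2 P) (hb : 0 < b)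
    (ht0 : 0 < t0) (h1 : t0 < t1) (h1' : t1 < T0) (h2 : t0 < t2) (h2' : t2 < T0)
    (hr : 0 < 1 / 2 - v x) (hD : 0 < chord v vp e x t1 t2)
    (hmax : ∀ x' s1 s2, v x' ≤ 1 / 2 → t0 ≤ s1 → s1 ≤ T0 → t0 ≤ s2 → s2 ≤ T0 →
      pogG v vp P b e x' s1 s2 ≤ pogG v vp P b e x t1 t2) :
    -Qf (hess v x) e / chord v vp e x t1 t2 - (-1 / (t1 + b) + 1 / (t2 + b) +
      n * (fderiv ℝ v x e / (1 / 2 - v x)) - fderiv ℝ P x e) ^ 2 + (-1 / (t1 + b)) ^ 2 +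
      (1 / (t2 + b)) ^ 2 - n * (Qf (hess v x) e / (1 / 2 - v x) +
      (fderiv ℝ v x e / (1 / 2 - v x)) ^ 2) + Qf (hess P x) e ≤ 0 := by
  have hlin : ∀ w α s : ℝ, HasDerivAt (fun s => w + s * α) α s := fun w α s => by
    simpa using ((hasDerivAt_id s).mul_const α).const_add w
  have key := log_max_test (m := n) (w1 := t1 + b) (w2 := t2 + b) (α1 := -1) (α2 := 1)
    (D := fun s => ((t2 + s * 1) * vp (x + t1 • e) + (t1 + s * (-1)) * vp (x - t2 • e)) / (t1 + t2)
      - v (x + s • e))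
    (D' := fun s => (1 * vp (x + t1 • e) + (-1) * vp (x - t2 • e)) / (t1 + t2)
      - fderiv ℝ v (x + s • e) e) (D2 := 0 - Bf (hess v (x + (0 : ℝ) • e)) e e)
    (r := fun s => 1 / 2 - v (x + s • e)) (r' := fun s => - fderiv ℝ v (x + s • e) e)
    (r2 := - Bf (hess v (x + (0 : ℝ) • e)) e e)
    (P := fun s => P (x + s • e)) (P' := fun s => fderiv ℝ P (x + s • e) e)
    (P₂ := Bf (hess P (x + (0 : ℝ) • e)) e e)
    (fun s => ((((hlin t2 1 s).mul_const _).add ((hlin t1 (-1) s).mul_const _)).div_const _).sub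
      (hasDerivAt_line hv x e s))
    ((hasDerivAt_const (0 : ℝ) _).sub (hasDerivAt_line2 hv x e e 0))
    (fun s => (hasDerivAt_line hv x e s).const_sub _) (hasDerivAt_line2 hv x e e 0).neg
    (hasDerivAt_line hP x e) (hasDerivAt_line2 hP x e e 0)
    (by simpa [chord] using hD) (by simpa using hr) (by linarith) (by linarith) ?_
  · have e0 : ((t2 + 0 * 1) * vp (x + t1 • e) + (t1 + 0 * (-1)) * vp (x - t2 • e)) / (t1 + t2)
      - v (x + (0 : ℝ) • e) = chord v vp e x t1 t2 := by simp [chord]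
    rw [e0] at key; simp only [zero_smul, add_zero, ← Qf_eq_Bf] at key
    refine le_trans (le_of_eq ?_) key; ring
  · have c1 : ∀ᶠ s in 𝓝 (0 : ℝ), v (x + s • e) < 1 / 2 :=
      (hasDerivAt_line hv x e 0).continuousAt.eventually (gt_mem_nhds (by simpa using hr))
    have cl : ∀ w α : ℝ, t0 < w → w < T0 → ∀ᶠ s in 𝓝 (0 : ℝ), t0 < w + s * α ∧ w + s * α < T0 :=
      fun w α h h' => ((hlin w α 0).continuousAt.eventually (lt_mem_nhds (by simpa using h))).and
        ((hlin w α 0).continuousAt.eventually (gt_mem_nhds (by simpa using h')))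
    filter_upwards [c1, cl t1 (-1) h1 h1', cl t2 1 h2 h2'] with s k1 k2 k3
    have := hmax (x + s • e) (t1 + s * (-1)) (t2 + s * 1) k1.le k2.1.le k2.2.le k3.1.le k3.2.le
    simp only [pogG, chord] at this
    have a1 : x + s • e + (t1 + s * (-1)) • e = x + t1 • e := by module
    have a2 : x + s • e - (t2 + s * 1) • e = x - t2 • e := by module
    have a3 : t1 + s * (-1) + (t2 + s * 1) = t1 + t2 := by ring
    rw [a1, a2, a3] at this; convert this using 3
    · ring_nf
    all_goals simp

lemma pog_var_outer (hv : ContDiff ℝ 2 v) (hvp : ContDiff ℝ 2 vp) (hP : ContDiff ℝ 2 P) (hb : 0 < b)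
    (ht0 : 0 < t0) (h1 : t0 < t1) (h1' : t1 < T0) (h2 : t0 < t2) (h2' : t2 < T0)
    (hr : 0 < 1 / 2 - v x) (hD : 0 < chord v vp e x t1 t2)
    (hmax : ∀ x' s1 s2, v x' ≤ 1 / 2 → t0 ≤ s1 → s1 ≤ T0 → t0 ≤ s2 → s2 ≤ T0 →
      pogG v vp P b e x' s1 s2 ≤ pogG v vp P b e x t1 t2) (ξ : Eu n) (c : ℝ) :
    (t2 / (t1 + t2) * Qf (hess vp (x + t1 • e)) (ξ + (t1 * c) • e) +
      t1 / (t1 + t2) * Qf (hess vp (x - t2 • e)) (ξ - (t2 * c) • e) - Qf (hess v x) ξ) /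
        chord v vp e x t1 t2 - (c * (t1 / (t1 + b)) + c * (t2 / (t2 + b)) +
      (n * (fderiv ℝ v x ξ / (1 / 2 - v x)) - fderiv ℝ P x ξ)) ^ 2 + (c * (t1 / (t1 + b))) ^ 2 +
      (c * (t2 / (t2 + b))) ^ 2 - n * (Qf (hess v x) ξ / (1 / 2 - v x) +
      (fderiv ℝ v x ξ / (1 / 2 - v x)) ^ 2) + Qf (hess P x) ξ ≤ 0 := by
  have hlin : ∀ w α s : ℝ, HasDerivAt (fun s => w + s * α) α s := fun w α s => by
    simpa using ((hasDerivAt_id s).mul_const α).const_add w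
  have ht : t1 + t2 ≠ 0 := by linarith
  set y := x + t1 • e with hy; set z := x - t2 • e with hz; set η := ξ + (t1 * c) • e with hη
  set ζ := ξ - (t2 * c) • e with hζ
  have e0 : t2 / (t1 + t2) * vp y + t1 / (t1 + t2) * vp z - v x = chord v vp e x t1 t2 := by
    simp only [chord]; rw [← hy, ← hz]; field_simp
  have key := log_max_test (m := n) (w1 := t1 + b) (w2 := t2 + b) (α1 := t1 * c) (α2 := t2 * c)
    (D := fun s => t2 / (t1 + t2) * vp (y + s • η) + t1 / (t1 + t2) * vp (z + s • ζ)
      - v (x + s • ξ))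
    (D' := fun s => t2 / (t1 + t2) * fderiv ℝ vp (y + s • η) η +
      t1 / (t1 + t2) * fderiv ℝ vp (z + s • ζ) ζ - fderiv ℝ v (x + s • ξ) ξ)
    (D2 := t2 / (t1 + t2) * Bf (hess vp (y + (0 : ℝ) • η)) η η +
      t1 / (t1 + t2) * Bf (hess vp (z + (0 : ℝ) • ζ)) ζ ζ - Bf (hess v (x + (0 : ℝ) • ξ)) ξ ξ)
    (r := fun s => 1 / 2 - v (x + s • ξ)) (r' := fun s => - fderiv ℝ v (x + s • ξ) ξ)
    (r2 := - Bf (hess v (x + (0 : ℝ) • ξ)) ξ ξ)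
    (P := fun s => P (x + s • ξ)) (P' := fun s => fderiv ℝ P (x + s • ξ) ξ)
    (P₂ := Bf (hess P (x + (0 : ℝ) • ξ)) ξ ξ)
    (fun s => (((hasDerivAt_line hvp y η s).const_mul _).add
      ((hasDerivAt_line hvp z ζ s).const_mul _)).sub (hasDerivAt_line hv x ξ s))
    ((((hasDerivAt_line2 hvp y η η 0).const_mul _).add
      ((hasDerivAt_line2 hvp z ζ ζ 0).const_mul _)).sub (hasDerivAt_line2 hv x ξ ξ 0))
    (fun s => (hasDerivAt_line hv x ξ s).const_sub _) (hasDerivAt_line2 hv x ξ ξ 0).neg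
    (hasDerivAt_line hP x ξ) (hasDerivAt_line2 hP x ξ ξ 0)
    (by simpa [e0] using hD) (by simpa using hr) (by linarith) (by linarith) ?_
  · simp only [zero_smul, add_zero, ← Qf_eq_Bf, e0] at key
    refine le_trans (le_of_eq ?_) key; ring
  · have c1 : ∀ᶠ s in 𝓝 (0 : ℝ), v (x + s • ξ) < 1 / 2 :=
      (hasDerivAt_line hv x ξ 0).continuousAt.eventually (gt_mem_nhds (by simpa using hr))
    have cl : ∀ w α : ℝ, t0 < w → w < T0 → ∀ᶠ s in 𝓝 (0 : ℝ), t0 < w + s * α ∧ w + s * α < T0 :=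
      fun w α h h' => ((hlin w α 0).continuousAt.eventually (lt_mem_nhds (by simpa using h))).and
        ((hlin w α 0).continuousAt.eventually (gt_mem_nhds (by simpa using h')))
    filter_upwards [c1, cl t1 (t1 * c) h1 h1', cl t2 (t2 * c) h2 h2'] with s k1 k2 k3
    have := hmax (x + s • ξ) (t1 + s * (t1 * c)) (t2 + s * (t2 * c)) k1.le k2.1.le k2.2.le k3.1.le
      k3.2.le
    have a1 : x + s • ξ + (t1 + s * (t1 * c)) • e = y + s • η := by rw [hy, hη]; module
    have a2 : x + s • ξ - (t2 + s * (t2 * c)) • e = z + s • ζ := by rw [hz, hζ]; module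
    have a3 : 1 + s * c ≠ 0 := by
      intro h; have : t1 + s * (t1 * c) = t1 * (1 + s * c) := by ring
      rw [this, h] at k2; linarith [k2.1]
    have e1 : chord v vp e (x + s • ξ) (t1 + s * (t1 * c)) (t2 + s * (t2 * c)) =
        t2 / (t1 + t2) * vp (y + s • η) + t1 / (t1 + t2) * vp (z + s • ζ) - v (x + s • ξ) := by
      simp only [chord]; rw [a1, a2]; have b1 : t1 + s * (t1 * c) = t1 * (1 + s * c) := by ring
      have b2 : t2 + s * (t2 * c) = t2 * (1 + s * c) := by ring
      have b3 : t1 * (1 + s * c) + t2 * (1 + s * c) = (t1 + t2) * (1 + s * c) := by ring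
      rw [b1, b2, b3]; field_simp
    simp only [pogG, e1] at this; simp only [zero_smul, add_zero, e0]; convert this using 3; ring_nf

end

/-- A normalised section of a convex solution whose determinant is close to one away from the
origin. -/
structure NormSection (C T Lam ε : ℝ) (v : Eu n → ℝ) : Prop where
  ma : MAConvex v
  zero : v 0 = 0
  nonneg : ∀ x, 0 ≤ v x
  bdd : ∀ y, v y ≤ 1 → ‖y‖ ≤ C
  sep : ∀ x w, v x ≤ 1 / 2 → ‖w‖ ≤ T → v (x + w) ≤ 1
  le : ∀ x, dhess v x ≤ Lam
  near : ∀ x, ε ≤ ‖x‖ → ‖x‖ ≤ C → |dhess v x - 1| ≤ ε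

/-- The correction of `v` which compensates the lack of control of the determinant at the origin. -/
def vcorr (C ε : ℝ) (v : Eu n → ℝ) (x : Eu n) : ℝ :=
  v x + (3 * ε) * psi ε x + (⟪(0 : Eu n), x⟫ + -(3 * ε * (C + 1)))

/-- The weight in the finite difference Pogorelov estimate. -/
def pogW (κ K ε : ℝ) (x : Eu n) : ℝ := κ * (1 / 2 * Qf 1 x) + K * psi ε x

section
variable {C T Lam ε κ K : ℝ} {v : Eu n → ℝ}

lemma contDiff_pogW (hε : 0 < ε) : ContDiff ℝ 2 (pogW (n := n) κ K ε) :=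
  (contDiff_const.mul (contDiff_const.mul (contDiff_Qf 1))).add (contDiff_const.mul (contDiff_psi hε))

lemma Qf_hess_pogW (hε : 0 < ε) (x ξ : Eu n) :
    Qf (hess (pogW κ K ε) x) ξ = κ * ‖ξ‖ ^ 2 + K * Qf (hess (psi ε) x) ξ := by
  have h1 : ContDiff ℝ 2 fun y : Eu n => 1 / 2 * Qf 1 y := contDiff_const.mul (contDiff_Qf 1)
  have := hess_add (contDiff_const (c := κ).mul h1) (contDiff_const (c := K).mul (contDiff_psi hε)) x
  rw [show pogW κ K ε = fun y : Eu n => κ * (1 / 2 * Qf 1 y) + K * psi ε y from rfl, this,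
    hess_const_mul h1, hess_const_mul (contDiff_psi hε), hess_half_Qf 1 isHermitian_one,
    Qf_add_matrix, Qf_smul_matrix, Qf_smul_matrix, Qf_one]

lemma abs_fderiv_pogW_le (hε : 0 < ε) (hκ : 0 ≤ κ) (hK : 0 ≤ K) (x ξ : Eu n) :
    |fderiv ℝ (pogW κ K ε) x ξ| ≤ (κ * ‖x‖ + K) * ‖ξ‖ := by
  have h1 := hasDerivAt_line (contDiff_pogW (κ := κ) (K := K) hε) x ξ 0
  have h2 : HasDerivAt (fun s : ℝ => pogW κ K ε (x + s • ξ))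
      (κ * (1 / 2 * (2 * ⟪x + (0 : ℝ) • ξ, ξ⟫)) + K * (⟪x + (0 : ℝ) • ξ, ξ⟫ / psi ε (x + (0 : ℝ) • ξ))) 0 := by
    have h3 : HasDerivAt (fun s : ℝ => Qf 1 (x + s • ξ)) (2 * ⟪x + (0 : ℝ) • ξ, ξ⟫) 0 := by
      simp only [Qf_one]; exact (hasDerivAt_add_smul x ξ 0).norm_sq
    exact ((h3.const_mul _).const_mul _).add ((hasDerivAt_psi_line hε x ξ 0).const_mul K)
  have h4 := h1.unique h2; simp only [zero_smul, add_zero] at h4; rw [h4, ← fderiv_psi hε]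
  have h5 := abs_fderiv_psi_le hε x ξ; have h6 := abs_real_inner_le_norm x ξ
  calc _ ≤ |κ * (1 / 2 * (2 * ⟪x, ξ⟫))| + |K * fderiv ℝ (psi ε) x ξ| := abs_add_le _ _
    _ = κ * |⟪x, ξ⟫| + K * |fderiv ℝ (psi ε) x ξ| := by
        rw [abs_mul κ, abs_mul K, abs_of_nonneg hκ, abs_of_nonneg hK]; congr 3; ring
    _ ≤ κ * (‖x‖ * ‖ξ‖) + K * ‖ξ‖ := by gcongr
    _ = _ := by ring

lemma pogW_nonneg (hε : 0 < ε) (hκ : 0 ≤ κ) (hK : 0 ≤ K) (x : Eu n) : 0 ≤ pogW κ K ε x := by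
  have := psi_pos hε x; rw [pogW, Qf_one]; positivity

lemma contDiff_vcorr (hε : 0 < ε) (hv : ContDiff ℝ 2 v) : ContDiff ℝ 2 (vcorr C ε v) :=
  (hv.add (contDiff_const.mul (contDiff_psi hε))).add (contDiff_affine _ _)

lemma convexOn_vcorr (hε : 0 < ε) (hv : ConvexOn ℝ Set.univ v) :
    ConvexOn ℝ Set.univ (vcorr C ε v) := by
  have h1 := (hv.add ((convexOn_psi (n := n) hε).smul (show 0 ≤ 3 * ε by positivity))).add_const
    (-(3 * ε * (C + 1)))
  refine h1.congr fun x _ => ?_; simp [vcorr]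

lemma Qf_hess_vcorr (hε : 0 < ε) (hv : ContDiff ℝ 2 v) (x ξ : Eu n) :
    Qf (hess (vcorr C ε v) x) ξ = Qf (hess v x) ξ + 3 * ε * Qf (hess (psi ε) x) ξ := by
  have h1 : ContDiff ℝ 2 fun y : Eu n => 3 * ε * psi ε y := contDiff_const.mul (contDiff_psi hε)
  have := hess_add (hv.add h1) (contDiff_affine (0 : Eu n) (-(3 * ε * (C + 1)))) x
  rw [show vcorr C ε v = fun y : Eu n => (v y + 3 * ε * psi ε y) +
    (⟪(0 : Eu n), y⟫ + -(3 * ε * (C + 1))) from rfl, this, hess_add hv h1,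
    hess_const_mul (contDiff_psi hε), hess_affine, add_zero, Qf_add_matrix, Qf_smul_matrix]

lemma vcorr_le (hε : 0 < ε) (hε1 : ε ≤ 1) {x : Eu n} (hx : ‖x‖ ≤ C) : vcorr C ε v x ≤ v x := by
  have := psi_le hε x; simp only [vcorr, inner_zero_left]; nlinarith

lemma le_vcorr (hε : 0 < ε) (x : Eu n) : v x - 3 * ε * (C + 1) ≤ vcorr C ε v x := by
  have := psi_pos hε x; simp only [vcorr, inner_zero_left]; nlinarith

lemma NormSection.posSemidef_vcorr (h : NormSection C T Lam ε v) (hε : 0 < ε) (x : Eu n) :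
    (hess (vcorr C ε v) x).PosSemidef :=
  hess_posSemidef (contDiff_vcorr hε h.ma.smooth) (convexOn_vcorr hε h.ma.convex) x

lemma NormSection.le_det_vcorr [NeZero n] (h : NormSection C T Lam ε v) (hε : 0 < ε) {x : Eu n}
    (hx : v x ≤ 1) : 1 - ε ≤ (hess (vcorr C ε v) x).det := by
  have hH := hess_isHermitian (contDiff_vcorr (C := C) hε h.ma.smooth) x
  have hQ := Qf_hess_vcorr (C := C) hε h.ma.smooth x; have hpd := h.ma.posDef x
  have hpq := (posDef_iff_Qf hpd.1).1 hpd; have hPD : (hess (vcorr C ε v) x).PosDef := by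
    refine (posDef_iff_Qf hH).2 fun ξ hξ => ?_; rw [hQ]; have := hpq ξ hξ
    have := Qf_hess_psi_nonneg hε x ξ; positivity
  rcases le_total ‖x‖ ε with hb | hb
  · have := det_mono (PosSemidef.one (n := Fin n) (R := ℝ)) hPD fun ξ => by
      rw [Qf_one, hQ]; have h1 : 0 ≤ Qf (hess v x) ξ := (posSemidef_iff_Qf hpd.1).1 hpd.posSemidef ξ
      have h2 := Qf_hess_psi_ge_near hε hb ξ
      have h3 : 3 * ε * (‖ξ‖ ^ 2 / (3 * ε)) = ‖ξ‖ ^ 2 := by field_simp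
      nlinarith
    rw [det_one] at this; linarith
  · have := det_mono hpd.posSemidef hPD fun ξ => by
      rw [hQ]; have := Qf_hess_psi_nonneg hε x ξ; nlinarith
    have h1 := (abs_le.1 (h.near x hb (h.bdd x hx))).1; rw [dhess] at h1; linarith

lemma NormSection.sub_le_div (h : NormSection C T Lam ε v) {x w : Eu n} (hx : v x ≤ 1 / 2)
    {t : ℝ} (ht : 0 ≤ t) (htT : t ≤ T) (hT : 0 < T) (hw : ‖w‖ ≤ 1) :
    v (x + t • w) - v x ≤ t / T := by
  have h1 := h.sep x (T • w) hx (by rw [norm_smul_of_nonneg hT.le]; nlinarith)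
  have hs : t / T ≤ 1 := (div_le_one hT).2 htT
  have h2 := h.ma.convex.2 (Set.mem_univ x) (Set.mem_univ (x + T • w)) (sub_nonneg.2 hs)
    (div_nonneg ht hT.le) (by ring)
  have h3 : (1 - t / T) • x + (t / T) • (x + T • w) = x + t • w := by
    have : t • w = (t / T * T) • w := by rw [div_mul_cancel₀ _ hT.ne']
    rw [this]; module
  rw [h3, smul_eq_mul, smul_eq_mul] at h2; have h4 := h.nonneg x
  have h5 : 0 ≤ t / T := by positivity
  nlinarith

lemma NormSection.fderiv_le (h : NormSection C T Lam ε v) {x : Eu n} (hx : v x ≤ 1 / 2)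
    (hT : 0 < T) (ξ : Eu n) : |fderiv ℝ v x ξ| ≤ ‖ξ‖ / T := by
  have key : ∀ ξ : Eu n, fderiv ℝ v x ξ ≤ ‖ξ‖ / T := by
    intro ξ
    rcases eq_or_ne ξ 0 with rfl | hξ
    · simp
    have hn : 0 < ‖ξ‖ := norm_pos_iff.2 hξ; have h1 := h.sep x ((T / ‖ξ‖) • ξ) hx (by
      rw [norm_smul_of_nonneg (by positivity), div_mul_cancel₀ _ hn.ne'])
    have h2 := convex_tangent h.ma.smooth h.ma.convex x (x + (T / ‖ξ‖) • ξ)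
    rw [add_sub_cancel_left, map_smul, smul_eq_mul] at h2; have h3 := h.nonneg x
    have h4 : T / ‖ξ‖ * fderiv ℝ v x ξ ≤ 1 := by linarith
    rw [le_div_iff₀ hT]; rw [div_mul_eq_mul_div, div_le_one hn] at h4; linarith
  refine abs_le.2 ⟨?_, key ξ⟩; have := key (-ξ); rw [map_neg, norm_neg] at this; linarith

lemma chord_neg (v vp : Eu n → ℝ) (e x : Eu n) (s t : ℝ) :
    chord v vp (-e) x s t = chord v vp e x t s := by
  simp only [chord, smul_neg, sub_neg_eq_add, ← sub_eq_add_neg, add_comm s t]; ring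

lemma pogG_neg (v vp P : Eu n → ℝ) (b : ℝ) (e x : Eu n) (s t : ℝ) :
    pogG v vp P b (-e) x s t = pogG v vp P b e x t s := by
  simp only [pogG, chord_neg, mul_comm (s + b)]

lemma exists_pogG_lt {v vp P : Eu n → ℝ} {e x : Eu n} {t0 T0 t : ℝ}
    (hvp : ConvexOn ℝ Set.univ vp) (hx : vp x ≤ v x) (ht0 : 0 < t0) (hT : t0 < T0) (ht : t0 ≤ t)
    (hD : 0 < chord v vp e x t0 t) (hr : 0 < 1 / 2 - v x) :
    ∃ s, t0 ≤ s ∧ s ≤ T0 ∧ pogG v vp P (2 * t0) e x t0 t < pogG v vp P (2 * t0) e x s t := by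
  set s := min T0 (3 / 2 * t0); have hs1 : t0 < s := lt_min hT (by linarith)
  have hs2 : s ≤ 3 / 2 * t0 := min_le_right _ _; refine ⟨s, hs1.le, min_le_left _ _, ?_⟩
  have hs0 : 0 < s := by linarith
  have ht' : 0 < t := by linarith
  rw [pogG, pogG]; have hq : 0 < (1 / 2 - v x) ^ n := pow_pos hr n; have he := exp_pos (P x)
  refine mul_lt_mul_of_pos_right (mul_lt_mul_of_pos_right ?_ hq) he
  have h1 : t0 / s ≤ 1 := (div_le_one hs0).2 hs1.le
  have h2 := hvp.2 (Set.mem_univ x) (Set.mem_univ (x + s • e)) (sub_nonneg.2 h1)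
    (div_nonneg ht0.le hs0.le) (by ring)
  have h3 : (1 - t0 / s) • x + (t0 / s) • (x + s • e) = x + t0 • e := by
    have : t0 • e = (t0 / s * s) • e := by rw [div_mul_cancel₀ _ hs0.ne']
    rw [this]; module
  rw [h3, smul_eq_mul, smul_eq_mul] at h2; set B := vp (x - t • e) - v x with hB
  have h4 : vp (x + t0 • e) - v x ≤ t0 / s * (vp (x + s • e) - v x) := by nlinarith
  set S := vp (x + s • e) - v x with hS
  have c1 : chord v vp e x t0 t = (t * (vp (x + t0 • e) - v x) + t0 * B) / (t0 + t) := by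
    rw [chord, hB]; field_simp; ring
  have c2 : chord v vp e x s t = (t * S + s * B) / (s + t) := by
    rw [chord, hB, hS]; field_simp; ring
  set E := t * (vp (x + t0 • e) - v x) + t0 * B with hE; have hE0 : 0 < E := by
    rw [c1] at hD; exact (div_pos_iff_of_pos_right (by linarith)).1 hD
  have h5 : s / t0 * E ≤ t * S + s * B := by
    have h6 : E ≤ t0 / s * (t * S + s * B) := by
      have : t0 / s * (t * S + s * B) = t * (t0 / s * S) + t0 * B := by field_simp
      rw [this, hE]; gcongr
    calc s / t0 * E ≤ s / t0 * (t0 / s * (t * S + s * B)) := by gcongr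
      _ = _ := by field_simp
  calc chord v vp e x t0 t / ((t0 + 2 * t0) * (t + 2 * t0))
      = E / ((t0 + t) * (t0 + 2 * t0) * (t + 2 * t0)) := by rw [c1]; field_simp
    _ < (s / t0 * E) / ((s + t) * (s + 2 * t0) * (t + 2 * t0)) := by
        rw [div_lt_div_iff₀ (by positivity) (by positivity)]
        have : (s + t) * (s + 2 * t0) < s / t0 * ((t0 + t) * (t0 + 2 * t0)) := by
          rw [div_mul_eq_mul_div, lt_div_iff₀ ht0]
          nlinarith [mul_pos (sub_pos.2 hs1) (show 0 < 2 * t * t0 - t0 * s by nlinarith)]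
        calc E * ((s + t) * (s + 2 * t0) * (t + 2 * t0))
            < E * (s / t0 * ((t0 + t) * (t0 + 2 * t0)) * (t + 2 * t0)) := by gcongr
          _ = _ := by ring
    _ ≤ (t * S + s * B) / ((s + t) * (s + 2 * t0) * (t + 2 * t0)) := by gcongr
    _ = _ := by rw [c2]; field_simp

lemma le_of_var_inner {m μ D w1 w2 r g p P₂ : ℝ} (hm : 0 ≤ m) (hD : 0 < D) (h1 : 0 < w1) (h2 : 0 < w2)
    (hr : 0 < r) (hP : 0 ≤ P₂)
    (h : -μ / D - (-1 / w1 + 1 / w2 + m * (g / r) - p) ^ 2 + (-1 / w1) ^ 2 + (1 / w2) ^ 2 -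
      m * (μ / r + (g / r) ^ 2) + P₂ ≤ 0)
    (k1 : |m * (g / r) - p| * |w1 - w2| ≤ 1 / 8) (k2 : w1 * w2 * (m * (g / r) - p) ^ 2 ≤ 1 / 16)
    (k3 : w1 * w2 * (m * (g / r) ^ 2) ≤ 1 / 16) (k4 : m * D / r ≤ 1 / 4) : D / (w1 * w2) ≤ μ := by
  set q := m * (g / r) - p with hq; have hω : 0 < w1 * w2 := by positivity
  have h3 : 2 / (w1 * w2) - 2 * q * (w1 - w2) / (w1 * w2) - q ^ 2 - m * (g / r) ^ 2 ≤
      μ / D * (1 + m * D / r) := by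
    have e1 : (-1 / w1 + 1 / w2 + m * (g / r) - p) ^ 2 = (-1 / w1) ^ 2 + (1 / w2) ^ 2 -
        2 / (w1 * w2) + 2 * q * (w1 - w2) / (w1 * w2) + q ^ 2 := by
      rw [show -1 / w1 + 1 / w2 + m * (g / r) - p = -1 / w1 + 1 / w2 + q by rw [hq]; ring]
      field_simp; ring
    have e2 : μ / D * (1 + m * D / r) = μ / D + m * (μ / r) := by field_simp
    rw [e2]; rw [e1] at h; have e3 : -μ / D = -(μ / D) := by ring
    rw [e3] at h; linarith
  have h4 : (3 : ℝ) / 2 ≤ (w1 * w2) * (μ / D * (1 + m * D / r)) := by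
    refine le_trans ?_ (mul_le_mul_of_nonneg_left h3 hω.le)
    have e4 : w1 * w2 * (2 / (w1 * w2) - 2 * q * (w1 - w2) / (w1 * w2) - q ^ 2 - m * (g / r) ^ 2) =
      2 - 2 * (q * (w1 - w2)) - w1 * w2 * q ^ 2 - w1 * w2 * (m * (g / r) ^ 2) := by field_simp
    have := le_abs_self (q * (w1 - w2)); rw [abs_mul] at this; rw [e4]; linarith
  have h5 : 0 ≤ m * D / r := by positivity
  have hμ : 0 < μ := by
    by_contra hcon
    push Not at hcon
    have : (w1 * w2) * (μ / D * (1 + m * D / r)) ≤ 0 := mul_nonpos_of_nonneg_of_nonpos hω.le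
        (mul_nonpos_of_nonpos_of_nonneg (div_nonpos_of_nonpos_of_nonneg hcon hD.le) (by linarith))
    linarith
  rw [div_le_iff₀ hω]
  have h6 : (w1 * w2) * (μ / D * (1 + m * D / r)) ≤ (w1 * w2) * (μ / D * (5 / 4)) := by
    gcongr; linarith
  have h7 : (w1 * w2) * (μ / D * (5 / 4)) * D = 5 / 4 * (μ * (w1 * w2)) := by field_simp
  have h8 : 3 / 2 * D ≤ (w1 * w2) * (μ / D * (5 / 4)) * D := by gcongr; linarith
  linarith

lemma le_of_var_outer {m X h a1 a2 r g p P₂ : ℝ} (hm : 2 ≤ m) (h1 : 0 < a1) (h2 : 0 < a2)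
    (hX : X - ((-(m * (g / r) - p) * (a1 + a2) / (2 * a1 * a2)) * a1 +
      (-(m * (g / r) - p) * (a1 + a2) / (2 * a1 * a2)) * a2 + (m * (g / r) - p)) ^ 2 +
      ((-(m * (g / r) - p) * (a1 + a2) / (2 * a1 * a2)) * a1) ^ 2 +
      ((-(m * (g / r) - p) * (a1 + a2) / (2 * a1 * a2)) * a2) ^ 2 - m * (h / r + (g / r) ^ 2) + P₂
        ≤ 0) :
    X - m * (h / r) + P₂ - p ^ 2 ≤ 0 := by
  set G := g / r; set q := m * G - p with hq; have e1 : -((-q * (a1 + a2) / (2 * a1 * a2)) * a1 +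
      (-q * (a1 + a2) / (2 * a1 * a2)) * a2 + q) ^ 2 +
      ((-q * (a1 + a2) / (2 * a1 * a2)) * a1) ^ 2 +
      ((-q * (a1 + a2) / (2 * a1 * a2)) * a2) ^ 2 = q ^ 2 + q ^ 2 * ((a1 - a2) ^ 2 / (2 * a1 * a2)) := by
    field_simp; ring
  have h3 : 0 ≤ q ^ 2 * ((a1 - a2) ^ 2 / (2 * a1 * a2)) := by positivity
  have h4 : m * G ^ 2 - p ^ 2 ≤ q ^ 2 := by
    rw [hq]
    nlinarith [sq_nonneg (m * G - 2 * p), mul_nonneg (show 0 ≤ m * (m - 2) by nlinarith) (sq_nonneg G)]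
  linarith
end

section
variable {C T Lam ε : ℝ} {x e : Eu n} {t1 t2 : ℝ}

lemma NormSection.chord_le (h : NormSection C T Lam ε v) (hε : 0 < ε) (hε1 : ε ≤ 1) (hT : 0 < T)
    (hx : v x ≤ 1 / 2) (he : ‖e‖ = 1) (h1 : 0 < t1) (h2 : 0 < t2) (h1' : t1 ≤ T) (h2' : t2 ≤ T) :
    chord v (vcorr C ε v) e x t1 t2 ≤ 2 * (t1 * t2) / ((t1 + t2) * T) := by
  have key : ∀ w : Eu n, ‖w‖ = 1 → ∀ t, 0 < t → t ≤ T → vcorr C ε v (x + t • w) - v x ≤ t / T := by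
    intro w hw t ht ht'
    have h3 := h.bdd _ (h.sep x (t • w) hx (by rw [norm_smul, hw, norm_of_nonneg ht.le]; linarith))
    have h4 := vcorr_le (v := v) hε hε1 h3; have h5 := h.sub_le_div hx ht.le ht' hT hw.le; linarith
  have k1 := key e he t1 h1 h1'; have k2 := key (-e) (by rwa [norm_neg]) t2 h2 h2'
  rw [smul_neg, ← sub_eq_add_neg] at k2
  have e1 : chord v (vcorr C ε v) e x t1 t2 = (t2 * (vcorr C ε v (x + t1 • e) - v x) +
      t1 * (vcorr C ε v (x - t2 • e) - v x)) / (t1 + t2) := by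
    rw [chord]; field_simp; ring
  rw [e1]
  calc _ ≤ (t2 * (t1 / T) + t1 * (t2 / T)) / (t1 + t2) := by gcongr
    _ = _ := by field_simp; ring

set_option maxHeartbeats 2000000 in
lemma NormSection.quot_le_Qf (hn : 2 ≤ n) (h : NormSection C T Lam ε v) (hC : 1 ≤ C)
    (hT : 0 < T) (hT1 : T ≤ 1) (hε : 0 < ε) (hε1 : ε ≤ 1) {κ K t0 c : ℝ} (hκ : κ = 1 / (16 * C ^ 2))
    (hK0 : 0 ≤ K) (hK : K ≤ 1 / (16 * C)) (he : ‖e‖ = 1) (ht0 : 0 < t0) (h1 : t0 < t1) (h2 : t0 < t2)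
    (hr : 0 < 1 / 2 - v x) (hD : 0 < chord v (vcorr C ε v) e x t1 t2)
    (hmax : ∀ x' s1 s2, v x' ≤ 1 / 2 → t0 ≤ s1 → s1 ≤ T → t0 ≤ s2 → s2 ≤ T →
      pogG v (vcorr C ε v) (pogW κ K ε) (2 * t0) e x' s1 s2 ≤
        pogG v (vcorr C ε v) (pogW κ K ε) (2 * t0) e x t1 t2)
    (hc1 : c * (n / T + 1) ≤ 1 / 8) (hc2 : n * c ≤ T / 2) (hsum : t1 + t2 ≤ c * (1 / 2 - v x)) :
    chord v (vcorr C ε v) e x t1 t2 / ((t1 + 2 * t0) * (t2 + 2 * t0)) ≤ Qf (hess v x) e := by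
  have hn' : (2 : ℝ) ≤ n := by exact_mod_cast hn
  have hx : v x ≤ 1 / 2 := by linarith
  have hr1 : 1 / 2 - v x ≤ 1 := by linarith [h.nonneg x]
  have hxC : ‖x‖ ≤ C := h.bdd x (by linarith); have hκ0 : 0 < κ := by rw [hκ]; positivity
  have hc0 : 0 < c := pos_of_mul_pos_left (lt_of_lt_of_le (by linarith) hsum) hr.le
  have hcT : 2 * c ≤ n * c := by gcongr
  have hcr : c * (1 / 2 - v x) ≤ c := mul_le_of_le_one_right hc0.le hr1
  have h1' : t1 < T := by linarith
  have h2' : t2 < T := by linarith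
  have key := pog_var_inner h.ma.smooth (contDiff_pogW hε) (by linarith) ht0 h1 h1' h2 h2' hr hD hmax
  have hg := h.fderiv_le hx hT e; have hp := abs_fderiv_pogW_le hε hκ0.le hK0 x e
  have hDle := h.chord_le hε hε1 hT hx he (by linarith) (by linarith) h1'.le h2'.le
  rw [he] at hg hp; have hP2 : 0 ≤ Qf (hess (pogW κ K ε) x) e := by
    rw [Qf_hess_pogW hε]; have := Qf_hess_psi_nonneg hε x e; positivity
  set r := 1 / 2 - v x; set g := fderiv ℝ v x e; set p := fderiv ℝ (pogW κ K ε) x e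
  set Q : ℝ := n / T + 1 with hQ; have hQ0 : 0 < Q := by positivity
  have hp1 : |p| ≤ 1 := by
    have h3 : κ * ‖x‖ ≤ 1 / 16 := by
      calc κ * ‖x‖ ≤ κ * C := by gcongr
        _ = 1 / (16 * C) := by rw [hκ]; field_simp
        _ ≤ 1 / (16 * 1) := by gcongr
        _ = 1 / 16 := by norm_num
    have h4 : K ≤ 1 / 16 := by
      refine hK.trans ?_
      calc 1 / (16 * C) ≤ 1 / (16 * 1) := by gcongr
        _ = 1 / 16 := by norm_num
    linarith
  have hgr : |g / r| ≤ 1 / T / r := by rw [abs_div, abs_of_pos hr]; gcongr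
  have hq : |n * (g / r) - p| ≤ Q / r := by
    have h3 : (1 : ℝ) ≤ 1 / r := by rw [le_div_iff₀ hr]; linarith
    calc |n * (g / r) - p| ≤ |n * (g / r)| + |p| := abs_sub _ _
      _ ≤ n * (1 / T / r) + 1 / r := by
          rw [abs_mul, abs_of_nonneg (by positivity : (0 : ℝ) ≤ n)]; gcongr; linarith
      _ = Q / r := by rw [hQ]; field_simp
  have hω : (t1 + 2 * t0) * (t2 + 2 * t0) ≤ 9 / 4 * (c * r) ^ 2 := by
    have h3 : (t1 + 2 * t0) * (t2 + 2 * t0) ≤ (3 * t1) * (3 * t2) := by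
      have := ht0.le; gcongr <;> linarith
    have h4 : (t1 + t2) ^ 2 ≤ (c * r) ^ 2 := pow_le_pow_left₀ (by linarith) hsum 2
    have h5 := sq_nonneg (t1 - t2); linarith
  have hω0 : 0 < (t1 + 2 * t0) * (t2 + 2 * t0) := by exact mul_pos (by linarith) (by linarith)
  have hcQ : (c * Q) ^ 2 ≤ 1 / 64 := by
    have : (c * Q) ^ 2 ≤ (1 / 8) ^ 2 := pow_le_pow_left₀ (by positivity) hc1 2; linarith
  have hq2 : (n * (g / r) - p) ^ 2 ≤ (Q / r) ^ 2 := by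
    rw [← sq_abs]; exact pow_le_pow_left₀ (abs_nonneg _) hq 2
  have hn2 : n * (g / r) ^ 2 ≤ (Q / r) ^ 2 := by
    have h3 : (g / r) ^ 2 ≤ (1 / T / r) ^ 2 := by
      rw [← sq_abs]; exact pow_le_pow_left₀ (abs_nonneg _) hgr 2
    have h4 : n * (1 / T) ^ 2 ≤ Q ^ 2 := by
      have h5 : n * (1 / T) ^ 2 ≤ (n * (1 / T)) ^ 2 := by
        rw [mul_pow]; gcongr; exact le_self_pow₀ (by linarith) two_ne_zero
      have h6 : (n * (1 / T)) ^ 2 ≤ Q ^ 2 := by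
        refine pow_le_pow_left₀ (by positivity) ?_ 2; rw [hQ, mul_one_div]; linarith
      linarith
    calc n * (g / r) ^ 2 ≤ n * (1 / T / r) ^ 2 := by gcongr
      _ = n * (1 / T) ^ 2 / r ^ 2 := by field_simp
      _ ≤ Q ^ 2 / r ^ 2 := by gcongr
      _ = _ := by rw [div_pow]
  have hbig : (t1 + 2 * t0) * (t2 + 2 * t0) * (Q / r) ^ 2 ≤ 1 / 16 := by
    calc _ ≤ 9 / 4 * (c * r) ^ 2 * (Q / r) ^ 2 := by gcongr
      _ = 9 / 4 * (c * Q) ^ 2 := by field_simp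
      _ ≤ _ := by linarith
  refine le_of_var_inner (by positivity) hD (by linarith) (by linarith) hr hP2 key ?_ ?_ ?_ ?_
  · have h3 : |t1 + 2 * t0 - (t2 + 2 * t0)| ≤ c * r := by rw [abs_le]; constructor <;> linarith
    calc _ ≤ Q / r * (c * r) := by gcongr
      _ = c * Q := by field_simp
      _ ≤ _ := hc1
  · exact (mul_le_mul_of_nonneg_left hq2 hω0.le).trans hbig
  · exact (mul_le_mul_of_nonneg_left hn2 hω0.le).trans hbig
  · have ht12 : 0 < t1 + t2 := by linarith
    have h3 : 2 * (t1 * t2) / ((t1 + t2) * T) ≤ c * r / (2 * T) := by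
      rw [div_le_div_iff₀ (by positivity) (by positivity)]
      have h4 : 2 * (t1 * t2) * 2 ≤ (t1 + t2) * (t1 + t2) := by linarith [sq_nonneg (t1 - t2)]
      have h5 : (t1 + t2) * (t1 + t2) ≤ c * r * (t1 + t2) := by gcongr
      calc 2 * (t1 * t2) * (2 * T) = 2 * (t1 * t2) * 2 * T := by ring
        _ ≤ c * r * (t1 + t2) * T := mul_le_mul_of_nonneg_right (h4.trans h5) hT.le
        _ = _ := by ring
    calc _ ≤ n * (c * r / (2 * T)) / r := by gcongr; linarith
      _ = n * c / (2 * T) := by field_simp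
      _ ≤ (T / 2) / (2 * T) := by gcongr
      _ = 1 / 4 := by field_simp; norm_num

set_option maxHeartbeats 2000000 in
lemma NormSection.sum_var (hn : 2 ≤ n) [NeZero n] (h : NormSection C T Lam ε v) (hC : 1 ≤ C)
    (hT : 0 < T) (hε : 0 < ε) {κ K t0 : ℝ} (hκ : κ = 1 / (16 * C ^ 2))
    (hK0 : 0 ≤ K) (hK : K ≤ 1 / (16 * C)) (ht0 : 0 < t0) (h1 : t0 < t1) (h2 : t0 < t2)
    (h1' : t1 < T) (h2' : t2 < T)
    (hr : 0 < 1 / 2 - v x) (hD : 0 < chord v (vcorr C ε v) e x t1 t2)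
    (hmax : ∀ x' s1 s2, v x' ≤ 1 / 2 → t0 ≤ s1 → s1 ≤ T → t0 ≤ s2 → s2 ≤ T →
      pogG v (vcorr C ε v) (pogW κ K ε) (2 * t0) e x' s1 s2 ≤
        pogG v (vcorr C ε v) (pogW κ K ε) (2 * t0) e x t1 t2)
    (hμr : 1 ≤ Qf (hess v x) e * (1 / 2 - v x)) (ξ : Fin n → Eu n) (hξ : ‖ξ 0‖ ^ 2 = (Qf (hess v x) e)⁻¹)
    (horth : ∀ k, Qf (hess v x) (ξ k) = 1) :
    ∃ c : Fin n → ℝ, c 0 = 0 ∧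
    (t2 / (t1 + t2) * (∑ k, Qf (hess (vcorr C ε v) (x + t1 • e)) (ξ k + (t1 * c k) • e)) +
      t1 / (t1 + t2) * (∑ k, Qf (hess (vcorr C ε v) (x - t2 • e)) (ξ k - (t2 * c k) • e)) - n) /
        chord v (vcorr C ε v) e x t1 t2 + κ / 2 * ∑ k, ‖ξ k‖ ^ 2 +
          K * ∑ k, Qf (hess (psi ε) x) (ξ k) ≤ (n ^ 2 + 3 * n ^ 2 / T ^ 2) / (1 / 2 - v x) := by
  have hn' : (2 : ℝ) ≤ n := by exact_mod_cast hn
  have hx : v x ≤ 1 / 2 := by linarith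
  have hxC : ‖x‖ ≤ C := h.bdd x (by linarith); have hκ0 : 0 < κ := by rw [hκ]; positivity
  set r := 1 / 2 - v x; set μ := Qf (hess v x) e; set D := chord v (vcorr C ε v) e x t1 t2
  set a1 := t1 / (t1 + 2 * t0); set a2 := t2 / (t2 + 2 * t0)
  have ha₁0 : 0 < a1 := div_pos (by linarith) (by linarith)
  have ha₂0 : 0 < a2 := div_pos (by linarith) (by linarith)
  have hp : ∀ ξ : Eu n, (fderiv ℝ (pogW κ K ε) x ξ) ^ 2 ≤ κ / 4 * ‖ξ‖ ^ 2 := by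
    intro ξ; have h3 := abs_fderiv_pogW_le hε hκ0.le hK0 x ξ
    have h4 : κ * ‖x‖ + K ≤ 1 / (8 * C) := by
      calc κ * ‖x‖ + K ≤ κ * C + 1 / (16 * C) := by gcongr
        _ = 1 / (8 * C) := by rw [hκ]; field_simp; norm_num
    calc _ = |fderiv ℝ (pogW κ K ε) x ξ| ^ 2 := (sq_abs _).symm
      _ ≤ ((1 / (8 * C)) * ‖ξ‖) ^ 2 := by
          refine pow_le_pow_left₀ (abs_nonneg _) (h3.trans ?_) 2; gcongr
      _ = _ := by rw [hκ, mul_pow]; congr 1; field_simp; norm_num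
  have key := pog_var_outer h.ma.smooth (contDiff_vcorr hε h.ma.smooth) (contDiff_pogW hε)
    (by linarith) ht0 h1 h1' h2 h2' hr hD hmax
  set q : Fin n → ℝ := fun k => n * (fderiv ℝ v x (ξ k) / r) - fderiv ℝ (pogW κ K ε) x (ξ k)
  set c : Fin n → ℝ := fun k => if k = 0 then 0 else -(q k) * (a1 + a2) / (2 * a1 * a2) with hc
  refine ⟨c, by simp [hc], ?_⟩
  set X : Fin n → ℝ := fun k => t2 / (t1 + t2) * Qf (hess (vcorr C ε v) (x + t1 • e)) (ξ k + (t1 * c k) • e)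
    + t1 / (t1 + t2) * Qf (hess (vcorr C ε v) (x - t2 • e)) (ξ k - (t2 * c k) • e) - 1 with hX
  have hk : ∀ k, X k / D + κ / 2 * ‖ξ k‖ ^ 2 + K * Qf (hess (psi ε) x) (ξ k) ≤
      n / r + if k = 0 then 3 * n ^ 2 / T ^ 2 / r else 0 := by
    intro k; have h3 := key (ξ k) (c k); have h4 := hp (ξ k); rw [Qf_hess_pogW hε, horth k] at h3
    by_cases hk0 : k = 0
    · subst hk0
      have hc0 : c 0 = 0 := by simp [hc]
      rw [if_pos rfl]
      have e1 : X 0 / D = (t2 / (t1 + t2) * Qf (hess (vcorr C ε v) (x + t1 • e)) (ξ 0 + (t1 * c 0) • e)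
        + t1 / (t1 + t2) * Qf (hess (vcorr C ε v) (x - t2 • e)) (ξ 0 - (t2 * c 0) • e) - 1) / D := rfl
      rw [← e1, hc0] at h3; have hg := h.fderiv_le hx hT (ξ 0); set g := fderiv ℝ v x (ξ 0)
      set p := fderiv ℝ (pogW κ K ε) x (ξ 0)
      have hμ0 : 0 < μ := pos_of_mul_pos_left (by linarith) hr.le
      have h5 : 3 * n ^ 2 * (g / r) ^ 2 ≤ 3 * n ^ 2 / T ^ 2 / r := by
        have h6 : g ^ 2 ≤ μ⁻¹ / T ^ 2 := by
          rw [← hξ, ← div_pow, ← sq_abs]; exact pow_le_pow_left₀ (abs_nonneg _) hg 2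
        have h7 : μ⁻¹ / r ≤ 1 := by rw [div_le_one hr, inv_le_iff_one_le_mul₀ hμ0]; linarith
        calc 3 * n ^ 2 * (g / r) ^ 2 = 3 * n ^ 2 * g ^ 2 / r ^ 2 := by ring
          _ ≤ 3 * n ^ 2 * (μ⁻¹ / T ^ 2) / r ^ 2 := by gcongr
          _ = 3 * n ^ 2 / T ^ 2 / r * (μ⁻¹ / r) := by ring
          _ ≤ 3 * n ^ 2 / T ^ 2 / r * 1 := by gcongr
          _ = _ := mul_one _
      have h8 : (n * (g / r) - p) ^ 2 ≤ 2 * n ^ 2 * (g / r) ^ 2 + 2 * p ^ 2 := by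
        linarith [sq_nonneg (n * (g / r) + p)]
      have h9 : n * (g / r) ^ 2 ≤ n ^ 2 * (g / r) ^ 2 := by
        gcongr; exact le_self_pow₀ (by linarith) two_ne_zero
      have h10 : (n : ℝ) * (1 / r + (g / r) ^ 2) = n / r + n * (g / r) ^ 2 := by ring
      simp only [zero_mul, add_zero, zero_add] at h3; rw [h10] at h3; linarith
    · rw [if_neg hk0, add_zero]
      have hck : c k = -(q k) * (a1 + a2) / (2 * a1 * a2) := by simp [hc, hk0]
      have e1 : X k / D = (t2 / (t1 + t2) * Qf (hess (vcorr C ε v) (x + t1 • e)) (ξ k + (t1 * c k) • e)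
        + t1 / (t1 + t2) * Qf (hess (vcorr C ε v) (x - t2 • e)) (ξ k - (t2 * c k) • e) - 1) / D := rfl
      rw [← e1, hck] at h3; have h5 := le_of_var_outer hn' ha₁0 ha₂0 h3
      have h6 : (n : ℝ) * (1 / r) = n / r := mul_one_div _ _
      have h7 : 0 ≤ κ * ‖ξ k‖ ^ 2 := by positivity
      rw [h6] at h5; linarith
  have hs := sum_le_sum fun k (_ : k ∈ Finset.univ) => hk k
  simp only [sum_add_distrib, sum_const, card_univ, card_fin, nsmul_eq_mul,
    Finset.sum_ite_eq', Finset.mem_univ, if_true, ← mul_sum, ← sum_div] at hs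
  have e2 : ∑ k, X k = t2 / (t1 + t2) * (∑ k, Qf (hess (vcorr C ε v) (x + t1 • e)) (ξ k + (t1 * c k) • e)) +
      t1 / (t1 + t2) * (∑ k, Qf (hess (vcorr C ε v) (x - t2 • e)) (ξ k - (t2 * c k) • e)) - n := by
    simp only [hX, sum_sub_distrib, sum_add_distrib, ← mul_sum]; simp
  rw [e2] at hs; refine hs.trans (le_of_eq ?_); field_simp
end

section
variable {C T Lam ε : ℝ} {x e : Eu n} {t1 t2 : ℝ}

lemma one_sub_le_rpow [NeZero n] {d G : ℝ} (hε : 0 < ε) (hε1 : ε ≤ 1 / 2) (hd : 0 < d)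
    (hd1 : d ≤ 1 + ε) (hG : 1 - ε ≤ G) : 1 - 2 * ε ≤ (G / d) ^ ((1 : ℝ) / n) := by
  have hn := one_le_n (n := n); have h1 : 1 - 2 * ε ≤ G / d := by rw [le_div_iff₀ hd]; nlinarith
  have h2 : (1 : ℝ) / n ≤ 1 := (div_le_one (by linarith)).2 hn
  calc 1 - 2 * ε ≤ (1 - 2 * ε) ^ ((1 : ℝ) / n) := by
        rcases eq_or_lt_of_le (show 0 ≤ 1 - 2 * ε by linarith) with h0 | h0
        · rw [← h0]; positivity
        · simpa using Real.rpow_le_rpow_of_exponent_ge h0 (by linarith) h2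
    _ ≤ _ := rpow_le_rpow (by linarith) h1 (by positivity)

set_option maxHeartbeats 2000000 in
lemma NormSection.pog_max_le (hn : 2 ≤ n) [NeZero n] (h : NormSection C T Lam ε v) (hC : 1 ≤ C)
    (hT : 0 < T) (hT1 : T ≤ 1) (hLam : 0 < Lam) (hε : 0 < ε) (hε1 : ε ≤ 1 / 2) {κ K t0 N1 : ℝ}
    (hκ : κ = 1 / (16 * C ^ 2)) (ht₀ : 0 < t0) (hKd : K = 3 * n / (2 * t0) ^ 2 * ε)
    (hK : K ≤ 1 / (16 * C)) (hεb : 2 * n * ε ≤ (2 * t0) ^ 2) (he : ‖e‖ = 1) (h1 : t0 < t1) (h2 : t0 < t2)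
    (h1' : t1 ≤ T) (h2' : t2 ≤ T) (hr : 0 < 1 / 2 - v x)
    (hmax : ∀ x' s₁ s₂, v x' ≤ 1 / 2 → t0 ≤ s₁ → s₁ ≤ T → t0 ≤ s₂ → s₂ ≤ T →
      pogG v (vcorr C ε v) (pogW κ K ε) (2 * t0) e x' s₁ s₂ ≤
        pogG v (vcorr C ε v) (pogW κ K ε) (2 * t0) e x t1 t2)
    (hN1 : 1 ≤ N1) (hN2 : Lam ≤ N1)
    (hN3 : Lam * (2 / (κ * n) * (n ^ 2 + 3 * n ^ 2 / T ^ 2 + 2)) ^ n ≤ N1)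
    (hc1 : 2 / (T * N1) * (n / T + 1) ≤ 1 / 8) (hc2 : n * (2 / (T * N1)) ≤ T / 2) :
    chord v (vcorr C ε v) e x t1 t2 / ((t1 + 2 * t0) * (t2 + 2 * t0)) * (1 / 2 - v x) ^ n ≤ N1 := by
  by_contra hcon
  push Not at hcon
  have hn' : (2 : ℝ) ≤ n := by exact_mod_cast hn
  have hx : v x ≤ 1 / 2 := by linarith
  have hr1 : 1 / 2 - v x ≤ 1 := by linarith [h.nonneg x]
  have hom0 : 0 < (t1 + 2 * t0) * (t2 + 2 * t0) := mul_pos (by linarith) (by linarith)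
  have hκ0 : 0 < κ := by rw [hκ]; positivity
  have hK0 : 0 ≤ K := by rw [hKd]; positivity
  have hκ1 : κ ≤ 1 := by rw [hκ, div_le_one (by positivity)]; nlinarith
  obtain ⟨D, hDd⟩ := ex_eq (chord v (vcorr C ε v) e x t1 t2)
  obtain ⟨om, hω⟩ := ex_eq ((t1 + 2 * t0) * (t2 + 2 * t0)); obtain ⟨r, hrd⟩ := ex_eq (1 / 2 - v x)
  have hDle := h.chord_le hε (by linarith) hT hx he (by linarith) (by linarith) h1' h2'
  rw [← hω] at hom0; rw [← hDd, ← hω, ← hrd] at hcon; rw [← hDd] at hDle; rw [← hrd] at hr hr1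
  have hrn : 0 < r ^ n := pow_pos hr n
  have hN0 : 0 < D / om := pos_of_mul_pos_left (lt_trans (by linarith) hcon) hrn.le
  have hD : 0 < D := (div_pos_iff_of_pos_right hom0).1 hN0
  have hrn1 : r ^ n ≤ r := pow_le_of_le_one hr.le hr1 (by omega)
  have hNr : N1 ≤ D / om * r := hcon.le.trans (by gcongr)
  have hNN : N1 ≤ D / om := hNr.trans (mul_le_of_le_one_right hN0.le hr1)
  have ht12 : 0 < t1 + t2 := by linarith
  have hsum : t1 + t2 ≤ 2 / (T * N1) * r := by
    have h3 : D / om ≤ 2 / ((t1 + t2) * T) := by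
      rw [div_le_iff₀ hom0]; refine hDle.trans ?_; rw [div_mul_eq_mul_div]
      have : t1 * t2 ≤ om := by rw [hω]; have := ht₀.le; gcongr <;> linarith
      gcongr
    have h4 : N1 ≤ 2 / ((t1 + t2) * T) * r := hNr.trans (by gcongr)
    rw [div_mul_eq_mul_div, le_div_iff₀ (by positivity)] at h4 ⊢; linarith
  have hμN : D / om ≤ Qf (hess v x) e := by
    rw [hDd, hω]
    exact h.quot_le_Qf hn hC hT hT1 hε (by linarith) hκ hK0 hK he ht₀ h1 h2 (hrd ▸ hr) (hDd ▸ hD) hmax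
      hc1 hc2 (hrd ▸ hsum)
  have hcT : 2 * (2 / (T * N1)) ≤ n * (2 / (T * N1)) := by gcongr
  have hcr : 2 / (T * N1) * r ≤ 2 / (T * N1) := mul_le_of_le_one_right (by positivity) hr1
  have he0 : e ≠ 0 := by rw [← norm_ne_zero_iff, he]; norm_num
  have hpd := h.ma.posDef x; have hμ0 : 0 < Qf (hess v x) e := (posDef_iff_Qf hpd.1).1 hpd e he0
  obtain ⟨ξ, hξ0, horth, hdet⟩ := exists_frame hpd he0
  have hZ := frame_norm_lower hpd he ξ hξ0 horth hdet; obtain ⟨μ, hμ⟩ := ex_eq (Qf (hess v x) e)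
  have hsq : sqrt μ ≠ 0 := (sqrt_pos.2 (hμ ▸ hμ0)).ne'
  have hξn : ‖ξ 0‖ ^ 2 = (Qf (hess v x) e)⁻¹ := by
    rw [hξ0, norm_smul, he, mul_one, norm_inv, inv_pow, norm_of_nonneg (Real.sqrt_nonneg _),
      sq_sqrt hμ0.le]
  have heξ : e = sqrt μ • ξ 0 := by rw [hξ0, ← hμ, smul_smul, mul_inv_cancel₀ hsq, one_smul]
  obtain ⟨c, hc0, hsumv⟩ := h.sum_var hn hC hT hε hκ hK0 hK ht₀ h1 h2 (by linarith) (by linarith)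
    (hrd ▸ hr) (hDd ▸ hD) hmax (by
      rw [← hrd]
      exact (hN1.trans hNr).trans (by gcongr)) ξ hξn (fun k => by rw [Qf_eq_Bf, horth, if_pos rfl])
  have hvy : v (x + t1 • e) ≤ 1 := h.sep x _ hx (by
    rw [norm_smul, he, norm_of_nonneg (by linarith)]; linarith)
  have hvz : v (x - t2 • e) ≤ 1 := by
    rw [sub_eq_add_neg, ← smul_neg]
    exact h.sep x _ hx (by rw [norm_smul, norm_neg, he, norm_of_nonneg (by linarith)]; linarith)
  have hS1 := amgm_sheared (h.ma.det_pos x) (h.posSemidef_vcorr hε (x + t1 • e)) ξ hdet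
    (fun k => t1 * c k * sqrt μ) (by simp [hc0])
  have hS2 := amgm_sheared (h.ma.det_pos x) (h.posSemidef_vcorr hε (x - t2 • e)) ξ hdet
    (fun k => -(t2 * c k * sqrt μ)) (by simp [hc0])
  have e1 : ∀ k, ξ k + (t1 * c k * sqrt μ) • ξ 0 = ξ k + (t1 * c k) • e := fun k => by
    conv_rhs => rw [heξ, smul_smul]
  have e2 : ∀ k, ξ k + (-(t2 * c k * sqrt μ)) • ξ 0 = ξ k - (t2 * c k) • e := fun k => by
    conv_rhs => rw [heξ, smul_smul]
    rw [neg_smul, sub_eq_add_neg]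
  simp only [e1] at hS1; simp only [e2] at hS2; have hdy := h.le_det_vcorr hε hvy
  have hdz := h.le_det_vcorr hε hvz; have hdp : 0 < dhess v x := h.ma.det_pos x; have hdL := h.le x
  have hdx : dhess v x = (hess v x).det := rfl; rw [← hdx] at hS1 hS2 hZ; rw [← hμ] at hZ hμN
  obtain ⟨s1, hs1⟩ := ex_eq (∑ k, Qf (hess (vcorr C ε v) (x + t1 • e)) (ξ k + (t1 * c k) • e))
  obtain ⟨s2, hs2⟩ := ex_eq (∑ k, Qf (hess (vcorr C ε v) (x - t2 • e)) (ξ k - (t2 * c k) • e))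
  obtain ⟨Z, hZd⟩ := ex_eq (∑ k, ‖ξ k‖ ^ 2); rw [← hs1, ← hs2, ← hZd, ← hDd, ← hrd] at hsumv
  rw [← hs1] at hS1; rw [← hs2] at hS2; rw [← hZd] at hZ; have hDb : (2 * t0) ^ 2 ≤ D := by
    have h3 : (2 * t0) ^ 2 ≤ om := by rw [hω, sq]; gcongr <;> linarith
    have h4 : D = D / om * om := by field_simp
    rw [h4]
    calc (2 * t0) ^ 2 ≤ om := h3
      _ = 1 * om := (one_mul _).symm
      _ ≤ D / om * om := by gcongr; linarith
  have hs : ∃ σ, σ = (μ / Lam) ^ ((1 : ℝ) / n) := ⟨_, rfl⟩; obtain ⟨σ, hσ⟩ := hs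
  have hμ0' : 0 < μ := hμ ▸ hμ0; have hσ1 : 1 ≤ σ := by
    rw [hσ]; refine Real.one_le_rpow ?_ (by positivity); rw [le_div_iff₀ hLam]; linarith
  have hZσ : n * σ - 1 ≤ Z := by refine le_trans ?_ hZ; rw [hσ]; gcongr
  have hnσ : (n : ℝ) ≤ n * σ := le_mul_of_one_le_right (by linarith) hσ1
  have hZ1 : 1 ≤ Z := by linarith
  have hψ : ∀ k, 0 ≤ Qf (hess (psi ε) x) (ξ k) := fun k => Qf_hess_psi_nonneg hε x _
  have hψs : 0 ≤ ∑ k, Qf (hess (psi ε) x) (ξ k) := sum_nonneg fun k _ => hψ k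
  have hl1 : 0 ≤ t2 / (t1 + t2) := div_nonneg (by linarith) ht12.le
  have hl2 : 0 ≤ t1 / (t1 + t2) := div_nonneg (by linarith) ht12.le
  have hl : t2 / (t1 + t2) + t1 / (t1 + t2) = 1 := by rw [← add_div, add_comm]; exact div_self ht12.ne'
  have hlow : -1 ≤ (t2 / (t1 + t2) * s1 + t1 / (t1 + t2) * s2 - n) / D +
      K * ∑ k, Qf (hess (psi ε) x) (ξ k) := by
    have hgen : ∀ m : ℝ, m ≤ s1 → m ≤ s2 → m ≤ t2 / (t1 + t2) * s1 + t1 / (t1 + t2) * s2 := by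
      intro m a1 a2
      calc m = t2 / (t1 + t2) * m + t1 / (t1 + t2) * m := by rw [← add_mul, hl, one_mul]
        _ ≤ _ := by gcongr
    rcases le_total ‖x‖ ε with hb | hb
    · have h3 : 0 ≤ t2 / (t1 + t2) * s1 + t1 / (t1 + t2) * s2 :=
        hgen 0 (le_trans (by have : 0 ≤ 1 - ε := by linarith
                             have := this.trans hdy; positivity) hS1)
          (le_trans (by have : 0 ≤ 1 - ε := by linarith
                        have := this.trans hdz; positivity) hS2)
      have h4 : -(n / (2 * t0) ^ 2) ≤ (t2 / (t1 + t2) * s1 + t1 / (t1 + t2) * s2 - n) / D := by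
        calc -(n / (2 * t0) ^ 2) ≤ -(n / D) := neg_le_neg (by gcongr)
          _ = (0 - n) / D := by ring
          _ ≤ _ := by gcongr
      have h5 : n / (2 * t0) ^ 2 ≤ K * ∑ k, Qf (hess (psi ε) x) (ξ k) := by
        calc n / (2 * t0) ^ 2 = n / (2 * t0) ^ 2 * 1 := (mul_one _).symm
          _ ≤ n / (2 * t0) ^ 2 * Z := by gcongr
          _ = K * ∑ k, ‖ξ k‖ ^ 2 / (3 * ε) := by rw [← sum_div, ← hZd, hKd]; field_simp
          _ ≤ _ := by gcongr with k; exact Qf_hess_psi_ge_near hε hb _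
      linarith
    · have hd1 : dhess v x ≤ 1 + ε := by
        have := (abs_le.1 (h.near x hb (h.bdd x (by linarith)))).2; linarith
      have g1 := one_sub_le_rpow (n := n) hε hε1 hdp hd1 hdy
      have g2 := one_sub_le_rpow (n := n) hε hε1 hdp hd1 hdz
      have h3 := hgen (n * (1 - 2 * ε)) (le_trans (by gcongr) hS1) (le_trans (by gcongr) hS2)
      have h4 : -1 ≤ (t2 / (t1 + t2) * s1 + t1 / (t1 + t2) * s2 - n) / D := by
        rw [le_div_iff₀ hD]; linarith
      have h5 := mul_nonneg hK0 hψs; linarith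
  obtain ⟨B, hB⟩ := ex_eq (n ^ 2 + 3 * n ^ 2 / T ^ 2 : ℝ); rw [← hB] at hsumv hN3
  have h3 : κ / 2 * (n * σ - 1) ≤ 1 + B / r := by
    calc κ / 2 * (n * σ - 1) ≤ κ / 2 * Z := by gcongr
      _ ≤ _ := by linarith
  have h4 : κ * n * (σ * r) ≤ 2 * (B + 2) := by
    have h5 : κ / 2 * (n * σ - 1) * r ≤ (1 + B / r) * r := by gcongr
    have h6 : (1 + B / r) * r = r + B := by field_simp
    have h7 : κ * r ≤ 1 := mul_le_one₀ hκ1 hr.le hr1; linarith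
  have h5 : σ * r ≤ 2 / (κ * n) * (B + 2) := by
    rw [div_mul_eq_mul_div, le_div_iff₀ (by positivity)]; linarith
  have h6 : σ ^ n = μ / Lam := by
    rw [hσ, ← Real.rpow_natCast, ← rpow_mul (by positivity), one_div,
      inv_mul_cancel₀ (by positivity), rpow_one]
  have h7 : μ * r ^ n ≤ N1 := by
    refine le_trans ?_ hN3
    calc μ * r ^ n = Lam * (σ * r) ^ n := by rw [mul_pow, h6]; field_simp
      _ ≤ _ := by gcongr
  have h8 : D / om * r ^ n ≤ μ * r ^ n := by gcongr
  linarith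

set_option maxHeartbeats 2000000 in
/-- Finite difference version of the Pogorelov interior estimate for second derivatives. -/
theorem pogorelov (n : ℕ) [NeZero n] (hn : 2 ≤ n) {C T Lam : ℝ} (hC : 1 ≤ C) (hT : 0 < T)
    (hT1 : T ≤ 1) (hLam : 0 < Lam) : ∃ C₀ : ℝ, 0 < C₀ ∧ ∀ t0, 0 < t0 → t0 < T → ∃ ε : ℝ, 0 < ε ∧
      ∀ v : Eu n → ℝ, NormSection C T Lam ε v → ∀ (x e : Eu n) (t : ℝ), v x ≤ 1 / 4 → ‖e‖ = 1 →
        t0 ≤ t → t ≤ T → v (x + t • e) + v (x - t • e) - 2 * v x ≤ C₀ * t ^ 2 := by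
  obtain ⟨κ, hκ⟩ := ex_eq (1 / (16 * C ^ 2))
  obtain ⟨M, hM⟩ := ex_eq (Lam * (2 / (κ * n) * (n ^ 2 + 3 * n ^ 2 / T ^ 2 + 2)) ^ n)
  have hκ0 : 0 < κ := by rw [hκ]; positivity
  have hM0 : 0 < M := by rw [hM]; positivity
  obtain ⟨N1, hN⟩ := ex_eq (1 + Lam + M + 16 / T * (n / T + 1) + 4 * n / T ^ 2)
  have p1 : 0 < 16 / T * (n / T + 1) := by positivity
  have p2 : 0 < 4 * n / T ^ 2 := by positivity
  have hN1 : 1 ≤ N1 := by linarith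
  refine ⟨2 * (9 * (N1 * exp 1 * 4 ^ n)) + 6, by positivity, fun t0 ht₀ ht₀T => ?_⟩
  obtain ⟨ε, hε⟩ := ex_eq (min (1 / 2) (min ((2 * t0) ^ 2 / (2 * n)) (min (t0 ^ 2 / (C + 1))
    (1 / (16 * C) / (3 * n / (2 * t0) ^ 2)))))
  have hε0 : 0 < ε := by
    rw [hε]
    refine lt_min (by norm_num) (lt_min (by positivity) (lt_min (by positivity) (by positivity)))
  have hε1 : ε ≤ 1 / 2 := hε ▸ min_le_left _ _
  have hε2 : ε ≤ (2 * t0) ^ 2 / (2 * n) := hε ▸ (min_le_right _ _).trans (min_le_left _ _)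
  have hε3 : ε ≤ t0 ^ 2 / (C + 1) :=
    hε ▸ ((min_le_right _ _).trans (min_le_right _ _)).trans (min_le_left _ _)
  have hε4 : ε ≤ 1 / (16 * C) / (3 * n / (2 * t0) ^ 2) :=
    hε ▸ ((min_le_right _ _).trans (min_le_right _ _)).trans (min_le_right _ _)
  rw [le_div_iff₀ (by positivity)] at hε2 hε3 hε4; refine ⟨ε, hε0, fun v h x e t hx he ht htT => ?_⟩
  obtain ⟨K, hKd⟩ := ex_eq (3 * n / (2 * t0) ^ 2 * ε)
  have hK : K ≤ 1 / (16 * C) := by rw [hKd, mul_comm]; exact hε4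
  have hK0 : 0 ≤ K := by rw [hKd]; positivity
  set G := pogG v (vcorr C ε v) (pogW κ K ε) (2 * t0) e with hG
  have hvc : Continuous v := h.ma.smooth.continuous
  have hvpc : Continuous (vcorr C ε v) := (contDiff_vcorr hε0 h.ma.smooth).continuous
  have hKc : IsCompact ({x | v x ≤ 1 / 2} ×ˢ (Icc t0 T ×ˢ Icc t0 T)) :=
    (h.ma.isCompact_sublevel h.zero h.nonneg (1 / 2)).prod (isCompact_Icc.prod isCompact_Icc)
  have hcont : ContinuousOn (fun p : Eu n × ℝ × ℝ => G p.1 p.2.1 p.2.2)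
      ({x | v x ≤ 1 / 2} ×ˢ (Icc t0 T ×ˢ Icc t0 T)) := by
    have hWc : Continuous (pogW (n := n) κ K ε) := (contDiff_pogW hε0).continuous
    simp only [hG, pogG, chord]
    refine ContinuousOn.mul (ContinuousOn.mul (ContinuousOn.div ?_ ?_ ?_) ?_) ?_
    · refine ContinuousOn.sub (ContinuousOn.div ?_ ?_ ?_) ?_
      · fun_prop
      · fun_prop
      · rintro ⟨y, s, s'⟩ ⟨-, h3, h4⟩
        have := h3.1; have := h4.1; simp only at *; linarith
      · fun_prop
    · fun_prop
    · rintro ⟨y, s, s'⟩ ⟨-, h3, h4⟩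
      have := h3.1; have := h4.1; simp only at *; exact (mul_pos (by linarith) (by linarith)).ne'
    · fun_prop
    · fun_prop
  have hxmem : (x, t, t) ∈ {x | v x ≤ 1 / 2} ×ˢ (Icc t0 T ×ˢ Icc t0 T) :=
    ⟨show v x ≤ 1 / 2 by linarith, ⟨ht, htT⟩, ht, htT⟩
  obtain ⟨⟨x1, t1, t2⟩, ⟨hx1, ⟨k1, k1'⟩, k2, k2'⟩, hmx⟩ := hKc.exists_isMaxOn ⟨_, hxmem⟩ hcont
  simp only [mem_ofPred_eq] at hx1 k1 k1' k2 k2'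
  have hmax : ∀ x' s₁ s₂, v x' ≤ 1 / 2 → t0 ≤ s₁ → s₁ ≤ T → t0 ≤ s₂ → s₂ ≤ T →
      G x' s₁ s₂ ≤ G x1 t1 t2 := fun x' s₁ s₂ a1 a2 a3 a4 a5 =>
    hmx (show (x', s₁, s₂) ∈ _ from ⟨a1, ⟨a2, a3⟩, a4, a5⟩)
  have hbound : G x t t ≤ N1 * exp 1 := by
    refine (hmax x t t (by linarith) ht htT ht htT).trans ?_
    rcases le_or_gt (G x1 t1 t2) 0 with hneg | hpos
    · exact hneg.trans (by positivity)
    have hom1 : 0 < (t1 + 2 * t0) * (t2 + 2 * t0) := mul_pos (by linarith) (by linarith)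
    have hr : 0 < 1 / 2 - v x1 := by
      refine lt_of_le_of_ne (by linarith) fun h0 => ?_
      rw [hG, pogG, ← h0, zero_pow (NeZero.ne n)] at hpos; simp at hpos
    have hD : 0 < chord v (vcorr C ε v) e x1 t1 t2 := by
      rw [hG, pogG] at hpos
      have h3 := pos_of_mul_pos_left (pos_of_mul_pos_left hpos (exp_pos _).le) (pow_pos hr n).le
      exact (div_pos_iff_of_pos_right hom1).1 h3
    have hxC : ‖x1‖ ≤ C := h.bdd x1 (by linarith)
    have hvple : vcorr C ε v x1 ≤ v x1 := vcorr_le hε0 (by linarith) hxC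
    have hvpcv := convexOn_vcorr (C := C) hε0 h.ma.convex; have l1 : t0 < t1 := by
      refine lt_of_le_of_ne k1 fun h0 => ?_; subst h0
      obtain ⟨s, s1, s2, s3⟩ := exists_pogG_lt (P := pogW κ K ε) hvpcv hvple ht₀ ht₀T k2 hD hr
      exact absurd (hmax x1 s t2 hx1 s1 s2 k2 k2') (not_le.2 s3)
    have l2 : t0 < t2 := by
      refine lt_of_le_of_ne k2 fun h0 => ?_; subst h0; rw [← chord_neg] at hD
      obtain ⟨s, s1, s2, s3⟩ := exists_pogG_lt (P := pogW κ K ε) hvpcv hvple ht₀ ht₀T k1 hD hr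
      rw [pogG_neg, pogG_neg] at s3; exact absurd (hmax x1 t1 s hx1 k1 k1' s1 s2) (not_le.2 s3)
    have hmain := h.pog_max_le hn hC hT hT1 hLam hε0 hε1 hκ ht₀ hKd hK (by linarith) he l1 l2 k1' k2' hr
      hmax hN1 (by linarith) (by rw [← hM]; linarith) (by
        have : 16 / T * (n / T + 1) ≤ N1 := by linarith
        rw [div_mul_eq_mul_div, div_le_iff₀ (by positivity)]
        rw [div_mul_eq_mul_div, div_le_iff₀ hT] at this; linarith) (by
        have : 4 * n / T ^ 2 ≤ N1 := by linarith
        rw [div_le_iff₀ (by positivity)] at this; rw [mul_div_assoc', div_le_iff₀ (by positivity)]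
        linarith)
    have hPle : pogW κ K ε x1 ≤ 1 := by
      have h3 := psi_le hε0 x1; have h4 : K * psi ε x1 ≤ 1 / (16 * C) * (2 * C) := by
        have := psi_pos hε0 x1; gcongr; linarith
      have h5 : κ * (1 / 2 * Qf 1 x1) ≤ κ * (1 / 2 * C ^ 2) := by rw [Qf_one]; gcongr
      have h6 : κ * (1 / 2 * C ^ 2) = 1 / 32 := by rw [hκ]; field_simp; norm_num
      have h7 : 1 / (16 * C) * (2 * C) = 1 / 8 := by field_simp; norm_num
      rw [pogW]; linarith
    rw [hG, pogG]; gcongr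
  have hP0 : 0 ≤ pogW κ K ε x := pogW_nonneg hε0 hκ0.le hK0 x
  have hchord : chord v (vcorr C ε v) e x t t ≤ 9 * t ^ 2 * (N1 * exp 1 * 4 ^ n) := by
    rcases le_or_gt (chord v (vcorr C ε v) e x t t) 0 with hneg | hpos
    · exact hneg.trans (by positivity)
    have ht0 : 0 < t := by linarith
    have hom1 : (t + 2 * t0) * (t + 2 * t0) ≤ 9 * t ^ 2 := by nlinarith
    have h3 : chord v (vcorr C ε v) e x t t / (9 * t ^ 2) * (1 / 4) ^ n * 1 ≤ G x t t := by
      rw [hG, pogG]; have h4 : (1 : ℝ) ≤ exp (pogW κ K ε x) := Real.one_le_exp hP0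
      have h5 : (1 / 4 : ℝ) ≤ 1 / 2 - v x := by linarith
      have : 0 ≤ 1 / 2 - v x := by linarith
      gcongr
    have h4 := h3.trans hbound
    have h5 : chord v (vcorr C ε v) e x t t / (9 * t ^ 2) * (1 / 4) ^ n * 1 =
      chord v (vcorr C ε v) e x t t / (9 * t ^ 2 * 4 ^ n) := by
      rw [mul_one, one_div, inv_pow, div_mul_eq_div_div _ (9 * t ^ 2), div_eq_mul_inv _ (4 ^ n : ℝ)]
    rw [h5, div_le_iff₀ (by positivity)] at h4; linarith
  have h6 : chord v (vcorr C ε v) e x t t =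
      (vcorr C ε v (x + t • e) + vcorr C ε v (x - t • e)) / 2 - v x := by
    have ht0 : t ≠ 0 := by linarith
    rw [chord]; field_simp; ring
  have h7 := le_vcorr (C := C) (v := v) hε0 (x + t • e)
  have h8 := le_vcorr (C := C) (v := v) hε0 (x - t • e); have h9 : t0 ^ 2 ≤ t ^ 2 := by gcongr
  rw [h6] at hchord; linarith
end

/-- Two sided quadratic control of a convex function by its supporting planes. -/
def QuadSupport (C₀ : ℝ) (U : Eu n → ℝ) (Gr : Eu n → Eu n) : Prop :=
  ∀ x y, 0 ≤ U y - U x - ⟪Gr x, y - x⟫ ∧ U y - U x - ⟪Gr x, y - x⟫ ≤ C₀ * ‖y - x‖ ^ 2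

/-- Local uniform approximation by convex functions with determinant close to one off the origin. -/
def Approx (U : Eu n → ℝ) : Prop :=
  ∀ ε > 0, ∀ R : ℝ, ∃ v : Eu n → ℝ, MAConvex v ∧ (∀ x, ‖x‖ ≤ R → |v x - U x| ≤ ε) ∧
    ∀ x, ε ≤ ‖x‖ → ‖x‖ ≤ R → |dhess v x - 1| ≤ ε

section
variable {C₀ : ℝ} {Gr : Eu n → Eu n}

lemma norm_le_of_inner_le {a : Eu n} {c : ℝ} (hc : 0 ≤ c) (h : ∀ w, ‖w‖ = 1 → ⟪a, w⟫ ≤ c) :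
    ‖a‖ ≤ c := by
  rcases eq_or_ne a 0 with rfl | ha
  · simpa using hc
  have hn := norm_pos_iff.2 ha; have := h (‖a‖⁻¹ • a) (by rw [norm_unit hn])
  rw [inner_smul_right, real_inner_self_eq_norm_sq, sq, inv_mul_cancel_left₀ hn.ne'] at this
  exact this

lemma QuadSupport.nonneg (h : QuadSupport C₀ U Gr) [NeZero n] : 0 ≤ C₀ := by
  obtain ⟨e, -, he⟩ := exists_coord_ne_zero (n := n); have h1 := h 0 e; rw [sub_zero, he] at h1
  linarith [h1.1, h1.2]

lemma QuadSupport.lipschitz (h : QuadSupport C₀ U Gr) [NeZero n] (x y : Eu n) :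
    ‖Gr x - Gr y‖ ≤ 2 * C₀ * ‖x - y‖ := by
  have h0 := h.nonneg; refine norm_le_of_inner_le (by positivity) fun w hw => ?_
  set d := ‖x - y‖ with hd; have h1 := (h x (y + d • w)).1; have h2 := (h y (y + d • w)).2
  have h3 := (h x y).2; rw [add_sub_cancel_left, norm_smul, hw, mul_one, norm_norm] at h2
  rw [norm_sub_rev, ← hd] at h3; rw [add_sub_right_comm, inner_add_right, inner_smul_right] at h1
  rw [inner_smul_right] at h2; rw [inner_sub_left]
  have h4 : d * (⟪Gr x, w⟫ - ⟪Gr y, w⟫) ≤ d * (2 * C₀ * d) := by linarith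
  rcases eq_or_lt_of_le (norm_nonneg (x - y)) with h5 | h5
  · have : x = y := by rw [← sub_eq_zero, ← norm_eq_zero]; exact h5.symm
    rw [hd, ← h5, this]; simp
  · exact le_of_mul_le_mul_left h4 h5

lemma QuadSupport.hasGradientAt (h : QuadSupport C₀ U Gr) (x : Eu n) : HasGradientAt U (Gr x) x := by
  rw [hasGradientAt_iff_isLittleO]
  refine Asymptotics.IsBigO.trans_isLittleO (g := fun y => ‖y - x‖ ^ 2) ?_ ?_
  · refine Asymptotics.IsBigO.of_bound C₀ (Eventually.of_forall fun y => ?_)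
    rw [norm_of_nonneg (h x y).1, norm_pow, norm_norm]; exact (h x y).2
  · exact (Asymptotics.isLittleO_pow_id one_lt_two).comp_tendsto (tendsto_norm_sub_self x) |>.norm_right.trans_le
      (fun y => by simp)

lemma QuadSupport.continuous (h : QuadSupport C₀ U Gr) : Continuous U :=
  continuous_iff_continuousAt.2 fun x => (h.hasGradientAt x).continuousAt

lemma QuadSupport.second_diff (h : QuadSupport C₀ U Gr) (x w : Eu n) :
    0 ≤ U (x + w) + U (x - w) - 2 * U x ∧ U (x + w) + U (x - w) - 2 * U x ≤ 2 * C₀ * ‖w‖ ^ 2 := by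
  have h1 := h x (x + w); have h2 := h x (x - w); rw [add_sub_cancel_left] at h1
  rw [sub_sub_cancel_left, inner_neg_right, norm_neg] at h2
  constructor <;> linarith [h1.1, h1.2, h2.1, h2.2]

lemma exists_ultralimit (l : Ultrafilter ℕ) (V : ℕ → Eu n → ℝ) (G : ℕ → Eu n → Eu n)
    (hG : ∀ k x y, 0 ≤ V k y - V k x - ⟪G k x, y - x⟫)
    (hb : ∀ R : ℝ, ∃ M, ∀ᶠ k in (l : Filter ℕ), ∀ x, ‖x‖ ≤ R → |V k x| ≤ M)
    (hs : ∀ x w, w ≠ 0 → ∀ᶠ k in (l : Filter ℕ), V k (x + w) + V k (x - w) - 2 * V k x ≤ C₀ * ‖w‖ ^ 2) :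
    ∃ U Gr, QuadSupport C₀ U Gr ∧ (∀ x, Tendsto (fun k => V k x) l (𝓝 (U x))) ∧
      ∀ ε > 0, ∀ R : ℝ, ∀ᶠ k in (l : Filter ℕ), ∀ x, ‖x‖ ≤ R → |V k x - U x| ≤ ε := by
  have hlip : ∀ R : ℝ, ∃ M, 0 ≤ M ∧ ∀ᶠ k in (l : Filter ℕ), ∀ x, ‖x‖ ≤ R → ‖G k x‖ ≤ M := by
    intro R; obtain ⟨M, hM⟩ := hb (R + 1)
    refine ⟨2 * |M|, by positivity, hM.mono fun k hk x hx => ?_⟩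
    refine norm_le_of_inner_le (by positivity) fun w hw => ?_; have h1 := hG k x (x + w)
    rw [add_sub_cancel_left] at h1
    have h2 := abs_le.1 (hk (x + w) ((norm_add_le _ _).trans (by linarith)))
    have h3 := abs_le.1 (hk x (by linarith)); linarith [le_abs_self M]
  have hU : ∀ x, ∃ a, Tendsto (fun k => V k x) l (𝓝 a) := by
    intro x; obtain ⟨M, hM⟩ := hb ‖x‖
    obtain ⟨a, -, ha⟩ := (isCompact_Icc (a := -M) (b := M)).ultrafilter_le_nhds (l.map fun k => V k x)
      (by rw [le_principal_iff]; exact hM.mono fun k hk => abs_le.1 (hk x le_rfl))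
    exact ⟨a, ha⟩
  have hGr : ∀ x, ∃ g, Tendsto (fun k => G k x) l (𝓝 g) := by
    intro x; obtain ⟨M, -, hM⟩ := hlip ‖x‖
    obtain ⟨a, -, ha⟩ := (isCompact_closedBall (0 : Eu n) M).ultrafilter_le_nhds (l.map fun k => G k x)
      (by rw [le_principal_iff]; exact hM.mono fun k hk => by
            rw [mem_closedBall_zero_iff]; exact hk x le_rfl)
    exact ⟨a, ha⟩
  choose U hU using hU
  choose Gr hGr using hGr
  have hlow : ∀ x y, 0 ≤ U y - U x - ⟪Gr x, y - x⟫ := fun x y =>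
    ge_of_tendsto' (((hU y).sub (hU x)).sub ((hGr x).inner tendsto_const_nhds)) fun k => hG k x y
  refine ⟨U, Gr, fun x y => ⟨hlow x y, ?_⟩, hU, ?_⟩
  · rcases eq_or_ne (y - x) 0 with h0 | h0
    · have : y = x := sub_eq_zero.1 h0
      simp [this]
    have h1 := le_of_tendsto (((hU _).add (hU _)).sub ((hU x).const_mul 2)) (hs x (y - x) h0)
    have h2 := hlow x (x - (y - x)); rw [add_sub_cancel] at h1
    rw [sub_sub_cancel_left, inner_neg_right] at h2; linarith
  · intro ε hε R
    obtain ⟨M, hM0, hM⟩ := hlip (R + 1)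
    have hUl : ∀ x y, ‖x‖ ≤ R + 1 → ‖y‖ ≤ R + 1 → |U x - U y| ≤ M * ‖x - y‖ := by
      have h1 : ∀ x y, ‖x‖ ≤ R + 1 → U x - U y ≤ M * ‖x - y‖ := by
        intro x y hx; have h2 := hlow x y
        have h3 : ‖Gr x‖ ≤ M := le_of_tendsto (hGr x).norm (hM.mono fun k hk => hk x hx)
        have h4 : ⟪Gr x, x - y⟫ ≤ M * ‖x - y‖ := (real_inner_le_norm _ _).trans (by gcongr)
        have h5 : ⟪Gr x, y - x⟫ = -⟪Gr x, x - y⟫ := by rw [← inner_neg_right, neg_sub]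
        linarith
      intro x y hx hy; refine abs_le.2 ⟨?_, h1 x y hx⟩; have := h1 y x hy; rw [norm_sub_rev] at this
      linarith
    set δ := min 1 (ε / (3 * (M + 1))); have hδ0 : 0 < δ := by positivity
    have hδM : M * δ ≤ ε / 3 := by
      calc M * δ ≤ (M + 1) * (ε / (3 * (M + 1))) := by
            gcongr
            · linarith
            · exact min_le_right _ _
        _ = ε / 3 := by field_simp
    obtain ⟨t, hts, htf, htc⟩ :=
      (finite_cover_balls_of_compact (isCompact_closedBall (0 : Eu n) R) hδ0)
    have h6 : ∀ᶠ k in (l : Filter ℕ), ∀ z ∈ t, |V k z - U z| ≤ ε / 3 := by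
      rw [eventually_all_finite htf]; intro z _
      have := (hU z).eventually (Metric.closedBall_mem_nhds (U z) (show 0 < ε / 3 by positivity))
      exact this
    filter_upwards [h6, hM] with k hk hMk x hx
    have hx' : x ∈ 𝔹 n R := by rwa [mem_closedBall_zero_iff]
    obtain ⟨z, hz, hxz⟩ := Set.mem_iUnion₂.1 (htc hx'); have hzR : ‖z‖ ≤ R + 1 := by
      have := hts hz; rw [mem_closedBall_zero_iff] at this; linarith
    rw [mem_ball, dist_eq_norm] at hxz; have h7 : |V k x - V k z| ≤ M * ‖x - z‖ := by
      have h8 := hG k x z; have h9 := hG k z x; have b1 : ⟪G k z, x - z⟫ ≥ -(M * ‖x - z‖) := by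
        have := abs_le.1 (abs_real_inner_le_norm (G k z) (x - z))
        have h10 : ‖G k z‖ * ‖x - z‖ ≤ M * ‖x - z‖ := by gcongr; exact hMk z hzR
        linarith [this.1]
      have b2 : ⟪G k x, z - x⟫ ≥ -(M * ‖x - z‖) := by
        have := abs_le.1 (abs_real_inner_le_norm (G k x) (z - x))
        have h10 : ‖G k x‖ * ‖z - x‖ ≤ M * ‖x - z‖ := by
          rw [norm_sub_rev z x]; gcongr; exact hMk x (by linarith)
        linarith [this.1]
      exact abs_le.2 ⟨by linarith, by linarith⟩
    have h8 := hUl x z (by linarith) hzR; have h9 : M * ‖x - z‖ ≤ M * δ := by gcongr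
    have h10 := hk z hz
    calc |V k x - U x| = |(V k x - V k z) + (V k z - U z) - (U x - U z)| := by ring_nf
      _ ≤ |V k x - V k z| + |V k z - U z| + |U x - U z| := (abs_sub _ _).trans (by gcongr; exact abs_add_le _ _)
      _ ≤ ε := by linarith
end

/-- Second order Taylor expansion at a point. -/
def Peano (f : Eu n → ℝ) (M : Mat n) (b x : Eu n) : Prop :=
  (fun w => f (x + w) - f x - ⟪b, w⟫ - 1 / 2 * Qf M w) =o[𝓝 0] fun w => ‖w‖ ^ 2

/-- Second symmetric derivative at `x` in direction `ξ`. -/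
def SymDeriv (f : Eu n → ℝ) (q : ℝ) (x ξ : Eu n) : Prop :=
  Tendsto (fun s : ℝ => (f (x + s • ξ) + f (x - s • ξ) - 2 * f x) / s ^ 2) (𝓝[≠] 0) (𝓝 q)

section
variable {C₀ : ℝ} {U f : Eu n → ℝ} {Gr : Eu n → Eu n} {M : Mat n} {b x : Eu n}

lemma Peano.symDeriv (h : Peano f M b x) (ξ : Eu n) : SymDeriv f (Qf M ξ) x ξ := by
  have h1 : ∀ ξ : Eu n, Tendsto (fun s : ℝ => (f (x + s • ξ) - f x - s * ⟪b, ξ⟫) / s ^ 2) (𝓝[≠] 0)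
      (𝓝 (1 / 2 * Qf M ξ)) := by
    intro ξ; have h2 : Tendsto (fun s : ℝ => s • ξ) (𝓝[≠] 0) (𝓝 0) := by
      have : Tendsto (fun s : ℝ => s • ξ) (𝓝 0) (𝓝 ((0 : ℝ) • ξ)) :=
        (continuous_id.smul continuous_const).tendsto 0
      rw [zero_smul] at this; exact this.mono_left nhdsWithin_le_nhds
    have h3 := h.comp_tendsto h2
    have h4 : (fun s : ℝ => f (x + s • ξ) - f x - ⟪b, s • ξ⟫ - 1 / 2 * Qf M (s • ξ)) =o[𝓝[≠] 0]
        fun s : ℝ => s ^ 2 := by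
      refine h3.trans_isBigO (Asymptotics.IsBigO.of_bound (‖ξ‖ ^ 2) (Eventually.of_forall fun s => ?_))
      simp only [comp, norm_smul, norm_pow, norm_mul, norm_norm]; rw [mul_pow]; linarith
    have h5 := (h4.tendsto_div_nhds_zero).add_const (1 / 2 * Qf M ξ); rw [zero_add] at h5
    refine h5.congr' ?_; filter_upwards [self_mem_nhdsWithin] with s hs; have hs0 : s ≠ 0 := hs
    rw [Qf_smul, inner_smul_right]; field_simp; ring
  have h2 := (h1 ξ).add (h1 (-ξ)); rw [Qf_neg] at h2
  have e : 1 / 2 * Qf M ξ + 1 / 2 * Qf M ξ = Qf M ξ := by ring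
  rw [e] at h2; refine h2.congr fun s => ?_
  rw [inner_neg_right, smul_neg, ← sub_eq_add_neg, ← add_div]
  congr 1
  ring

lemma SymDeriv.add {f g : Eu n → ℝ} {p q : ℝ} {x ξ : Eu n} (hf : SymDeriv f p x ξ)
    (hg : SymDeriv g q x ξ) : SymDeriv (fun y => f y + g y) (p + q) x ξ := by
  refine (Tendsto.add hf hg).congr fun s => ?_; ring

lemma SymDeriv.const_mul {p : ℝ} {x ξ : Eu n} (hf : SymDeriv f p x ξ) (c : ℝ) :
    SymDeriv (fun y => c * f y) (c * p) x ξ := by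
  refine (Tendsto.const_mul c hf).congr fun s => ?_; ring

lemma SymDeriv.translate {p : ℝ} {x a ξ : Eu n} (hf : SymDeriv f p (x + a) ξ) :
    SymDeriv (fun y => f (y + a)) p x ξ := by
  refine hf.congr fun s => ?_; simp only [add_right_comm, sub_add_eq_add_sub]

lemma SymDeriv.nonpos {q : ℝ} {x ξ p : Eu n} (h : SymDeriv f q x ξ)
    (hm : ∀ᶠ y in 𝓝 x, f y - ⟪p, y⟫ ≤ f x - ⟪p, x⟫) : q ≤ 0 := by
  refine le_of_tendsto h ?_; have h1 := (tendsto_line_zero x ξ).eventually hm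
  have h2 := (tendsto_line_zero x (-ξ)).eventually hm
  filter_upwards [h1.filter_mono nhdsWithin_le_nhds, h2.filter_mono nhdsWithin_le_nhds] with s k1 k2
  rw [smul_neg, ← sub_eq_add_neg] at k2; rw [inner_add_right] at k1; rw [inner_sub_right] at k2
  exact div_nonpos_of_nonpos_of_nonneg (by linarith) (sq_nonneg s)

lemma exists_sym_matrix (T : Eu n →L[ℝ] Eu n) : ∃ M : Mat n, M.IsHermitian ∧ ∀ w, Qf M w = ⟪T w, w⟫ := by
  let B : Mat n := Matrix.of fun i j => T (single j 1) i
  have hB : ∀ w, Qf B w = ⟪T w, w⟫ := by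
    intro w; have h1 : T w = mulE B w := by
      conv_lhs => rw [Eu_sum_single w, map_sum]
      ext i; rw [mulE_apply]; simp [B, mul_comm]
    rw [h1, Qf_eq_Bf, Bf_eq_inner, real_inner_comm]
  refine ⟨(1 / 2 : ℝ) • (B + Bᵀ), ?_, fun w => ?_⟩
  · ext i j; simp; ring
  · have : Qf Bᵀ w = Qf B w := by
      rw [Qf, Qf, sum_comm]; refine sum_congr rfl fun i _ => sum_congr rfl fun j _ => ?_
      rw [Matrix.transpose_apply]; ring
    rw [Qf_smul_matrix, Qf_add_matrix, this, hB]; ring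

lemma peano_of_gradient (hG : ∀ y, HasGradientAt f (Gr y) y) {T : Eu n →L[ℝ] Eu n}
    (hd : HasFDerivAt Gr T x) (hM : ∀ w, Qf M w = ⟪T w, w⟫) : Peano f M (Gr x) x := by
  refine Asymptotics.IsLittleO.of_bound fun c hc => ?_
  have h1 := (hasFDerivAt_iff_isLittleO_nhds_zero.1 hd).bound hc
  obtain ⟨δ, hδ, h2⟩ := Metric.eventually_nhds_iff_ball.1 h1
  filter_upwards [ball_mem_nhds (0 : Eu n) hδ] with w hw; rw [mem_ball_zero_iff] at hw
  have h3 : ∀ s ∈ Icc (0 : ℝ) 1, HasDerivWithinAt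
      (fun s : ℝ => f (x + s • w) - s * ⟪Gr x, w⟫ - s ^ 2 * (1 / 2 * Qf M w))
      (⟪Gr (x + s • w), w⟫ - 1 * ⟪Gr x, w⟫ - (2 * s) * (1 / 2 * Qf M w)) (Icc 0 1) s := by
    intro s _; have a1 : HasDerivAt (fun s : ℝ => f (x + s • w)) ⟪Gr (x + s • w), w⟫ s := by
      have := (hG (x + s • w)).hasFDerivAt.comp_hasDerivAt s (hasDerivAt_add_smul x w s)
      refine HasDerivAt.congr_deriv this ?_; simp
    have a2 : HasDerivAt (fun s : ℝ => s ^ 2) (2 * s) s := by simpa using hasDerivAt_pow 2 s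
    exact ((a1.sub ((hasDerivAt_id s).mul_const _)).sub (a2.mul_const _)).hasDerivWithinAt
  have h4 := norm_image_sub_le_of_norm_deriv_le_segment_01' h3 (C := c * ‖w‖ ^ 2) (by
    intro s hs; have hsw : ‖s • w‖ ≤ ‖w‖ := by
      rw [norm_smul_of_nonneg hs.1]; exact mul_le_of_le_one_left (norm_nonneg _) hs.2.le
    have b1 := h2 (s • w) (by rw [mem_ball_zero_iff]; linarith)
    have b2 : ⟪Gr (x + s • w), w⟫ - 1 * ⟪Gr x, w⟫ - (2 * s) * (1 / 2 * Qf M w) =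
        ⟪Gr (x + s • w) - Gr x - T (s • w), w⟫ := by
      rw [inner_sub_left, inner_sub_left, map_smul, real_inner_smul_left, hM]; ring
    rw [b2]; refine (norm_inner_le_norm _ _).trans ?_
    calc _ ≤ (c * ‖s • w‖) * ‖w‖ := by gcongr
      _ ≤ (c * ‖w‖) * ‖w‖ := by gcongr
      _ = _ := by ring)
  rw [norm_pow, norm_norm]; refine le_trans (le_of_eq ?_) h4
  congr 1
  simp only [one_smul, zero_smul, add_zero]; ring

lemma symDeriv_of_contDiff (hv : ContDiff ℝ 2 v) (x ξ : Eu n) : SymDeriv v (Qf (hess v x) ξ) x ξ :=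
  (peano_of_gradient (fun y => ((hu_diff hv) y).hasGradientAt) (hasFDerivAt_gradient hv x)
    (fun w => by rw [Qf_eq_Bf, Bf_eq_inner, real_inner_comm])).symDeriv ξ

lemma QuadSupport.ae_peano [NeZero n] (h : QuadSupport C₀ U Gr) :
    ∀ᵐ x, ∃ M : Mat n, M.IsHermitian ∧ Peano U M (Gr x) x := by
  have hl : LipschitzWith (2 * C₀).toNNReal Gr := LipschitzWith.of_dist_le_mul fun x y => by
    rw [dist_eq_norm, dist_eq_norm, coe_toNNReal _ (by linarith [h.nonneg])]; exact h.lipschitz x y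
  filter_upwards [hl.ae_differentiableAt] with x hx
  obtain ⟨M, hM, hQ⟩ := exists_sym_matrix (fderiv ℝ Gr x)
  exact ⟨M, hM, peano_of_gradient h.hasGradientAt hx.hasFDerivAt hQ⟩

lemma Peano.Qf_bounds (hp : Peano U M b x) (h : QuadSupport C₀ U Gr) (ξ : Eu n) :
    0 ≤ Qf M ξ ∧ Qf M ξ ≤ 2 * C₀ * ‖ξ‖ ^ 2 := by
  have h1 := hp.symDeriv ξ; constructor
  · exact ge_of_tendsto' h1 fun s => div_nonneg (h.second_diff _ _).1 (sq_nonneg s)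
  · refine le_of_tendsto h1 ?_
    filter_upwards [self_mem_nhdsWithin] with s hs; have hs0 : s ≠ 0 := hs
    rw [div_le_iff₀ (by positivity)]; have := (h.second_diff x (s • ξ)).2
    rw [norm_smul, mul_pow, norm_eq_abs, sq_abs] at this; linarith

lemma null_image_of_lipschitzOn {K : NNReal} {g : Eu n → Eu n} {s : Set (Eu n)}
    (hg : LipschitzOnWith K g s) (hs : volume s = 0) : volume (g '' s) = 0 := by
  set d := Module.finrank ℝ (Eu n); have h1 : hausdorffMeasure (d : ℝ) s = 0 :=
    Measure.absolutelyContinuous_isAddHaarMeasure (hausdorffMeasure (d : ℝ)) volume hs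
  have h2 := hg.hausdorffMeasure_image_le (d := (d : ℝ)) (by positivity); rw [h1, mul_zero] at h2
  exact Measure.absolutelyContinuous_isAddHaarMeasure volume (hausdorffMeasure (d : ℝ))
    (le_antisymm h2 zero_le)

lemma exists_contact {Ω Z : Set (Eu n)} (hΩ : IsCompact Ω) {K : NNReal}
    (hG : ∀ y, HasGradientAt f (Gr y) y) (hl : LipschitzOnWith K Gr Ω) {x0 : Eu n} (hx0 : x0 ∈ Ω)
    (hb : ∀ x ∈ Ω, x ∉ interior Ω → f x < f x0) (hZ : volume Z = 0) :
    ∃ x ∈ interior Ω, x ∉ Z ∧ ∃ p : Eu n, ∀ᶠ y in 𝓝 x, f y - ⟪p, y⟫ ≤ f x - ⟪p, x⟫ := by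
  have hc : Continuous f := continuous_iff_continuousAt.2 fun y => (hG y).continuousAt
  obtain ⟨R, hR0, hR⟩ : ∃ R : ℝ, 0 < R ∧ ∀ x ∈ Ω, ‖x‖ ≤ R := by
    obtain ⟨R, hR⟩ := hΩ.isBounded.exists_norm_le
    exact ⟨max R 1, by positivity, fun x hx => (hR x hx).trans (le_max_left _ _)⟩
  obtain ⟨δ, hδ, hgap⟩ : ∃ δ > 0, ∀ x ∈ Ω, x ∉ interior Ω → f x + δ ≤ f x0 := by
    have hk : IsCompact (Ω \ interior Ω) := hΩ.diff isOpen_interior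
    rcases (Ω \ interior Ω).eq_empty_or_nonempty with he | hne
    · refine ⟨1, one_pos, fun x hx hx' => ?_⟩
      have : x ∈ Ω \ interior Ω := ⟨hx, hx'⟩; rw [he] at this
      exact absurd this (Set.notMem_empty x)
    · obtain ⟨z, hz, hmax⟩ := hk.exists_isMaxOn hne hc.continuousOn
      have := hb z hz.1 hz.2; refine ⟨f x0 - f z, by linarith, fun x hx hx' => ?_⟩
      have : f x ≤ f z := hmax ⟨hx, hx'⟩; linarith
  have key : ∀ p ∈ ball (0 : Eu n) (δ / (2 * R)), ∃ x ∈ interior Ω, Gr x = p ∧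
      ∀ᶠ y in 𝓝 x, f y - ⟪p, y⟫ ≤ f x - ⟪p, x⟫ := by
    intro p hp; rw [mem_ball_zero_iff] at hp; obtain ⟨x, hx, hmax⟩ := hΩ.exists_isMaxOn ⟨x0, hx0⟩
      (f := fun y => f y - ⟪p, y⟫) (by fun_prop)
    have hin : x ∈ interior Ω := by
      by_contra hcon
      have h1 := hgap x hx hcon; have h2 : f x0 - ⟪p, x0⟫ ≤ f x - ⟪p, x⟫ := hmax hx0
      have h3 : ∀ z ∈ Ω, |⟪p, z⟫| < δ / 2 := by
        intro z hz; refine (abs_real_inner_le_norm _ _).trans_lt ?_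
        calc ‖p‖ * ‖z‖ ≤ ‖p‖ * R := by gcongr; exact hR z hz
          _ < δ / (2 * R) * R := by gcongr
          _ = δ / 2 := by field_simp
      have h4 := abs_lt.1 (h3 x hx); have h5 := abs_lt.1 (h3 x0 hx0); linarith [h4.1, h5.2]
    have hloc : ∀ᶠ y in 𝓝 x, f y - ⟪p, y⟫ ≤ f x - ⟪p, x⟫ := by
      filter_upwards [mem_interior_iff_mem_nhds.1 hin] with y hy; exact hmax hy
    refine ⟨x, hin, ?_, hloc⟩; have hm : IsLocalMax (fun y => f y - ⟪p, y⟫) x := hloc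
    have hd : HasFDerivAt (fun y => f y - ⟪p, y⟫) (InnerProductSpace.toDual ℝ (Eu n) (Gr x) - innerSL ℝ p) x :=
      (hG x).hasFDerivAt.sub (innerSL ℝ p).hasFDerivAt
    have h0 := hm.hasFDerivAt_eq_zero hd; refine ext_inner_right ℝ fun w => ?_
    have := DFunLike.congr_fun h0 w; simpa [sub_eq_zero] using this
  by_contra hcon
  push Not at hcon
  have hsub : ball (0 : Eu n) (δ / (2 * R)) ⊆ Gr '' (Z ∩ Ω) := by
    intro p hp; obtain ⟨x, h1, h2, h3⟩ := key p hp; refine ⟨x, ⟨?_, interior_subset h1⟩, h2⟩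
    by_contra hxZ
    exact hcon x h1 hxZ p (h3.mono fun y hy => not_lt.2 hy)
  have h1 := null_image_of_lipschitzOn (hl.mono Set.inter_subset_right)
    (measure_mono_null (Set.inter_subset_left (t := Ω)) hZ)
  have h2 := measure_mono_null hsub h1
  exact (measure_ball_pos volume (0 : Eu n) (by positivity)).ne' h2
end

section
variable {C₀ : ℝ} {U f : Eu n → ℝ} {Gr : Eu n → Eu n} {M : Mat n} {b x : Eu n}

lemma Peano.touch (hp : Peano U M b x) (hM : M.IsHermitian) (ha : Approx U) (hx : x ≠ 0) {δ ε : ℝ}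
    (hδ : 0 < δ) (hε : 0 < ε) :
    (∃ H : Mat n, H.PosDef ∧ |H.det - 1| ≤ ε ∧ ∀ ξ : Eu n, Qf H ξ ≤ Qf M ξ + δ * ‖ξ‖ ^ 2) ∧
    ∃ H : Mat n, H.PosDef ∧ |H.det - 1| ≤ ε ∧ ∀ ξ : Eu n, Qf M ξ + (-δ) * ‖ξ‖ ^ 2 ≤ Qf H ξ := by
  obtain ⟨ρ0, hρ₀, h1⟩ := Metric.eventually_nhds_iff_ball.1 (hp.bound (show 0 < δ / 8 by positivity))
  set ρ := min (ρ0 / 2) (‖x‖ / 2); have hρ0 : 0 < ρ := by positivity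
  have hρ1 : ρ < ρ0 := (min_le_left _ _).trans_lt (by linarith)
  have hρ2 : ρ ≤ ‖x‖ / 2 := min_le_right _ _
  have h2 : ∀ z ∈ closedBall x ρ, |U z - (1 / 2 * Qf M (z - x) + (⟪b, z - x⟫ + U x))| ≤
      δ / 8 * ‖z - x‖ ^ 2 := by
    intro z hz; have := h1 (z - x) (by
      rw [mem_ball_zero_iff]; rw [mem_closedBall, dist_eq_norm] at hz; linarith)
    rw [add_sub_cancel, norm_pow, norm_norm, norm_eq_abs] at this
    refine le_trans (le_of_eq ?_) this
    congr 1; ring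
  obtain ⟨ε', hε', hε'0⟩ := ex_pos (min (δ * ρ ^ 2 / 16) (min ε (‖x‖ / 2)))
  have hε'1 : ε' ≤ δ * ρ ^ 2 / 16 := hε' ▸ min_le_left _ _
  have hε'2 : ε' ≤ ε := hε' ▸ (min_le_right _ _).trans (min_le_left _ _)
  have hε'3 : ε' ≤ ‖x‖ / 2 := hε' ▸ (min_le_right _ _).trans (min_le_right _ _)
  obtain ⟨v, hv, hva, hvd⟩ := ha ε' hε'0 (2 * ‖x‖)
  have hball : ∀ z ∈ closedBall x ρ, ‖x‖ / 2 ≤ ‖z‖ ∧ ‖z‖ ≤ 2 * ‖x‖ := by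
    intro z hz; rw [mem_closedBall, dist_eq_norm] at hz; have a1 := norm_sub_norm_le x z
    have a2 := norm_sub_norm_le z x; rw [norm_sub_rev] at a1; constructor <;> linarith
  have hS : ∀ s : ℝ, (M + s • (1 : Mat n)).IsHermitian := fun s =>
    hM.add (isHermitian_one.smul (by simp [IsSelfAdjoint]))
  have hQ : ∀ (s : ℝ) (ξ : Eu n), Qf (M + s • (1 : Mat n)) ξ = Qf M ξ + s * ‖ξ‖ ^ 2 := by
    intro s ξ; rw [Qf_add_matrix, Qf_smul_matrix, Qf_one]
  set q : ℝ → Eu n → ℝ := fun s z => 1 / 2 * Qf (M + s • (1 : Mat n)) (z - x) + (⟪b, z - x⟫ + U x)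
  have hqs : ∀ s, ContDiff ℝ 2 (q s) := fun s => contDiff_quad _ x b _
  have hqx : ∀ s, q s x = U x := fun s => by simp [q, Qf_zero_right]
  have hx0 : x ∈ closedBall x ρ := mem_closedBall_self hρ0.le
  have hvx := abs_le.1 (hva x (by linarith))
  have hbd : ∀ z ∈ closedBall x ρ, z ∉ interior (closedBall x ρ) → ‖z - x‖ = ρ := by
    intro z hz hz'; rw [mem_closedBall, dist_eq_norm] at hz; refine le_antisymm hz ?_
    by_contra hlt
    push Not at hlt
    refine hz' (ball_subset_interior_closedBall ?_)
    rwa [mem_ball, dist_eq_norm]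
  have hsphere : ∀ z ∈ closedBall x ρ, z ∉ interior (closedBall x ρ) →
      |v z - q 0 z| ≤ δ / 8 * ρ ^ 2 + δ * ρ ^ 2 / 16 := by
    intro z hz hz'; have a1 := h2 z hz; rw [hbd z hz hz'] at a1; have a2 := hva z (hball z hz).2
    have a3 : q 0 z = 1 / 2 * Qf M (z - x) + (⟪b, z - x⟫ + U x) := by simp [q]
    rw [a3]
    calc _ = |(v z - U z) + (U z - (1 / 2 * Qf M (z - x) + (⟪b, z - x⟫ + U x)))| := by ring_nf
      _ ≤ _ := (abs_add_le _ _).trans (by linarith)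
  have hqd : ∀ s z, q s z = q 0 z + s / 2 * ‖z - x‖ ^ 2 := by
    intro s z; simp only [q]; rw [hQ, hQ]; ring
  have fin : ∀ z ∈ interior (closedBall x ρ), |(hess v z).det - 1| ≤ ε := fun z hz => by
    have := hball z (interior_subset hz); exact (hvd z (by linarith) this.2).trans hε'2
  constructor
  · obtain ⟨z, hz, hz2⟩ := exists_hess_ge (hqs δ) hv.smooth (isCompact_closedBall x ρ) hx0 (by
      intro z hz hz'; have a1 := abs_le.1 (hsphere z hz hz'); rw [hqx, hqd, hbd z hz hz']
      linarith [hvx.1, a1.2])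
    refine ⟨hess v z, hv.posDef z, fin z hz, fun ξ => (hz2 ξ).trans (le_of_eq ?_)⟩
    rw [hess_quad (hS δ), hQ]
  · obtain ⟨z, hz, hz2⟩ := exists_hess_ge hv.smooth (hqs (-δ)) (isCompact_closedBall x ρ) hx0 (by
      intro z hz hz'; have a1 := abs_le.1 (hsphere z hz hz'); rw [hqx, hqd, hbd z hz hz']
      linarith [hvx.2, a1.1])
    refine ⟨hess v z, hv.posDef z, fin z hz, fun ξ => (le_of_eq ?_).trans (hz2 ξ)⟩
    rw [hess_quad (hS (-δ)), hQ]

lemma exists_Qf_lower (hM : M.PosDef) : ∃ c > 0, ∀ ξ : Eu n, c * ‖ξ‖ ^ 2 ≤ Qf M ξ := by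
  obtain ⟨L, B, -, h2, -, h4⟩ := exists_normalizing hM
  refine ⟨(‖mulE L‖ ^ 2 + 1)⁻¹, by positivity, fun ξ => ?_⟩; have h5 : Qf M ξ = ‖mulE B ξ‖ ^ 2 := by
    rw [h4, ← Qf_one, ← Qf_transpose_mul_mul, mul_one]
  have h6 : ‖ξ‖ ≤ ‖mulE L‖ * ‖mulE B ξ‖ := by
    have := (mulE L).le_opNorm (mulE B ξ)
    rwa [← mulE_mul, h2, mulE_one] at this
  have h7 : ‖ξ‖ ^ 2 ≤ ‖mulE L‖ ^ 2 * ‖mulE B ξ‖ ^ 2 := by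
    rw [← mul_pow]; exact pow_le_pow_left₀ (norm_nonneg _) h6 2
  rw [h5, inv_mul_le_iff₀ (by positivity)]; nlinarith [sq_nonneg ‖mulE B ξ‖]

lemma Peano.det_eq_one [NeZero n] (hp : Peano U M b x) (hM : M.IsHermitian) (h : QuadSupport C₀ U Gr)
    (ha : Approx U) (hx : x ≠ 0) : M.PosDef ∧ M.det = 1 := by
  have hps : M.PosSemidef := (posSemidef_iff_Qf hM).2 fun ξ => (hp.Qf_bounds h ξ).1
  have hS : ∀ s : ℝ, (M + s • (1 : Mat n)).IsHermitian := fun s =>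
    hM.add (isHermitian_one.smul (by simp [IsSelfAdjoint]))
  have hQ : ∀ (s : ℝ) (ξ : Eu n), Qf (M + s • (1 : Mat n)) ξ = Qf M ξ + s * ‖ξ‖ ^ 2 := by
    intro s ξ; rw [Qf_add_matrix, Qf_smul_matrix, Qf_one]
  have hcont : Tendsto (fun s : ℝ => (M + s • (1 : Mat n)).det) (𝓝 0) (𝓝 M.det) := by
    have : Continuous fun s : ℝ => (M + s • (1 : Mat n)).det :=
      (continuous_const.add (continuous_id.smul continuous_const)).matrix_det
    simpa using this.tendsto 0
  have hge : 1 ≤ M.det := by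
    refine ge_of_tendsto (hcont.mono_left (nhdsWithin_le_nhds (s := Set.Ioi 0))) ?_
    filter_upwards [self_mem_nhdsWithin] with δ hδ; have hδ0 : 0 < δ := hδ
    refine le_of_forall_pos_le_add fun ε hε => ?_
    obtain ⟨H, h1, h2, h3⟩ := (hp.touch hM ha hx hδ0 hε).1
    have hpd : (M + δ • (1 : Mat n)).PosDef := (posDef_iff_Qf (hS δ)).2 fun ξ hξ => by
      rw [hQ]; have := (hp.Qf_bounds h ξ).1; have := norm_pos_iff.2 hξ; positivity
    have := det_mono h1.posSemidef hpd fun ξ => by rw [hQ]; exact h3 ξ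
    linarith [(abs_le.1 h2).1]
  have hpd := posDef_of_posSemidef_det_pos hps (by linarith); refine ⟨hpd, le_antisymm ?_ hge⟩
  obtain ⟨c, hc, hcQ⟩ := exists_Qf_lower hpd
  refine le_of_tendsto (hcont.mono_left (nhdsWithin_le_nhds (s := Set.Iio 0))) ?_
  filter_upwards [self_mem_nhdsWithin, mem_nhdsWithin_of_mem_nhds (Ioi_mem_nhds (show -c < 0 by linarith))]
    with s hs hs'
  have hs0 : 0 < -s := neg_pos.2 hs; have hsc : -c < s := hs'
  refine le_of_forall_pos_le_add fun ε hε => ?_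
  obtain ⟨H, h1, h2, h3⟩ := (hp.touch hM ha hx hs0 hε).2
  have hps' : (M + s • (1 : Mat n)).PosSemidef := (posSemidef_iff_Qf (hS s)).2 fun ξ => by
    rw [hQ]; nlinarith [hcQ ξ, sq_nonneg ‖ξ‖]
  have := det_mono hps' h1 fun ξ => by rw [hQ]; have := h3 ξ; rwa [neg_neg] at this
  linarith [(abs_le.1 h2).2]

lemma Qf_lower_of_upper [NeZero n] (hM : M.PosDef) (hdet : M.det = 1) {Λ : ℝ} (hΛ : 0 < Λ)
    (hu : ∀ ξ : Eu n, Qf M ξ ≤ Λ * ‖ξ‖ ^ 2) {y : Eu n} (hy : ‖y‖ = 1) : Λ / (2 * Λ) ^ n ≤ Qf M y := by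
  have hq := (posDef_iff_Qf hM.1).1 hM
  have hm : 0 < Qf M y := hq y (by rw [← norm_ne_zero_iff, hy]; norm_num); set m := Qf M y with hmd
  let a : Fin n → ℝ := fun i => y i
  have ha : ∀ z : Eu n, ∑ i, a i * z i = ⟪y, z⟫ := fun z => by simp [PiLp.inner_apply, a, mul_comm]
  have ha2 : ∑ i, a i ^ 2 = 1 := by
    have := ha y; rw [real_inner_self_eq_norm_sq, hy] at this; rw [← one_pow 2, ← this]
    exact sum_congr rfl fun i _ => by simp [a, sq]
  let G : Mat n := (2 * Λ) • (1 + (-(1 - m / Λ)) • vecMulVec a a)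
  have hQG : ∀ z, Qf G z = 2 * Λ * (‖z‖ ^ 2 - (1 - m / Λ) * ⟪y, z⟫ ^ 2) := fun z => by
    simp only [G]
    rw [Qf_smul_matrix, Qf_add_matrix, Qf_one, Qf_smul_matrix, Qf_vecMulVec, ha]; ring
  have hle : ∀ z, Qf M z ≤ Qf G z := by
    intro z; set s := ⟪y, z⟫ with hs; set z' := z - s • y with hz'
    have h1 : ‖z'‖ ^ 2 = ‖z‖ ^ 2 - s ^ 2 := by
      rw [hz', norm_sub_sq_real, norm_smul, hy, inner_smul_right, real_inner_comm, ← hs, mul_one,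
        norm_eq_abs, sq_abs]; ring
    have h2 := Qf_add_sub M (s • y) z'; have h3 : s • y + z' = z := by rw [hz']; abel
    rw [h3, Qf_smul, ← hmd] at h2
    have h4 : 0 ≤ Qf M (s • y - z') := (posSemidef_iff_Qf hM.1).1 hM.posSemidef _; have h5 := hu z'
    rw [h1] at h5; rw [hQG]
    have h6 : 2 * Λ * (‖z‖ ^ 2 - (1 - m / Λ) * s ^ 2) = 2 * (Λ * (‖z‖ ^ 2 - s ^ 2)) + 2 * (s ^ 2 * m) := by
      field_simp; ring
    linarith
  have hGh : G.IsHermitian := by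
    refine (isHermitian_one.add ((isHermitian_vecMulVec_self a).smul ?_)).smul ?_ <;>
      simp [IsSelfAdjoint]
  have hGp : G.PosDef := (posDef_iff_Qf hGh).2 fun z hz => (hq z hz).trans_le (hle z)
  have h7 := det_mono hM.posSemidef hGp hle; simp only [G] at h7
  rw [det_smul, det_one_add_vecMulVec, ha2, hdet, card_fin] at h7; rw [div_le_iff₀ (by positivity)]
  have h8 : (2 * Λ) ^ n * (1 + -(1 - m / Λ) * 1) = (2 * Λ) ^ n * m / Λ := by ring
  rw [h8, le_div_iff₀ hΛ] at h7; linarith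

lemma exists_frame_bounds [NeZero n] (hM : M.PosDef) (hdet : M.det = 1) {Λ : ℝ} (hΛ : 0 < Λ)
    (hu : ∀ ξ : Eu n, Qf M ξ ≤ Λ * ‖ξ‖ ^ 2) :
    ∃ ξ : Fin n → Eu n, (∀ k, Qf M (ξ k) = 1) ∧
      (∀ G : Mat n, G.PosSemidef → G.det = 1 → (n : ℝ) ≤ ∑ k, Qf G (ξ k)) ∧
      (∀ y, ‖y‖ ^ 2 / Λ ≤ ∑ k, ⟪y, ξ k⟫ ^ 2) ∧ ∀ k, ‖ξ k‖ ^ 2 ≤ (2 * Λ) ^ n / Λ := by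
  obtain ⟨L, B, h1, h2, h3, h4⟩ := exists_normalizing hM
  set ξ : Fin n → Eu n := fun k => mulE L (single k 1) with hξ; have hcols : colsOf ξ = L := by
    ext i k; simp [colsOf, hξ, mulE_apply]
  have hL : L.det ^ 2 = 1 := by have := det_sq_mul_det h1; rwa [hdet, mul_one] at this
  have hk : ∀ k, Qf M (ξ k) = 1 := fun k => by rw [hξ, ← Qf_transpose_mul_mul, h1, Qf_one]; simp
  refine ⟨ξ, hk, fun G hG hGd => ?_, fun y => ?_, fun k => ?_⟩
  · have := amgm_frame hG ξ
    rw [hcols, hL, hGd, mul_one, one_rpow, mul_one] at this; exact this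
  · have a1 : ∑ k, ⟪y, ξ k⟫ ^ 2 = ‖mulE Lᵀ y‖ ^ 2 := by
      rw [EuclideanSpace.real_norm_sq_eq]; refine sum_congr rfl fun k _ => ?_
      congr 1
      rw [hξ, ← Bf_eq_inner, mulE_apply]; simp [Bf, mul_comm]
    have a2 : ‖y‖ ^ 2 ≤ ‖mulE Lᵀ y‖ * ‖mulE B y‖ := by
      have : ‖y‖ ^ 2 = ⟪mulE Lᵀ y, mulE B y⟫ := by
        rw [← real_inner_self_eq_norm_sq, inner_mulE_transpose, ← mulE_mul, h2, mulE_one]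
      rw [this]; exact real_inner_le_norm _ _
    have a3 : ‖mulE B y‖ ^ 2 ≤ Λ * ‖y‖ ^ 2 := by rw [← Qf_transpose_mul_self, ← h4]; exact hu y
    rw [a1, div_le_iff₀ hΛ]
    rcases eq_or_lt_of_le (norm_nonneg y) with h0 | h0
    · rw [← h0, zero_pow two_ne_zero]; positivity
    have a4 : (‖y‖ ^ 2) ^ 2 ≤ ‖mulE Lᵀ y‖ ^ 2 * (Λ * ‖y‖ ^ 2) := by
      calc (‖y‖ ^ 2) ^ 2 ≤ (‖mulE Lᵀ y‖ * ‖mulE B y‖) ^ 2 := by gcongr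
        _ = ‖mulE Lᵀ y‖ ^ 2 * ‖mulE B y‖ ^ 2 := by ring
        _ ≤ _ := by gcongr
    have a5 : 0 < ‖y‖ ^ 2 := by positivity
    nlinarith
  · have hn0 : ξ k ≠ 0 := fun h0 => by
      have := hk k; rw [h0, Qf_zero_right] at this; norm_num at this
    have hnp := norm_pos_iff.2 hn0; have a1 := Qf_lower_of_upper hM hdet hΛ hu (y := ‖ξ k‖⁻¹ • ξ k)
      (by rw [norm_unit hnp])
    rw [Qf_smul, hk, mul_one, inv_pow, div_le_iff₀ (by positivity)] at a1; rw [le_div_iff₀ hΛ]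
    rw [inv_mul_eq_div, le_div_iff₀ (by positivity)] at a1; linarith
end

lemma setIntegral_le_of_le (hg : Continuous g) {x : Eu n} {r c : ℝ} (hr : 0 ≤ r)
    (h : ∀ y ∈ closedBall x r, g y ≤ c) : ∫ y in closedBall x r, g y ≤ c * (ωn n * r ^ n) := by
  calc ∫ y in closedBall x r, g y ≤ ∫ y in closedBall x r, c :=
        int_mono h
    _ = c * (ωn n * r ^ n) := by rw [setIntegral_const, vol_closedBall x hr, smul_eq_mul]; ring

lemma sum_geom_add_le {κ e0 s : ℝ} (hκ : 0 ≤ κ) (hκ1 : κ < 1) (he : 0 ≤ e0) (J : ℕ) :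
    ∑ j ∈ range (J + 1), (e0 * κ ^ j + s) ≤ e0 / (1 - κ) + (J + 1) * s := by
  rw [sum_add_distrib, ← mul_sum, sum_const, Finset.card_range, nsmul_eq_mul]; push_cast
  have h1 : ∑ j ∈ range (J + 1), κ ^ j ≤ (1 - κ)⁻¹ := by
    rw [← tsum_geometric_of_lt_one hκ hκ1]
    exact (summable_geometric_of_lt_one hκ hκ1).sum_le_tsum _ fun j _ => by positivity
  rw [div_eq_mul_inv]; gcongr

lemma second_diff_of_mean (hv : ConvexOn ℝ Set.univ v) (hvc : Continuous v)
    {M : Mat n} {m r ε β : ℝ} (hm : 0 ≤ m) (hM : ∀ y : Eu n, Qf M y ≤ m * ‖y‖ ^ 2)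
    (hr : 0 < r) (hβ : 0 < β) (hβ1 : β ≤ 1 / 4)
    (h : QApprox v M 0 r (ε * r ^ (n + 2))) {x : Eu n} (hx : ‖x‖ ≤ r / 4) :
    |v x + v (-x) - 2 * v 0 - Qf M x| ≤ (16 * (ωn n)⁻¹ * (β ^ n)⁻¹ * ε + 4 * m * β ^ 2) * r ^ 2 := by
  obtain ⟨b, c, h⟩ := h
  obtain ⟨w, hw⟩ := ex_eq (fun x => v x - (1 / 2 * Qf M x + ⟪b, x⟫ + c) : Eu n → ℝ)
  have hwc : Continuous w := by rw [hw]; exact hvc.sub (continuous_quad M b c)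
  have hP : ∀ x y, (v (x + y) - w (x + y)) + (v (x - y) - w (x - y)) - 2 * (v x - w x) = Qf M y := by
    intro x y; rw [← Qf_quad_second_diff M b c x y, hw]; ring
  have hω := @ωn_pos n
  have key : ∀ z : Eu n, ‖z‖ ≤ r / 4 → |w z| ≤ (4 * (ωn n)⁻¹ * (β ^ n)⁻¹ * ε + m * β ^ 2) * r ^ 2 := by
    intro z hz; have h1 := convex_sup_le_integral hv hwc hm hM hP z (ρ := β * r) (by positivity)
    have h2 : ∫ y in closedBall z (2 * (β * r)), |w y| ≤ ε * r ^ (n + 2) := by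
      refine le_trans (setIntegral_mono_ball hwc.abs (fun _ => abs_nonneg _) ?_)
        (by rw [hw]; exact h)
      refine closedBall_subset_closedBall' ?_; rw [dist_zero_right]; nlinarith
    calc |w z| ≤ 4 * (ωn n * (β * r) ^ n)⁻¹ * (ε * r ^ (n + 2)) + m * (β * r) ^ 2 :=
          h1.trans (by gcongr)
      _ = _ := by rw [mul_pow, mul_pow, pow_add]; field_simp
  have e1 : v x + v (-x) - 2 * v 0 - Qf M x = w x + w (-x) - 2 * w 0 := by
    have := hP 0 x; rw [zero_add, zero_sub] at this; linarith
  have k1 := abs_le.1 (key x hx); have k2 := abs_le.1 (key (-x) (by rwa [norm_neg]))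
  have k3 := abs_le.1 (key 0 (by rw [norm_zero]; positivity)); rw [e1, abs_le]
  constructor <;> linarith [k1.1, k1.2, k2.1, k2.2, k3.1, k3.2]

set_option maxHeartbeats 1000000 in
lemma small_scale (n : ℕ) [NeZero n] {η : ℝ} (hη : 0 < η) : ∃ ε1 > 0, ∀ t : ℝ, 0 < t → t ≤ 1 / 4 →
    ∃ σ > 0, ∀ v : Eu n → ℝ, MAConvex v → ∀ (b : Eu n) (c : ℝ),
      (∀ y, ‖y‖ ≤ 1 → |v y - (1 / 2 * Qf 1 y + ⟪b, y⟫ + c)| ≤ ε1) →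
      (∀ y, ‖y‖ ≤ 1 → |dhess v y - 1| ≤ σ) →
      ∀ e, ‖e‖ = 1 → v (t • e) + v (-(t • e)) - 2 * v 0 ≤ (1 + η) * t ^ 2 := by
  obtain ⟨θ, ε0, C, hθ, hθ32, hε0, hC, hit⟩ := iteration n (a := 1 / 2) (by norm_num)
  have hω := @ωn_pos n; have hn : (0 : ℝ) < n := by exact_mod_cast Nat.pos_of_ne_zero (NeZero.ne n)
  obtain ⟨κ, hκ, hκ0⟩ := ex_pos (θ ^ (1 / 2 : ℝ))
  have hκ1 : κ < 1 := by rw [hκ]; exact Real.rpow_lt_one hθ.le (by linarith) (by norm_num)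
  obtain ⟨β, hβ, hβ0⟩ := ex_pos (min (1 / 4) (θ * sqrt (η / 384)))
  have hβ1 : β ≤ 1 / 4 := hβ ▸ min_le_left _ _; have hβ2 : 8 * β ^ 2 * (16 / θ ^ 2) ≤ η / 3 := by
    have h1 : β ^ 2 ≤ θ ^ 2 * (η / 384) := by
      calc β ^ 2 ≤ (θ * sqrt (η / 384)) ^ 2 := by gcongr; exact hβ ▸ min_le_right _ _
        _ = _ := by rw [mul_pow, sq_sqrt (by positivity)]
    calc 8 * β ^ 2 * (16 / θ ^ 2) ≤ 8 * (θ ^ 2 * (η / 384)) * (16 / θ ^ 2) := by gcongr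
      _ = η / 3 := by field_simp; norm_num
  obtain ⟨D, hD, hD0⟩ := ex_pos (16 * (ωn n)⁻¹ * (β ^ n)⁻¹ * (16 / θ ^ 2))
  obtain ⟨S, hS, hS0⟩ := ex_pos (min ε0 (min (1 / (n * C)) (min (η / (3 * (n * C))) (η / (3 * D)))))
  have hS1 : S ≤ ε0 := hS ▸ min_le_left _ _
  have hS2 : S ≤ 1 / (n * C) := hS ▸ (min_le_right _ _).trans (min_le_left _ _)
  have hS3 : S ≤ η / (3 * (n * C)) :=
    hS ▸ ((min_le_right _ _).trans (min_le_right _ _)).trans (min_le_left _ _)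
  have hS4 : S ≤ η / (3 * D) :=
    hS ▸ ((min_le_right _ _).trans (min_le_right _ _)).trans (min_le_right _ _)
  rw [le_div_iff₀ (by positivity)] at hS2 hS3 hS4; obtain ⟨e0, he₀⟩ := ex_eq (S * (1 - κ) / 2)
  have he0 : 0 < e0 := by rw [he₀]; have : 0 < 1 - κ := by linarith
                          positivity
  refine ⟨e0 / ωn n, by positivity, fun t ht ht4 => ?_⟩
  obtain ⟨J, hJ1, hJ2⟩ := exists_nat_pow_near_of_lt_one (show 0 < 4 * t by linarith) (by linarith) hθ
    (by linarith)
  obtain ⟨s, hs, hs0⟩ := ex_pos (S / (2 * (J + 1))); have h1κ : 0 < 1 - κ := by linarith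
  refine ⟨(1 - κ) * s / (C * ωn n), by positivity, fun v hv b c hvb hvd e he => ?_⟩
  have hσ0 : 0 ≤ (1 - κ) * s / C := by positivity
  have hsum : ∀ j ≤ J, ∑ i ∈ range (j + 1), (e0 * κ ^ i + s) ≤ S := by
    intro j hj; refine (sum_geom_add_le hκ0.le hκ1 he0.le j).trans ?_
    have h1 : e0 / (1 - κ) = S / 2 := by rw [he₀]; field_simp
    have h2 : ((j : ℝ) + 1) * s ≤ S / 2 := by
      have : (j : ℝ) ≤ J := by exact_mod_cast hj
      calc ((j : ℝ) + 1) * s ≤ (J + 1) * s := by gcongr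
        _ = S / 2 := by rw [hs]; field_simp
    linarith
  have hvc := hv.smooth.continuous
  obtain ⟨M, hM1, -, hM3, hM4⟩ := hit v hv (fun j => e0 * κ ^ j + s) (fun _ => (1 - κ) * s / C) J
    (fun j => by positivity) (fun j => hσ0)
    (fun j hj => by
      refine (setIntegral_le_of_le (hv.continuous_dhess.sub continuous_const).abs (by positivity)
        (c := (1 - κ) * s / (C * ωn n)) fun y hy => hvd y ?_).trans (le_of_eq ?_)
      · rw [mem_closedBall_zero_iff] at hy
        exact hy.trans (pow_le_one₀ hθ.le (by linarith))
      · field_simp)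
    (fun j hj => by
      rw [← hκ]; have : C * ((1 - κ) * s / C) = (1 - κ) * s := by field_simp
      rw [this, pow_succ]; linarith)
    ((hsum J le_rfl).trans hS1) ⟨b, c, by
      refine (setIntegral_le_of_le (hvc.sub (continuous_quad 1 b c)).abs zero_le_one
        (c := e0 / ωn n) fun y hy => hvb y (by rwa [mem_closedBall_zero_iff] at hy)).trans ?_
      rw [one_pow, mul_one, div_mul_cancel₀ _ hω.ne', pow_zero, mul_one]; linarith⟩ J le_rfl
  set E := ∑ i ∈ range (J + 1), (e0 * κ ^ i + s) with hE; have hE1 : E ≤ S := hsum J le_rfl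
  have hE0 : 0 ≤ E := sum_nonneg fun i _ => by positivity
  have hQ : ∀ y : Eu n, Qf M y ≤ (1 + n * (C * E)) * ‖y‖ ^ 2 := by
    intro y; have h1 := abs_Qf_le (S := M - 1) (by positivity) hM3 y
    rw [Qf_sub_matrix, Qf_one] at h1; linarith [(abs_le.1 h1).2]
  have hnCE : n * (C * E) ≤ S * (n * C) := by
    calc n * (C * E) ≤ n * (C * S) := by gcongr
      _ = _ := by ring
  have hte : ‖t • e‖ = t := by rw [norm_smul, he, mul_one, norm_of_nonneg ht.le]
  have hmain := second_diff_of_mean hv.convex hvc (m := 2) (by norm_num)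
    (fun y => (hQ y).trans (by gcongr; linarith)) (pow_pos hθ J) hβ0 hβ1 hM4 (x := t • e)
    (by rw [hte]; linarith)
  have hQe := hQ (t • e); rw [hte] at hQe; have heJ : e0 * κ ^ J + s ≤ S := by
    refine le_trans ?_ hE1
    exact single_le_sum (f := fun i => e0 * κ ^ i + s) (fun i _ => by positivity)
      (Finset.mem_range.2 (Nat.lt_succ_self J))
  have hθJ : (θ ^ J) ^ 2 ≤ 16 / θ ^ 2 * t ^ 2 := by
    have h1 : θ ^ J * θ ≤ 4 * t := by rw [← pow_succ]; exact hJ1.le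
    have h2 : (θ ^ J * θ) ^ 2 ≤ (4 * t) ^ 2 := by gcongr
    rw [div_mul_eq_mul_div, le_div_iff₀ (by positivity)]; linarith
  have hfin : (16 * (ωn n)⁻¹ * (β ^ n)⁻¹ * (e0 * κ ^ J + s) + 4 * 2 * β ^ 2) * (θ ^ J) ^ 2 ≤
      (η / 3 + η / 3) * t ^ 2 := by
    calc _ ≤ (16 * (ωn n)⁻¹ * (β ^ n)⁻¹ * S + 4 * 2 * β ^ 2) * (16 / θ ^ 2 * t ^ 2) := by gcongr
      _ = (S * D + 8 * β ^ 2 * (16 / θ ^ 2)) * t ^ 2 := by rw [hD]; ring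
      _ ≤ _ := by gcongr; linarith
  have h3 : n * (C * E) * t ^ 2 ≤ η / 3 * t ^ 2 := by gcongr; linarith
  linarith [(abs_le.1 hmain).2]

section
variable {C₀ : ℝ} {Gr : Eu n → Eu n}

set_option maxHeartbeats 1000000 in
lemma small_scale_approx [NeZero n] {A : Mat n} (hA : A.PosDef) (hdet : A.det = 1) {η : ℝ} (hη : 0 < η) :
    ∃ ε1 > 0, ∃ c0 > 0, ∀ U : Eu n → ℝ, Approx U → ∀ (q : Eu n) (δ : ℝ), 0 < δ → δ < ‖q‖ →
      ∀ (b : Eu n) (c : ℝ),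
      (∀ x ∈ closedBall q δ, |U x - (1 / 2 * Qf A (x - q) + ⟪b, x - q⟫ + c)| ≤ ε1 * δ ^ 2) →
      ∀ t, 0 < t → t ≤ c0 * δ → ∀ e, ‖e‖ = 1 →
        U (q + t • e) + U (q - t • e) - 2 * U q ≤ (Qf A e + η) * t ^ 2 := by
  obtain ⟨L, B, h1, h2, h3, h4⟩ := exists_normalizing hA
  have hBQ : ∀ e, Qf A e = ‖mulE B e‖ ^ 2 := fun e => by rw [h4, Qf_transpose_mul_self]
  have hL : L.det ^ 2 = 1 := by have := det_sq_mul_det h1; rwa [hdet, mul_one] at this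
  obtain ⟨ℓ, hℓ⟩ := ex_eq (‖mulE L‖ + 1); obtain ⟨β, hβ⟩ := ex_eq (‖mulE B‖ + 1)
  have hℓ1 : 1 ≤ ℓ := by rw [hℓ]; linarith [norm_nonneg (mulE L)]
  have hβ1 : 1 ≤ β := by rw [hβ]; linarith [norm_nonneg (mulE B)]
  obtain ⟨ε1, hε1, hS⟩ := small_scale n (η := η / β ^ 2) (by positivity)
  refine ⟨ε1 / (2 * ℓ ^ 2), by positivity, 1 / (4 * ℓ * β), by positivity, ?_⟩
  intro U hU q δ hδ hδq b c hUb t ht htc e he; have hBe : ‖mulE B e‖ ≤ β := by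
    have := (mulE B).le_opNorm e; rw [he] at this; linarith
  have he0 : e ≠ 0 := by rw [← norm_ne_zero_iff, he]; norm_num
  have hBe0 : 0 < ‖mulE B e‖ := by
    have := (posDef_iff_Qf hA.1).1 hA e he0; rw [hBQ] at this
    exact (sq_pos_iff.1 this |>.lt_of_le' (norm_nonneg _))
  obtain ⟨r, hr, hr0⟩ := ex_pos (δ / ℓ); have hrδ : r * ℓ = δ := by rw [hr]; field_simp
  obtain ⟨t', ht', ht'0⟩ := ex_pos (t * ‖mulE B e‖ / r); have ht'4 : t' ≤ 1 / 4 := by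
    rw [ht', div_le_iff₀ hr0, hr]
    calc t * ‖mulE B e‖ ≤ (1 / (4 * ℓ * β) * δ) * β := by gcongr
      _ = 1 / 4 * (δ / ℓ) := by field_simp
  have htδ : t ≤ δ := htc.trans (by
    refine mul_le_of_le_one_left hδ.le ?_; rw [div_le_one (by positivity)]; nlinarith)
  obtain ⟨σ, hσ, hS⟩ := hS t' ht'0 ht'4; refine le_of_forall_pos_le_add fun ε hε => ?_
  obtain ⟨ε', hε'⟩ := ex_eq (min (ε / 4) (min σ (min (‖q‖ - δ) (ε1 * r ^ 2 / 2))))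
  have hε'0 : 0 < ε' := by rw [hε']; positivity
  have e1 : ε' ≤ ε / 4 := hε' ▸ min_le_left _ _
  have e2 : ε' ≤ σ := hε' ▸ (min_le_right _ _).trans (min_le_left _ _)
  have e3 : ε' ≤ ‖q‖ - δ := hε' ▸ ((min_le_right _ _).trans (min_le_right _ _)).trans (min_le_left _ _)
  have e4 : ε' ≤ ε1 * r ^ 2 / 2 :=
    hε' ▸ ((min_le_right _ _).trans (min_le_right _ _)).trans (min_le_right _ _)
  obtain ⟨v, hv, hva, hvd⟩ := hU ε' hε'0 (‖q‖ + δ)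
  have hnorm : ∀ x ∈ closedBall q δ, ‖q‖ - δ ≤ ‖x‖ ∧ ‖x‖ ≤ ‖q‖ + δ := by
    intro x hx; rw [mem_closedBall, dist_eq_norm] at hx; have a1 := norm_sub_norm_le q x
    have a2 := norm_sub_norm_le x q; rw [norm_sub_rev] at a1; constructor <;> linarith
  have hmem : ∀ y : Eu n, ‖y‖ ≤ 1 → q + mulE (r • L) y ∈ closedBall q δ := by
    intro y hy; rw [mem_closedBall, dist_eq_norm, add_sub_cancel_left, mulE_smul, norm_smul,
      norm_of_nonneg hr0.le, ← hrδ]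
    gcongr; have := (mulE L).le_opNorm y; have : ‖mulE L‖ * ‖y‖ ≤ ‖mulE L‖ * 1 := by gcongr
    linarith
  have hmain := hS _ (rescale_maconvex hv hr0 q hL) (r⁻¹ • mulE Lᵀ b) (c / r ^ 2) (by
    intro y hy; have hx := hmem y hy; have a1 := hUb _ hx; have a2 := hva _ (hnorm _ hx).2
    rw [add_sub_cancel_left] at a1; have a3 : Qf A (mulE (r • L) y) = r ^ 2 * Qf 1 y := by
      rw [mulE_smul, Qf_smul, ← Qf_transpose_mul_mul, h1]
    have a4 : ⟪b, mulE (r • L) y⟫ = r ^ 2 * ⟪r⁻¹ • mulE Lᵀ b, y⟫ := by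
      rw [real_inner_smul_left, inner_mulE_transpose, mulE_smul, inner_smul_right]; field_simp
    rw [a3, a4] at a1; obtain ⟨V, hV⟩ := ex_eq (v (q + mulE (r • L) y)); rw [← hV] at a2 ⊢
    have a5 : (r ^ 2)⁻¹ * V - (1 / 2 * Qf 1 y + ⟪r⁻¹ • mulE Lᵀ b, y⟫ + c / r ^ 2) = (r ^ 2)⁻¹ *
        ((V - U (q + mulE (r • L) y)) + (U (q + mulE (r • L) y) - (1 / 2 * (r ^ 2 * Qf 1 y) +
          r ^ 2 * ⟪r⁻¹ • mulE Lᵀ b, y⟫ + c))) := by field_simp; ring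
    rw [a5, abs_mul, abs_of_pos (by positivity), inv_mul_le_iff₀ (by positivity)]
    refine (abs_add_le _ _).trans ?_
    have a6 : ε1 / (2 * ℓ ^ 2) * δ ^ 2 = ε1 * r ^ 2 / 2 := by rw [hr]; field_simp
    rw [a6] at a1; linarith) (by
    intro y hy; rw [dhess_rescale hv.smooth hr0 q hL]; have := hnorm _ (hmem y hy)
    exact (hvd _ (e3.trans this.1) this.2).trans e2) (‖mulE B e‖⁻¹ • mulE B e)
    (by rw [norm_unit hBe0])
  have hpt : mulE (r • L) (t' • ‖mulE B e‖⁻¹ • mulE B e) = t • e := by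
    rw [mulE_smul, map_smul, map_smul, ← mulE_mul, h2, mulE_one, smul_smul, smul_smul, ht']
    congr 1; field_simp
  rw [map_neg, hpt, map_zero, add_zero, ← sub_eq_add_neg] at hmain
  have hfin : v (q + t • e) + v (q - t • e) - 2 * v q ≤ (Qf A e + η) * t ^ 2 := by
    have b1 : (r ^ 2)⁻¹ * (v (q + t • e) + v (q - t • e) - 2 * v q) ≤ (1 + η / β ^ 2) * t' ^ 2 := by
      linarith
    rw [inv_mul_le_iff₀ (by positivity)] at b1; have b2 : r ^ 2 * ((1 + η / β ^ 2) * t' ^ 2) =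
        (‖mulE B e‖ ^ 2 + η * (‖mulE B e‖ ^ 2 / β ^ 2)) * t ^ 2 := by rw [ht']; field_simp
    have b3 : ‖mulE B e‖ ^ 2 / β ^ 2 ≤ 1 := (div_le_one (by positivity)).2 (by gcongr)
    rw [b2] at b1; refine b1.trans ?_; rw [hBQ]; gcongr; exact mul_le_of_le_one_right hη.le b3
  have hpm : ∀ w : Eu n, ‖w‖ ≤ δ → |v (q + w) - U (q + w)| ≤ ε / 4 := fun w hw =>
    (hva _ (hnorm _ (by rw [mem_closedBall, dist_eq_norm, add_sub_cancel_left]; exact hw)).2).trans e1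
  have hte : ‖t • e‖ = t := by rw [norm_smul, he, mul_one, norm_of_nonneg ht.le]
  have p1 := abs_le.1 (hpm (t • e) (by rw [hte]; exact htδ))
  have p2 := abs_le.1 (hpm (-(t • e)) (by rw [norm_neg, hte]; exact htδ))
  have p3 := abs_le.1 (hpm 0 (by rw [norm_zero]; exact hδ.le)); rw [← sub_eq_add_neg] at p2
  rw [add_zero] at p3; linarith [p1.1, p2.1, p3.2]

/-- A Gaussian barrier. -/
def gauss (a : ℝ) (p x : Eu n) : ℝ := exp (-(a * ‖x - p‖ ^ 2))

lemma contDiff_gauss (a : ℝ) (p : Eu n) : ContDiff ℝ 2 (gauss a p) :=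
  (contDiff_const.mul ((contDiff_id.sub contDiff_const).norm_sq ℝ)).neg.exp

lemma hasDerivAt_gauss_line (a : ℝ) (p x ξ : Eu n) (s : ℝ) : HasDerivAt (fun s : ℝ => gauss a p (x + s • ξ))
    (gauss a p (x + s • ξ) * -(a * (2 * ⟪x + s • ξ - p, ξ⟫))) s := by
  have h1 : HasDerivAt (fun s : ℝ => ‖x + s • ξ - p‖ ^ 2) (2 * ⟪x + s • ξ - p, ξ⟫) s :=
    ((hasDerivAt_add_smul x ξ s).sub_const p).norm_sq
  exact ((h1.const_mul a).neg).exp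

lemma Qf_hess_gauss (a : ℝ) (p x ξ : Eu n) : Qf (hess (gauss a p) x) ξ =
    gauss a p x * (4 * a ^ 2 * ⟪x - p, ξ⟫ ^ 2 - 2 * a * ‖ξ‖ ^ 2) := by
  have h0 : ∀ y ξ : Eu n, fderiv ℝ (gauss a p) y ξ = gauss a p y * -(a * (2 * ⟪y - p, ξ⟫)) := by
    intro y ξ; have h1 := hasDerivAt_line (contDiff_gauss a p) y ξ 0
    have h2 := hasDerivAt_gauss_line a p y ξ 0; simpa using h1.unique h2
  have h1 := hasDerivAt_line2 (contDiff_gauss a p) x ξ ξ 0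
  have hin : HasDerivAt (fun s : ℝ => ⟪x + s • ξ - p, ξ⟫) (‖ξ‖ ^ 2) 0 := by
    have := ((hasDerivAt_add_smul x ξ 0).sub_const p).inner ℝ (hasDerivAt_const (0 : ℝ) ξ)
    simpa [real_inner_self_eq_norm_sq] using this
  have h2 := (hasDerivAt_gauss_line a p x ξ 0).mul (((hin.const_mul 2).const_mul a).neg)
  have e : (fun s : ℝ => fderiv ℝ (gauss a p) (x + s • ξ) ξ) =
      fun s : ℝ => gauss a p (x + s • ξ) * -(a * (2 * ⟪x + s • ξ - p, ξ⟫)) := by ext s; rw [h0]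
  rw [e] at h1; have h3 := h1.unique h2; simp only [Pi.neg_apply, zero_smul, add_zero] at h3
  rw [Qf_eq_Bf, h3]; ring

lemma QuadSupport.ae_good [NeZero n] (h : QuadSupport C₀ U Gr) (ha : Approx U) :
    ∀ᵐ x, ∃ M : Mat n, M.PosDef ∧ M.det = 1 ∧ Peano U M (Gr x) x := by
  filter_upwards [h.ae_peano, ae_ne volume (0 : Eu n)] with x ⟨M, hM, hp⟩ hx
  obtain ⟨h1, h2⟩ := hp.det_eq_one hM h ha hx; exact ⟨M, h1, h2, hp⟩

lemma exists_lipschitzOn_gradient (hg : ContDiff ℝ 2 g) {Ω : Set (Eu n)}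
    (hΩ : IsCompact Ω) : ∃ K, LipschitzOnWith K (gradient g) Ω := by
  have h1 : ContDiff ℝ 1 (gradient g) :=
    (InnerProductSpace.toDual ℝ (Eu n)).symm.contDiff.comp (contDiff_one_fderiv hg)
  exact (h1.locallyLipschitz.locallyLipschitzOn).exists_lipschitzOnWith_of_compact hΩ

set_option maxHeartbeats 1000000 in
lemma QuadSupport.barrier [NeZero n] (h : QuadSupport C₀ U Gr) (ha : Approx U) {e p : Eu n}
    {δ R m η t a : ℝ} (hδ : 0 < δ) (hη : 0 < η) (ht : 0 < t)
    (haδ : n * (2 * (2 * C₀ + 1)) ^ n < 2 * a * δ ^ 2)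
    (hm : ∀ x, U (x + t • e) + U (x - t • e) - 2 * U x ≤ m * t ^ 2)
    (hm' : ∀ x, ‖x - p‖ ≤ δ → U (x + t • e) + U (x - t • e) - 2 * U x ≤ (m - η) * t ^ 2)
    {x : Eu n} (hx : ‖x - p‖ ≤ R) : U (x + t • e) + U (x - t • e) - 2 * U x ≤
      m * t ^ 2 - η * t ^ 2 * (gauss a p x - exp (-(a * R ^ 2))) := by
  have hC0 := h.nonneg; obtain ⟨Λ, hΛ⟩ := ex_eq (2 * C₀ + 1); have hΛ0 : 0 < Λ := by linarith
  rw [← hΛ] at haδ; have ha0 : 0 < a := by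
    have : 0 ≤ n * (2 * Λ) ^ n := by positivity
    by_contra hc
    push Not at hc
    nlinarith [sq_nonneg δ]
  have hηt : 0 < η * t ^ 2 := by positivity
  by_contra hcon
  push Not at hcon
  have hgle : gauss a p x ≤ 1 := Real.exp_le_one_iff.2 (by nlinarith [sq_nonneg ‖x - p‖])
  have hx1 : δ < ‖x - p‖ := by
    by_contra hle
    push Not at hle
    have h1 := hm' x hle; nlinarith [exp_pos (-(a * R ^ 2))]
  set f : Eu n → ℝ := fun x => U (x + t • e) + U (x + -(t • e)) + (-2) * U x + (η * t ^ 2) * gauss a p x with hf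
  set Ω : Set (Eu n) := {x | δ ≤ ‖x - p‖ ∧ ‖x - p‖ ≤ R}
  have hcn : Continuous fun x : Eu n => ‖x - p‖ := by fun_prop
  have hΩc : IsCompact Ω := by
    refine (isCompact_closedBall p R).of_isClosed_subset
      ((isClosed_le continuous_const hcn).inter (isClosed_le hcn continuous_const)) fun y hy => ?_
    rw [mem_closedBall, dist_eq_norm]; exact hy.2
  have hG : ∀ y, HasGradientAt f (Gr (y + t • e) + Gr (y + -(t • e)) + (-2 : ℝ) • Gr y +
      (η * t ^ 2) • gradient (gauss a p) y) y := by
    intro y; have htr : ∀ w : Eu n, HasGradientAt (fun y => U (y + w)) (Gr (y + w)) y := by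
      intro w; rw [hasGradientAt_iff_hasFDerivAt]
      have := (h.hasGradientAt (y + w)).hasFDerivAt.comp y ((hasFDerivAt_id y).add_const w)
      refine HasFDerivAt.congr_fderiv this ?_; ext; simp
    have hgg := ((hu_diff (contDiff_gauss a p)) y).hasGradientAt; rw [hasGradientAt_iff_hasFDerivAt]
    have := ((((htr (t • e)).hasFDerivAt.add (htr (-(t • e))).hasFDerivAt).add
      ((h.hasGradientAt y).hasFDerivAt.const_mul (-2))).add (hgg.hasFDerivAt.const_mul (η * t ^ 2)))
    refine this.congr_fderiv ?_; simp [map_add, map_smul]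
  have hl : ∃ K, LipschitzOnWith K (fun y => Gr (y + t • e) + Gr (y + -(t • e)) + (-2 : ℝ) • Gr y +
      (η * t ^ 2) • gradient (gauss a p) y) Ω := by
    obtain ⟨K, hK⟩ := exists_lipschitzOn_gradient (contDiff_gauss a p) hΩc
    refine ⟨(8 * C₀ + η * t ^ 2 * K).toNNReal, LipschitzOnWith.of_dist_le_mul fun y hy z hz => ?_⟩
    rw [coe_toNNReal _ (by positivity), dist_eq_norm, dist_eq_norm]
    have k1 := h.lipschitz (y + t • e) (z + t • e)
    have k2 := h.lipschitz (y + -(t • e)) (z + -(t • e)); have k3 := h.lipschitz y z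
    have k4 := hK.dist_le_mul y hy z hz; rw [add_sub_add_right_eq_sub] at k1 k2
    rw [dist_eq_norm, dist_eq_norm] at k4
    have e1 : Gr (y + t • e) + Gr (y + -(t • e)) + (-2 : ℝ) • Gr y + (η * t ^ 2) • gradient (gauss a p) y -
        (Gr (z + t • e) + Gr (z + -(t • e)) + (-2 : ℝ) • Gr z + (η * t ^ 2) • gradient (gauss a p) z) =
        (Gr (y + t • e) - Gr (z + t • e)) + (Gr (y + -(t • e)) - Gr (z + -(t • e))) +
        (-2 : ℝ) • (Gr y - Gr z) + (η * t ^ 2) • (gradient (gauss a p) y - gradient (gauss a p) z) := by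
      module
    rw [e1]; refine (norm_add_le _ _).trans ?_; refine (add_le_add (norm_add₃_le) le_rfl).trans ?_
    rw [norm_smul, norm_smul_of_nonneg hηt.le, norm_neg, Real.norm_ofNat]
    have k5 := mul_le_mul_of_nonneg_left k4 hηt.le; linarith
  obtain ⟨K, hK⟩ := hl
  set good : Eu n → Prop := fun x => ∃ M : Mat n, M.PosDef ∧ M.det = 1 ∧ Peano U M (Gr x) x
  have hae : ∀ᵐ x, good x ∧ good (x + t • e) ∧ good (x + -(t • e)) := by
    have h1 := h.ae_good ha
    exact h1.and (((measurePreserving_add_right volume (t • e)).quasiMeasurePreserving.ae h1).and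
      ((measurePreserving_add_right volume (-(t • e))).quasiMeasurePreserving.ae h1))
  have hfx : m * t ^ 2 + η * t ^ 2 * exp (-(a * R ^ 2)) < f x := by
    simp only [hf, ← sub_eq_add_neg]; linarith
  obtain ⟨z, hz, hzZ, p', hp'⟩ := exists_contact (f := f) hΩc hG hK (x0 := x) ⟨hx1.le, hx⟩ (by
    intro y hy hyi; refine lt_of_le_of_lt ?_ hfx; have hW := hm y
    by_cases hyR : ‖y - p‖ = R
    · have : gauss a p y = exp (-(a * R ^ 2)) := by rw [gauss, hyR]
      simp only [hf, ← sub_eq_add_neg, this]; linarith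
    · have hyδ : ‖y - p‖ ≤ δ := by
        by_contra hc
        push Not at hc
        refine hyi (mem_interior.2 ⟨{y | δ < ‖y - p‖ ∧ ‖y - p‖ < R}, fun w hw => ⟨hw.1.le, hw.2.le⟩,
          (isOpen_lt continuous_const hcn).inter (isOpen_lt hcn continuous_const),
          hc, lt_of_le_of_ne hy.2 hyR⟩)
      have h1 := hm' y hyδ
      have h2 : gauss a p y ≤ 1 := Real.exp_le_one_iff.2 (by nlinarith [sq_nonneg ‖y - p‖])
      have h3 := mul_le_mul_of_nonneg_left h2 hηt.le
      have h4 : 0 < η * t ^ 2 * exp (-(a * R ^ 2)) := by positivity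
      simp only [hf, ← sub_eq_add_neg]; linarith) (ae_iff.1 hae)
  simp only [mem_ofPred_eq, not_not] at hzZ
  obtain ⟨⟨M, hM, hMd, hMp⟩, ⟨M1, hM1, hMd1, hMp1⟩, ⟨M2, hM2, hMd2, hMp2⟩⟩ := hzZ
  have hq : ∀ ξ, Qf M1 ξ + Qf M2 ξ + (-2) * Qf M ξ + (η * t ^ 2) * (gauss a p z *
      (4 * a ^ 2 * ⟪z - p, ξ⟫ ^ 2 - 2 * a * ‖ξ‖ ^ 2)) ≤ 0 := by
    intro ξ; rw [← Qf_hess_gauss]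
    exact SymDeriv.nonpos ((((hMp1.symDeriv ξ).translate.add (hMp2.symDeriv ξ).translate).add
      ((hMp.symDeriv ξ).const_mul (-2))).add
      ((symDeriv_of_contDiff (contDiff_gauss a p) z ξ).const_mul (η * t ^ 2))) hp'
  obtain ⟨ξ, k1, k2, k3, k4⟩ := exists_frame_bounds hM hMd hΛ0 fun ξ =>
    (hMp.Qf_bounds h ξ).2.trans (by rw [hΛ]; gcongr; linarith)
  have hs := sum_le_sum fun k (_ : k ∈ Finset.univ) => hq (ξ k)
  simp only [sum_add_distrib, ← mul_sum, sum_sub_distrib, k1, sum_const,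
    card_univ, card_fin, nsmul_eq_mul, mul_zero, mul_one] at hs
  have b1 := k2 M1 hM1.posSemidef hMd1; have b2 := k2 M2 hM2.posSemidef hMd2; have b3 := k3 (z - p)
  have b4 : ∑ k, ‖ξ k‖ ^ 2 ≤ n * ((2 * Λ) ^ n / Λ) := by
    calc ∑ k, ‖ξ k‖ ^ 2 ≤ ∑ k : Fin n, (2 * Λ) ^ n / Λ := sum_le_sum fun k _ => k4 k
      _ = _ := by simp
  have hzδ : δ ≤ ‖z - p‖ := (interior_subset hz).1
  have b5 : 0 < 4 * a ^ 2 * ∑ k, ⟪z - p, ξ k⟫ ^ 2 - 2 * a * ∑ k, ‖ξ k‖ ^ 2 := by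
    have c1 : 4 * a ^ 2 * (δ ^ 2 / Λ) ≤ 4 * a ^ 2 * ∑ k, ⟪z - p, ξ k⟫ ^ 2 := by
      gcongr; refine le_trans ?_ b3; gcongr
    have c2 : 2 * a * ∑ k, ‖ξ k‖ ^ 2 ≤ 2 * a * (n * ((2 * Λ) ^ n / Λ)) := by gcongr
    have c3 : 2 * a * (n * ((2 * Λ) ^ n / Λ)) < 4 * a ^ 2 * (δ ^ 2 / Λ) := by
      have : 2 * a / Λ * (n * (2 * Λ) ^ n) < 2 * a / Λ * (2 * a * δ ^ 2) := by gcongr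
      calc _ = 2 * a / Λ * (n * (2 * Λ) ^ n) := by ring
        _ < 2 * a / Λ * (2 * a * δ ^ 2) := this
        _ = _ := by ring
    linarith
  have b6 : 0 < (η * t ^ 2) * (gauss a p z * (4 * a ^ 2 * ∑ k, ⟪z - p, ξ k⟫ ^ 2 - 2 * a * ∑ k, ‖ξ k‖ ^ 2)) :=
    mul_pos hηt (mul_pos (exp_pos _) b5)
  linarith
end

section
variable {C₀ : ℝ} {Gr : Eu n → Eu n}

lemma Qf_eq_of_le [NeZero n] {A M : Mat n} (hA : A.PosDef) (hM : M.PosDef) (hAd : A.det = 1)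
    (hMd : M.det = 1) (h : ∀ ξ : Eu n, Qf M ξ ≤ Qf A ξ) (e : Eu n) (he : e ≠ 0) : Qf M e = Qf A e := by
  have hq : 0 < Qf A e := (posDef_iff_Qf hA.1).1 hA e he
  obtain ⟨ξ, h1, h2, h3⟩ := exists_frame hA he
  have h4 := amgm_sheared hA.det_pos hM.posSemidef ξ h3 (fun _ => 0) rfl
  simp only [hAd, hMd, div_one, one_rpow, mul_one, zero_smul, add_zero] at h4
  have hA1 : ∀ k, Qf A (ξ k) = 1 := fun k => by rw [Qf_eq_Bf, h2, if_pos rfl]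
  have h5 : ∑ k, (Qf A (ξ k) - Qf M (ξ k)) ≤ 0 := by
    rw [sum_sub_distrib]; simp only [hA1, sum_const, card_univ, card_fin, nsmul_eq_mul, mul_one]
    linarith
  have h6 := single_le_sum (f := fun k => Qf A (ξ k) - Qf M (ξ k))
    (fun k _ => sub_nonneg.2 (h (ξ k))) (Finset.mem_univ 0)
  have h7 : Qf A (ξ 0) - Qf M (ξ 0) ≤ 0 := h6.trans h5
  rw [h1, Qf_smul, Qf_smul, ← mul_sub, inv_pow, sq_sqrt hq.le] at h7
  have h8 : 0 < (Qf A e)⁻¹ := inv_pos.2 hq; exact le_antisymm (h e) (by nlinarith)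

lemma QuadSupport.le_sq (h : QuadSupport C₀ U Gr) (h0 : U 0 = 0) (hnn : ∀ x, 0 ≤ U x) (x : Eu n) :
    U x ≤ 2 * C₀ * ‖x‖ ^ 2 := by
  have := (h.second_diff 0 x).2; rw [zero_add, zero_sub, h0] at this; linarith [hnn (-x)]

set_option maxHeartbeats 1000000 in
lemma QuadSupport.eq_paraboloid [NeZero n] (h : QuadSupport C₀ U Gr) (ha : Approx U) (h0 : U 0 = 0)
    (hnn : ∀ x, 0 ≤ U x) {A : Mat n} (hA : A.PosDef) (hAd : A.det = 1)
    (hs : ∀ x w, U (x + w) + U (x - w) - 2 * U x ≤ Qf A w) (x : Eu n) : U x = 1 / 2 * Qf A x := by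
  set F : Eu n → ℝ := fun x => 1 / 2 * Qf A x - U x with hF
  have hQ0 : ∀ x, 0 ≤ Qf A x := fun x => (posSemidef_iff_Qf hA.1).1 hA.posSemidef x
  have hF0 : ∀ w, 0 ≤ F w := by
    intro w; have hdbl : ∀ y, 2 * F y ≤ F ((2 : ℝ) • y) := by
      intro y; have h1 := hs y y; rw [← two_smul ℝ y, sub_self, h0] at h1; simp only [hF, Qf_smul]
      linarith
    have hk : ∀ k : ℕ, 2 ^ k * F (((2 : ℝ) ^ k)⁻¹ • w) ≤ F w := by
      intro k
      induction k with
      | zero => simp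
      | succ k ih =>
        refine le_trans ?_ ih; have := hdbl (((2 : ℝ) ^ (k + 1))⁻¹ • w)
        have e1 : (2 : ℝ) • ((2 : ℝ) ^ (k + 1))⁻¹ • w = ((2 : ℝ) ^ k)⁻¹ • w := by
          rw [smul_smul, pow_succ]; congr 1; field_simp
        rw [e1] at this
        calc _ = 2 ^ k * (2 * F (((2 : ℝ) ^ (k + 1))⁻¹ • w)) := by rw [pow_succ, mul_assoc]
          _ ≤ _ := by gcongr
    have hk2 : ∀ k : ℕ, -(2 * C₀ * ‖w‖ ^ 2) * (1 / 2) ^ k ≤ F w := by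
      intro k; refine le_trans ?_ (hk k); have h1 := h.le_sq h0 hnn (((2 : ℝ) ^ k)⁻¹ • w)
      have h2 := hQ0 (((2 : ℝ) ^ k)⁻¹ • w)
      rw [norm_smul, mul_pow, norm_of_nonneg (by positivity)] at h1
      have h3 : -(2 * C₀ * (((2 : ℝ) ^ k)⁻¹ ^ 2 * ‖w‖ ^ 2)) ≤ F (((2 : ℝ) ^ k)⁻¹ • w) := by
        simp only [hF]; linarith
      calc _ = 2 ^ k * -(2 * C₀ * (((2 : ℝ) ^ k)⁻¹ ^ 2 * ‖w‖ ^ 2)) := by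
            rw [one_div, inv_pow]; field_simp
        _ ≤ _ := by gcongr
    have ht := (tendsto_pow_atTop_nhds_zero_of_lt_one (show (0 : ℝ) ≤ 1 / 2 by norm_num)
      (by norm_num)).const_mul (-(2 * C₀ * ‖w‖ ^ 2))
    rw [mul_zero] at ht; exact le_of_tendsto' ht hk2
  suffices hle : F x ≤ 0 by have := hF0 x; simp only [hF] at *; linarith
  by_contra hpos
  push Not at hpos
  have hx0 : x ≠ 0 := by rintro rfl; simp [hF, h0, Qf_zero_right] at hpos
  obtain ⟨b, hb⟩ := ex_eq (‖x‖); have hb0 : 0 < b := hb ▸ norm_pos_iff.2 hx0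
  obtain ⟨e, he⟩ := ex_eq (b⁻¹ • x : Eu n)
  have hxe : x = b • e := by rw [he, smul_smul, mul_inv_cancel₀ hb0.ne', one_smul]
  have hen : ‖e‖ = 1 := by rw [he, norm_smul, ← hb, norm_inv, norm_of_nonneg hb0.le, inv_mul_cancel₀ hb0.ne']
  have he0 : e ≠ 0 := by rw [← norm_ne_zero_iff, hen]; norm_num
  have hee : ⟪e, e⟫ = 1 := by rw [real_inner_self_eq_norm_sq, hen, one_pow]
  have hFc : Continuous F := (continuous_const.mul (contDiff_Qf A (k := 2)).continuous).sub h.continuous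
  obtain ⟨φ, hφ, hφ0⟩ := ex_pos (F x / 4); obtain ⟨ρ, hρ, hρF⟩ := Metric.eventually_nhds_iff_ball.1
    (hFc.continuousAt.eventually (lt_mem_nhds (show 2 * φ < F x by linarith)))
  obtain ⟨γ, hγ⟩ := ex_eq (φ / b); obtain ⟨δ, hδ⟩ := ex_eq (φ / (2 * b ^ 2))
  obtain ⟨K, hK⟩ := ex_eq (16 * φ / ρ ^ 2); have hγ0 : 0 < γ := by rw [hγ]; positivity
  have hδ0 : 0 < δ := by rw [hδ]; positivity
  have hK0 : 0 < K := by rw [hK]; positivity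
  have hγb : γ * b = φ := by rw [hγ]; field_simp
  have hδb : δ * b ^ 2 = φ / 2 := by rw [hδ]; field_simp
  have hKρ : K * ρ ^ 2 = 16 * φ := by rw [hK]; field_simp
  set g : Eu n → ℝ := fun y => 1 / 2 * δ * ⟪y, e⟫ ^ 2 + γ * ⟪y, e⟫ - 1 / 2 * K * (‖y‖ ^ 2 - ⟪y, e⟫ ^ 2) with hg
  have hgc : ContDiff ℝ 2 g := by
    have h1 : ContDiff ℝ 2 fun y : Eu n => ⟪y, e⟫ := contDiff_id.inner ℝ contDiff_const
    exact ((contDiff_const.mul (h1.pow 2)).add (contDiff_const.mul h1)).sub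
      (contDiff_const.mul ((contDiff_norm_sq ℝ).sub (h1.pow 2)))
  have hqc : ContDiff ℝ 2 fun y : Eu n => (-1) * (1 / 2 * Qf A y) :=
    contDiff_const.mul (contDiff_const.mul (contDiff_Qf A))
  have hgs : ∀ z, SymDeriv g δ z e := by
    intro z; refine tendsto_const_nhds.congr' ?_; filter_upwards [self_mem_nhdsWithin] with s hs
    have hs0 : s ≠ 0 := hs; have e1 : g (z + s • e) + g (z - s • e) - 2 * g z = δ * s ^ 2 := by
      simp only [hg, inner_add_left, inner_sub_left, real_inner_smul_left, hee, norm_add_sq_real,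
        norm_sub_sq_real, inner_smul_right, norm_smul, hen, norm_eq_abs, mul_one, sq_abs]
      ring
    rw [e1]; field_simp
  set f : Eu n → ℝ := fun y => (U y + (-1) * (1 / 2 * Qf A y)) + g y with hf
  have hfF : ∀ y, f y = -F y + g y := fun y => by simp only [hf, hF]; ring
  have hG : ∀ y, HasGradientAt f (Gr y + gradient (fun y : Eu n => (-1) * (1 / 2 * Qf A y)) y +
      gradient g y) y := by
    intro y; rw [hasGradientAt_iff_hasFDerivAt, map_add, map_add]
    exact ((h.hasGradientAt y).hasFDerivAt.add ((hu_diff hqc) y).hasGradientAt.hasFDerivAt).add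
      ((hu_diff hgc) y).hasGradientAt.hasFDerivAt
  have hΩ := isCompact_closedBall (0 : Eu n) b
  obtain ⟨K1, hK1⟩ := exists_lipschitzOn_gradient hqc hΩ
  obtain ⟨K2, hK2⟩ := exists_lipschitzOn_gradient hgc hΩ
  have hl : LipschitzWith (2 * C₀).toNNReal Gr := LipschitzWith.of_dist_le_mul fun x y => by
    rw [dist_eq_norm, dist_eq_norm, coe_toNNReal _ (by linarith [h.nonneg])]; exact h.lipschitz x y
  have hg0 : f 0 = 0 := by simp [hf, hg, h0, Qf_zero_right]
  obtain ⟨z, hz, hzZ, p', hp'⟩ := exists_contact (f := f) hΩ hG ((hl.lipschitzOnWith.add hK1).add hK2)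
    (x0 := 0) (mem_closedBall_self hb0.le) (by
    intro y hy hyi; rw [hg0, hfF]; have hyb : ‖y‖ = b := by
      rw [mem_closedBall_zero_iff] at hy
      refine le_antisymm hy (not_lt.1 fun hlt => hyi (ball_subset_interior_closedBall ?_))
      rwa [mem_ball_zero_iff]
    obtain ⟨s, hsd⟩ := ex_eq (⟪y, e⟫); have hsb : |s| ≤ b := by
      have := abs_real_inner_le_norm y e
      rwa [hyb, hen, mul_one, ← hsd] at this
    have hs2 : s ^ 2 ≤ b ^ 2 := sq_le_sq' (abs_le.1 hsb).1 (abs_le.1 hsb).2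
    have hδs : 1 / 2 * δ * s ^ 2 ≤ φ / 4 := by
      have := mul_le_mul_of_nonneg_left hs2 hδ0.le; linarith
    have hFy := hF0 y
    have hKs : 0 ≤ 1 / 2 * K * (b ^ 2 - s ^ 2) := mul_nonneg (by positivity) (by linarith)
    have hγs : γ * s ≤ φ := by rw [← hγb]; gcongr; exact (abs_le.1 hsb).2
    simp only [hg]; rw [hyb, ← hsd]
    rcases lt_or_ge ‖y - x‖ ρ with hyx | hyx
    · have := hρF y (by rwa [mem_ball, dist_eq_norm])
      linarith
    · have h1 : ρ ^ 2 ≤ ‖y - x‖ ^ 2 := by gcongr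
      have h2 : ‖y - x‖ ^ 2 = 2 * b ^ 2 - 2 * b * s := by
        rw [norm_sub_sq_real, hyb, ← hb, hxe, inner_smul_right, ← hsd]; ring
      rcases le_or_gt s (-(b / 2)) with h3 | h3
      · have : γ * s ≤ γ * (-(b / 2)) := by gcongr
        linarith
      · have h4 : ρ ^ 2 / 4 ≤ b ^ 2 - s ^ 2 := by
          have h5 : (b / 2) * (ρ ^ 2) ≤ (b + s) * (2 * b ^ 2 - 2 * b * s) := by
            rw [h2] at h1; exact mul_le_mul (by linarith) h1 (by positivity) (by linarith)
          have h6 : b * (ρ ^ 2 / 4) ≤ b * (b ^ 2 - s ^ 2) := by nlinarith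
          exact le_of_mul_le_mul_left h6 hb0
        have h7 : 1 / 2 * K * (ρ ^ 2 / 4) ≤ 1 / 2 * K * (b ^ 2 - s ^ 2) := by gcongr
        linarith) (ae_iff.1 (h.ae_good ha))
  simp only [mem_ofPred_eq, not_not] at hzZ; obtain ⟨M, hM, hMd, hMp⟩ := hzZ
  have hMA : ∀ ξ, Qf M ξ ≤ Qf A ξ := fun ξ => by
    refine le_of_tendsto (hMp.symDeriv ξ) ?_; filter_upwards [self_mem_nhdsWithin] with s hs'
    have hs0 : s ≠ 0 := hs'; rw [div_le_iff₀ (by positivity), mul_comm (Qf A ξ), ← Qf_smul]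
    exact hs z (s • ξ)
  have hq := SymDeriv.nonpos (((hMp.symDeriv e).add
    ((symDeriv_of_contDiff (contDiff_const.mul (contDiff_Qf A)) z e).const_mul (-1))).add (hgs z)) hp'
  rw [hess_half_Qf A hA.1, Qf_eq_of_le hA hM hAd hMd hMA e he0] at hq; linarith

lemma QuadSupport.rescale (h : QuadSupport C₀ U Gr) {r : ℝ} (hr : 0 < r) :
    QuadSupport C₀ (fun x => (r ^ 2)⁻¹ * U (r • x)) fun x => r⁻¹ • Gr (r • x) := by
  intro x y; have h1 := h (r • x) (r • y)
  rw [← smul_sub, norm_smul, mul_pow, norm_of_nonneg hr.le, inner_smul_right] at h1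
  have e1 : (r ^ 2)⁻¹ * U (r • y) - (r ^ 2)⁻¹ * U (r • x) - ⟪r⁻¹ • Gr (r • x), y - x⟫ =
      (r ^ 2)⁻¹ * (U (r • y) - U (r • x) - r * ⟪Gr (r • x), y - x⟫) := by
    rw [real_inner_smul_left]; field_simp
  rw [e1]; refine ⟨mul_nonneg (by positivity) h1.1, ?_⟩; rw [inv_mul_le_iff₀ (by positivity)]
  linarith [h1.2]

lemma Approx.rescale (h : Approx U) {r : ℝ} (hr : 1 ≤ r) : Approx fun x => (r ^ 2)⁻¹ * U (r • x) := by
  intro ε hε R; have hr0 : 0 < r := by linarith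
  obtain ⟨v, hv, h1, h2⟩ := h ε hε (r * R)
  have e1 : ∀ x : Eu n, (0 : Eu n) + mulE (r • (1 : Mat n)) x = r • x := fun x => by
    rw [zero_add, mulE_smul, mulE_one]
  refine ⟨_, rescale_maconvex hv hr0 0 (L := 1) (by simp), fun x hx => ?_, fun x hx hxR => ?_⟩
  · have h3 := h1 (r • x) (by rw [norm_smul_of_nonneg hr0.le]; gcongr)
    rw [e1, ← mul_sub, abs_mul, abs_of_pos (by positivity), inv_mul_le_iff₀ (by positivity)]
    refine h3.trans (le_mul_of_one_le_left hε.le (one_le_pow₀ hr))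
  · rw [dhess_rescale hv.smooth hr0 0 (by simp), e1]
    refine h2 (r • x) ?_ ?_ <;> rw [norm_smul_of_nonneg hr0.le]
    · exact hx.trans (le_mul_of_one_le_left (norm_nonneg _) hr)
    · gcongr

lemma approx_of_forall (h : ∀ ε > 0, ∀ R : ℝ, ∃ V, Approx V ∧ ∀ x, ‖x‖ ≤ R → |V x - U x| ≤ ε) :
    Approx U := by
  intro ε hε R; obtain ⟨V, hV, h1⟩ := h (ε / 2) (by positivity) R
  obtain ⟨v, hv, h2, h3⟩ := hV (ε / 2) (by positivity) R
  refine ⟨v, hv, fun x hx => ?_, fun x hx hxR => ?_⟩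
  · calc |v x - U x| ≤ |v x - V x| + |V x - U x| := abs_sub_le _ _ _
      _ ≤ ε := by linarith [h2 x hx, h1 x hx]
  · linarith [h3 x (by linarith) hxR]

set_option maxHeartbeats 1000000 in
/-- Entire solutions with bounded second differences are paraboloids. -/
theorem liouville [NeZero n] (h : QuadSupport C₀ U Gr) (ha : Approx U) (h0 : U 0 = 0)
    (hnn : ∀ x, 0 ≤ U x) : ∃ A : Mat n, A.PosDef ∧ A.det = 1 ∧ ∀ x, U x = 1 / 2 * Qf A x := by
  have hC0 := h.nonneg; set l : Ultrafilter ℕ := hyperfilter ℕ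
  have hla : (l : Filter ℕ) ≤ atTop := by rw [← Nat.cofinite_eq_atTop]; exact hyperfilter_le_cofinite
  set V : ℕ → Eu n → ℝ := fun k x => (((k : ℝ) + 1) ^ 2)⁻¹ * U (((k : ℝ) + 1) • x) with hV
  have hr : ∀ k : ℕ, (0 : ℝ) < (k : ℝ) + 1 := fun k => by positivity
  have hVs : ∀ k, QuadSupport C₀ (V k) _ := fun k => h.rescale (hr k)
  have hVa : ∀ k, Approx (V k) := fun k => ha.rescale (by linarith [(Nat.cast_nonneg k : (0 : ℝ) ≤ k)])
  obtain ⟨W, Gw, hW, -, hWu⟩ := exists_ultralimit l V _ (fun k x y => (hVs k x y).1) (C₀ := 2 * C₀)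
    (fun R => ⟨2 * C₀ * R ^ 2, Eventually.of_forall fun k x hx => by
      have a1 := (hVs k).le_sq (by simp [hV, h0]) (fun x => mul_nonneg (by positivity) (hnn _)) x
      have a2 : 0 ≤ V k x := mul_nonneg (by positivity) (hnn _); rw [abs_of_nonneg a2]
      exact a1.trans (by gcongr)⟩)
    (fun x w _ => Eventually.of_forall fun k => ((hVs k).second_diff x w).2)
  have hWa : Approx W := approx_of_forall fun ε hε R => by
    obtain ⟨k, hk⟩ := (hWu ε hε R).exists; exact ⟨V k, hVa k, hk⟩
  obtain ⟨p, ⟨A, hA, hAd, hAp⟩, hp0⟩ := ((hW.ae_good hWa).and (ae_ne volume (0 : Eu n))).exists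
  refine ⟨A, hA, hAd, h.eq_paraboloid ha h0 hnn hA hAd ?_⟩
  have key : ∀ e : Eu n, ‖e‖ = 1 → ∀ (x : Eu n) (t : ℝ), 0 < t →
      (U (x + t • e) + U (x - t • e) - 2 * U x) / t ^ 2 ≤ Qf A e := by
    intro e he
    set S : Set ℝ := {q | ∃ (x : Eu n) (t : ℝ), 0 < t ∧ q = (U (x + t • e) + U (x - t • e) - 2 * U x) / t ^ 2}
      with hS
    have hSb : BddAbove S := by
      refine ⟨2 * C₀, ?_⟩; rintro _ ⟨x, t, ht, rfl⟩; have := (h.second_diff x (t • e)).2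
      rw [norm_smul, he, mul_one, norm_of_nonneg ht.le] at this
      rwa [div_le_iff₀ (by positivity)]
    have hSne : S.Nonempty := ⟨_, 0, 1, one_pos, rfl⟩; obtain ⟨m, hm⟩ := ex_eq (sSup S)
    have hmS : ∀ x (t : ℝ), 0 < t → (U (x + t • e) + U (x - t • e) - 2 * U x) / t ^ 2 ≤ m :=
      fun x t ht => hm ▸ le_csSup hSb ⟨x, t, ht, rfl⟩
    suffices hmA : m ≤ Qf A e from fun x t ht => (hmS x t ht).trans hmA
    by_contra hlt
    push Not at hlt
    obtain ⟨η, hη⟩ := ex_eq ((m - Qf A e) / 2); have hη0 : 0 < η := by rw [hη]; linarith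
    obtain ⟨ε1, hε1, c0, hc0, hss⟩ := small_scale_approx hA hAd hη0
    obtain ⟨ρ, hρ, hPρ⟩ := Metric.eventually_nhds_iff_ball.1 (hAp.bound (show 0 < ε1 / 8 by positivity))
    obtain ⟨δ, hδ, hδ0⟩ := ex_pos (min (ρ / 3) (‖p‖ / 4))
    have hδ1 : δ ≤ ρ / 3 := hδ ▸ min_le_left _ _; have hδ2 : δ ≤ ‖p‖ / 4 := hδ ▸ min_le_right _ _
    obtain ⟨a, had, ha0⟩ := ex_pos ((n * (2 * (2 * C₀ + 1)) ^ n + 1) / (2 * δ ^ 2))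
    have haδ : n * (2 * (2 * C₀ + 1)) ^ n < 2 * a * δ ^ 2 := by
      have : 2 * a * δ ^ 2 = n * (2 * (2 * C₀ + 1)) ^ n + 1 := by rw [had]; field_simp
      linarith
    obtain ⟨b0, hb₀⟩ := ex_eq (exp (-(a * (3 / 2 * ‖p‖) ^ 2)) - exp (-(a * (2 * ‖p‖) ^ 2)))
    have hb₀0 : 0 < b0 := by rw [hb₀, sub_pos, Real.exp_lt_exp, neg_lt_neg_iff]; gcongr; norm_num
    have hev : ∀ᶠ k in (l : Filter ℕ), ∀ t, 0 < t → t ≤ c0 * δ → ∀ x, ‖x‖ ≤ ‖p‖ / 2 →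
        V k (x + t • e) + V k (x - t • e) - 2 * V k x ≤ (m - η * b0) * t ^ 2 := by
      filter_upwards [hWu (ε1 * δ ^ 2 / 2) (by positivity) (‖p‖ + 2 * δ)] with k hk t ht htc x hx
      have hVm : ∀ x, V k (x + t • e) + V k (x - t • e) - 2 * V k x ≤ m * t ^ 2 := by
        intro x; have h1 := hmS (((k : ℝ) + 1) • x) (((k : ℝ) + 1) * t) (mul_pos (hr k) ht)
        rw [div_le_iff₀ (by have := hr k; positivity)] at h1
        simp only [hV, smul_add, smul_sub, smul_smul]
        have e1 : ∀ A B C : ℝ, (((k : ℝ) + 1) ^ 2)⁻¹ * A + (((k : ℝ) + 1) ^ 2)⁻¹ * B -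
            2 * ((((k : ℝ) + 1) ^ 2)⁻¹ * C) = (((k : ℝ) + 1) ^ 2)⁻¹ * (A + B - 2 * C) := fun A B C => by ring
        rw [e1, inv_mul_le_iff₀ (by have := hr k; positivity)]; linarith
      have hVm' : ∀ x, ‖x - p‖ ≤ δ → V k (x + t • e) + V k (x - t • e) - 2 * V k x ≤ (m - η) * t ^ 2 := by
        intro q hq; have hqp : ‖p‖ - δ ≤ ‖q‖ := by
          have := norm_sub_norm_le p q; rw [norm_sub_rev] at this; linarith
        have h1 := hss (V k) (hVa k) q δ hδ0 (by linarith) (Gw p + mulE A (q - p))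
          (1 / 2 * Qf A (q - p) + ⟪Gw p, q - p⟫ + W p) (by
          intro y hy; rw [mem_closedBall, dist_eq_norm] at hy; have hyp : ‖y - p‖ ≤ 2 * δ := by
            have := norm_sub_le_norm_sub_add_norm_sub y q p; linarith
          have h2 := hPρ (y - p) (by rw [mem_ball_zero_iff]; linarith)
          rw [add_sub_cancel, norm_pow, norm_norm, norm_eq_abs] at h2; have h3 := hk y (by
            have := norm_sub_norm_le y p; linarith)
          have h4 : ‖y - p‖ ^ 2 ≤ (2 * δ) ^ 2 := by gcongr
          have h5 : 1 / 2 * Qf A (y - q) + ⟪Gw p + mulE A (q - p), y - q⟫ +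
              (1 / 2 * Qf A (q - p) + ⟪Gw p, q - p⟫ + W p) =
              1 / 2 * Qf A (y - p) + ⟪Gw p, y - p⟫ + W p := by
            have h6 : y - p = (y - q) + (q - p) := by abel
            have h7 : Qf A ((y - q) + (q - p)) = Qf A (y - q) + 2 * Bf A (y - q) (q - p) + Qf A (q - p) := Qf_add A hA.1 _ _
            rw [h6, h7, Bf_eq_inner, inner_add_left, inner_add_right, real_inner_comm (y - q) (mulE A (q - p))]
            ring
          rw [h5]
          calc _ = |(V k y - W y) + (W y - W p - ⟪Gw p, y - p⟫ - 1 / 2 * Qf A (y - p))| := by ring_nf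
            _ ≤ ε1 * δ ^ 2 / 2 + ε1 / 8 * (2 * δ) ^ 2 :=
                (abs_add_le _ _).trans (add_le_add h3 (h2.trans (by gcongr)))
            _ = _ := by ring) t ht htc e he
        have h2 : Qf A e + η = m - η := by rw [hη]; ring
        rwa [h2] at h1
      have h1 := (hVs k).barrier (hVa k) hδ0 hη0 ht haδ hVm hVm' (R := 2 * ‖p‖) (x := x)
        ((norm_sub_le _ _).trans (by linarith))
      refine h1.trans ?_; have h2 : b0 ≤ gauss a p x - exp (-(a * (2 * ‖p‖) ^ 2)) := by
        rw [hb₀, gauss]; have : ‖x - p‖ ≤ 3 / 2 * ‖p‖ := (norm_sub_le _ _).trans (by linarith)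
        gcongr
      have h3 := mul_le_mul_of_nonneg_left h2 (show 0 ≤ η * t ^ 2 by positivity); linarith
    have hbound : m ≤ m - η * b0 := by
      conv_lhs => rw [hm]
      refine csSup_le hSne ?_; rintro _ ⟨x, t, ht, rfl⟩
      have hlarge : ∀ᶠ k : ℕ in (l : Filter ℕ), max (‖x‖ / (‖p‖ / 2)) (t / (c0 * δ)) ≤ (k : ℝ) :=
        hla (tendsto_natCast_atTop_atTop.eventually_ge_atTop _)
      obtain ⟨k, hk1, hk2⟩ := (hev.and hlarge).exists; have hk3 := (le_max_left _ _).trans hk2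
      have hk4 := (le_max_right _ _).trans hk2; rw [div_le_iff₀ (by positivity)] at hk3 hk4
      have hrk := hr k; have h1 := hk1 (((k : ℝ) + 1)⁻¹ * t) (by positivity) (by
        rw [inv_mul_le_iff₀ hrk]; have : 0 < c0 * δ := by positivity
        linarith) (((k : ℝ) + 1)⁻¹ • x) (by
        rw [norm_smul, norm_inv, norm_of_nonneg hrk.le, inv_mul_le_iff₀ hrk]; linarith)
      simp only [hV, smul_add, smul_sub, smul_smul, mul_inv_cancel_left₀ hrk.ne',
        mul_inv_cancel₀ hrk.ne', one_smul] at h1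
      rw [div_le_iff₀ (by positivity)]
      have e1 : ∀ A B C : ℝ, (((k : ℝ) + 1) ^ 2)⁻¹ * A + (((k : ℝ) + 1) ^ 2)⁻¹ * B -
          2 * ((((k : ℝ) + 1) ^ 2)⁻¹ * C) = (((k : ℝ) + 1) ^ 2)⁻¹ * (A + B - 2 * C) := fun A B C => by ring
      rw [e1, inv_mul_le_iff₀ (by positivity)] at h1; refine h1.trans (le_of_eq ?_); field_simp
    have := mul_pos hη0 hb₀0; linarith
  intro x w
  rcases eq_or_ne w 0 with rfl | hw
  · simp [Qf_zero_right]; linarith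
  have hwn := norm_pos_iff.2 hw; have h1 := key (‖w‖⁻¹ • w) (by rw [norm_unit hwn]) x ‖w‖ hwn
  rw [smul_smul, mul_inv_cancel₀ hwn.ne', one_smul, Qf_smul, div_le_iff₀ (by positivity)] at h1
  refine h1.trans (le_of_eq ?_); field_simp
end

/-- Normalised entire solutions whose determinant tends to one at infinity. -/
structure EntireSol (lam Lam : ℝ) (u : Eu n → ℝ) : Prop where
  ma : MAConvex u
  zero : u 0 = 0
  nonneg : ∀ x, 0 ≤ u x
  lam_pos : 0 < lam
  ge : ∀ x, lam ≤ dhess u x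
  le : ∀ x, dhess u x ≤ Lam
  lim : ∀ ε > 0, ∃ R, ∀ x, R ≤ ‖x‖ → |dhess u x - 1| ≤ ε

section
variable {C₀ lam Lam : ℝ} {u : Eu n → ℝ}

lemma NormSection.mono {C T ε ε' : ℝ} (h : NormSection C T Lam ε v) (hε : ε ≤ ε') :
    NormSection C T Lam ε' v :=
  ⟨h.ma, h.zero, h.nonneg, h.bdd, h.sep, h.le, fun x h1 h2 => (h.near x (hε.trans h1) h2).trans hε⟩

lemma dhess_normalized (hu : ContDiff ℝ 2 u) {h : ℝ} (hh : 0 < h) {T : Mat n} (hT : T.det ^ 2 = h ^ n)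
    (y : Eu n) : dhess (fun y => h⁻¹ * u (0 + mulE T y)) y = dhess u (mulE T y) := by
  rw [dhess, det_hess_comp_affine hu, hT, inv_pow, inv_mul_cancel₀ (by positivity), one_mul, zero_add]
  rfl

lemma maconvex_normalized (hu : MAConvex u) {h : ℝ} (hh : 0 < h) {T : Mat n} (hT : T.det ^ 2 = h ^ n) :
    MAConvex fun y => h⁻¹ * u (0 + mulE T y) := by
  refine hu.comp_affine (by positivity) 0 fun h0 => ?_; rw [h0, zero_pow two_ne_zero] at hT
  have : 0 < h ^ n := by positivity
  linarith

lemma EntireSol.exists_scaling [NeZero n] (hn : 2 ≤ n) (hu : EntireSol lam Lam u) :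
    ∃ C₀ : ℝ, 0 < C₀ ∧ ∀ N : ℝ, 1 ≤ N → ∃ h₀ : ℝ, 0 < h₀ ∧ ∀ h, h₀ ≤ h → ∃ T : Mat n, T.det ^ 2 = h ^ n ∧
      (∀ x w : Eu n, ‖x‖ ≤ N → 1 / N ≤ ‖w‖ → ‖w‖ ≤ N → h⁻¹ * u (mulE T (x + w)) +
        h⁻¹ * u (mulE T (x - w)) - 2 * (h⁻¹ * u (mulE T x)) ≤ C₀ * ‖w‖ ^ 2) ∧
      ∀ y : Eu n, 1 / N ≤ ‖y‖ → ‖y‖ ≤ N → |dhess u (mulE T y) - 1| ≤ 1 / N := by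
  have hLam : 0 < Lam := hu.lam_pos.trans_le ((hu.ge 0).trans (hu.le 0))
  obtain ⟨C, hC, hnorm⟩ := exists_normalization n hu.lam_pos
  obtain ⟨T0, hT0, hT₀1, hsep⟩ := sublevel_separation n (Lam := Lam) hC
  obtain ⟨C₀, hC0, hpog⟩ := pogorelov n hn hC hT0 hT₀1 hLam; refine ⟨C₀, hC0, fun N hN => ?_⟩
  obtain ⟨A, hA, hA0⟩ := ex_pos (4 * N / T0); have hNA : N / A = T0 / 4 := by rw [hA]; field_simp
  have hA1 : 1 ≤ A := by rw [hA, le_div_iff₀ hT0]; linarith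
  obtain ⟨t0, ht0, ht₀0⟩ := ex_pos (1 / (N * A)); have ht₀T : t0 < T0 := by
    rw [ht0, hA, div_lt_iff₀ (by positivity)]
    have : T0 * (N * (4 * N / T0)) = 4 * N ^ 2 := by field_simp
    nlinarith
  obtain ⟨ε, hε, hpog⟩ := hpog t0 ht₀0 ht₀T
  obtain ⟨ε', hε', hε'0⟩ := ex_pos (min ε (min t0 (1 / N)))
  have e1 : ε' ≤ ε := hε' ▸ min_le_left _ _
  have e2 : ε' ≤ t0 := hε' ▸ (min_le_right _ _).trans (min_le_left _ _)
  have e3 : ε' ≤ 1 / N := hε' ▸ (min_le_right _ _).trans (min_le_right _ _)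
  obtain ⟨R1, hR1⟩ := hu.lim ε' hε'0; obtain ⟨R, hRd, hR0⟩ := ex_pos (max R1 1)
  obtain ⟨M, hM⟩ := ((isCompact_closedBall (0 : Eu n) (2 * C * R / ε')).image
    hu.ma.smooth.continuous).bddAbove
  refine ⟨max M 1, by positivity, fun h hh => ?_⟩
  have hh0 : 0 < h := lt_of_lt_of_le (by positivity) hh; have hH0 : 0 < A ^ 2 * h := by positivity
  have hHM : M ≤ A ^ 2 * h :=
    ((le_max_left _ _).trans hh).trans (le_mul_of_one_le_left hh0.le (one_le_pow₀ hA1))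
  obtain ⟨T, hTd, hTb⟩ := hnorm u hu.ma hu.ge hu.zero hu.nonneg (A ^ 2 * h) hH0
  have hw := maconvex_normalized hu.ma hH0 hTd; have hwd := dhess_normalized hu.ma.smooth hH0 hTd
  have hw0 : (A ^ 2 * h)⁻¹ * u (0 + mulE T 0) = 0 := by rw [map_zero, add_zero, hu.zero, mul_zero]
  have hwn : ∀ y, 0 ≤ (A ^ 2 * h)⁻¹ * u (0 + mulE T y) := fun y => mul_nonneg (by positivity) (hu.nonneg _)
  have hwb : ∀ y, (A ^ 2 * h)⁻¹ * u (0 + mulE T y) ≤ 1 → ‖y‖ ≤ C := fun y hy => by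
    rw [inv_mul_le_iff₀ hH0, mul_one, zero_add] at hy; exact hTb y hy
  have hns : NormSection C T0 Lam ε' fun y => (A ^ 2 * h)⁻¹ * u (0 + mulE T y) := by
    refine ⟨hw, hw0, hwn, hwb, hsep _ hw (fun y => by rw [hwd]; exact hu.le _) hw0 hwn hwb,
      fun y => by rw [hwd]; exact hu.le _, fun y hy _ => ?_⟩
    rw [hwd]
    refine hR1 _ (le_trans (hRd ▸ le_max_left _ _) (not_lt.1 fun hlt : ‖mulE T y‖ < R => ?_))
    have h1 := hTb ((2 * C / ε') • y) (by
      refine le_trans (hM ⟨_, ?_, rfl⟩) hHM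
      rw [mem_closedBall_zero_iff, map_smul, norm_smul_of_nonneg (by positivity)]
      calc 2 * C / ε' * ‖mulE T y‖ ≤ 2 * C / ε' * R := by gcongr
        _ = _ := by ring)
    rw [norm_smul_of_nonneg (by positivity)] at h1
    have h2 : 2 * C / ε' * ε' ≤ 2 * C / ε' * ‖y‖ := by gcongr
    rw [div_mul_cancel₀ _ hε'0.ne'] at h2; linarith
  refine ⟨A⁻¹ • T, ?_, fun x w hx hw1 hw2 => ?_, fun y hy hyN => ?_⟩
  · rw [det_smul, card_fin, mul_pow, hTd, mul_pow, inv_pow, inv_pow, ← pow_mul, ← pow_mul,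
      mul_comm 2 n, inv_mul_cancel_left₀ (by positivity)]
  · have hwn0 : 0 < ‖w‖ := lt_of_lt_of_le (by positivity) hw1
    have hxA : ‖A⁻¹ • x‖ ≤ T0 / 4 := by
      rw [norm_smul, norm_inv, norm_of_nonneg hA0.le, inv_mul_eq_div, ← hNA]; gcongr
    have h1 : (A ^ 2 * h)⁻¹ * u (0 + mulE T (A⁻¹ • x)) ≤ 1 / 4 := by
      rcases eq_or_ne (A⁻¹ • x) 0 with h0 | h0
      · rw [h0, hw0]; norm_num
      have hp := norm_pos_iff.2 h0
      have h2 := hns.sub_le_div (x := 0) (w := ‖A⁻¹ • x‖⁻¹ • A⁻¹ • x) (by rw [hw0]; norm_num) hp.le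
        (by linarith) hT0 (by rw [norm_unit hp])
      rw [smul_smul, mul_inv_cancel₀ hp.ne', one_smul, zero_add (A⁻¹ • x), hw0, sub_zero] at h2
      refine h2.trans ?_; rw [div_le_iff₀ hT0]; linarith
    have h2 := hpog _ (hns.mono e1) (A⁻¹ • x) (‖w‖⁻¹ • w) (‖w‖ / A) h1 (by rw [norm_unit hwn0])
      (by rw [ht0, ← div_div]; gcongr) (by
        have : ‖w‖ / A ≤ N / A := by gcongr
        linarith)
    have h3 : (‖w‖ / A) • ‖w‖⁻¹ • w = A⁻¹ • w := by rw [smul_smul]; congr 1; field_simp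
    simp only [h3, ← smul_add, ← smul_sub, zero_add] at h2; simp only [mulE_smul, ← map_smul]
    have e4 : ∀ X Y Z : ℝ, h⁻¹ * X + h⁻¹ * Y - 2 * (h⁻¹ * Z) =
        A ^ 2 * ((A ^ 2 * h)⁻¹ * X + (A ^ 2 * h)⁻¹ * Y - 2 * ((A ^ 2 * h)⁻¹ * Z)) := fun X Y Z => by
      field_simp
    rw [e4]
    calc _ ≤ A ^ 2 * (C₀ * (‖w‖ / A) ^ 2) := by gcongr
      _ = _ := by field_simp
  · rw [mulE_smul, ← map_smul, ← hwd]
    have hyA : ‖A⁻¹ • y‖ = ‖y‖ / A := by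
      rw [norm_smul, norm_inv, norm_of_nonneg hA0.le, inv_mul_eq_div]
    refine (hns.near _ ?_ ?_).trans e3
    · rw [hyA]
      refine e2.trans ?_; rw [ht0, ← div_div]; gcongr
    · rw [hyA]
      have : ‖y‖ / A ≤ N / A := by gcongr
      linarith

set_option maxHeartbeats 1000000 in
/-- Large sections are close to ellipsoids. -/
theorem EntireSol.near_paraboloid [NeZero n] (hn : 2 ≤ n) (hu : EntireSol lam Lam u) {ε : ℝ} (hε : 0 < ε)
    (R : ℝ) : ∃ h₀ : ℝ, 0 < h₀ ∧ ∀ h, h₀ ≤ h → ∃ T : Mat n, T.det ^ 2 = h ^ n ∧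
      ∀ y, ‖y‖ ≤ R → |h⁻¹ * u (mulE T y) - 1 / 2 * ‖y‖ ^ 2| ≤ ε := by
  obtain ⟨C₀, hC0, hsc⟩ := hu.exists_scaling hn
  by_contra hcon
  push Not at hcon
  have hN1 : ∀ k : ℕ, (1 : ℝ) ≤ (k : ℝ) + 1 := fun k => by linarith [(Nat.cast_nonneg k : (0 : ℝ) ≤ k)]
  have hex : ∀ k : ℕ, ∃ (h : ℝ) (T : Mat n), 0 < h ∧ T.det ^ 2 = h ^ n ∧
      (∀ x w : Eu n, ‖x‖ ≤ (k : ℝ) + 1 → 1 / ((k : ℝ) + 1) ≤ ‖w‖ → ‖w‖ ≤ (k : ℝ) + 1 →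
        h⁻¹ * u (mulE T (x + w)) + h⁻¹ * u (mulE T (x - w)) - 2 * (h⁻¹ * u (mulE T x)) ≤ C₀ * ‖w‖ ^ 2) ∧
      (∀ y : Eu n, 1 / ((k : ℝ) + 1) ≤ ‖y‖ → ‖y‖ ≤ (k : ℝ) + 1 →
        |dhess u (mulE T y) - 1| ≤ 1 / ((k : ℝ) + 1)) ∧
      ∀ T : Mat n, T.det ^ 2 = h ^ n → ∃ y, ‖y‖ ≤ R ∧ ε < |h⁻¹ * u (mulE T y) - 1 / 2 * ‖y‖ ^ 2| := by
    intro k; obtain ⟨h₀, hh₀, H⟩ := hsc _ (hN1 k); obtain ⟨h, hh, hbad⟩ := hcon h₀ hh₀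
    obtain ⟨T, h1, h2, h3⟩ := H h hh; exact ⟨h, T, hh₀.trans_le hh, h1, h2, h3, hbad⟩
  choose h T hh hT hs hd hbad using hex
  set l : Ultrafilter ℕ := hyperfilter ℕ
  have hla : (l : Filter ℕ) ≤ atTop := by rw [← Nat.cofinite_eq_atTop]; exact hyperfilter_le_cofinite
  have hlarge : ∀ c : ℝ, ∀ᶠ k : ℕ in (l : Filter ℕ), c ≤ (k : ℝ) := fun c =>
    hla (tendsto_natCast_atTop_atTop.eventually_ge_atTop _)
  have hlarge' : ∀ c : ℝ, 0 < c → ∀ᶠ k : ℕ in (l : Filter ℕ), 1 / ((k : ℝ) + 1) ≤ c := fun c hc => by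
    filter_upwards [hlarge (1 / c)] with k hk; rw [div_le_iff₀ hc] at hk
    rw [div_le_iff₀ (by linarith [hN1 k])]; linarith
  set V : ℕ → Eu n → ℝ := fun k y => (h k)⁻¹ * u (0 + mulE (T k) y) with hV
  have hVm : ∀ k, MAConvex (V k) := fun k => maconvex_normalized hu.ma (hh k) (hT k)
  have hV0 : ∀ k, V k 0 = 0 := fun k => by simp only [hV]; rw [map_zero, add_zero, hu.zero, mul_zero]
  have hVn : ∀ k y, 0 ≤ V k y := fun k y => mul_nonneg (inv_nonneg.2 (hh k).le) (hu.nonneg _)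
  have hVs : ∀ (k : ℕ) (x w : Eu n), ‖x‖ ≤ (k : ℝ) + 1 → 1 / ((k : ℝ) + 1) ≤ ‖w‖ → ‖w‖ ≤ (k : ℝ) + 1 →
      V k (x + w) + V k (x - w) - 2 * V k x ≤ C₀ * ‖w‖ ^ 2 := by
    intro k; simp only [hV, zero_add]; exact hs k
  obtain ⟨U, Gr, hU, hUl, hUu⟩ := exists_ultralimit l V (fun k => gradient (V k)) (C₀ := C₀)
    (fun k x y => by
      have := convex_tangent (hVm k).smooth (hVm k).convex x y; rw [inner_gradient]; linarith)
    (fun R' => by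
      obtain ⟨ρ, hρ⟩ := ex_eq (|R'| + 1); have hρ1 : 1 ≤ ρ := by rw [hρ]; linarith [abs_nonneg R']
      refine ⟨C₀ * ρ ^ 2, ?_⟩; filter_upwards [hlarge ρ] with k hk x hx
      rw [abs_of_nonneg (hVn k x)]
      rcases eq_or_ne x 0 with rfl | hx0
      · rw [hV0]; positivity
      have hxn := norm_pos_iff.2 hx0; have hxρ : ‖x‖ ≤ ρ := by rw [hρ]; linarith [le_abs_self R']
      have h1 := hVs k 0 ((ρ / ‖x‖) • x) (by rw [norm_zero]; linarith) (by
        rw [norm_smul_of_nonneg (by positivity), div_mul_cancel₀ _ hxn.ne']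
        exact ((div_le_one (by linarith)).2 (hN1 k)).trans hρ1) (by
        rw [norm_smul_of_nonneg (by positivity), div_mul_cancel₀ _ hxn.ne']; linarith)
      rw [norm_smul_of_nonneg (by positivity), div_mul_cancel₀ _ hxn.ne', zero_add, hV0] at h1
      have h2 := hVn k (0 - (ρ / ‖x‖) • x)
      have hsm : ‖x‖ / ρ ≤ 1 := (div_le_one (by linarith)).2 hxρ
      have h3 := (hVm k).convex.2 (Set.mem_univ 0) (Set.mem_univ ((ρ / ‖x‖) • x)) (sub_nonneg.2 hsm)
        (show 0 ≤ ‖x‖ / ρ by positivity) (by ring)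
      have h4 : (1 - ‖x‖ / ρ) • (0 : Eu n) + (‖x‖ / ρ) • (ρ / ‖x‖) • x = x := by
        rw [smul_zero, zero_add, smul_smul]; have : ‖x‖ / ρ * (ρ / ‖x‖) = 1 := by field_simp
        rw [this, one_smul]
      rw [h4, hV0, smul_zero, zero_add, smul_eq_mul] at h3
      have h5 := mul_le_of_le_one_left (hVn k ((ρ / ‖x‖) • x)) hsm; linarith)
    (fun x w hw => by
      filter_upwards [hlarge ‖x‖, hlarge ‖w‖, hlarge' ‖w‖ (norm_pos_iff.2 hw)] with k k1 k2 k3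
      exact hVs k x w (by linarith) k3 (by linarith))
  have hUa : Approx U := by
    intro ε hε R
    obtain ⟨k, k1, k2, k3⟩ := ((hUu ε hε R).and ((hlarge R).and (hlarge' ε hε))).exists
    refine ⟨V k, hVm k, k1, fun x hx hxR => ?_⟩; rw [dhess_normalized hu.ma.smooth (hh k) (hT k)]
    exact (hd k x (k3.trans hx) (by linarith)).trans k3
  have hU0 : U 0 = 0 := tendsto_nhds_unique (hUl 0) (by simp only [hV0]; exact tendsto_const_nhds)
  have hUn : ∀ x, 0 ≤ U x := fun x => ge_of_tendsto' (hUl x) fun k => hVn k x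
  obtain ⟨A, hA, hAd, hUA⟩ := liouville hU hUa hU0 hUn
  obtain ⟨L, B, h1, -, -, -⟩ := exists_normalizing hA; have hL : L.det ^ 2 = 1 := by
    have := congrArg Matrix.det h1; rw [det_mul, det_mul, det_transpose, hAd, det_one] at this
    linarith
  obtain ⟨k, hk⟩ := (hUu ε hε (‖mulE L‖ * R)).exists
  obtain ⟨y, hy, hbig⟩ := hbad k (T k * L) (by rw [det_mul, mul_pow, hL, mul_one, hT])
  have h2 := hk (mulE L y) (((mulE L).le_opNorm y).trans (by gcongr))
  rw [hUA, ← Qf_transpose_mul_mul, h1, Qf_one] at h2; simp only [hV, zero_add, ← mulE_mul] at h2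
  linarith
end

variable {u v : Eu n → ℝ} {M N : Mat n} {x0 x1 : Eu n} {r s E E' : ℝ}

lemma QApprox.change (h : QApprox u M 0 r (E * r ^ (n + 2))) (hu : Continuous u) (hr : 0 ≤ r) {δ : ℝ}
    (hδ : ∀ i j, |M i j - N i j| ≤ δ) (hδ0 : 0 ≤ δ) :
    QApprox u N 0 r ((E + n * δ * ωn n) * r ^ (n + 2)) := by
  obtain ⟨b, c, h⟩ := h; refine ⟨b, c, ?_⟩; have c1 := continuous_quad M b c
  have c2 : Continuous fun x : Eu n => 1 / 2 * Qf (M - N) x := by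
    have := (contDiff_Qf (M - N) (k := 0)).continuous; fun_prop
  have h1 : ∫ x in 𝔹 n r, |1 / 2 * Qf (M - N) x| ≤ n * δ * r ^ 2 * (ωn n * r ^ n) := by
    refine setIntegral_le_of_le (by fun_prop) hr fun y hy => ?_
    have hy' : ‖y‖ ≤ r := by simpa using hy
    have h2 := abs_Bf_le_norm hδ0 (S := M - N) hδ y y; rw [← Qf_eq_Bf] at h2
    have h3 : n * δ * (‖y‖ * ‖y‖) ≤ n * δ * r ^ 2 := by rw [← sq]; gcongr
    rw [abs_mul, abs_of_pos (by norm_num)]; linarith [abs_nonneg (Qf (M - N) y)]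
  have c3 := continuous_quad N b c
  calc _ ≤ ∫ x in 𝔹 n r, (|u x - (1 / 2 * Qf M x + ⟪b, x⟫ + c)| +
        |1 / 2 * Qf (M - N) x|) := by
        refine int_mono fun x _ => ?_; refine le_trans (le_of_eq ?_) (abs_add_le _ _)
        rw [Qf_sub_matrix]; congr 1; ring
    _ = _ := int_add
    _ ≤ _ := add_le_add h h1
    _ = _ := by ring

lemma exists_matrix_limit {N : ℕ → Mat n} {C t : ℝ} (ht1 : t < 1)
    (h : ∀ k i j, |N k i j - N (k + 1) i j| ≤ C * t ^ k) :
    ∃ A : Mat n, Tendsto N atTop (𝓝 A) ∧ ∀ k i j, |N k i j - A i j| ≤ C / (1 - t) * t ^ k := by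
  have h1 : ∀ i j, ∃ a, Tendsto (fun k => N k i j) atTop (𝓝 a) := fun i j =>
    cauchySeq_tendsto_of_complete (cauchySeq_of_le_geometric t C ht1 fun k => h k i j)
  choose A hA using h1
  refine ⟨Matrix.of A, tendsto_pi_nhds.2 fun i => tendsto_pi_nhds.2 fun j => hA i j, fun k i j => ?_⟩
  have := dist_le_of_le_geometric_of_tendsto t C ht1 (fun k => h k i j) (hA i j) k
  rw [dist_eq] at this; exact this.trans (le_of_eq (by ring))

lemma integral_comp_linear_decay (hn : 1 ≤ n) (hg : Continuous g) {K h ρ : ℝ}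
    (hK : ∀ x, g x ≤ K / (1 + ‖x‖)) (hK0 : 0 ≤ K) (hh : 0 < h) (hρ : 0 < ρ) {T : Mat n}
    (hT : T.det ^ 2 = (h ^ 2) ^ n) (hq : 1 ≤ h * ρ) :
    ∫ y in 𝔹 n ρ, g (mulE T y) ≤ 2 * K * ωn n / √(h * ρ) * ρ ^ n := by
  have hTd : |T.det| = h ^ n := by
    rw [← abs_of_pos (pow_pos hh n), ← sq_eq_sq_iff_abs_eq_abs, hT]; ring
  have hT0 : T.det ≠ 0 := by rw [← abs_pos, hTd]; positivity
  obtain ⟨q, hq1, hqd⟩ : ∃ q, 1 ≤ q ∧ √(h * ρ) = q := ⟨_, Real.one_le_sqrt.2 hq, rfl⟩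
  have hq2 : q ^ 2 = h * ρ := by rw [← hqd, sq_sqrt (by positivity)]
  rw [hqd]; set D : Set (Eu n) := mulE T ⁻¹' closedBall 0 q with hD
  have hDm : MeasurableSet D := (isClosed_closedBall.preimage (mulE T).continuous).measurableSet
  have hDv : ∫ y in 𝔹 n ρ, D.indicator (fun _ => K) y ≤ K * (ωn n * ρ ^ n / q) := by
    have hinj := integral_affine_image 0 hT0 hDm fun _ => (1 : ℝ)
    have him : (fun y => 0 + mulE T y) '' D = closedBall 0 q := by
      simp only [zero_add, hD]; refine Set.image_preimage_eq _ fun x => ⟨mulE T⁻¹ x, ?_⟩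
      rw [← mulE_mul, mul_nonsing_inv _ hT0.isUnit, mulE_one]
    rw [him, setIntegral_const, setIntegral_const, vol_closedBall _ (by linarith), hTd] at hinj
    simp only [smul_eq_mul, mul_one] at hinj; have hfin : volume D ≠ ⊤ := by
      intro h; rw [real, h] at hinj; simp only [ENNReal.toReal_top, mul_zero] at hinj
      have := @ωn_pos n; have : 0 < q ^ n * ωn n := by positivity
      linarith
    have hIB : Integrable (D.indicator fun _ => K) :=
      (integrable_indicator_iff hDm).2 (integrableOn_const hfin)
    calc _ ≤ ∫ y, D.indicator (fun _ => K) y :=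
          setIntegral_le_integral hIB (Eventually.of_forall fun y => Set.indicator_nonneg (fun _ _ => hK0) y)
      _ = K * volume.real D := by
          rw [integral_indicator hDm, setIntegral_const, smul_eq_mul, mul_comm]
      _ ≤ _ := by
          gcongr; rw [le_div_iff₀ (by linarith)]
          have h1 : h ^ n * (volume.real D * q) ≤ h ^ n * (ωn n * ρ ^ n) := by
            have : ωn n * (q ^ n * q) ≤ ωn n * (q ^ n * q ^ n) := by
              have := @ωn_pos n; have := le_self_pow₀ hq1 (by omega : n ≠ 0); gcongr
            have e : q ^ n * q ^ n = h ^ n * ρ ^ n := by rw [← mul_pow, ← sq, hq2, mul_pow]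
            rw [e] at this
            calc _ = ωn n * (q ^ n * q) := by rw [← mul_assoc, ← hinj]; ring
              _ ≤ _ := this.trans (le_of_eq (by ring))
          exact le_of_mul_le_mul_left h1 (by positivity)
  have hle : ∀ y, g (mulE T y) ≤ K / q + D.indicator (fun _ => K) y := by
    intro y; have h0 := hK (mulE T y); have hpos : 0 ≤ K / q := by positivity
    by_cases hy : y ∈ D
    · rw [Set.indicator_of_mem hy]
      have : K / (1 + ‖mulE T y‖) ≤ K := div_le_self hK0 (by linarith [norm_nonneg (mulE T y)])
      linarith
    · rw [Set.indicator_of_notMem hy, add_zero]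
      refine h0.trans ?_; have : q < ‖mulE T y‖ := by simpa [hD] using hy
      gcongr; linarith
  have hi1 : IntegrableOn (fun _ : Eu n => K / q) (closedBall 0 ρ) := intOn
  have hi2 : IntegrableOn (D.indicator fun _ : Eu n => K) (closedBall 0 ρ) := (intOn).indicator hDm
  calc _ ≤ ∫ y in 𝔹 n ρ, (K / q + D.indicator (fun _ => K) y) :=
        setIntegral_mono intOn (hi1.add hi2) hle
    _ = _ := integral_add hi1 hi2
    _ ≤ K / q * (ωn n * ρ ^ n) + K * (ωn n * ρ ^ n / q) :=
        add_le_add (setIntegral_le_of_le continuous_const hρ.le fun _ _ => le_rfl) hDv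
    _ = _ := by ring

variable {lam Lam : ℝ} {u : Eu n → ℝ}

lemma norm_mulE_lower [NeZero n] {S : Mat n} (hS : S.det ^ 2 = 1) {Λ : ℝ} (hΛ : 0 < Λ)
    (h : ∀ y, ‖mulE S y‖ ≤ Λ * ‖y‖) (y : Eu n) :
    √(Λ ^ 2 / (2 * Λ ^ 2) ^ n) * ‖y‖ ≤ ‖mulE S y‖ := by
  have hQ := Qf_transpose_mul_self S
  have hd : (Sᵀ * S).det = 1 := by rw [det_mul, det_transpose, ← sq, hS]
  have hps : (Sᵀ * S).PosSemidef := by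
    rw [← Matrix.conjTranspose_eq_transpose_of_trivial]
    exact Matrix.posSemidef_conjTranspose_mul_self S
  rcases eq_or_ne y 0 with rfl | hy
  · simp
  have hy0 : 0 < ‖y‖ := norm_pos_iff.2 hy
  have h1 := Qf_lower_of_upper (posDef_of_posSemidef_det_pos hps (by rw [hd]; norm_num)) hd
    (Λ := Λ ^ 2) (by positivity) (fun ξ => by rw [hQ, ← mul_pow]; gcongr; exact h ξ)
    (y := ‖y‖⁻¹ • y) (by rw [norm_unit hy0])
  rw [hQ, map_smul, norm_smul, norm_inv, norm_norm, ← Real.sqrt_le_sqrt_iff (by positivity),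
    sqrt_sq (by positivity), inv_mul_eq_div, le_div_iff₀ hy0] at h1
  exact h1

set_option maxHeartbeats 1000000 in
/-- Quadratic approximation of an entire solution along a sequence of increasing balls. -/
theorem EntireSol.quad_scales [NeZero n] (hn : 2 ≤ n) (hu : EntireSol lam Lam u) {K : ℝ}
    (hK : ∀ x, |dhess u x - 1| ≤ K / (1 + ‖x‖)) :
    ∃ t r0 C : ℝ, 0 < t ∧ t ≤ 1 / 4 ∧ 0 < r0 ∧ 0 < C ∧ ∀ i : ℕ, ∃ N : Mat n, N.PosDef ∧ N.det = 1 ∧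
      QApprox u N 0 (r0 / (t ^ 2) ^ i) (C * t ^ i * (r0 / (t ^ 2) ^ i) ^ (n + 2)) := by
  obtain ⟨θ, ε0, C, hθ, hθ1, hε0, hC, H⟩ := iteration n (a := 1 / 2) (by norm_num)
  obtain ⟨t, rfl⟩ : ∃ t, θ = t ^ 2 := ⟨√θ, (sq_sqrt hθ.le).symm⟩
  wlog ht : 0 < t generalizing t
  · refine this (-t) (by simpa using hθ) (by simpa using hθ1) (by simpa using H) ?_
    rcases lt_trichotomy t 0 with h | h | h
    · linarith
    · rw [h] at hθ; norm_num at hθ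
    · exact absurd h ht
  have hta : (t ^ 2) ^ ((1 : ℝ) / 2) = t := by rw [← Real.sqrt_eq_rpow, sqrt_sq ht.le]
  rw [hta] at H; have ht4 : t ≤ 1 / 4 := by nlinarith
  have hω := @ωn_pos n; have hK0 : 0 ≤ K := by simpa using (abs_nonneg _).trans (hK 0)
  obtain ⟨h₀, hh₀, hnear⟩ := hu.near_paraboloid hn (ε := ε0 / 4 / ωn n) (by positivity) 1
  obtain ⟨m, hm⟩ := ex_eq (1 + h₀ + 16 * C * K * ωn n / ε0)
  have hpos : 0 ≤ 16 * C * K * ωn n / ε0 := by positivity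
  have hm1 : 1 ≤ m := by linarith
  have hm0 : 0 < m := by linarith
  obtain ⟨D, hD⟩ := ex_eq (2 * K * ωn n / m); have hD0 : 0 ≤ D := by rw [hD]; positivity
  have hCD : C * D ≤ ε0 / 8 := by
    have h1 : 16 * C * K * ωn n / ε0 ≤ m := by linarith
    rw [div_le_iff₀ hε0] at h1; rw [hD, mul_div_assoc', div_le_iff₀ hm0]; linarith
  have hCD0 : 0 ≤ C * D := by positivity
  have hgeom : ∀ (J : ℕ) (a : ℝ), 0 ≤ a → ∑ j ∈ range (J + 1), a * t ^ j ≤ 2 * a := by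
    intro J a ha; have := sum_geom_add_le (s := 0) ht.le (by linarith) ha J
    simp only [add_zero, mul_zero] at this; refine this.trans ?_; rw [div_le_iff₀ (by linarith)]
    nlinarith
  obtain ⟨mM, hmM⟩ := ex_eq (1 + n * (C * ε0)); have hmM0 : 0 ≤ mM := by rw [hmM]; positivity
  obtain ⟨P, hP⟩ := ex_eq ((16 * (ωn n)⁻¹ * ((1 / 4 : ℝ) ^ n)⁻¹ * ε0 + 4 * mM * (1 / 4) ^ 2) + mM)
  obtain ⟨R1, hR₁0, hR1⟩ := ((hu.ma.isCompact_sublevel hu.zero hu.nonneg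
    (P * m ^ 4)).isBounded).exists_pos_norm_le
  obtain ⟨Λ, hΛ, hΛ0⟩ := ex_pos (4 * R1 / m ^ 2)
  obtain ⟨c, hc, hc0⟩ := ex_pos (√(Λ ^ 2 / (2 * Λ ^ 2) ^ n))
  refine ⟨t, c * m ^ 2, (ε0 / 4 + C * D) / c ^ (n + 2), ht, ht4, by positivity, by positivity, fun i => ?_⟩
  obtain ⟨J, hJ⟩ := ex_eq (i + i); obtain ⟨h, hh⟩ := ex_eq (m ^ 2 / (t ^ 2) ^ J)
  have hθJ : (t ^ 2) ^ J ≤ 1 := pow_le_one₀ hθ.le (by linarith)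
  have hh1 : m ^ 2 ≤ h := by rw [hh]; exact le_div_self (by positivity) (by positivity) hθJ
  have hh0 : 0 < h := lt_of_lt_of_le (by positivity) hh1
  have hhJ : h * (t ^ 2) ^ J = m ^ 2 := by rw [hh]; field_simp
  obtain ⟨T, hT, hTn⟩ := hnear (h ^ 2) (by nlinarith [one_le_pow₀ hm1 (n := 2)])
  obtain ⟨v, hvd⟩ := ex_eq (fun y => (h ^ 2)⁻¹ * u (0 + mulE T y) : Eu n → ℝ)
  have hv : MAConvex v := hvd ▸ maconvex_normalized hu.ma (by positivity) hT
  have hvx : ∀ y, u (mulE T y) = h ^ 2 * v y := fun y => by simp only [hvd, zero_add]; field_simp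
  have hdv : ∀ y, dhess v y = dhess u (mulE T y) := fun y => by
    rw [hvd]; exact dhess_normalized hu.ma.smooth (by positivity) hT y
  have hTd : |T.det| = h ^ n := by
    rw [← abs_of_pos (pow_pos hh0 n), ← sq_eq_sq_iff_abs_eq_abs, hT]; ring
  have hT0 : T.det ≠ 0 := by rw [← abs_pos, hTd]; positivity
  have hTB : T * T⁻¹ = 1 := mul_nonsing_inv _ hT0.isUnit; have cv := hv.smooth.continuous
  have cd := hu.ma.continuous_dhess
  have hsum : ∑ j ∈ range (J + 1), (ε0 / 4 * t ^ j + C * D * t ^ (J - j)) ≤ ε0 := by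
    rw [sum_add_distrib]; have h2 := Finset.sum_range_reflect (fun j => C * D * t ^ j) (J + 1)
    simp only [Nat.add_sub_cancel] at h2; rw [h2]
    linarith [hgeom J (ε0 / 4) (by positivity), hgeom J (C * D) hCD0]
  have hiter := H v hv (fun j => ε0 / 4 * t ^ j + C * D * t ^ (J - j)) (fun j => D * t ^ (J - j)) J
    (fun j => by positivity) (fun j => by positivity) (fun j hj => by
      obtain ⟨l, rfl⟩ := Nat.exists_eq_add_of_le hj.le
      simp_rw [hdv]
      have hq : h * (t ^ 2) ^ j = (m / t ^ l) ^ 2 := by rw [hh]; field_simp; ring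
      have hml : 1 ≤ m / t ^ l := by
        rw [one_le_div (by positivity)]; exact (pow_le_one₀ ht.le (by linarith)).trans hm1
      refine (integral_comp_linear_decay (g := fun x => |dhess u x - 1|) (by omega) (by fun_prop) hK hK0
        hh0 (by positivity) hT (by rw [hq]; exact one_le_pow₀ hml)).trans (le_of_eq ?_)
      rw [hq, sqrt_sq (by positivity), hD, Nat.add_sub_cancel_left]; field_simp) (fun j hj => by
      obtain ⟨l, rfl⟩ := Nat.exists_eq_add_of_le (Nat.succ_le_of_lt hj)
      have e1 : j.succ + l - j = l + 1 := by omega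
      have e2 : j.succ + l - (j + 1) = l := by omega
      simp only [e1, e2]; have h1 : 0 ≤ C * D * t ^ l := by positivity
      have h2 : t * t + t ≤ 1 := by nlinarith
      calc _ = ε0 / 4 * t ^ (j + 1) + C * D * t ^ l * (t * t + t) := by ring
        _ ≤ _ := by linarith [mul_le_of_le_one_right h1 h2]) hsum ⟨0, 0, by
      have h1 : ∀ y ∈ 𝔹 n 1, |v y - (1 / 2 * Qf 1 y + ⟪0, y⟫ + 0)| ≤ ε0 / 4 / ωn n := by
        intro y hy; have := hTn y (by simpa using hy)
        simpa only [hvd, Qf_one, inner_zero_left, zero_add, add_zero]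
      have c1 := continuous_quad (1 : Mat n) 0 0
      refine (setIntegral_le_of_le (by fun_prop) zero_le_one h1).trans ?_
      have : 0 ≤ C * D * t ^ (J - 0) := by positivity
      simp only [one_pow, mul_one, pow_zero]; rw [div_mul_cancel₀ _ hω.ne']; linarith⟩
  have hTup : ∀ y, ‖mulE (h⁻¹ • T) y‖ ≤ Λ * ‖y‖ := by
    obtain ⟨M, -, -, hM1, hMI⟩ := hiter J le_rfl; have hMQ : ∀ y : Eu n, Qf M y ≤ mM * ‖y‖ ^ 2 := by
      intro y; have h1 := abs_Bf_le_norm (S := M - 1) (ε := C * ε0) (by positivity)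
        (fun i j => (hM1 i j).trans (mul_le_mul_of_nonneg_left hsum (by positivity))) y y
      rw [← Qf_eq_Bf, Qf_sub_matrix, Qf_one] at h1; rw [hmM]; linarith [(abs_le.1 h1).2]
    intro y
    rcases eq_or_ne y 0 with rfl | hy
    · simp
    have hy0 : 0 < ‖y‖ := norm_pos_iff.2 hy; obtain ⟨k, hk, hk0⟩ := ex_pos ((t ^ 2) ^ J / 4 / ‖y‖)
    have hkx : ‖k • y‖ = (t ^ 2) ^ J / 4 := by
      rw [norm_smul_of_nonneg hk0.le, hk, div_mul_cancel₀ _ hy0.ne']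
    have h1 := second_diff_of_mean hv.convex cv hmM0 hMQ (by positivity) (by norm_num) le_rfl
      (hMI.mono cv subset_rfl (mul_le_mul_of_nonneg_right (b := _) (c := ε0) (by
        rw [Nat.sub_self, pow_zero, mul_one]
        have : ε0 / 4 * t ^ J ≤ ε0 / 4 := mul_le_of_le_one_right (by positivity)
          (pow_le_one₀ ht.le (by linarith))
        linarith) (by positivity))) hkx.le
    have hvn : ∀ y, 0 ≤ v y := fun y => by rw [hvd]; exact mul_nonneg (by positivity) (hu.nonneg _)
    have hv0 : v 0 = 0 := by simp only [hvd, map_zero, add_zero, hu.zero, mul_zero]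
    have h2 : v (k • y) ≤ P * ((t ^ 2) ^ J) ^ 2 := by
      have h3 := (abs_le.1 h1).2; have h4 := hMQ (k • y); rw [hkx] at h4
      have h5 : mM * ((t ^ 2) ^ J / 4) ^ 2 ≤ mM * ((t ^ 2) ^ J) ^ 2 := by
        gcongr; exact div_le_self (by positivity) (by norm_num)
      rw [hP, add_mul]; linarith [hvn (-(k • y))]
    have h3 := hR1 (mulE T (k • y)) (by
      rw [mem_ofPred_eq, hvx]
      calc _ ≤ h ^ 2 * (P * ((t ^ 2) ^ J) ^ 2) := by gcongr
        _ = P * (h * (t ^ 2) ^ J) ^ 2 := by ring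
        _ = _ := by rw [hhJ]; ring)
    rw [map_smul, norm_smul_of_nonneg hk0.le] at h3
    rw [mulE_smul, norm_smul, norm_inv, norm_of_nonneg hh0.le, hΛ, ← hhJ]
    rw [hk, div_div, div_mul_eq_mul_div, div_le_iff₀ (by positivity)] at h3
    rw [inv_mul_le_iff₀ hh0]
    have e : h * (4 * R1 / (h * (t ^ 2) ^ J) * ‖y‖) = R1 * (4 * ‖y‖) / (t ^ 2) ^ J := by field_simp
    rw [e, le_div_iff₀ (by positivity)]; linarith
  have hlow := norm_mulE_lower (S := h⁻¹ • T) (by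
    rw [det_smul, mul_pow, hT, card_fin, ← pow_mul, ← pow_mul, mul_comm n 2, ← mul_pow,
      inv_mul_cancel₀ hh0.ne', one_pow]) hΛ0 hTup
  rw [← hc] at hlow; obtain ⟨M, hM, hMd, -, hMI⟩ := hiter i (by omega)
  have hei : ε0 / 4 * t ^ i + C * D * t ^ (J - i) = (ε0 / 4 + C * D) * t ^ i := by
    rw [show J - i = i by omega]; ring
  rw [hei] at hMI; have hiB : |T⁻¹.det|⁻¹ = h ^ n := by
    rw [Matrix.det_nonsing_inv, Ring.inverse_eq_inv', abs_inv, inv_inv, hTd]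
  have hB0 : T⁻¹.det ≠ 0 := by
    intro h0; rw [h0, abs_zero, inv_zero] at hiB; exact absurd hiB.symm (by positivity)
  refine ⟨h ^ 2 • (T⁻¹ᵀ * M * T⁻¹), (posDef_transpose_mul_mul hM hTB).smul (by positivity), ?_, ?_⟩
  · rw [det_smul, det_mul, det_mul, det_transpose, hMd, mul_one,
      card_fin, ← hT, ← sq, ← mul_pow, ← det_mul, hTB, det_one, one_pow]
  · have hp := hMI.pullback (u := u) (x1 := 0) (s := c * m ^ 2 / (t ^ 2) ^ i) cv hM.1
      (k := h ^ 2) (by positivity) 0 hB0 (fun x => by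
        rw [← hvx, zero_add, ← mulE_mul, hTB, mulE_one]) (fun x hx => by
        have hx' : ‖x‖ ≤ c * m ^ 2 / (t ^ 2) ^ i := by simpa using hx
        rw [zero_add, mem_closedBall, dist_zero_right]; have h1 := hlow (mulE T⁻¹ x)
        rw [mulE_smul, ← mulE_mul, hTB, mulE_one, norm_smul, norm_inv, norm_of_nonneg hh0.le,
          le_inv_mul_iff₀ hh0] at h1
        have h2 := h1.trans hx'; rw [le_div_iff₀ (by positivity), hh, hJ, pow_add] at h2
        have h3 : m ^ 2 / ((t ^ 2) ^ i * (t ^ 2) ^ i) * (c * ‖mulE T⁻¹ x‖) * (t ^ 2) ^ i =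
            c * m ^ 2 * (‖mulE T⁻¹ x‖ / (t ^ 2) ^ i) := by field_simp
        rw [h3] at h2; have h4 := le_of_mul_le_mul_left (h2.trans (mul_one _).ge) (by positivity)
        rwa [div_le_one (by positivity)] at h4)
    refine hp.mono hu.ma.smooth.continuous subset_rfl (le_of_eq ?_)
    have hq : c * m ^ 2 / (t ^ 2) ^ i = c * (h * (t ^ 2) ^ i) := by rw [hh, hJ, pow_add]; field_simp
    rw [hiB, hq, mul_pow c, div_mul_eq_mul_div, div_mul_eq_mul_div, eq_div_iff (by positivity)]
    ring

variable {lam Lam : ℝ} {u v : Eu n → ℝ}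

/-- An entire solution is asymptotic, in mean, to a single quadratic form. -/
theorem EntireSol.exists_limit [NeZero n] (hn : 2 ≤ n) (hu : EntireSol lam Lam u) {K : ℝ}
    (hK : ∀ x, |dhess u x - 1| ≤ K / (1 + ‖x‖)) :
    ∃ (A : Mat n) (r0 C : ℝ), A.PosDef ∧ A.det = 1 ∧ 0 < r0 ∧ 0 < C ∧
      ∀ ρ, r0 ≤ ρ → QApprox u A 0 ρ (C / √ρ * ρ ^ (n + 2)) := by
  obtain ⟨t, r0, C, ht, ht4, hr0, hC, h⟩ := hu.quad_scales hn hK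
  choose N hN hNd hNQ using h
  have cu := hu.ma.smooth.continuous; have hω := @ωn_pos n; have ht2 : t ^ 2 < 1 := by nlinarith
  have hr : ∀ i : ℕ, r0 / (t ^ 2) ^ (i + 1) = r0 / (t ^ 2) ^ i / t ^ 2 := fun i => by
    rw [pow_succ, div_div]
  obtain ⟨k, hk, hk0⟩ := ex_pos (32 * 2 ^ n * (ωn n)⁻¹ * (C + C * t * ((t ^ 2) ^ (n + 2))⁻¹))
  obtain ⟨A, hA, hAd⟩ := exists_matrix_limit (N := N) (t := t) (C := k) (by linarith) (fun i a b => by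
    have h1 := (hNQ (i + 1)).mono (x1 := 0) (s := r0 / (t ^ 2) ^ i)
      (E' := C * t ^ (i + 1) * ((t ^ 2) ^ (n + 2))⁻¹ * (r0 / (t ^ 2) ^ i) ^ (n + 2)) cu
      (closedBall_subset_closedBall (by
        rw [hr]; exact le_div_self (by positivity) (by positivity) ht2.le))
      (le_of_eq (by rw [hr, div_pow _ (t ^ 2)]; ring))
    refine ((hNQ i).entry h1 cu (hN _).1 (hN _).1 (by positivity) a b).trans (le_of_eq ?_)
    rw [hk]; ring)
  have hAh : A.IsHermitian := isClosed_eq (X := Mat n) (Continuous.matrix_conjTranspose continuous_id)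
    continuous_id |>.mem_of_tendsto hA (Eventually.of_forall fun i => (hN i).1)
  have hdet : A.det = 1 := tendsto_nhds_unique
    (((Continuous.matrix_det continuous_id).tendsto A).comp hA) (by simp [Function.comp_def, hNd])
  have hps : A.PosSemidef := (posSemidef_iff_Qf hAh).2 fun x => by
    have c : Continuous fun M : Mat n => Qf M x := by unfold Qf; fun_prop
    exact ge_of_tendsto' ((c.tendsto A).comp hA) fun i => (posSemidef_iff_Qf (hN i).1).1 (hN i).posSemidef x
  have hA2 : ∀ i, QApprox u A 0 (r0 / (t ^ 2) ^ i)
      ((C + n * (k / (1 - t)) * ωn n) * t ^ i * (r0 / (t ^ 2) ^ i) ^ (n + 2)) := fun i => by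
    have : 0 ≤ k / (1 - t) := div_nonneg hk0.le (by linarith)
    refine ((hNQ i).change cu (by positivity) (hAd i) (by positivity)).mono cu subset_rfl (le_of_eq ?_)
    ring
  obtain ⟨C', hC'⟩ := ex_eq (C + n * (k / (1 - t)) * ωn n); have hC'0 : 0 < C' := by
    rw [hC']; have : 0 ≤ k / (1 - t) := div_nonneg hk0.le (by linarith); positivity
  refine ⟨A, r0, C' * √r0 * ((t ^ 2)⁻¹) ^ (n + 2), posDef_of_posSemidef_det_pos hps (by rw [hdet]; norm_num),
    hdet, hr0, by positivity, fun ρ hρ => ?_⟩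
  have hρ0 : 0 < ρ := hr0.trans_le hρ
  obtain ⟨i, hi1, hi2⟩ := exists_nat_pow_near (x := ρ / r0) (y := (t ^ 2)⁻¹) ((one_le_div hr0).2 hρ)
    ((one_lt_inv₀ (by positivity)).2 ht2)
  rw [le_div_iff₀ hr0] at hi1; rw [div_lt_iff₀ hr0] at hi2
  have e : r0 / (t ^ 2) ^ (i + 1) = ((t ^ 2)⁻¹) ^ (i + 1) * r0 := by rw [inv_pow]; ring
  rw [← hC'] at hA2
  refine (hA2 (i + 1)).mono cu (closedBall_subset_closedBall (by rw [e]; exact hi2.le)) ?_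
  have h1 : t ^ (i + 1) ≤ √r0 / √ρ := by
    rw [← Real.sqrt_div hr0.le, Real.le_sqrt' (by positivity), ← pow_mul, mul_comm, pow_mul,
      le_div_iff₀ hρ0, mul_comm, ← le_div_iff₀ (by positivity), e]
    exact hi2.le
  have h2 : r0 / (t ^ 2) ^ (i + 1) ≤ (t ^ 2)⁻¹ * ρ := by
    rw [e, pow_succ, mul_comm _ (t ^ 2)⁻¹, mul_assoc]; gcongr
  calc _ ≤ C' * (√r0 / √ρ) * ((t ^ 2)⁻¹ * ρ) ^ (n + 2) := by gcongr
    _ = _ := by rw [mul_pow]; ring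

lemma taylor_decay (n : ℕ) [NeZero n] {α : ℝ} (hα : 0 < α) (hα1 : α < 1) : ∃ ε0 > 0, ∃ C > 0,
    ∀ v : Eu n → ℝ, MAConvex v → ∀ e : ℝ, 0 ≤ e → e ≤ ε0 →
      (∀ y, ‖y‖ ≤ 1 → |dhess v y - 1| ≤ e * ‖y‖ ^ α) → QApprox v 1 0 1 e →
      ∀ ρ, 0 < ρ → ρ ≤ 1 → QApprox v (hess v 0) 0 ρ (C * e * ρ ^ α * ρ ^ (n + 2)) := by
  obtain ⟨θ, ε, C, hθ, hθ1, hε, hC, H⟩ := iteration n (a := (α + 1) / 2) (by linarith)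
  have hω := @ωn_pos n; obtain ⟨τ, hτ, hτ0⟩ := ex_pos (θ ^ α)
  have hτ1 : τ < 1 := by rw [hτ]; exact Real.rpow_lt_one hθ.le (by linarith) hα
  have hτa : θ ^ ((α + 1) / 2) < τ := by
    rw [hτ]; exact Real.rpow_lt_rpow_of_exponent_gt hθ (by linarith) (by linarith)
  generalize θ ^ ((α + 1) / 2) = κ at H hτa
  have hpow : ∀ j : ℕ, (θ ^ j) ^ α = τ ^ j := fun j => by
    rw [hτ, ← Real.rpow_natCast_mul hθ.le, mul_comm, Real.rpow_mul_natCast hθ.le]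
  obtain ⟨K, hK⟩ := ex_eq (1 + C * ωn n / (τ - κ)); have hτκ : 0 < τ - κ := by linarith
  have hK1 : 1 ≤ K := by rw [hK]; linarith [show 0 ≤ C * ωn n / (τ - κ) by positivity]
  have hKrec : κ * K + C * ωn n ≤ K * τ := by
    have : C * ωn n ≤ K * (τ - κ) := by rw [hK, add_mul, div_mul_cancel₀ _ hτκ.ne']; linarith
    linarith
  have h1τ : 0 < 1 - τ := by linarith
  obtain ⟨k, hk, hk0⟩ := ex_pos (32 * 2 ^ n * (ωn n)⁻¹)
  obtain ⟨K2, hK2, hK₂0⟩ := ex_pos (k * (K * (θ ^ (n + 2))⁻¹ + K * τ) / (1 - τ))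
  refine ⟨ε * (1 - τ) / K, by positivity, (K + n * K2 * ωn n) * τ⁻¹ * (θ⁻¹) ^ (n + 2), by positivity, ?_⟩
  intro v hv e he he1 hd hQ; have cv := hv.smooth.continuous; have cd := hv.continuous_dhess
  rw [le_div_iff₀ (by linarith)] at he1
  have hM : ∀ j : ℕ, ∃ M : Mat n, M.IsHermitian ∧ QApprox v M 0 (θ ^ j) (K * e * τ ^ j * (θ ^ j) ^ (n + 2)) := by
    intro j
    obtain ⟨M, h1, -, -, h4⟩ := H v hv (fun j => K * e * τ ^ j) (fun j => e * τ ^ j * ωn n) j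
      (fun j => by positivity) (fun j => by positivity) (fun i _ => by
        refine (setIntegral_le_of_le (c := e * τ ^ i) (by fun_prop) (by positivity) fun y hy => ?_).trans
          (le_of_eq (by ring))
        have hy' : ‖y‖ ≤ θ ^ i := by simpa using hy
        refine (hd y (hy'.trans (pow_le_one₀ hθ.le (by linarith)))).trans ?_; rw [← hpow]
        gcongr) (fun i _ => by
        have : 0 ≤ e * τ ^ i := by positivity
        calc _ = (e * τ ^ i) * (κ * K + C * ωn n) := by ring
          _ ≤ (e * τ ^ i) * (K * τ) := by gcongr
          _ = _ := by ring) (by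
        have := sum_geom_add_le (s := 0) hτ0.le hτ1 (show 0 ≤ K * e by positivity) j
        simp only [add_zero, mul_zero] at this; refine this.trans ?_; rw [div_le_iff₀ h1τ]
        linarith) (hQ.mono cv subset_rfl (by
        rw [pow_zero, mul_one]; exact le_mul_of_one_le_left he hK1)) j le_rfl
    exact ⟨M, h1.1, h4⟩
  choose M hMh hMQ using hM
  obtain ⟨A, hA, hAd⟩ := exists_matrix_limit (N := M) hτ1 (C := K2 * (1 - τ) * e) (fun i a b => by
    have h2 := (hMQ i).mono (x1 := 0) (s := θ ^ (i + 1))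
      (E' := K * e * τ ^ i * (θ ^ (n + 2))⁻¹ * (θ ^ (i + 1)) ^ (n + 2)) cv
      (closedBall_subset_closedBall (pow_le_pow_of_le_one hθ.le (by linarith) (by omega)))
      (le_of_eq (by rw [pow_succ θ i, mul_pow (θ ^ i)]; field_simp))
    refine (h2.entry (hMQ (i + 1)) cv (hMh _) (hMh _) (by positivity) a b).trans (le_of_eq ?_)
    rw [hK2, div_mul_cancel₀ _ h1τ.ne', ← hk]; ring)
  have hAv : A = hess v 0 := by
    ext a b; have hp := peano_of_gradient (fun y => ((hu_diff hv.smooth) y).hasGradientAt)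
      (hasFDerivAt_gradient hv.smooth 0) (M := hess v 0)
      (fun w => by rw [Qf_eq_Bf, Bf_eq_inner, real_inner_comm])
    refine eq_of_abs_sub_nonpos (le_of_forall_pos_le_add fun η hη => ?_)
    have hp' := Asymptotics.isLittleO_iff.1 hp (c := η / (k * ωn n)) (by positivity)
    obtain ⟨δ, hδ, hδ'⟩ := Metric.eventually_nhds_iff.1 hp'
    have h1 : ∀ᶠ j : ℕ in atTop, |M j a b - hess v 0 a b| ≤ k * (K * e * τ ^ j + η / (k * ωn n) * ωn n) := by
      have h2 := (tendsto_pow_atTop_nhds_zero_of_lt_one hθ.le (by linarith)).eventually_lt_const hδ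
      filter_upwards [h2] with j hj
      have h3 : QApprox v (hess v 0) 0 (θ ^ j) (η / (k * ωn n) * ωn n * (θ ^ j) ^ (n + 2)) := by
        refine ⟨gradient v 0, v 0, ?_⟩; have c1 := continuous_quad (hess v 0) (gradient v 0) (v 0)
        refine (setIntegral_le_of_le (c := η / (k * ωn n) * (θ ^ j) ^ 2) (by fun_prop) (by positivity)
          fun y hy => ?_).trans (le_of_eq (by ring))
        have hy' : ‖y‖ ≤ θ ^ j := by simpa using hy
        have h4 := hδ' (y := y) (by rw [dist_zero_right]; linarith)
        rw [zero_add, norm_eq_abs, norm_of_nonneg (by positivity)] at h4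
        refine le_trans (le_of_eq ?_) (h4.trans (by gcongr))
        congr 1; ring
      refine le_of_le_of_eq ?_ (congrArg (· * _) hk.symm)
      exact (hMQ j).entry h3 cv (hMh j) (hess_isHermitian hv.smooth 0) (by positivity) a b
    have h2 : Tendsto (fun j : ℕ => k * (K * e * τ ^ j + η / (k * ωn n) * ωn n)) atTop
        (𝓝 (k * (K * e * 0 + η / (k * ωn n) * ωn n))) :=
      (((tendsto_pow_atTop_nhds_zero_of_lt_one hτ0.le hτ1).const_mul _).add_const _).const_mul _
    have h3 : Tendsto (fun j => |M j a b - hess v 0 a b|) atTop (𝓝 |A a b - hess v 0 a b|) :=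
      (((tendsto_pi_nhds.1 (tendsto_pi_nhds.1 hA a) b)).sub_const _).abs
    refine (le_of_tendsto_of_tendsto h3 h2 h1).trans (le_of_eq ?_); field_simp; ring
  intro ρ hρ hρ1; obtain ⟨j, hj1, hj2⟩ := exists_nat_pow_near_of_lt_one hρ hρ1 hθ (by linarith)
  have h1 := (hMQ j).change cv (by positivity) (hAd j) (by positivity); rw [hAv] at h1
  refine h1.mono cv (closedBall_subset_closedBall hj2) ?_; have h2 : τ ^ j ≤ τ⁻¹ * ρ ^ α := by
    rw [le_inv_mul_iff₀ hτ0, mul_comm, ← pow_succ, ← hpow]; gcongr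
  have h3 : θ ^ j ≤ θ⁻¹ * ρ := by rw [le_inv_mul_iff₀ hθ, mul_comm, ← pow_succ]; exact hj1.le
  calc _ = (K + n * K2 * ωn n) * e * τ ^ j * (θ ^ j) ^ (n + 2) := by field_simp
    _ ≤ (K + n * K2 * ωn n) * e * (τ⁻¹ * ρ ^ α) * (θ⁻¹ * ρ) ^ (n + 2) := by gcongr
    _ = _ := by rw [mul_pow]; ring

variable {lam Lam α : ℝ} {u : Eu n → ℝ}

lemma local_decay [NeZero n] {A : Mat n} (hA : A.PosDef) (hα : 0 < α) (hα1 : α < 1) :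
    ∃ ε0 > 0, ∃ C > 0, ∃ κ > 0, κ ≤ 1 ∧ ∀ u : Eu n → ℝ, MAConvex u → ∀ (x0 : Eu n) (r e : ℝ), 0 < r → 0 ≤ e →
      e ≤ ε0 → (∀ y ∈ closedBall x0 r, |dhess u y - dhess u x0| ≤ e * (‖y - x0‖ / r) ^ α) →
      |dhess u x0 - A.det| ≤ e → QApprox u A x0 r (e * r ^ (n + 2)) →
      (∀ ρ, 0 < ρ → ρ ≤ κ * r → QApprox u (hess u x0) x0 ρ (C * e * (ρ / r) ^ α * ρ ^ (n + 2))) ∧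
      ∀ i j, |hess u x0 i j - A i j| ≤ C * e := by
  obtain ⟨ε, hε, C, hC, H⟩ := taylor_decay n hα hα1
  obtain ⟨L, B, h1, h2, h3, h4⟩ := exists_normalizing hA; have hω := @ωn_pos n
  obtain ⟨D, hD⟩ := ex_eq A.det; have hD0 : 0 < D := hD ▸ hA.det_pos
  have hLd : L.det ^ 2 * D = 1 := hD ▸ det_sq_mul_det h1
  have hL0 : L.det ≠ 0 := fun h => by rw [h] at hLd; norm_num at hLd
  have hB0 : B.det ≠ 0 := fun h => by
    have := congrArg Matrix.det h2; rw [det_mul, h, mul_zero, det_one] at this; norm_num at this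
  obtain ⟨ℓ, hℓ⟩ := ex_eq (‖mulE L‖ + 1); obtain ⟨β, hβ⟩ := ex_eq (‖mulE B‖ + 1)
  have hℓ1 : 1 ≤ ℓ := by rw [hℓ]; linarith [norm_nonneg (mulE L)]
  have hβ1 : 1 ≤ β := by rw [hβ]; linarith [norm_nonneg (mulE B)]
  have hLn : ∀ y, ‖mulE L y‖ ≤ ℓ * ‖y‖ := fun y => ((mulE L).le_opNorm y).trans (by gcongr; linarith)
  have hBn : ∀ y, ‖mulE B y‖ ≤ β * ‖y‖ := fun y => ((mulE B).le_opNorm y).trans (by gcongr; linarith)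
  obtain ⟨C1, hC1⟩ := ex_eq (2 / D + (2 * ℓ ^ (n + 2) * |L.det|⁻¹ + n * (2 / D) * ωn n))
  have hC₁D : 2 / D ≤ C1 := by rw [hC1]; exact le_add_of_nonneg_right (by positivity)
  have hC₁0 : 0 < C1 := (by positivity : 0 < 2 / D).trans_le hC₁D
  obtain ⟨κ, hκ, hκ0⟩ := ex_pos ((ℓ * β)⁻¹)
  have hκ1 : κ ≤ 1 := by rw [hκ]; exact inv_le_one_of_one_le₀ (by nlinarith)
  obtain ⟨C2, hC2, hC₂0⟩ := ex_pos (2 * |B.det|⁻¹ * (C * C1) * (β * ℓ) ^ α * β ^ (n + 2))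
  have hcore : ∀ u : Eu n → ℝ, MAConvex u → ∀ (x0 : Eu n) (r e : ℝ), 0 < r → 0 ≤ e →
      e ≤ min (D / 2) (ε / C1) → (∀ y ∈ closedBall x0 r, |dhess u y - dhess u x0| ≤ e * (‖y - x0‖ / r) ^ α) →
      |dhess u x0 - A.det| ≤ e → QApprox u A x0 r (e * r ^ (n + 2)) →
      ∀ ρ, 0 < ρ → ρ ≤ κ * r → QApprox u (hess u x0) x0 ρ (C2 * e * (ρ / r) ^ α * ρ ^ (n + 2)) := by
    intro u hu x0 r e hr he he0 hd hdA hQ ρ hρ hρr; have heD := he0.trans (min_le_left _ _)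
    have heε := he0.trans (min_le_right _ _); rw [le_div_iff₀ hC₁0] at heε
    have cu := hu.smooth.continuous; obtain ⟨g, hg⟩ := ex_eq (dhess u x0); rw [← hg, ← hD] at hdA
    rw [← hg] at hd; have hgD : D / 2 ≤ g := by linarith [(abs_le.1 hdA).1]
    have hg0 : 0 < g := by linarith
    obtain ⟨d, hd0, hdn⟩ : ∃ d : ℝ, 0 < d ∧ d ^ n = g / D :=
      ⟨(g / D) ^ ((n : ℝ)⁻¹), by positivity, Real.rpow_inv_natCast_pow (by positivity) (NeZero.ne n)⟩
    have hd1 : |d - 1| ≤ e / D := by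
      have a1 : |d ^ n - 1| ≤ e / D := by
        rw [hdn, div_sub_one hD0.ne', abs_div, abs_of_pos hD0]; gcongr
      refine le_trans ?_ a1
      rcases le_total 1 d with h | h
      · have := le_self_pow₀ h (NeZero.ne n)
        rw [abs_of_nonneg (by linarith), abs_of_nonneg (by linarith)]; linarith
      · have := pow_le_of_le_one hd0.le h (NeZero.ne n)
        rw [abs_of_nonpos (by linarith), abs_of_nonpos (by linarith)]; linarith
    have heD2 : e / D ≤ 1 / 2 := by rw [div_le_iff₀ hD0]; linarith
    have hdl : 1 / 2 ≤ d := by linarith [(abs_le.1 hd1).1]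
    have hdu : d ≤ 2 := by linarith [(abs_le.1 hd1).2]
    obtain ⟨s, hs, hs0⟩ := ex_pos (r / ℓ); have hrs : r = s * ℓ := by rw [hs]; field_simp
    have hLx : ∀ y, ‖mulE (s • L) y‖ ≤ r * ‖y‖ := fun y => by
      rw [mulE_smul, norm_smul_of_nonneg hs0.le, hrs, mul_assoc]
      exact mul_le_mul_of_nonneg_left (hLn y) hs0.le
    have hsL : (s • L).det = s ^ n * L.det := by rw [det_smul, card_fin]
    have hsB : (s⁻¹ • B).det = (s ^ n)⁻¹ * B.det := by rw [det_smul, card_fin, inv_pow]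
    have hsL0 : (s • L).det ≠ 0 := by rw [hsL]; positivity
    have hsB0 : (s⁻¹ • B).det ≠ 0 := by rw [hsB]; positivity
    obtain ⟨v, hv⟩ := ex_eq (fun y => (d * s ^ 2)⁻¹ * u (x0 + mulE (s • L) y) : Eu n → ℝ)
    have hvc : MAConvex v := hv ▸ hu.comp_affine (by positivity) x0 hsL0
    have cv := hvc.smooth.continuous
    have hmem : ∀ y ∈ 𝔹 n 1, x0 + mulE (s • L) y ∈ closedBall x0 r := fun y hy => by
      rw [mem_closedBall, dist_eq_norm, add_sub_cancel_left]
      exact (hLx y).trans (mul_le_of_le_one_right hr.le (by simpa using hy))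
    have hdv : ∀ y, dhess v y = dhess u (x0 + mulE (s • L) y) / g := fun y => by
      rw [dhess, hv, det_hess_comp_affine hu.smooth, hsL, mul_pow, inv_pow, mul_pow d, hdn, dhess]
      have : L.det ^ 2 = D⁻¹ := eq_inv_of_mul_eq_one_left hLd; rw [this]; field_simp; ring
    have hdec := H v hvc (C1 * e) (by positivity) (by linarith) (fun y hy => by
      rw [hdv, div_sub_one hg0.ne', abs_div, abs_of_pos hg0, div_le_iff₀ hg0]
      refine (hd _ (hmem y (by simpa using hy))).trans ?_; rw [add_sub_cancel_left]
      have a1 : ‖mulE (s • L) y‖ / r ≤ ‖y‖ := by rw [div_le_iff₀ hr, mul_comm]; exact hLx y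
      have a2 : 1 ≤ C1 * g := by
        calc 1 = 2 / D * (D / 2) := by field_simp
          _ ≤ _ := by gcongr
      calc e * (‖mulE (s • L) y‖ / r) ^ α ≤ e * ‖y‖ ^ α := by gcongr
        _ ≤ (C1 * g) * (e * ‖y‖ ^ α) := le_mul_of_one_le_left (by positivity) a2
        _ = _ := by ring) (by
      have a1 := hQ.pullback cu hA.1 (u := v) (k := (d * s ^ 2)⁻¹) (by positivity) x0 hsL0
        (fun y => by rw [hv]) hmem
      have a2 : (d * s ^ 2)⁻¹ * s ^ 2 = d⁻¹ := by field_simp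
      rw [smul_transpose_mul_mul, a2, h1] at a1
      have a3 := (a1.mono (x1 := 0) (s := 1) (E' := 2 * ℓ ^ (n + 2) * |L.det|⁻¹ * e * 1 ^ (n + 2)) cv
        subset_rfl (by
          rw [hsL, abs_mul, abs_of_pos (by positivity : 0 < s ^ n), hrs, one_pow, mul_one]
          have a4 : d⁻¹ ≤ 2 := by rw [inv_le_comm₀ hd0 (by norm_num)]; linarith
          calc _ = d⁻¹ * (ℓ ^ (n + 2) * |L.det|⁻¹ * e) := by field_simp; ring
            _ ≤ 2 * (ℓ ^ (n + 2) * |L.det|⁻¹ * e) := by gcongr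
            _ = _ := by ring)).change (N := 1) (δ := 2 / D * e) cv zero_le_one (fun i j => by
          have a4 : |d⁻¹ - 1| ≤ 2 / D * e := by
            have : d⁻¹ - 1 = -((d - 1) / d) := by field_simp; ring
            rw [this, abs_neg, abs_div, abs_of_pos hd0, div_le_iff₀ hd0]
            calc _ ≤ e / D := hd1
              _ = 2 / D * e * (1 / 2) := by ring
              _ ≤ _ := by gcongr
          rw [Matrix.smul_apply, smul_eq_mul, ← sub_one_mul, abs_mul]
          refine le_trans (mul_le_of_le_one_right (abs_nonneg _) ?_) a4
          rw [Matrix.one_apply]; split_ifs <;> simp) (by positivity)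
      refine a3.mono cv subset_rfl ?_; rw [one_pow, mul_one, hC1]
      linarith [show 0 ≤ 2 / D * e by positivity])
    have hux : ∀ x, u x = d * s ^ 2 * v (-mulE (s⁻¹ • B) x0 + mulE (s⁻¹ • B) x) := fun x => by
      have : mulE (s • L) (-mulE (s⁻¹ • B) x0 + mulE (s⁻¹ • B) x) = x - x0 := by
        rw [map_add, map_neg, ← mulE_mul, ← mulE_mul, smul_mul, Matrix.mul_smul, smul_smul,
          mul_inv_cancel₀ hs0.ne', one_smul, h2, mulE_one, mulE_one]; abel
      simp only [hv, this, add_sub_cancel]; field_simp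
    have hhess : hess u x0 = (d * s ^ 2) • ((s⁻¹ • B)ᵀ * hess v 0 * (s⁻¹ • B)) := by
      have := hess_comp_affine hvc.smooth (d * s ^ 2) (-mulE (s⁻¹ • B) x0) (s⁻¹ • B) x0
      rw [← funext hux, neg_add_cancel] at this; exact this
    have hρβ : β * ρ / s ≤ 1 := by
      rw [div_le_one hs0]
      calc β * ρ ≤ β * (κ * r) := by gcongr
        _ = s := by rw [hκ, hrs]; field_simp
    have hfin := (hdec (β * ρ / s) (by positivity) hρβ).pullback cv (hess_isHermitian hvc.smooth 0) (u := u)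
      (x1 := x0) (s := ρ) (by positivity) _ hsB0 hux (fun x hx => by
        rw [mem_closedBall, dist_eq_norm] at hx
        rw [mem_closedBall, dist_zero_right, neg_add_eq_sub, ← map_sub, mulE_smul, norm_smul, norm_inv,
          norm_of_nonneg hs0.le, inv_mul_eq_div]
        gcongr; exact (hBn _).trans (by gcongr))
    rw [← hhess] at hfin
    refine hfin.mono cu subset_rfl ?_
    have a5 : β * ρ / s = β * ℓ * (ρ / r) := by rw [hrs]; field_simp
    have a6 : (β * ρ / s) ^ (n + 2) = β ^ (n + 2) * ρ ^ (n + 2) / s ^ (n + 2) := by rw [div_pow, mul_pow]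
    rw [hsB, abs_mul, abs_of_pos (by positivity : 0 < (s ^ n)⁻¹), a6, a5,
      mul_rpow (by positivity) (by positivity), hC2]
    calc _ = d * (|B.det|⁻¹ * (C * C1) * (β * ℓ) ^ α * β ^ (n + 2) * e * (ρ / r) ^ α * ρ ^ (n + 2)) := by
          field_simp; ring
      _ ≤ 2 * (|B.det|⁻¹ * (C * C1) * (β * ℓ) ^ α * β ^ (n + 2) * e * (ρ / r) ^ α * ρ ^ (n + 2)) := by gcongr
      _ = _ := by ring
  refine ⟨min (D / 2) (ε / C1), by positivity, C2 + 32 * 2 ^ n * (ωn n)⁻¹ * (C2 + (κ ^ (n + 2))⁻¹),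
    by positivity, κ, hκ0, hκ1, fun u hu x0 r e hr he he0 hd hdA hQ => ?_⟩
  have hm := hcore u hu x0 r e hr he he0 hd hdA hQ; have cu := hu.smooth.continuous
  refine ⟨fun ρ hρ hρr => (hm ρ hρ hρr).mono cu subset_rfl ?_, fun i j => ?_⟩
  · gcongr
    exact le_add_of_nonneg_right (by positivity)
  · have a1 := hm (κ * r) (by positivity) le_rfl
    have a2 := hQ.mono (x1 := x0) (s := κ * r) (E' := e * (κ ^ (n + 2))⁻¹ * (κ * r) ^ (n + 2)) cu
      (closedBall_subset_closedBall (mul_le_of_le_one_left hr.le hκ1)) (le_of_eq (by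
        rw [mul_pow]; field_simp))
    refine (a1.entry a2 cu (hess_isHermitian hu.smooth x0) hA.1 (by positivity) i j).trans ?_
    have a3 : (κ * r / r) ^ α ≤ 1 := by
      rw [mul_div_cancel_right₀ _ hr.ne']; exact Real.rpow_le_one hκ0.le hκ1 hα.le
    calc _ ≤ 32 * 2 ^ n * (ωn n)⁻¹ * (C2 * e * 1 + e * (κ ^ (n + 2))⁻¹) := by gcongr
      _ ≤ _ := by linarith [show 0 ≤ C2 * e by positivity]

/-- Approximation by second order Taylor polynomials of order `2 + α` at `x`, in mean. -/
def TaylorDecay (u : Eu n → ℝ) (α : ℝ) (x : Eu n) (r K : ℝ) : Prop :=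
  ∀ ρ, 0 < ρ → ρ ≤ r → QApprox u (hess u x) x ρ (K * ρ ^ α * ρ ^ (n + 2))

variable {lam Lam α : ℝ} {u : Eu n → ℝ}

lemma TaylorDecay.mono {x : Eu n} {r r' K K' : ℝ} (h : TaylorDecay u α x r K) (hu : Continuous u)
    (hr : r' ≤ r) (hK : K ≤ K') : TaylorDecay u α x r' K' := fun ρ hρ hρr =>
  (h ρ hρ (hρr.trans hr)).mono hu subset_rfl (by gcongr)

lemma TaylorDecay.holder {x y : Eu n} {r K : ℝ} (hx : TaylorDecay u α x r K) (hy : TaylorDecay u α y r K)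
    (hu : ContDiff ℝ 2 u) (hα : α ≤ 1) (hK : 0 ≤ K) (hxy : 2 * ‖x - y‖ ≤ r) (i j : Fin n) :
    |hess u x i j - hess u y i j| ≤ 32 * 2 ^ n * (ωn n)⁻¹ * (2 ^ (n + 3) + 1) * K * ‖x - y‖ ^ α := by
  have hω := @ωn_pos n
  rcases eq_or_ne x y with rfl | hne
  · rw [sub_self, abs_zero]; positivity
  have h0 : 0 < ‖x - y‖ := norm_pos_iff.2 (sub_ne_zero.2 hne); have cu := hu.continuous
  obtain ⟨ρ, hρ⟩ := ex_eq (‖x - y‖); rw [← hρ] at h0 hxy ⊢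
  have h2 : (2 : ℝ) ^ α ≤ 2 := (rpow_le_rpow_of_exponent_le one_le_two hα).trans_eq (rpow_one 2)
  have h1 := (hx (2 * ρ) (by linarith) hxy).mono (x1 := y) (s := ρ)
    (E' := 2 ^ (n + 3) * (K * ρ ^ α) * ρ ^ (n + 2)) cu
    (closedBall_subset_closedBall' (by rw [dist_comm, dist_eq_norm, ← hρ]; linarith)) (by
      rw [mul_rpow zero_le_two h0.le, mul_pow]
      calc _ = 2 ^ α * (2 ^ (n + 2) * (K * ρ ^ α) * ρ ^ (n + 2)) := by ring
        _ ≤ 2 * (2 ^ (n + 2) * (K * ρ ^ α) * ρ ^ (n + 2)) := by gcongr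
        _ = _ := by ring)
  exact (h1.entry (hy ρ h0 (by linarith)) cu (hess_isHermitian hu x) (hess_isHermitian hu y) h0 i j).trans
    (le_of_eq (by ring))

lemma exists_taylorDecay_nhds [NeZero n] (hu : MAConvex u) (hα : 0 < α) (hα1 : α < 1)
    (hd : ∀ R, ∃ C, ∀ x y, ‖x‖ ≤ R → ‖y‖ ≤ R → |dhess u x - dhess u y| ≤ C * ‖x - y‖ ^ α) (p : Eu n) :
    ∃ t ∈ 𝓝 p, ∃ r > 0, ∃ K > 0, ∀ x ∈ t, TaylorDecay u α x r K := by
  have hω := @ωn_pos n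
  have hpd : (hess u p).PosDef := hess_posDef hu.smooth hu.convex (hu.det_pos p)
  have cu := hu.smooth.continuous; obtain ⟨ε, hε, C, hC, κ, hκ, hκ1, H⟩ := local_decay hpd hα hα1
  obtain ⟨Ch, hCh⟩ := hd (‖p‖ + 2)
  have hp := peano_of_gradient (fun y => ((hu_diff hu.smooth) y).hasGradientAt)
    (hasFDerivAt_gradient hu.smooth p) (M := hess u p)
    (fun w => by rw [Qf_eq_Bf, Bf_eq_inner, real_inner_comm])
  obtain ⟨δ, hδ, hδ'⟩ := Metric.eventually_nhds_iff.1
    (Asymptotics.isLittleO_iff.1 hp (c := ε / (2 ^ (n + 2) * ωn n)) (by positivity))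
  have ht : Tendsto (fun r : ℝ => |Ch| * r ^ α) (𝓝[>] 0) (𝓝 (|Ch| * 0)) := by
    refine Tendsto.const_mul _ (Tendsto.mono_left ?_ nhdsWithin_le_nhds)
    have := (Real.continuousAt_rpow_const 0 α (Or.inr hα.le)).tendsto
    rwa [Real.zero_rpow hα.ne'] at this
  obtain ⟨r, hr1, hr2, hr3, hr0⟩ := ((ht.eventually_lt_const (by simpa using hε)).and
    (((eventually_lt_nhds (show (0 : ℝ) < δ / 3 by positivity)).filter_mono nhdsWithin_le_nhds).and
    (((eventually_lt_nhds (zero_lt_one (α := ℝ))).filter_mono nhdsWithin_le_nhds).and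
      self_mem_nhdsWithin))).exists
  have hr0 : 0 < r := hr0
  have hnear := ((hu.continuous_dhess.tendsto p).eventually (Metric.closedBall_mem_nhds _ hε)).and
    (Metric.closedBall_mem_nhds p hr0)
  refine ⟨_, hnear, κ * r, by positivity, C * ε * (r ^ α)⁻¹, by positivity, fun x hx ρ hρ hρr => ?_⟩
  obtain ⟨hx1, hx2⟩ := hx; have hx2' : ‖x - p‖ ≤ r := by rwa [dist_eq_norm] at hx2
  have hnp : ∀ y, ‖y - p‖ ≤ 2 → ‖y‖ ≤ ‖p‖ + 2 := fun y hy => by linarith [norm_le_insert' y p]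
  have hm := (H u hu x r ε hr0 hε.le le_rfl (fun y hy => by
    rw [mem_closedBall, dist_eq_norm] at hy; have h1 := hCh y x (hnp y (by
      have := norm_add_le (y - x) (x - p); rw [sub_add_sub_cancel] at this
      linarith)) (hnp x (by linarith))
    refine h1.trans ?_
    rw [div_rpow (norm_nonneg _) hr0.le, mul_div_assoc', le_div_iff₀ (by positivity)]
    calc _ = (Ch * r ^ α) * ‖y - x‖ ^ α := by ring
      _ ≤ _ := by
        gcongr; exact (mul_le_mul_of_nonneg_right (le_abs_self _) (by positivity)).trans hr1.le)
    (by rwa [dist_eq] at hx1) (by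
    have h1 : QApprox (fun w => u (p + w)) (hess u p) 0 (2 * r) (ε * r ^ (n + 2)) := by
      refine ⟨gradient u p, u p, ?_⟩; have c1 := continuous_quad (hess u p) (gradient u p) (u p)
      refine (setIntegral_le_of_le (c := ε / (2 ^ (n + 2) * ωn n) * (2 * r) ^ 2) (by fun_prop) (by positivity)
        fun y hy => ?_).trans (le_of_eq (by rw [mul_pow, mul_pow]; field_simp; ring))
      have hy' : ‖y‖ ≤ 2 * r := by simpa using hy
      have h4 := hδ' (y := y) (by rw [dist_zero_right]; linarith)
      rw [norm_eq_abs, norm_of_nonneg (by positivity)] at h4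
      refine le_trans (le_of_eq ?_) (h4.trans (by gcongr))
      congr 1; ring
    have h2 := h1.pullback (by fun_prop) hpd.1 (u := u) (x1 := x) (s := r) (k := 1) zero_le_one (-p)
      (B := 1) (by simp) (fun y => by simp [mulE_one]) (fun y hy => by
        rw [mem_closedBall, dist_eq_norm] at hy
        rw [mem_closedBall, dist_zero_right, mulE_one, neg_add_eq_sub]
        have := norm_add_le (y - x) (x - p); rw [sub_add_sub_cancel] at this; linarith)
    simpa using h2)).1 ρ hρ hρr
  refine hm.mono cu subset_rfl (le_of_eq ?_); rw [div_rpow hρ.le hr0.le]; ring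

/-- Decay of the second derivatives of an entire solution towards a constant matrix, and their
global Hölder continuity. -/
theorem EntireSol.asymptotics [NeZero n] (hn : 2 ≤ n) (hu : EntireSol lam Lam u) (hα : 0 < α)
    (hα1 : α < 1) {K ζ' C1 R1 : ℝ} (hζ' : 0 < ζ') (hK : ∀ x, |dhess u x - 1| ≤ K / (1 + ‖x‖))
    (hd : ∀ R, ∃ C, ∀ x y, ‖x‖ ≤ R → ‖y‖ ≤ R → |dhess u x - dhess u y| ≤ C * ‖x - y‖ ^ α)
    (hC1 : 0 ≤ C1) (hfar : ∀ x, R1 ≤ ‖x‖ → ∀ y ∈ closedBall x (‖x‖ / 2),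
      ‖x‖ ^ (α + ζ') * |dhess u y - dhess u x| ≤ C1 * ‖y - x‖ ^ α) :
    ∃ (A : Mat n) (C ε : ℝ), A.PosDef ∧ A.det = 1 ∧ 0 < C ∧ 0 < ε ∧ ε < 1 ∧
      (∀ x i j, |hess u x i j - A i j| ≤ C * (1 + ‖x‖) ^ (-ε)) ∧
      ∀ x y i j, |hess u x i j - hess u y i j| ≤ C * ‖x - y‖ ^ α := by
  obtain ⟨A, r0, C2, hA, hAd, hr₀, hC2, hlim⟩ := hu.exists_limit hn hK
  obtain ⟨ε0, hε₀, C, hC, κ, hκ, hκ1, H⟩ := local_decay hA hα hα1; have hω := @ωn_pos n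
  have cu := hu.ma.smooth.continuous; have hK0 : 0 ≤ K := by simpa using (abs_nonneg _).trans (hK 0)
  obtain ⟨ε, hε, hε0⟩ := ex_pos (min (1 / 2) ζ'); have hε1 : ε ≤ 1 / 2 := hε ▸ min_le_left _ _
  have hεζ : ε ≤ ζ' := hε ▸ min_le_right _ _
  obtain ⟨C4, hC4, hC₄0⟩ := ex_pos (C1 + K + C2 * 4 ^ (n + 2))
  have htend : Tendsto (fun s : ℝ => C4 * s ^ (-ε)) atTop (𝓝 (C4 * 0)) :=
    (tendsto_rpow_neg_atTop hε0).const_mul _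
  obtain ⟨R, hR1, hR2⟩ : ∃ R, 1 + |R1| + r0 ≤ R ∧ ∀ s, R ≤ s → C4 * s ^ (-ε) ≤ ε0 := by
    obtain ⟨R, hR⟩ := eventually_atTop.1 (htend.eventually_lt_const (by simpa using hε₀))
    exact ⟨max R (1 + |R1| + r0), le_max_right _ _, fun s hs => (hR s ((le_max_left _ _).trans hs)).le⟩
  have hRR : R1 ≤ R := by linarith [le_abs_self R1]
  have hRr : r0 ≤ R := by linarith [abs_nonneg R1]
  have hR0 : 1 ≤ R := by linarith [abs_nonneg R1]
  have hmain : ∀ x : Eu n, R ≤ ‖x‖ → TaylorDecay u α x (κ / 2) (C * ε0 * 2) ∧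
      ∀ i j, |hess u x i j - A i j| ≤ C * (C4 * ‖x‖ ^ (-ε)) := by
    intro x hx; obtain ⟨s, hs⟩ := ex_eq (‖x‖); have hs1 : 1 ≤ s := by linarith
    have hs0 : 0 < s := by linarith
    have hm := H u hu.ma x (s / 2) (C4 * s ^ (-ε)) (by positivity) (by positivity) (hR2 _ (by linarith))
      (fun y hy => by
        have h1 := hfar x (by linarith) y (by rwa [← hs]); rw [← hs, rpow_add hs0] at h1
        have h2 : s ^ (-ζ') ≤ s ^ (-ε) := rpow_le_rpow_of_exponent_le hs1 (by linarith)
        have h3 : (‖y - x‖ / s) ^ α ≤ (‖y - x‖ / (s / 2)) ^ α := by gcongr; linarith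
        calc |dhess u y - dhess u x| ≤ C1 * ‖y - x‖ ^ α / (s ^ α * s ^ ζ') := by
              rw [le_div_iff₀ (by positivity), mul_comm]; exact h1
          _ = C1 * s ^ (-ζ') * (‖y - x‖ / s) ^ α := by
              rw [div_rpow (norm_nonneg _) hs0.le, rpow_neg hs0.le]; field_simp
          _ ≤ C4 * s ^ (-ε) * (‖y - x‖ / (s / 2)) ^ α := by
              gcongr; rw [hC4, add_assoc]; exact le_add_of_nonneg_right (by positivity))
      (by
        rw [hAd]; refine (hK x).trans ?_; rw [← hs]
        have h2 : s ^ (-1 : ℝ) ≤ s ^ (-ε) := rpow_le_rpow_of_exponent_le hs1 (by linarith)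
        rw [Real.rpow_neg_one] at h2
        calc K / (1 + s) ≤ K * s⁻¹ := by rw [div_eq_mul_inv]; gcongr; linarith
          _ ≤ C4 * s ^ (-ε) := by
            gcongr; rw [hC4]; linarith [show 0 ≤ C2 * 4 ^ (n + 2) by positivity])
      ((hlim (2 * s) (by linarith)).mono cu (closedBall_subset_closedBall' (by
          rw [dist_zero_right, ← hs]; linarith)) (by
        have h2 : s ^ (-(1 / 2) : ℝ) ≤ s ^ (-ε) := rpow_le_rpow_of_exponent_le hs1 (by linarith)
        rw [rpow_neg hs0.le, ← Real.sqrt_eq_rpow] at h2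
        calc C2 / √(2 * s) * (2 * s) ^ (n + 2) ≤ C2 / √s * (2 * s) ^ (n + 2) := by gcongr; linarith
          _ = C2 * 4 ^ (n + 2) * (√s)⁻¹ * (s / 2) ^ (n + 2) := by
              rw [show 2 * s = 4 * (s / 2) by ring, mul_pow]; ring
          _ ≤ _ := by gcongr; rw [hC4]; linarith))
    refine ⟨fun ρ hρ hρr => (hm.1 ρ hρ (hρr.trans ?_)).mono cu subset_rfl ?_, by rw [← hs]; exact hm.2⟩
    · have : κ * 1 ≤ κ * s := by gcongr
      linarith
    · have h1 : (ρ / (s / 2)) ^ α ≤ 2 * ρ ^ α := by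
        have h2 : (2 : ℝ) ^ α ≤ 2 :=
          (rpow_le_rpow_of_exponent_le one_le_two hα1.le).trans_eq (rpow_one 2)
        calc (ρ / (s / 2)) ^ α ≤ (2 * ρ) ^ α := by
              gcongr; rw [div_le_iff₀ (by positivity)]; nlinarith
          _ ≤ _ := by rw [mul_rpow zero_le_two hρ.le]; gcongr
      have h2 := hR2 s (by linarith)
      calc _ ≤ C * ε0 * (2 * ρ ^ α) * ρ ^ (n + 2) := by gcongr
        _ = _ := by ring
  obtain ⟨r, hr, K1, hK1, hnear⟩ : ∃ r > 0, ∃ K > 0, ∀ x ∈ 𝔹 n R, TaylorDecay u α x r K := by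
    refine (isCompact_closedBall (0 : Eu n) R).induction_on
      (p := fun S => ∃ r > 0, ∃ K > 0, ∀ x ∈ S, TaylorDecay u α x r K) ⟨1, one_pos, 1, one_pos, by simp⟩
      (fun S T hST ⟨r, hr, K, hK, h⟩ => ⟨r, hr, K, hK, fun x hx => h x (hST hx)⟩) ?_ ?_
    · rintro S T ⟨r, hr, K, hK, h⟩ ⟨r', hr', K', hK', h'⟩
      refine ⟨min r r', by positivity, max K K', by positivity, fun x hx => ?_⟩
      rcases hx with hx | hx
      · exact (h x hx).mono cu (min_le_left _ _) (le_max_left _ _)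
      · exact (h' x hx).mono cu (min_le_right _ _) (le_max_right _ _)
    · intro p _
      obtain ⟨t, ht, h⟩ := exists_taylorDecay_nhds hu.ma hα hα1 hd p
      exact ⟨t, mem_nhdsWithin_of_mem_nhds ht, h⟩
  obtain ⟨r', hr', hr'0⟩ := ex_pos (min r (κ / 2))
  have hloc : ∀ x, TaylorDecay u α x r' (max K1 (C * ε0 * 2)) := by
    intro x
    rcases le_total ‖x‖ R with h | h
    · exact (hnear x (by simpa using h)).mono cu (hr' ▸ min_le_left _ _) (le_max_left _ _)
    · exact (hmain x h).1.mono cu (hr' ▸ min_le_right _ _) (le_max_right _ _)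
  obtain ⟨C5, hC5⟩ : ∃ C5, ∀ x ∈ 𝔹 n R, ∀ i j, |hess u x i j - A i j| ≤ C5 := by
    have hc : Continuous fun x => ∑ i, ∑ j, |hess u x i j - A i j| := by
      have := fun i j => continuous_hess_apply hu.ma.smooth i j; fun_prop
    obtain ⟨C5, h⟩ := (isCompact_closedBall (0 : Eu n) R).exists_bound_of_continuousOn hc.continuousOn
    refine ⟨C5, fun x hx i j => le_trans ?_ ((le_abs_self _).trans (h x hx))⟩
    refine le_trans ?_ (single_le_sum (f := fun i => ∑ j, |hess u x i j - A i j|)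
      (fun i _ => sum_nonneg fun j _ => abs_nonneg _) (Finset.mem_univ i))
    exact single_le_sum (f := fun j => |hess u x i j - A i j|) (fun j _ => abs_nonneg _)
      (Finset.mem_univ j)
  obtain ⟨C6, hC6, hC₆0⟩ := ex_pos (|C5| * (1 + R) ^ ε + C * C4 * 2)
  have hdec : ∀ x i j, |hess u x i j - A i j| ≤ C6 * (1 + ‖x‖) ^ (-ε) := by
    intro x i j; have hx0 : 0 < 1 + ‖x‖ := by positivity
    rw [rpow_neg hx0.le, ← div_eq_mul_inv, le_div_iff₀ (by positivity), hC6]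
    rcases le_total ‖x‖ R with h | h
    · refine le_trans ?_ (le_add_of_nonneg_right (by positivity))
      have := (hC5 x (by simpa using h) i j).trans (le_abs_self _); gcongr
    · refine le_trans ?_ (le_add_of_nonneg_left (by positivity))
      have hx1 : 0 < ‖x‖ := by linarith
      have h1 : (1 + ‖x‖) ^ ε ≤ 2 * ‖x‖ ^ ε := by
        have h2 : (2 : ℝ) ^ ε ≤ 2 :=
          (rpow_le_rpow_of_exponent_le one_le_two (by linarith)).trans_eq (rpow_one 2)
        calc (1 + ‖x‖) ^ ε ≤ (2 * ‖x‖) ^ ε := by gcongr; linarith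
          _ ≤ _ := by rw [mul_rpow zero_le_two hx1.le]; gcongr
      calc _ ≤ C * (C4 * ‖x‖ ^ (-ε)) * (2 * ‖x‖ ^ ε) := by gcongr; exact (hmain x h).2 i j
        _ = C * C4 * 2 * (‖x‖ ^ (-ε) * ‖x‖ ^ ε) := by ring
        _ = _ := by rw [← rpow_add hx1]; simp
  obtain ⟨C7, hC7, hC₇0⟩ := ex_pos (32 * 2 ^ n * (ωn n)⁻¹ * (2 ^ (n + 3) + 1) * max K1 (C * ε0 * 2))
  obtain ⟨C8, hC8, hC₈0⟩ := ex_pos (2 * C6 * ((r' / 2) ^ α)⁻¹)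
  refine ⟨A, C6 + C7 + C8, ε, hA, hAd, by positivity, hε0, by linarith, fun x i j => (hdec x i j).trans ?_,
    fun x y i j => ?_⟩
  · gcongr; linarith
  · rcases le_total (2 * ‖x - y‖) r' with h | h
    · refine ((hloc x).holder (hloc y) hu.ma.smooth hα1.le (by positivity) h i j).trans ?_
      rw [← hC7]; gcongr; linarith
    · have hb : ∀ x, |hess u x i j - A i j| ≤ C6 := fun x => (hdec x i j).trans
        (mul_le_of_le_one_right hC₆0.le (Real.rpow_le_one_of_one_le_of_nonpos
          (by linarith [norm_nonneg x]) (by linarith)))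
      have h1 : |hess u x i j - hess u y i j| ≤ 2 * C6 := by
        have := abs_sub_le (hess u x i j) (A i j) (hess u y i j); rw [abs_sub_comm (A i j)] at this
        linarith [hb x, hb y]
      calc _ ≤ 2 * C6 := h1
        _ = C8 * (r' / 2) ^ α := by rw [hC8]; field_simp
        _ ≤ C8 * ‖x - y‖ ^ α := by gcongr; linarith
        _ ≤ _ := by gcongr; linarith

lemma abs_le_of_deriv_growth {φ φ' : ℝ → ℝ} (h : ∀ t, HasDerivAt φ (φ' t) t) (h0 : φ 0 = 0) {C p : ℝ}
    (hC : 0 ≤ C) (hp : 0 < p + 1) (hb : ∀ t, 0 ≤ t → |φ' t| ≤ C * (1 + t) ^ p) {t : ℝ} (ht : 0 ≤ t) :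
    |φ t| ≤ C / (p + 1) * (1 + t) ^ (p + 1) := by
  have hB : ∀ s : ℝ, 0 ≤ s → HasDerivAt (fun s : ℝ => C / (p + 1) * (1 + s) ^ (p + 1)) (C * (1 + s) ^ p) s := by
    intro s hs
    have h1 := (((hasDerivAt_id s).const_add 1).rpow_const (p := p + 1)
      (Or.inl (by simp only [id]; linarith))).const_mul (C / (p + 1))
    refine h1.congr_deriv ?_
    simp only [id, add_sub_cancel_right]
    field_simp
  refine image_norm_le_of_norm_deriv_right_le_deriv_boundary' (a := 0) (b := t)
    (fun s _ => (h s).continuousAt.continuousWithinAt) (fun s _ => (h s).hasDerivWithinAt)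
    (B := fun s : ℝ => C / (p + 1) * (1 + s) ^ (p + 1)) (B' := fun s => C * (1 + s) ^ p) ?_
    (fun s hs => (hB s hs.1).continuousAt.continuousWithinAt) (fun s hs => (hB s hs.1).hasDerivWithinAt)
    (fun s hs => hb s hs.1) ⟨ht, le_rfl⟩
  simp only [h0, norm_zero]
  positivity

lemma iteratedFDeriv_le_of_hess_le (hw : ContDiff ℝ 2 w) (h0 : w 0 = 0)
    (h1 : fderiv ℝ w 0 = 0) {C ε : ℝ} (hC : 0 ≤ C) (hε : 0 < ε) (hε1 : ε < 1)
    (h : ∀ x i j, |hess w x i j| ≤ C * (1 + ‖x‖) ^ (-ε)) {k : ℕ} (hk : k ≤ 2) {x : Eu n} (hx : 1 ≤ ‖x‖) :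
    ‖iteratedFDeriv ℝ k w x‖ ≤ 4 * (n * C / (1 - ε)) * ‖x‖ ^ ((2 : ℝ) - ε - k) := by
  have hε2 : 0 < 1 - ε := by linarith
  obtain ⟨C1, hC1⟩ := ex_eq (n * C / (1 - ε))
  have hC₁0 : 0 ≤ C1 := by rw [hC1]; positivity
  have hnC : n * C ≤ C1 := by
    rw [hC1]; exact le_div_self (by positivity) hε2 (by linarith)
  have hB : ∀ z ξ η : Eu n, |Bf (hess w z) ξ η| ≤ n * C * (1 + ‖z‖) ^ (-ε) * (‖ξ‖ * ‖η‖) := fun z ξ η =>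
    (abs_Bf_le_norm (by positivity) (h z) ξ η).trans (le_of_eq (by ring))
  have hD1 : ∀ e η : Eu n, ‖e‖ = 1 → ∀ t : ℝ, 0 ≤ t →
      |fderiv ℝ w (0 + t • e) η| ≤ C1 * ‖η‖ * (1 + t) ^ (1 - ε) := by
    intro e η he t ht
    have := abs_le_of_deriv_growth (hasDerivAt_line2 hw 0 e η) (by simp [h1]) (C := n * C * ‖η‖) (p := -ε)
      (by positivity) (by linarith) (fun s hs => by
        refine (hB _ _ _).trans (le_of_eq ?_)
        rw [zero_add, norm_smul, he, norm_of_nonneg hs]; ring) ht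
    rw [show -ε + 1 = 1 - ε by ring] at this
    refine this.trans (le_of_eq ?_)
    rw [hC1]; ring
  have hD0 : ∀ e : Eu n, ‖e‖ = 1 → ∀ t : ℝ, 0 ≤ t → |w (0 + t • e)| ≤ C1 * (1 + t) ^ (2 - ε) := by
    intro e he t ht
    have := abs_le_of_deriv_growth (hasDerivAt_line hw 0 e) (by simp [h0]) hC₁0 (p := 1 - ε)
      (by linarith) (fun s hs => by have := hD1 e e he s hs; rwa [he, mul_one] at this) ht
    rw [show 1 - ε + 1 = 2 - ε by ring] at this
    refine this.trans ?_
    gcongr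
    exact div_le_self hC₁0 (by linarith)
  have hx0 : 0 < ‖x‖ := by linarith
  obtain ⟨e, he, hxe⟩ : ∃ e : Eu n, ‖e‖ = 1 ∧ x = 0 + ‖x‖ • e :=
    ⟨‖x‖⁻¹ • x, by rw [norm_unit hx0], by
      rw [zero_add, smul_smul, mul_inv_cancel₀ hx0.ne', one_smul]⟩
  have hpow : ∀ q : ℝ, 0 ≤ q → q ≤ 2 → (1 + ‖x‖) ^ q ≤ 4 * ‖x‖ ^ q := by
    intro q hq hq2
    have h2 : (2 : ℝ) ^ q ≤ 4 := (rpow_le_rpow_of_exponent_le one_le_two hq2).trans_eq (by norm_num)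
    calc (1 + ‖x‖) ^ q ≤ (2 * ‖x‖) ^ q := by gcongr; linarith
      _ ≤ _ := by rw [mul_rpow zero_le_two hx0.le]; gcongr
  rw [← hC1]
  interval_cases k
  · rw [norm_iteratedFDeriv_zero, Nat.cast_zero, sub_zero]
    have h2 := hD0 e he ‖x‖ hx0.le
    rw [← hxe] at h2
    calc _ ≤ C1 * (1 + ‖x‖) ^ (2 - ε) := h2
      _ ≤ C1 * (4 * ‖x‖ ^ (2 - ε)) := by gcongr; exact hpow _ (by linarith) (by linarith)
      _ = _ := by ring
  · rw [norm_iteratedFDeriv_one, Nat.cast_one, show (2 : ℝ) - ε - 1 = 1 - ε by ring]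
    refine ContinuousLinearMap.opNorm_le_bound _ (by positivity) fun η => ?_
    have h2 := hD1 e η he ‖x‖ hx0.le
    rw [← hxe] at h2
    calc _ ≤ C1 * ‖η‖ * (1 + ‖x‖) ^ (1 - ε) := h2
      _ ≤ C1 * ‖η‖ * (4 * ‖x‖ ^ (1 - ε)) := by gcongr; exact hpow _ (by linarith) (by linarith)
      _ = _ := by ring
  · rw [← norm_iteratedFDeriv_fderiv, norm_iteratedFDeriv_one, Nat.cast_two,
      show (2 : ℝ) - ε - 2 = -ε by ring]
    refine ContinuousLinearMap.opNorm_le_bound _ (by positivity) fun ξ =>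
      ContinuousLinearMap.opNorm_le_bound _ (by positivity) fun η => ?_
    rw [fderiv_fderiv_eq]
    have h2 : (1 + ‖x‖) ^ (-ε) ≤ ‖x‖ ^ (-ε) :=
      Real.rpow_le_rpow_of_nonpos hx0 (by linarith) (by linarith)
    calc _ ≤ n * C * (1 + ‖x‖) ^ (-ε) * (‖ξ‖ * ‖η‖) := hB _ _ _
      _ ≤ (4 * C1) * ‖x‖ ^ (-ε) * (‖ξ‖ * ‖η‖) := by
        have : n * C ≤ 4 * C1 := by linarith
        gcongr
      _ = _ := by ring

lemma abs_exp_sub_exp_le {a b B : ℝ} (ha : a ≤ B) (hb : b ≤ B) :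
    |exp a - exp b| ≤ exp B * |a - b| := by
  wlog hab : b ≤ a generalizing a b
  · rw [abs_sub_comm, abs_sub_comm a]; exact this hb ha (le_of_not_ge hab)
  rw [abs_of_nonneg (by linarith [exp_le_exp.2 hab]), abs_of_nonneg (by linarith)]
  have h1 : exp b = exp a * exp (b - a) := by rw [← exp_add]; ring_nf
  have h2 := Real.add_one_le_exp (b - a)
  have h3 := exp_le_exp.2 ha
  calc _ = exp a * (1 - exp (b - a)) := by rw [h1]; ring
    _ ≤ exp a * (a - b) := mul_le_mul_of_nonneg_left (by linarith) (exp_pos a).le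
    _ ≤ _ := mul_le_mul_of_nonneg_right h3 (by linarith)

lemma exists_decay_bound {α ζ C R finf : ℝ} (hα : 0 < α) (hζ : 1 < ζ) {f : Eu n → ℝ}
    (hf : ∀ K : Set (Eu n), IsCompact K → ∃ C : ℝ, ∀ x ∈ K, ∀ y ∈ K, |f x - f y| ≤ C * ‖x - y‖ ^ α)
    (hC : 0 < C) (hR : 0 < R) (hd : ∀ x, R ≤ ‖x‖ → ‖x‖ ^ ζ * |f x - finf| ≤ C) :
    ∃ K > 0, ∀ x, |f x - finf| ≤ K / (1 + ‖x‖) := by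
  obtain ⟨C', hC'⟩ := hf _ (isCompact_closedBall (0 : Eu n) (R + 1))
  obtain ⟨Φ, hΦ⟩ := ex_eq (|C'| * (R + 1) ^ α + |f 0 - finf|)
  have hΦ0 : 0 ≤ Φ := by rw [hΦ]; positivity
  refine ⟨2 * C + Φ * (1 + (R + 1)), by positivity, fun x => ?_⟩
  rw [le_div_iff₀ (by positivity)]
  rcases le_total ‖x‖ (R + 1) with h | h
  · have h1 := hC' x (by simpa using h) 0 (by simp; positivity)
    rw [sub_zero] at h1
    have h2 : C' * ‖x‖ ^ α ≤ |C'| * (R + 1) ^ α := by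
      gcongr; exact le_abs_self _
    have h3 : |f x - finf| ≤ Φ := by
      rw [hΦ]; exact (abs_sub_le _ (f 0) _).trans (by linarith)
    calc _ ≤ Φ * (1 + (R + 1)) := by gcongr
      _ ≤ _ := by linarith
  · have h1 := hd x (by linarith)
    have h2 : ‖x‖ ≤ ‖x‖ ^ ζ := by
      conv_lhs => rw [← rpow_one ‖x‖]
      exact rpow_le_rpow_of_exponent_le (by linarith) hζ.le
    calc |f x - finf| * (1 + ‖x‖) ≤ |f x - finf| * (2 * ‖x‖ ^ ζ) := by gcongr; linarith
      _ ≤ 2 * C := by linarith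
      _ ≤ _ := le_add_of_nonneg_right (by positivity)

lemma exists_entireSol [NeZero n] {α ζ ζ' finf : ℝ} (hα : 0 < α) (hζ : 1 < ζ)
    {f u : Eu n → ℝ} (hf : ∀ K : Set (Eu n), IsCompact K →
      ∃ C : ℝ, ∀ x ∈ K, ∀ y ∈ K, |f x - f y| ≤ C * ‖x - y‖ ^ α)
    (hd : ∃ C R : ℝ, 0 < C ∧ 0 < R ∧ ∀ x : Eu n, R ≤ ‖x‖ → ‖x‖ ^ ζ * |f x - finf| ≤ C ∧
      ∀ y ∈ closedBall x (‖x‖ / 2), ∀ z ∈ closedBall x (‖x‖ / 2),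
        ‖x‖ ^ (α + ζ') * |f y - f z| ≤ C * ‖y - z‖ ^ α)
    (hu : ContDiff ℝ 2 u) (hc : ConvexOn ℝ Set.univ u) (hMA : ∀ x, (hess u x).det = exp (n * f x)) :
    ∃ (v : Eu n → ℝ) (lam Lam K C1 R1 : ℝ), EntireSol lam Lam v ∧ (∀ x, |dhess v x - 1| ≤ K / (1 + ‖x‖)) ∧
      (∀ R, ∃ C, ∀ x y, ‖x‖ ≤ R → ‖y‖ ≤ R → |dhess v x - dhess v y| ≤ C * ‖x - y‖ ^ α) ∧ 0 ≤ C1 ∧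
      (∀ x, R1 ≤ ‖x‖ → ∀ y ∈ closedBall x (‖x‖ / 2),
        ‖x‖ ^ (α + ζ') * |dhess v y - dhess v x| ≤ C1 * ‖y - x‖ ^ α) ∧
      ∀ x, u x = exp finf * v x + (⟪gradient u 0, x⟫ + u 0) := by
  obtain ⟨C, R, hC, hR, hd⟩ := hd
  obtain ⟨K, hK, hfK⟩ := exists_decay_bound hα hζ hf hC hR fun x hx => (hd x hx).1
  obtain ⟨s, hs, hs0⟩ := ex_pos (exp finf)
  have hma : MAConvex u := ⟨hu, hc, fun x => by rw [hMA]; positivity⟩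
  have hw := hma.sub_affine (gradient u 0) (u 0)
  obtain ⟨v, hv⟩ := ex_eq (fun x => s⁻¹ * (u x - (⟪gradient u 0, x⟫ + u 0)) : Eu n → ℝ)
  have hvm : MAConvex v := by
    have := hw.comp_affine (inv_pos.2 hs0) 0 (L := 1) (by simp)
    simp only [mulE_one, zero_add] at this
    rw [hv]; exact this
  have hvd : ∀ x, dhess v x = exp (n * (f x - finf)) := fun x => by
    rw [dhess, hv, hess_const_mul hw.smooth, det_smul, card_fin, ← dhess,
      dhess_sub_affine hu, dhess, hMA, hs, ← Real.exp_neg, ← Real.exp_nat_mul, ← exp_add]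
    congr 1; ring
  have hB : ∀ x, |n * (f x - finf)| ≤ n * K := fun x => by
    rw [abs_mul, Nat.abs_cast]
    gcongr
    exact (hfK x).trans (div_le_self hK.le (by linarith [norm_nonneg x]))
  obtain ⟨G, hG⟩ := ex_eq (exp (n * K) * n)
  have hG0 : 0 ≤ G := by rw [hG]; positivity
  have hlip : ∀ x y, |dhess v x - dhess v y| ≤ G * |f x - f y| := fun x y => by
    rw [hvd, hvd]
    refine (abs_exp_sub_exp_le (abs_le.1 (hB x)).2 (abs_le.1 (hB y)).2).trans (le_of_eq ?_)
    rw [← mul_sub, sub_sub_sub_cancel_right, abs_mul, Nat.abs_cast, hG]; ring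
  have hdec : ∀ x, |dhess v x - 1| ≤ G * K / (1 + ‖x‖) := fun x => by
    have h1 := abs_exp_sub_exp_le (abs_le.1 (hB x)).2 (show (0 : ℝ) ≤ n * K by positivity)
    rw [exp_zero, sub_zero, abs_mul, Nat.abs_cast, ← mul_assoc, ← hG, ← hvd] at h1
    rw [mul_div_assoc]
    exact h1.trans (mul_le_mul_of_nonneg_left (hfK x) hG0)
  refine ⟨v, exp (-(n * K)), exp (n * K), G * K, G * C, R, ⟨hvm, ?_, fun x => ?_, by positivity,
    fun x => ?_, fun x => ?_, fun ε hε => ⟨G * K / ε, fun x hx => (hdec x).trans ?_⟩⟩, hdec, fun R' => ?_,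
    by positivity, fun x hx y hy => ?_, fun x => ?_⟩
  · simp [hv]
  · have := convex_tangent hu hc 0 x
    rw [← inner_gradient, sub_zero] at this
    rw [hv]
    exact mul_nonneg (by positivity) (by linarith)
  · rw [hvd]; exact exp_le_exp.2 (abs_le.1 (hB x)).1
  · rw [hvd]; exact exp_le_exp.2 (abs_le.1 (hB x)).2
  · rw [div_le_iff₀ hε] at hx
    rw [div_le_iff₀ (by positivity)]
    linarith
  · obtain ⟨C', hC'⟩ := hf _ (isCompact_closedBall (0 : Eu n) R')
    refine ⟨G * C', fun x y hx hy => (hlip x y).trans ?_⟩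
    rw [mul_assoc]
    exact mul_le_mul_of_nonneg_left (hC' x (by simpa using hx) y (by simpa using hy)) hG0
  · have h1 := (hd x hx).2 y hy x (mem_closedBall_self (by positivity))
    calc _ ≤ ‖x‖ ^ (α + ζ') * (G * |f y - f x|) := by gcongr; exact hlip y x
      _ = G * (‖x‖ ^ (α + ζ') * |f y - f x|) := by ring
      _ ≤ G * (C * ‖y - x‖ ^ α) := by gcongr
      _ = _ := by ring
  · rw [hv, ← hs]; field_simp; ring

lemma abs_entry_le_sum (A : Mat n) (i j : Fin n) : |A i j| ≤ ∑ i, ∑ j, |A i j| :=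
  (single_le_sum (f := fun j => |A i j|) (fun _ _ => abs_nonneg _) (Finset.mem_univ j)).trans
    (single_le_sum (f := fun i => ∑ j, |A i j|)
      (fun _ _ => sum_nonneg fun _ _ => abs_nonneg _) (Finset.mem_univ i))

end

theorem MongeAmpere_quadratic_asymptotics
    (n : ℕ) (hn : 3 ≤ n) (α ζ ζ' : ℝ) (hα₀ : 0 < α) (hα₁ : α < 1)
    (hζ : 1 < ζ) (hζ' : 0 < ζ')
    (f : EuclideanSpace ℝ (Fin n) → ℝ) (finf : ℝ)
    (hf_holder : ∀ K : Set (EuclideanSpace ℝ (Fin n)), IsCompact K →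
      ∃ C : ℝ, ∀ x ∈ K, ∀ y ∈ K, |f x - f y| ≤ C * ‖x - y‖ ^ α)
    (hf_lim : Tendsto f (cocompact _) (nhds finf))
    (hf_decay : ∃ C R : ℝ, 0 < C ∧ 0 < R ∧ ∀ x : EuclideanSpace ℝ (Fin n), R ≤ ‖x‖ →
      ‖x‖ ^ ζ * |f x - finf| ≤ C ∧
      ∀ y ∈ Metric.closedBall x (‖x‖ / 2), ∀ z ∈ Metric.closedBall x (‖x‖ / 2),
        ‖x‖ ^ (α + ζ') * |f y - f z| ≤ C * ‖y - z‖ ^ α)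
    (u : EuclideanSpace ℝ (Fin n) → ℝ) (hu : ContDiff ℝ 2 u)
    (hconvex : ConvexOn ℝ Set.univ u)
    (hMA : ∀ x, (hess u x).det = Real.exp (n * f x)) :
    ∃ (C ε : ℝ) (A : Matrix (Fin n) (Fin n) ℝ) (b : Fin n → ℝ) (c : ℝ),
      0 < C ∧ 0 < ε ∧ A.PosDef ∧ A.det = Real.exp (n * finf) ∧
      (∀ (x : EuclideanSpace ℝ (Fin n)) (i j : Fin n), |hess u x i j| ≤ C) ∧
      (∀ (x y : EuclideanSpace ℝ (Fin n)) (i j : Fin n),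
        |hess u x i j - hess u y i j| ≤ C * ‖x - y‖ ^ α) ∧
      (∀ k : ℕ, k ≤ 2 → ∀ x : EuclideanSpace ℝ (Fin n), 1 ≤ ‖x‖ →
        ‖iteratedFDeriv ℝ k
            (fun y => u y - ((1/2) * ∑ i, ∑ j, A i j * y i * y j + ∑ i, b i * y i + c)) x‖
          ≤ C * ‖x‖ ^ ((2 : ℝ) - ε - k)) := by
  have : NeZero n := ⟨by omega⟩
  obtain ⟨v, lam, Lam, K, C1, R1, hv, hK, hloc, hC1, hfar, huv⟩ :=
    exists_entireSol hα₀ hζ hf_holder hf_decay hu hconvex hMA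
  obtain ⟨A, C, ε, hA, hAd, hC, hε, hε1, hdec, hhol⟩ :=
    hv.asymptotics (by omega) hα₀ hα₁ hζ' hK hloc hC1 hfar
  have hvs := hv.ma.smooth
  obtain ⟨s, hs⟩ := ex_eq (Real.exp finf)
  rw [← hs] at huv
  have hs0 : 0 < s := by rw [hs]; positivity
  have hh : ∀ x, hess u x = s • hess v x := fun x => by
    rw [funext huv, hess_add (contDiff_const.mul hvs) (contDiff_affine _ _), hess_affine,
      hess_const_mul hvs, add_zero]
  have hq : ContDiff ℝ 2 fun y : Eu n => 1 / 2 * Qf A y := contDiff_const.mul (contDiff_Qf A)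
  obtain ⟨w, hw⟩ := ex_eq (fun y => s * (v y - 1 / 2 * Qf A y) : Eu n → ℝ)
  have hws : ContDiff ℝ 2 w := hw ▸ contDiff_const.mul (hvs.sub hq)
  have hw0 : w 0 = 0 := by simp [hw, hv.zero, Qf_zero_right]
  have hw1 : fderiv ℝ w 0 = 0 := by
    have h1 : fderiv ℝ v 0 = 0 :=
      IsLocalMin.fderiv_eq_zero (Eventually.of_forall fun x => by rw [hv.zero]; exact hv.nonneg x)
    rw [hw, fderiv_const_mul ((hu_diff hvs 0).fun_sub (hu_diff hq 0)),
      fderiv_fun_sub (hu_diff hvs 0) (hu_diff hq 0), h1, fderiv_half_Qf A hA.1]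
    simp
  have hwh : ∀ x i j, |hess w x i j| ≤ s * C * (1 + ‖x‖) ^ (-ε) := fun x i j => by
    rw [hw, hess_const_mul (hvs.sub hq), hess_sub hvs hq, hess_half_Qf A hA.1, Matrix.smul_apply,
      smul_eq_mul, abs_mul, abs_of_pos hs0, mul_assoc]
    exact mul_le_mul_of_nonneg_left (hdec x i j) hs0.le
  obtain ⟨S, hS⟩ := ex_eq (∑ i, ∑ j, |A i j|)
  have hS0 : 0 ≤ S := by rw [hS]; positivity
  obtain ⟨D, hD⟩ := ex_eq (4 * (n * (s * C) / (1 - ε)))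
  have hD0 : 0 ≤ D := by rw [hD]; positivity
  refine ⟨s * (S + C) + D, ε, s • A, fun i => gradient u 0 i, u 0, by positivity, hε, hA.smul hs0, ?_,
    fun x i j => ?_, fun x y i j => ?_, fun k hk x hx => ?_⟩
  · rw [Matrix.det_smul, hAd, Fintype.card_fin, mul_one, hs, Real.exp_nat_mul]
  · have h1 : |hess v x i j| ≤ S + C := by
      have h2 := (hdec x i j).trans (mul_le_of_le_one_right hC.le (Real.rpow_le_one_of_one_le_of_nonpos
        (by linarith [norm_nonneg x]) (by linarith)))
      have h3 := abs_entry_le_sum A i j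
      have h4 := abs_add_le (hess v x i j - A i j) (A i j)
      rw [sub_add_cancel] at h4
      linarith
    rw [hh, Matrix.smul_apply, smul_eq_mul, abs_mul, abs_of_pos hs0]
    linarith [mul_le_mul_of_nonneg_left h1 hs0.le]
  · rw [hh, hh, Matrix.smul_apply, Matrix.smul_apply, smul_eq_mul, smul_eq_mul, ← mul_sub, abs_mul,
      abs_of_pos hs0]
    calc _ ≤ s * (C * ‖x - y‖ ^ α) := by gcongr; exact hhol x y i j
      _ ≤ _ := by
        rw [← mul_assoc]
        gcongr
        linarith [mul_nonneg hs0.le hS0]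
  · have he : (fun y : Eu n => u y - ((1/2) * ∑ i, ∑ j, (s • A) i j * y i * y j +
        ∑ i, gradient u 0 i * y i + u 0)) = w := by
      funext y
      have e1 : ∑ i, ∑ j, (s • A) i j * y i * y j = s * Qf A y := Qf_smul_matrix s A y
      have e2 : ∑ i, gradient u 0 i * y i = inner ℝ (gradient u 0) y := by
        rw [PiLp.inner_apply]
        exact Finset.sum_congr rfl fun i _ => by simp [mul_comm]
      rw [e1, e2, huv y, hw]
      ring
    refine le_trans (le_of_eq (by rw [← he])) ((iteratedFDeriv_le_of_hess_le hws hw0 hw1 (by positivity)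
      hε hε1 hwh hk hx).trans ?_)
    rw [← hD]
    gcongr
    linarith [show 0 ≤ s * (S + C) by positivity]
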